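/- Reverse Hölder inequality: Let p > max{2n/(n+2),1} and u be a weak solution of ∂_t(|u|^{p-2}u) − div A(x,t,u,Du) = div(|F|^{p-2}F) in Ω_T. Suppose Q_{2ρ}^{(μ)}(z_o) ⊆ Ω_T with ρ, μ > 0 satisfies: (i) ⨍⨍_{Q_{2ρ}^{(μ)}(z_o)} |u|^p/(μ^{2−𝔭}(2ρ)^p) dx dt ≤ K μ^p ⨍⨍_{Q_ρ^{(μ)}(z_o)} (|Du|^p + |F|^p) dx dt for some K ≥ 1, and (ii) either μ^p ⨍⨍_{Q_{2ρ}^{(μ)}(z_o)} (|Du|^p + |F|^p) dx dt ≤ K ⨍⨍_{Q_ρ^{(μ)}(z_o)} |u|^p/(μ^{2−𝔭}ρ^p) dx dt or μ^p ≤ K. Then ⨍⨍_{Q_ρ^{(μ)}(z_o)} |Du|^p dx dt ≤ c [⨍⨍_{Q_{2ρ}^{(μ)}(z_o)} |Du|^q dx dt]^{p/q} + c ⨍⨍_{Q_{2ρ}^{(μ)}(z_o)} |F|^p dx dt with q := max{2n/(n+2), np/(n+2), 1, p−1} and c = c(n,p,ν,L,K). -/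

import Mathlib

open MeasureTheory Set Filter
open scoped ENNReal Topology BigOperators

noncomputable section

abbrev Spc (n : ℕ) := EuclideanSpace ℝ (Fin n)
abbrev Vec (N : ℕ) := EuclideanSpace ℝ (Fin N)
abbrev Mat (N n : ℕ) := EuclideanSpace ℝ (Fin N × Fin n)

variable {n N : ℕ}

/-- Spatial partial derivative in direction `j` of a scalar function on space-time. -/
def pderivS (j : Fin n) (f : Spc n × ℝ → ℝ) (z : Spc n × ℝ) : ℝ :=
  fderiv ℝ (fun y => f (y, z.2)) z.1 (EuclideanSpace.single j 1)

/-- Time derivative of a vector-valued function on space-time. -/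
def tderiv (φ : Spc n × ℝ → Vec N) (z : Spc n × ℝ) : Vec N :=
  deriv (fun s => φ (z.1, s)) z.2

/-- Pairing `M · Dφ = ∑_{i,j} M_{ij} ∂_j φ_i` of a matrix field with the spatial gradient of a
test function. -/
def gradPair (M : Spc n × ℝ → Mat N n) (φ : Spc n × ℝ → Vec N) (z : Spc n × ℝ) : ℝ :=
  ∑ i : Fin N, ∑ j : Fin n, M z (i, j) * pderivS j (fun w => φ w i) z

/-- The power `w^⟨α⟩ := |w|^{α-1} w` of a vector. -/
def pw (α : ℝ) (w : Vec N) : Vec N := ‖w‖ ^ (α - 1) • w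

/-- Weak solution of the doubly nonlinear system
`∂_t(|u|^{p-2}u) − div A(x,t,u,Du) = div(|F|^{p-2}F)` in `Ω_T = Ω × (0,T)`. -/
structure WeakSolution (p ν L T : ℝ) (Ω : Set (Spc n))
    (A : Spc n × ℝ → Vec N → Mat N n → Mat N n)
    (F : Spc n × ℝ → Mat N n)
    (u : Spc n × ℝ → Vec N) (Du : Spc n × ℝ → Mat N n) : Prop where
  hn : 1 ≤ n
  hT : 0 < T
  openΩ : IsOpen Ω
  bddΩ : Bornology.IsBounded Ω
  connΩ : IsConnected Ω
  hν : 0 < ν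
  hνL : ν ≤ L
  measA : ∀ (v : Vec N) (ξ : Mat N n), Measurable fun z => A z v ξ
  contA : ∀ᵐ z ∂(volume.restrict (Ω ×ˢ Ioo 0 T)),
    Continuous fun q : Vec N × Mat N n => A z q.1 q.2
  coercivity : ∀ᵐ z ∂(volume.restrict (Ω ×ˢ Ioo 0 T)),
    ∀ (v : Vec N) (ξ : Mat N n), ν * ‖ξ‖ ^ p ≤ (inner ℝ (A z v ξ) ξ : ℝ)
  growth : ∀ᵐ z ∂(volume.restrict (Ω ×ˢ Ioo 0 T)),
    ∀ (v : Vec N) (ξ : Mat N n), ‖A z v ξ‖ ≤ L * ‖ξ‖ ^ (p - 1)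
  measu : Measurable u
  measDu : Measurable Du
  measF : Measurable F
  memLp_u : MemLp u (ENNReal.ofReal p) (volume.restrict (Ω ×ˢ Ioo 0 T))
  memLp_Du : MemLp Du (ENNReal.ofReal p) (volume.restrict (Ω ×ˢ Ioo 0 T))
  memLp_F : MemLp F (ENNReal.ofReal p) (volume.restrict (Ω ×ˢ Ioo 0 T))
  sliceLp : ∀ t ∈ Icc (0:ℝ) T,
    MemLp (fun x => u (x, t)) (ENNReal.ofReal p) (volume.restrict Ω)
  timeCont : ∀ t₀ ∈ Icc (0:ℝ) T,
    Tendsto (fun t => ∫ x in Ω, ‖u (x, t) - u (x, t₀)‖ ^ p) (𝓝[Icc (0:ℝ) T] t₀) (𝓝 0)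
  weakGrad : ∀ ψ : Spc n × ℝ → ℝ, ContDiff ℝ (⊤ : ℕ∞) ψ → HasCompactSupport ψ →
    tsupport ψ ⊆ Ω ×ˢ Ioo 0 T → ∀ (i : Fin N) (j : Fin n),
      ∫ z in Ω ×ˢ Ioo 0 T, u z i * pderivS j ψ z
        = - ∫ z in Ω ×ˢ Ioo 0 T, Du z (i, j) * ψ z
  weakForm : ∀ φ : Spc n × ℝ → Vec N, ContDiff ℝ (⊤ : ℕ∞) φ → HasCompactSupport φ →
    tsupport φ ⊆ Ω ×ˢ Ioo 0 T →
      ∫ z in Ω ×ˢ Ioo 0 T,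
        (‖u z‖ ^ (p - 2) * (inner ℝ (u z) (tderiv φ z) : ℝ)
          - gradPair (fun w => A w (u w) (Du w)) φ z)
        = ∫ z in Ω ×ˢ Ioo 0 T, ‖F z‖ ^ (p - 2) * gradPair F φ z

/-- The scaled parabolic cylinder `Q_ρ^{(μ)}(z₀)`:
`B_ρ(x₀) × (t₀ − μ^{p−2}ρ^p, t₀ + μ^{p−2}ρ^p)` if `p < 2`, and
`B_{μ^{(2−p)/p}ρ}(x₀) × (t₀ − ρ^p, t₀ + ρ^p)` if `p ≥ 2`. -/
def parCyl (p μ ρ : ℝ) (z₀ : Spc n × ℝ) : Set (Spc n × ℝ) :=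
  if p < 2 then
    Metric.ball z₀.1 ρ ×ˢ Ioo (z₀.2 - μ ^ (p - 2) * ρ ^ p) (z₀.2 + μ ^ (p - 2) * ρ ^ p)
  else
    Metric.ball z₀.1 (μ ^ ((2 - p) / p) * ρ) ×ˢ Ioo (z₀.2 - ρ ^ p) (z₀.2 + ρ ^ p)

/-- `Q_ρ^{(μ)}(z₀)` is `μ`-sub-intrinsic with constant `K`:
`⨍⨍ |u|^p/(μ^{2−𝔭}ρ^p) ≤ K μ^p ⨍⨍ (|Du|^p + |F|^p)`, where `𝔭 = max{p,2}`. -/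
def SubIntrinsic (p K μ ρ : ℝ) (z₀ : Spc n × ℝ) (u : Spc n × ℝ → Vec N)
    (Du F : Spc n × ℝ → Mat N n) : Prop :=
  ⨍ z in parCyl p μ ρ z₀, ‖u z‖ ^ p / (μ ^ (2 - max p 2) * ρ ^ p)
    ≤ K * μ ^ p * ⨍ z in parCyl p μ ρ z₀, (‖Du z‖ ^ p + ‖F z‖ ^ p)

/-- `Q_ρ^{(μ)}(z₀)` is `μ`-super-intrinsic with constant `K`:
either `μ^p ⨍⨍ (|Du|^p + |F|^p) ≤ K ⨍⨍ |u|^p/(μ^{2−𝔭}ρ^p)` or `μ^p ≤ K`. -/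
def SuperIntrinsic (p K μ ρ : ℝ) (z₀ : Spc n × ℝ) (u : Spc n × ℝ → Vec N)
    (Du F : Spc n × ℝ → Mat N n) : Prop :=
  (μ ^ p * ⨍ z in parCyl p μ ρ z₀, (‖Du z‖ ^ p + ‖F z‖ ^ p)
      ≤ K * ⨍ z in parCyl p μ ρ z₀, ‖u z‖ ^ p / (μ ^ (2 - max p 2) * ρ ^ p))
    ∨ μ ^ p ≤ K

namespace RevHoelder

/-! ### Algebra of the power map -/

section Algebra

variable {H : Type*} [NormedAddCommGroup H] [InnerProductSpace ℝ H] {p : ℝ}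

/-- The duality map `w ↦ |w|^{p-2} w`. -/
def J (p : ℝ) (w : H) : H := ‖w‖ ^ (p - 2) • w

/-- The Bregman-type boundary term associated with `|·|^p / p`. -/
def bdry (p : ℝ) (v c : H) : ℝ :=
  (1 - 1 / p) * ‖v‖ ^ p - inner ℝ (J p v) c + ‖c‖ ^ p / p

theorem rpow_sub_two_mul_self (hp : 1 < p) {X : ℝ} (hX : 0 ≤ X) :
    X ^ (p - 2) * X = X ^ (p - 1) := by
  rcases hX.eq_or_lt with rfl | h
  · rw [mul_zero, Real.zero_rpow (by linarith)]
  · rw [← Real.rpow_add_one h.ne']; congr 1; ring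

theorem rpow_sub_one_mul_self (hp : 0 < p) {X : ℝ} (hX : 0 ≤ X) :
    X ^ (p - 1) * X = X ^ p := by
  rcases hX.eq_or_lt with rfl | h
  · rw [mul_zero, Real.zero_rpow (by linarith)]
  · rw [← Real.rpow_add_one h.ne']; congr 1; ring

theorem rpow_sub_two_mul_sq (hp : 1 < p) {X : ℝ} (hX : 0 ≤ X) :
    X ^ (p - 2) * X ^ 2 = X ^ p := by
  rw [pow_two, ← mul_assoc, rpow_sub_two_mul_self hp hX, rpow_sub_one_mul_self (by linarith) hX]

theorem norm_J (hp : 1 < p) (w : H) : ‖J p w‖ = ‖w‖ ^ (p - 1) := by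
  rw [J, norm_smul, Real.norm_of_nonneg (by positivity), rpow_sub_two_mul_self hp (norm_nonneg _)]

theorem inner_J_self (hp : 1 < p) (w : H) : inner ℝ (J p w) w = ‖w‖ ^ p := by
  rw [J, real_inner_smul_left, real_inner_self_eq_norm_sq,
    rpow_sub_two_mul_sq hp (norm_nonneg _)]

@[simp] theorem J_zero : J p (0 : H) = 0 := by simp [J]

theorem exists_J_eq (hp : 1 < p) (y : H) : ∃ a : H, J p a = y := by
  by_cases hy : y = 0
  · exact ⟨0, by simp [hy]⟩
  have h0 : 0 < ‖y‖ := norm_pos_iff.2 hy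
  refine ⟨‖y‖ ^ (1 / (p - 1) - 1) • y, ?_⟩
  have hp1 : p - 1 ≠ 0 := by linarith
  rw [J, norm_smul, Real.norm_of_nonneg (by positivity), smul_smul]
  have h1 : ‖y‖ ^ (1 / (p - 1) - 1) * ‖y‖ = ‖y‖ ^ (1 / (p - 1)) := by
    rw [← Real.rpow_add_one h0.ne']; congr 1; ring
  rw [h1, ← Real.rpow_mul h0.le, ← Real.rpow_add h0]
  have : 1 / (p - 1) * (p - 2) + (1 / (p - 1) - 1) = 0 := by field_simp; ring
  rw [this, Real.rpow_zero, one_smul]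

theorem sub_rpow_bounds (hp : 1 < p) {X Y : ℝ} (hY : 0 ≤ Y) (hXY : Y ≤ X) (hX : 0 < X) :
    min 1 (p - 1) * (X ^ (p - 2) * (X - Y)) ≤ X ^ (p - 1) - Y ^ (p - 1) ∧
    X ^ (p - 1) - Y ^ (p - 1) ≤ max 1 (p - 1) * (X ^ (p - 2) * (X - Y)) := by
  set r := Y / X with hr
  have hr0 : 0 ≤ r := by positivity
  have hr1 : r ≤ 1 := (div_le_one hX).2 hXY
  have hYr : Y = r * X := by rw [hr]; field_simp
  have e1 : X ^ (p - 2) * (X - Y) = X ^ (p - 1) * (1 - r) := by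
    rw [hYr, ← rpow_sub_two_mul_self hp hX.le]; ring
  have e2 : X ^ (p - 1) - Y ^ (p - 1) = X ^ (p - 1) * (1 - r ^ (p - 1)) := by
    rw [hYr, Real.mul_rpow hr0 hX.le]; ring
  have key : min 1 (p - 1) * (1 - r) ≤ 1 - r ^ (p - 1) ∧
      1 - r ^ (p - 1) ≤ max 1 (p - 1) * (1 - r) := by
    rcases le_total 1 (p - 1) with h | h
    · rw [min_eq_left h, max_eq_right h]
      have a1 := one_add_mul_self_le_rpow_one_add (s := r - 1) (by linarith) h
      rw [show (1 + (r - 1)) = r by ring] at a1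
      have a2 : r ^ (p - 1) ≤ r := by
        simpa using Real.rpow_le_rpow_of_exponent_ge' hr0 hr1 zero_le_one h
      constructor <;> nlinarith
    · rw [min_eq_right h, max_eq_left h]
      have a1 := rpow_one_add_le_one_add_mul_self (s := r - 1) (by linarith) (by linarith) h
      rw [show (1 + (r - 1)) = r by ring] at a1
      have a2 : r ≤ r ^ (p - 1) := by
        simpa using Real.rpow_le_rpow_of_exponent_ge' hr0 hr1 (by linarith) h
      constructor <;> nlinarith
  have hXp : 0 ≤ X ^ (p - 1) := by positivity
  rw [e1, e2]
  constructor
  · nlinarith [mul_le_mul_of_nonneg_left key.1 hXp]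
  · nlinarith [mul_le_mul_of_nonneg_left key.2 hXp]

theorem affine_nonneg {A B m s : ℝ} (h1 : 0 ≤ A + B * m) (h2 : 0 ≤ A - B * m) (hs : |s| ≤ m) :
    0 ≤ A + B * s := by
  have := abs_le.1 hs
  rcases le_total 0 B with hB | hB <;> nlinarith

/-- Ellipticity constant of the power map. -/
def cJ (p : ℝ) : ℝ := min 1 (p - 1) / 2

theorem cJ_pos (hp : 1 < p) : 0 < cJ p := by
  have : 0 < min 1 (p - 1) := lt_min one_pos (by linarith)
  unfold cJ; positivity

theorem J_estimates_aux (hp : 1 < p) (v c : H) (hvc : ‖c‖ ≤ ‖v‖) :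
    cJ p * (‖v‖ ^ (p - 2) * ‖v - c‖ ^ 2) ≤ inner ℝ (J p v - J p c) (v - c) ∧
    ‖J p v - J p c‖ ≤ (p + 1) * (‖v‖ ^ (p - 2) * ‖v - c‖) := by
  rcases (norm_nonneg v).eq_or_lt with h0 | hX
  · have hv : v = 0 := norm_eq_zero.1 h0.symm
    have hc : c = 0 := norm_le_zero_iff.1 (by rw [h0]; exact hvc)
    subst hv; subst hc; simp
  have hs := abs_real_inner_le_norm v c
  have hY := norm_nonneg c
  have hb := sub_rpow_bounds hp hY hvc hX
  have eX := rpow_sub_two_mul_self hp hX.le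
  have eY := rpow_sub_two_mul_self hp hY
  have hmono : ‖c‖ ^ (p - 1) ≤ ‖v‖ ^ (p - 1) := by gcongr
  have hn : ‖v - c‖ ^ 2 = ‖v‖ ^ 2 + ‖c‖ ^ 2 - 2 * inner ℝ v c := by
    rw [norm_sub_sq_real]; ring
  have hin : inner ℝ (J p v - J p c) (v - c) =
      ‖v‖ ^ (p - 2) * ‖v‖ ^ 2 + ‖c‖ ^ (p - 2) * ‖c‖ ^ 2
        - (‖v‖ ^ (p - 2) + ‖c‖ ^ (p - 2)) * inner ℝ v c := by
    simp only [J, inner_sub_left, inner_sub_right, real_inner_smul_left,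
      real_inner_self_eq_norm_sq, real_inner_comm v c]
    ring
  have hJn : ‖J p v - J p c‖ ^ 2 = (‖v‖ ^ (p - 2) * ‖v‖) ^ 2 + (‖c‖ ^ (p - 2) * ‖c‖) ^ 2
      - 2 * (‖v‖ ^ (p - 2) * ‖c‖ ^ (p - 2)) * inner ℝ v c := by
    rw [norm_sub_sq_real, norm_J hp, norm_J hp, eX, eY]
    simp only [J, real_inner_smul_left, real_inner_smul_right]
    ring
  have hα : 0 < ‖v‖ ^ (p - 2) := by positivity
  set X := ‖v‖
  set Y := ‖c‖
  set s := inner ℝ v c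
  set α := X ^ (p - 2)
  set β := Y ^ (p - 2)
  set P := X ^ (p - 1)
  set Q := Y ^ (p - 1)
  have hQ : 0 ≤ Q := by positivity
  have hc1 : cJ p ≤ 1 / 2 := by unfold cJ; linarith [min_le_left 1 (p - 1)]
  have hc0 := cJ_pos hp
  have hlow : cJ p * (α * (X - Y)) ≤ P - Q := by
    refine le_trans ?_ hb.1
    have : 0 ≤ α * (X - Y) := mul_nonneg hα.le (by linarith)
    apply mul_le_mul_of_nonneg_right _ this
    have : 0 < min 1 (p - 1) := lt_min one_pos (by linarith)
    unfold cJ; linarith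
  constructor
  · rw [hin, hn]
    have : 0 ≤ (α * X ^ 2 + β * Y ^ 2 - cJ p * α * (X ^ 2 + Y ^ 2))
        + (2 * cJ p * α - (α + β)) * s := by
      refine affine_nonneg ?_ ?_ hs
      · have : 0 ≤ (P - Q - cJ p * (α * (X - Y))) * (X - Y) :=
          mul_nonneg (by linarith) (by linarith)
        rw [← eX, ← eY] at this
        linarith
      · have : 0 ≤ (P + Q - cJ p * (α * (X + Y))) * (X + Y) := by
          refine mul_nonneg ?_ (by linarith)
          have : cJ p * (α * (X + Y)) ≤ 1 / 2 * (α * (X + X)) := by gcongr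
          rw [← eX]; linarith
        rw [← eX, ← eY] at this
        linarith
    linarith
  · have h2 : (p + 1) * (α * ‖v - c‖) ≥ 0 := by positivity
    refine (sq_le_sq₀ (norm_nonneg _) h2).1 ?_
    have e3 : ((p + 1) * (α * ‖v - c‖)) ^ 2 = (p + 1) ^ 2 * α ^ 2 * ‖v - c‖ ^ 2 := by ring
    rw [hJn, e3, hn]
    have hmx : max 1 (p - 1) ≤ p + 1 := max_le (by linarith) (by linarith)
    have : 0 ≤ ((p + 1) ^ 2 * α ^ 2 * (X ^ 2 + Y ^ 2) - (α * X) ^ 2 - (β * Y) ^ 2)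
        + (2 * α * β - 2 * (p + 1) ^ 2 * α ^ 2) * s := by
      refine affine_nonneg ?_ ?_ hs
      · have h3 : P - Q ≤ (p + 1) * (α * (X - Y)) :=
          hb.2.trans (mul_le_mul_of_nonneg_right hmx (mul_nonneg hα.le (by linarith)))
        have h4 : (P - Q) ^ 2 ≤ ((p + 1) * (α * (X - Y))) ^ 2 :=
          pow_le_pow_left₀ (by linarith) h3 2
        rw [← eX, ← eY] at h4
        linarith
      · have h3 : P + Q ≤ (p + 1) * (α * (X + Y)) := by
          have : 2 * (α * X) ≤ (p + 1) * (α * (X + Y)) := by gcongr <;> linarith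
          linarith
        have h4 : (P + Q) ^ 2 ≤ ((p + 1) * (α * (X + Y))) ^ 2 :=
          pow_le_pow_left₀ (by positivity) h3 2
        rw [← eX, ← eY] at h4
        linarith
    linarith

theorem le_inner_J_sub (hp : 1 < p) (v c : H) :
    cJ p * (max ‖v‖ ‖c‖ ^ (p - 2) * ‖v - c‖ ^ 2) ≤ inner ℝ (J p v - J p c) (v - c) := by
  rcases le_total ‖c‖ ‖v‖ with h | h
  · rw [max_eq_left h]; exact (J_estimates_aux hp v c h).1
  · rw [max_eq_right h]
    have := (J_estimates_aux hp c v h).1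
    rw [norm_sub_rev v c, ← neg_sub c v, ← neg_sub (J p c), inner_neg_neg]
    exact this

theorem norm_J_sub_le (hp : 1 < p) (v c : H) :
    ‖J p v - J p c‖ ≤ (p + 1) * (max ‖v‖ ‖c‖ ^ (p - 2) * ‖v - c‖) := by
  rcases le_total ‖c‖ ‖v‖ with h | h
  · rw [max_eq_left h]; exact (J_estimates_aux hp v c h).2
  · rw [max_eq_right h, norm_sub_rev v c, norm_sub_rev (J p v)]
    exact (J_estimates_aux hp c v h).2

theorem bdry_nonneg (hp : 1 < p) (v c : H) : 0 ≤ bdry p v c := by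
  have h1 : inner ℝ (J p v) c ≤ ‖v‖ ^ (p - 1) * ‖c‖ := by
    rw [← norm_J hp]; exact real_inner_le_norm _ _
  have hpq : (p / (p - 1)).HolderConjugate p := by
    have := Real.HolderConjugate.conjExponent hp
    exact this.symm
  have h2 := Real.young_inequality_of_nonneg (a := ‖v‖ ^ (p - 1)) (b := ‖c‖)
    (by positivity) (norm_nonneg _) hpq
  have hp1 : p - 1 ≠ 0 := by linarith
  have h3 : (‖v‖ ^ (p - 1)) ^ (p / (p - 1)) = ‖v‖ ^ p := by
    rw [← Real.rpow_mul (norm_nonneg _)]; congr 1; field_simp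
  rw [h3] at h2
  have h4 : ‖v‖ ^ p / (p / (p - 1)) = (1 - 1 / p) * ‖v‖ ^ p := by
    field_simp
  unfold bdry
  linarith

theorem bdry_add_bdry (hp : 1 < p) (v c : H) :
    bdry p v c + bdry p c v = inner ℝ (J p v - J p c) (v - c) := by
  simp only [bdry, inner_sub_left, inner_sub_right, inner_J_self hp]
  field_simp
  ring

theorem bdry_le_inner (hp : 1 < p) (v c : H) :
    bdry p v c ≤ inner ℝ (J p v - J p c) (v - c) := by
  rw [← bdry_add_bdry hp]; linarith [bdry_nonneg hp c v]

theorem bdry_le (hp : 1 < p) (v c : H) :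
    bdry p v c ≤ (p + 1) * (max ‖v‖ ‖c‖ ^ (p - 2) * ‖v - c‖ ^ 2) := by
  refine (bdry_le_inner hp v c).trans ((real_inner_le_norm _ _).trans ?_)
  nlinarith [mul_le_mul_of_nonneg_right (norm_J_sub_le hp v c) (norm_nonneg (v - c))]

theorem bdry_sub_bdry_le (hp : 1 < p) (v v' c : H) :
    bdry p v c - bdry p v' c ≤ inner ℝ (J p v - J p v') (v - c) := by
  have h := bdry_nonneg hp v' v
  simp only [bdry, inner_sub_left, inner_sub_right, inner_J_self hp] at h ⊢
  have : ‖v‖ ^ p / p = 1 / p * ‖v‖ ^ p := by ring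
  linarith

/-- Coercivity constant of the boundary term. -/
def cB (p : ℝ) : ℝ := cJ p / 4 * 3 ^ (-p)

theorem cB_pos (hp : 1 < p) : 0 < cB p := by
  have := cJ_pos hp
  unfold cB; positivity

theorem le_bdry (hp : 1 < p) (v c : H) :
    cB p * (max ‖v‖ ‖c‖ ^ (p - 2) * ‖v - c‖ ^ 2) ≤ bdry p v c := by
  set m : H := (1 / 2 : ℝ) • (v + c) with hm
  have e1 : c - m = m - v := by
    rw [hm]; module
  have hmc := bdry_nonneg hp m c
  have hvm := bdry_nonneg hp v m
  have key : inner ℝ (J p m - J p v) (m - v) ≤ bdry p v c := by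
    have h3 : bdry p v c = bdry p v m + bdry p m c + inner ℝ (J p m - J p v) (c - m) := by
      simp only [bdry, inner_sub_left, inner_sub_right, inner_J_self hp]
      ring
    rw [h3, e1]; linarith
  refine le_trans ?_ key
  refine le_trans ?_ (le_inner_J_sub hp m v)
  have hd : ‖m - v‖ ^ 2 = ‖v - c‖ ^ 2 / 4 := by
    have : m - v = (1 / 2 : ℝ) • (c - v) := by rw [hm]; module
    rw [this, norm_smul, norm_sub_rev v c]; norm_num; ring
  rw [hd]
  set M := max ‖v‖ ‖c‖
  set M' := max ‖m‖ ‖v‖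
  have hM0 : 0 ≤ M := le_max_of_le_left (norm_nonneg _)
  have hM'0 : 0 ≤ M' := le_max_of_le_left (norm_nonneg _)
  have hmM : ‖m‖ ≤ M := by
    rw [hm, norm_smul]; norm_num
    have := norm_add_le v c
    have := le_max_left ‖v‖ ‖c‖
    have := le_max_right ‖v‖ ‖c‖
    linarith
  have hM'M : M' ≤ M := max_le hmM (le_max_left _ _)
  have hcM' : ‖c‖ ≤ 3 * M' := by
    have : c = (2 : ℝ) • m - v := by rw [hm]; module
    have h1 : ‖c‖ ≤ 2 * ‖m‖ + ‖v‖ := by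
      rw [this]; refine (norm_sub_le _ _).trans ?_
      rw [norm_smul]; norm_num
    have := le_max_left ‖m‖ ‖v‖
    have := le_max_right ‖m‖ ‖v‖
    linarith
  have hMM' : M ≤ 3 * M' := max_le (by linarith [le_max_right ‖m‖ ‖v‖]) hcM'
  rcases hM'0.eq_or_lt with h0 | hpos
  · have hM : M = 0 := by linarith
    have hv : ‖v‖ = 0 := le_antisymm (by rw [← hM]; exact le_max_left _ _) (norm_nonneg _)
    have hc : ‖c‖ = 0 := le_antisymm (by rw [← hM]; exact le_max_right _ _) (norm_nonneg _)
    rw [norm_eq_zero] at hv hc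
    rw [hv, hc]; simp
  have hMpos : 0 < M := by
    by_contra h; linarith
  have h3 : (3 : ℝ) ^ (-p) * M ^ (p - 2) ≤ M' ^ (p - 2) := by
    rcases le_total 2 p with h | h
    · calc (3 : ℝ) ^ (-p) * M ^ (p - 2) ≤ 3 ^ (-(p - 2)) * (3 * M') ^ (p - 2) := by
            gcongr <;> linarith
        _ = M' ^ (p - 2) := by
            rw [Real.mul_rpow (by norm_num) hM'0, ← mul_assoc, ← Real.rpow_add (by norm_num)]
            simp
    · calc (3 : ℝ) ^ (-p) * M ^ (p - 2) ≤ 1 * M' ^ (p - 2) := by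
            gcongr ?_ * ?_
            · exact Real.rpow_le_one_of_one_le_of_nonpos (by norm_num) (by linarith)
            · exact Real.rpow_le_rpow_of_nonpos hpos hM'M (by linarith)
        _ = _ := one_mul _
  have hcJ := cJ_pos hp
  calc cB p * (M ^ (p - 2) * ‖v - c‖ ^ 2)
      = cJ p * ((3 ^ (-p) * M ^ (p - 2)) * (‖v - c‖ ^ 2 / 4)) := by unfold cB; ring
    _ ≤ _ := by gcongr

theorem norm_sub_le_two_max {H : Type*} [NormedAddCommGroup H] (v c : H) : ‖v - c‖ ≤ 2 * max ‖v‖ ‖c‖ := by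
  linarith [norm_sub_le v c, le_max_left ‖v‖ ‖c‖, le_max_right ‖v‖ ‖c‖]

theorem norm_J_sub_le_of_le_two (hp : 1 < p) (hp2 : p ≤ 2) (v c : H) :
    ‖J p v - J p c‖ ≤ 2 * (p + 1) * ‖v - c‖ ^ (p - 1) := by
  rcases (norm_nonneg (v - c)).eq_or_lt with h0 | hd
  · have : v = c := sub_eq_zero.1 (norm_eq_zero.1 h0.symm)
    rw [this]; simp; positivity
  have hM : ‖v - c‖ / 2 ≤ max ‖v‖ ‖c‖ := by linarith [norm_sub_le_two_max v c]
  refine (norm_J_sub_le hp v c).trans ?_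
  have h1 : max ‖v‖ ‖c‖ ^ (p - 2) ≤ (‖v - c‖ / 2) ^ (p - 2) :=
    Real.rpow_le_rpow_of_nonpos (by positivity) hM (by linarith)
  have h2 : (‖v - c‖ / 2) ^ (p - 2) = 2 ^ (2 - p) * ‖v - c‖ ^ (p - 2) := by
    rw [Real.div_rpow (by positivity) (by norm_num), show p - 2 = -(2 - p) by ring,
      Real.rpow_neg (by norm_num : (0:ℝ) ≤ 2)]
    field_simp
  have h3 : (2 : ℝ) ^ (2 - p) ≤ 2 := by
    calc (2 : ℝ) ^ (2 - p) ≤ 2 ^ (1 : ℝ) := by gcongr <;> linarith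
      _ = 2 := by simp
  calc (p + 1) * (max ‖v‖ ‖c‖ ^ (p - 2) * ‖v - c‖)
      ≤ (p + 1) * ((2 * ‖v - c‖ ^ (p - 2)) * ‖v - c‖) := by
        gcongr; rw [h2] at h1; exact h1.trans (by gcongr)
    _ = 2 * (p + 1) * (‖v - c‖ ^ (p - 2) * ‖v - c‖) := by ring
    _ = _ := by rw [rpow_sub_two_mul_self hp hd.le]

end Algebra


/-! ### Measure-theoretic tools -/

section Tools

open scoped Convolution

variable {H : Type*} [NormedAddCommGroup H] [InnerProductSpace ℝ H]

theorem holderConjugate_ofReal {p : ℝ} (hp : 1 < p) :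
    ENNReal.HolderConjugate (ENNReal.ofReal (p / (p - 1))) (ENNReal.ofReal p) := by
  have h : (p / (p - 1)).HolderConjugate p := (Real.HolderConjugate.conjExponent hp).symm
  exact h.ennrealOfReal

theorem integrable_inner_of_memLp {α : Type*} [MeasurableSpace α] {m : Measure α} {p : ℝ}
    (hp : 1 < p) {X Y : α → H}
    (hX : MemLp X (ENNReal.ofReal (p / (p - 1))) m) (hY : MemLp Y (ENNReal.ofReal p) m) :
    Integrable (fun z => inner ℝ (X z) (Y z)) m := by
  have := holderConjugate_ofReal hp
  have h : Integrable (fun z => ‖X z‖ * ‖Y z‖) m := MemLp.integrable_mul hX.norm hY.norm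
  refine h.mono' (hX.1.inner hY.1) (Eventually.of_forall fun z => ?_)
  exact norm_inner_le_norm (𝕜 := ℝ) _ _

theorem memLp_comp_add_right {G : Type*} [NormedAddCommGroup G] [MeasurableSpace G] [BorelSpace G]
    {m : Measure G} [m.IsAddHaarMeasure] {F : Type*} [NormedAddCommGroup F] {q : ℝ≥0∞} {Y : G → F}
    (hY : MemLp Y q m) (y : G) : MemLp (fun z => Y (z + y)) q m :=
  hY.comp_measurePreserving (measurePreserving_add_right m y)

variable {G : Type*} [NormedAddCommGroup G] [NormedSpace ℝ G] [FiniteDimensional ℝ G]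
  [MeasurableSpace G] [BorelSpace G] {m : Measure G} [m.IsAddHaarMeasure]

/-- Correlations of conjugate `L^p` functions are continuous. -/
theorem continuous_correlation {p : ℝ} (hp : 1 < p) {X Y : G → H}
    (hX : MemLp X (ENNReal.ofReal (p / (p - 1))) m) (hY : MemLp Y (ENNReal.ofReal p) m) :
    Continuous fun y => ∫ z, inner ℝ (X z) (Y (z + y)) ∂m := by
  have := holderConjugate_ofReal hp
  have : Fact (1 ≤ ENNReal.ofReal p) := ⟨by simpa using hp.le⟩
  have : Fact (1 ≤ ENNReal.ofReal (p / (p - 1))) := ⟨by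
    rw [ENNReal.one_le_ofReal, le_div_iff₀ (by linarith)]; linarith⟩
  let T : G → C(G, G) := fun y => ⟨fun z => z + y, by fun_prop⟩
  have hT : Continuous T := by
    refine ContinuousMap.continuous_of_continuous_uncurry _ ?_
    simp only [T, Function.uncurry_def, ContinuousMap.coe_mk]
    fun_prop
  have hTm : ∀ y, MeasurePreserving (T y) m m := fun y => measurePreserving_add_right m y
  have hc : Continuous fun y => Lp.compMeasurePreserving (T y) (hTm y) hY.toLp :=
    Continuous.compMeasurePreservingLp continuous_const hT hTm ENNReal.ofReal_ne_top
  have h2 := ((innerSL ℝ (E := H)).lpPairing m (ENNReal.ofReal (p / (p - 1)))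
    (ENNReal.ofReal p) hX.toLp).continuous.comp hc
  convert h2 using 1
  ext y
  simp only [Function.comp, ContinuousLinearMap.lpPairing_eq_integral]
  refine integral_congr_ae ?_
  have e1 := hX.coeFn_toLp
  have e2 := Lp.coeFn_compMeasurePreserving hY.toLp (hTm y)
  have e3 := (hTm y).quasiMeasurePreserving.ae_eq_comp hY.coeFn_toLp
  filter_upwards [e1, e2, e3] with z h1 h2 h3
  rw [h1, h2, h3]
  rfl

/-- Pairing against a mollified function is the mollification of the correlation. -/
theorem integral_inner_convolution [CompleteSpace H] [MeasurableSpace H] [BorelSpace H]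
    [SecondCountableTopology H] {p : ℝ} (hp : 1 < p) {X Y : G → H} (hXm : Measurable X)
    (hYm : Measurable Y) (hX : MemLp X (ENNReal.ofReal (p / (p - 1))) m)
    (hY : MemLp Y (ENNReal.ofReal p) m) {χ : G → ℝ} (hχ : Continuous χ)
    (hχc : HasCompactSupport χ) (y : G) :
    ∫ z, inner ℝ (X z) ((χ ⋆[ContinuousLinearMap.lsmul ℝ ℝ, m] Y) (z + y)) ∂m
      = ∫ w, χ w * ∫ z, inner ℝ (X z) (Y (z + (y - w))) ∂m ∂m := by
  have h_int : Integrable (Function.uncurry fun z w => χ w * inner ℝ (X z) (Y (z + (y - w))))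
      (m.prod m) := by
    have hm : Measurable (Function.uncurry
        fun z w => χ w * inner ℝ (X z) (Y (z + (y - w)))) := by
      refine Measurable.mul (hχ.measurable.comp measurable_snd) ?_
      refine Measurable.inner (hXm.comp measurable_fst) (hYm.comp ?_)
      fun_prop
    rw [integrable_prod_iff' hm.aestronglyMeasurable]
    constructor
    · refine Eventually.of_forall fun w => ?_
      exact (integrable_inner_of_memLp hp hX (memLp_comp_add_right hY (y - w))).const_mul (χ w)
    · have hc : Continuous fun w => ∫ z, inner ℝ (‖X z‖) (‖Y (z + w)‖) ∂m :=
        continuous_correlation hp hX.norm hY.norm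
      have hc2 : Continuous fun w => ‖χ w‖ * ∫ z, inner ℝ (‖X z‖) (‖Y (z + (y - w))‖) ∂m :=
        hχ.norm.mul (hc.comp (by fun_prop))
      have hi : Integrable
          (fun w => ‖χ w‖ * ∫ z, inner ℝ (‖X z‖) (‖Y (z + (y - w))‖) ∂m) m :=
        hc2.integrable_of_hasCompactSupport hχc.norm.mul_right
      refine hi.mono' ?_ (Eventually.of_forall fun w => ?_)
      · exact hm.norm.aestronglyMeasurable.prod_swap.integral_prod_right'
      · rw [Real.norm_of_nonneg (integral_nonneg fun _ => norm_nonneg _), ← integral_const_mul]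
        refine integral_mono_of_nonneg (Eventually.of_forall fun _ => norm_nonneg _) ?_
          (Eventually.of_forall fun z => ?_)
        · exact (integrable_inner_of_memLp hp hX.norm
            (memLp_comp_add_right hY (y - w)).norm).const_mul _
        · simp only [Function.uncurry, norm_mul]
          gcongr
          refine (norm_inner_le_norm (𝕜 := ℝ) _ _).trans ?_
          simp [mul_comm]
  have h1 : ∀ z, inner ℝ (X z) ((χ ⋆[ContinuousLinearMap.lsmul ℝ ℝ, m] Y) (z + y))
      = ∫ w, χ w * inner ℝ (X z) (Y (z + (y - w))) ∂m := by
    intro z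
    have hYl : LocallyIntegrable Y m :=
      hY.locallyIntegrable (by simpa using hp.le)
    have hce : ConvolutionExistsAt χ Y (z + y) (ContinuousLinearMap.lsmul ℝ ℝ) m :=
      hχc.convolutionExists_left _ hχ hYl _
    rw [convolution_def, ← innerSL_apply_apply ℝ, ← ContinuousLinearMap.integral_comp_comm _ hce]
    refine integral_congr_ae (Eventually.of_forall fun w => ?_)
    simp [add_sub_assoc]
  simp_rw [h1]
  rw [integral_integral_swap h_int]
  simp_rw [integral_const_mul]

/-- A locally integrable function all of whose nonnegative smooth averages near points of an open
set lie in a closed set takes its values there a.e. -/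
theorem ae_mem_of_forall_average_mem {F : Type*} [NormedAddCommGroup F] [NormedSpace ℝ F]
    [CompleteSpace F] {B : G → F} (hB : LocallyIntegrable B m) {U : Set G} (hU : IsOpen U)
    {S : Set F} (hS : IsClosed S)
    (h : ∀ g : G → ℝ, ContDiff ℝ (⊤ : ℕ∞) g → HasCompactSupport g → tsupport g ⊆ U →
      (∀ z, 0 ≤ g z) → ∫ z, g z ∂m = 1 → ∫ z, g z • B z ∂m ∈ S) :
    ∀ᵐ z ∂m, z ∈ U → B z ∈ S := by
  let φ : ℕ → ContDiffBump (0 : G) := fun k =>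
    ⟨1 / (2 * (k + 1)), 1 / (k + 1), by positivity, by
      gcongr; linarith [(k.cast_nonneg : (0:ℝ) ≤ k)]⟩
  have hφ : Tendsto (fun k => (φ k).rOut) atTop (𝓝 0) :=
    tendsto_one_div_add_atTop_nhds_zero_nat
  have hφ' : ∀ᶠ k in atTop, (φ k).rOut ≤ 2 * (φ k).rIn := Eventually.of_forall fun k => by
    simp only [φ]; apply le_of_eq; field_simp
  filter_upwards [ContDiffBump.ae_convolution_tendsto_right_of_locallyIntegrable hφ hφ' hB]
    with z hz hzU
  refine hS.mem_of_tendsto hz ?_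
  obtain ⟨r, hr, hrU⟩ := Metric.isOpen_iff.1 hU z hzU
  filter_upwards [hφ.eventually (gt_mem_nhds hr)] with k hk
  rw [convolution_eq_swap]
  simp only [ContinuousLinearMap.lsmul_apply]
  have hsub : tsupport (fun y => (φ k).normed m (z - y)) ⊆ Metric.closedBall z (φ k).rOut := by
    refine closure_minimal (fun y hy => ?_) Metric.isClosed_closedBall
    have : z - y ∈ Function.support ((φ k).normed m) := hy
    rw [ContDiffBump.support_normed_eq, mem_ball_zero_iff] at this
    rw [Metric.mem_closedBall, dist_eq_norm, norm_sub_rev]; exact this.le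
  refine h _ ?_ ?_ ?_ ?_ ?_
  · exact (ContDiffBump.contDiff_normed _).comp (contDiff_const.sub contDiff_id)
  · exact HasCompactSupport.of_support_subset_isCompact (isCompact_closedBall z (φ k).rOut)
      ((subset_tsupport _).trans hsub)
  · exact hsub.trans ((Metric.closedBall_subset_ball hk).trans hrU)
  · intro y; exact ContDiffBump.nonneg_normed _ _
  · rw [integral_sub_left_eq_self (fun y => (φ k).normed m y) m z]
    exact ContDiffBump.integral_normed _

/-- Differentiation of `s ↦ ∫ ⟨g, ψ(· + s d)⟩`. -/
theorem hasDerivAt_correlation_smooth [CompleteSpace H] {g : G → H} (hg : Integrable g m)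
    {ψ : G → H} (hψ : ContDiff ℝ 1 ψ) (hψc : HasCompactSupport ψ) (d : G) (s : ℝ) :
    HasDerivAt (fun s : ℝ => ∫ z, inner ℝ (g z) (ψ (z + s • d)) ∂m)
      (∫ z, inner ℝ (g z) (fderiv ℝ ψ (z + s • d) d) ∂m) s := by
  have hcont : Continuous (fderiv ℝ ψ) := hψ.continuous_fderiv one_ne_zero
  obtain ⟨C, hC⟩ := (hψc.fderiv (𝕜 := ℝ)).exists_bound_of_continuous hcont
  obtain ⟨C0, hC0⟩ := hψc.exists_bound_of_continuous hψ.continuous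
  have hm : ∀ s : ℝ, AEStronglyMeasurable (fun z => inner ℝ (g z) (ψ (z + s • d))) m := fun s =>
    hg.1.inner (hψ.continuous.comp (by fun_prop)).aestronglyMeasurable
  refine (hasDerivAt_integral_of_dominated_loc_of_deriv_le (s := univ) (x₀ := s)
    (F' := fun s z => inner ℝ (g z) (fderiv ℝ ψ (z + s • d) d))
    (bound := fun z => ‖g z‖ * (C * ‖d‖)) Filter.univ_mem
    (Eventually.of_forall hm) ?_ ?_ ?_ ?_ ?_).2
  · refine (hg.norm.mul_const C0).mono' (hm s) (Eventually.of_forall fun z => ?_)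
    refine (norm_inner_le_norm (𝕜 := ℝ) _ _).trans ?_
    gcongr; exact hC0 _
  · exact hg.1.inner ((hcont.comp (by fun_prop)).clm_apply continuous_const).aestronglyMeasurable
  · refine Eventually.of_forall fun z s _ => ?_
    refine (norm_inner_le_norm (𝕜 := ℝ) _ _).trans ?_
    gcongr
    exact ((fderiv ℝ ψ (z + s • d)).le_opNorm d).trans (by gcongr; exact hC _)
  · exact hg.norm.mul_const _
  · refine Eventually.of_forall fun z s _ => ?_
    have h1 : HasDerivAt (fun s : ℝ => z + s • d) d s := by
      simpa using ((hasDerivAt_id s).smul_const d).const_add z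
    have h2 := ((hψ.differentiable one_ne_zero (z + s • d)).hasFDerivAt).comp_hasDerivAt s h1
    have h3 := (innerSL ℝ (g z)).hasFDerivAt.comp_hasDerivAt s h2
    exact h3

/-- Jensen's inequality combined with Tonelli's theorem. -/
theorem lintegral_rpow_lintegral_le {α β : Type*} [MeasurableSpace α] [MeasurableSpace β]
    {μ : Measure α} [SFinite μ] {P : Measure β} [IsProbabilityMeasure P] {s : ℝ} (hs : 1 ≤ s)
    {F : α → β → ℝ≥0∞} (hF : Measurable (Function.uncurry F)) {B : ℝ≥0∞}
    (h : ∀ᵐ y ∂P, ∫⁻ x, F x y ^ s ∂μ ≤ B) :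
    ∫⁻ x, (∫⁻ y, F x y ∂P) ^ s ∂μ ≤ B := by
  have h1 : ∀ x, (∫⁻ y, F x y ∂P) ^ s ≤ ∫⁻ y, F x y ^ s ∂P := by
    intro x
    have hm : Measurable (F x) := hF.comp measurable_prodMk_left
    have h2 := eLpNorm'_le_eLpNorm'_of_exponent_le one_pos hs P (f := F x)
      hm.aestronglyMeasurable
    simp only [eLpNorm', enorm_eq_self, ENNReal.rpow_one, div_one] at h2
    calc (∫⁻ y, F x y ∂P) ^ s ≤ ((∫⁻ y, F x y ^ s ∂P) ^ (1 / s)) ^ s := by gcongr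
      _ = _ := by
        rw [← ENNReal.rpow_mul, one_div, inv_mul_cancel₀ (by linarith), ENNReal.rpow_one]
  calc ∫⁻ x, (∫⁻ y, F x y ∂P) ^ s ∂μ ≤ ∫⁻ x, ∫⁻ y, F x y ^ s ∂P ∂μ := lintegral_mono h1
    _ = ∫⁻ y, ∫⁻ x, F x y ^ s ∂μ ∂P :=
      lintegral_lintegral_swap (hF.pow_const s).aemeasurable
    _ ≤ ∫⁻ y, B ∂P := lintegral_mono_ae h
    _ = B := by simp

end Tools


/-! ### Calculus on space-time and mollification -/

section SpaceTime

open scoped Convolution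

/-- Space-time. -/
abbrev ST (n : ℕ) := Spc n × ℝ

instance isAddHaarMeasure_volume_ST : (volume : Measure (ST n)).IsAddHaarMeasure :=
  inferInstanceAs ((volume : Measure (Spc n)).prod (volume : Measure ℝ)).IsAddHaarMeasure

/-- The `j`-th spatial unit vector in space-time. -/
def sdir (j : Fin n) : ST n := (EuclideanSpace.single j 1, 0)

/-- The unit vector in time direction. -/
def tdir (n : ℕ) : ST n := (0, 1)

/-- Spatial gradient of a scalar function. -/
def gradS (θ : ST n → ℝ) (z : ST n) : Spc n := WithLp.toLp 2 fun j => fderiv ℝ θ z (sdir j)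

/-- Spatial gradient of a vector-valued function. -/
def gradM (Ψ : ST n → Vec N) (z : ST n) : Mat N n :=
  WithLp.toLp 2 fun ij => fderiv ℝ Ψ z (sdir ij.2) ij.1

/-- The tensor product `b ⊗ a`. -/
def tens (b : Vec N) (a : Spc n) : Mat N n := WithLp.toLp 2 fun ij => b ij.1 * a ij.2

/-- The product of a matrix and a vector. -/
def matVec (M : Mat N n) (e : Spc n) : Vec N := WithLp.toLp 2 fun i => ∑ j, M (i, j) * e j

/-- `Dw` is the weak spatial gradient of `w` in `U`. -/
def WGrad (U : Set (ST n)) (w : ST n → Vec N) (Dw : ST n → Mat N n) : Prop :=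
  ∀ ψ : ST n → ℝ, ContDiff ℝ (⊤ : ℕ∞) ψ → HasCompactSupport ψ → tsupport ψ ⊆ U →
    ∀ (i : Fin N) (j : Fin n), ∫ z, w z i * fderiv ℝ ψ z (sdir j) = - ∫ z, Dw z (i, j) * ψ z

theorem norm_tens (b : Vec N) (a : Spc n) : ‖tens b a‖ = ‖b‖ * ‖a‖ := by
  rw [← sq_eq_sq₀ (norm_nonneg _) (by positivity), mul_pow]
  simp only [EuclideanSpace.norm_sq_eq, tens, Fintype.sum_prod_type, Finset.sum_mul_sum,
    norm_mul, mul_pow]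

theorem norm_matVec_le (M : Mat N n) (e : Spc n) : ‖matVec M e‖ ≤ ‖M‖ * ‖e‖ := by
  rw [← sq_le_sq₀ (norm_nonneg _) (by positivity), mul_pow]
  simp only [EuclideanSpace.norm_sq_eq, matVec, Fintype.sum_prod_type, Real.norm_eq_abs, sq_abs]
  rw [Finset.sum_mul]
  refine Finset.sum_le_sum fun i _ => ?_
  exact Finset.sum_mul_sq_le_sq_mul_sq _ _ _

theorem fderiv_spatial {Ψ : ST n → Vec N} (z : ST n) (e : Spc n) :
    fderiv ℝ Ψ z (e, 0) = matVec (gradM Ψ z) e := by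
  have he : ((e, 0) : ST n) = ∑ j, e j • sdir j := by
    refine Prod.ext ?_ ?_
    · rw [Prod.fst_sum]
      ext i
      simp [sdir, Finset.sum_apply, Pi.single_apply]
    · simp [Prod.snd_sum, sdir]
  rw [he, map_sum]
  ext i
  simp [matVec, gradM, mul_comm]

/-- A standard sequence of mollifiers. -/
def mol (n k : ℕ) : ContDiffBump (0 : ST n) :=
  ⟨1 / (2 * (k + 1)), 1 / (k + 1), by positivity, by
    gcongr; linarith [(k.cast_nonneg : (0:ℝ) ≤ k)]⟩

theorem tendsto_mol_rOut : Tendsto (fun k => (mol n k).rOut) atTop (𝓝 0) :=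
  tendsto_one_div_add_atTop_nhds_zero_nat

/-- Mollification. -/
def moll {F : Type*} [NormedAddCommGroup F] [NormedSpace ℝ F] (k : ℕ) (w : ST n → F) : ST n → F :=
  (mol n k).normed volume ⋆[ContinuousLinearMap.lsmul ℝ ℝ, volume] w

variable {F : Type*} [NormedAddCommGroup F] [NormedSpace ℝ F]

theorem tendsto_moll_ae [CompleteSpace F] {w : ST n → F} (hw : LocallyIntegrable w volume) :
    ∀ᵐ z, Tendsto (fun k => moll k w z) atTop (𝓝 (w z)) := by
  refine ContDiffBump.ae_convolution_tendsto_right_of_locallyIntegrable (K := 2)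
    tendsto_mol_rOut (Eventually.of_forall fun k => ?_) hw
  simp only [mol]; apply le_of_eq; field_simp

theorem contDiff_moll [CompleteSpace F] {w : ST n → F} (hw : LocallyIntegrable w volume) (k : ℕ) :
    ContDiff ℝ (⊤ : ℕ∞) (moll k w) :=
  HasCompactSupport.contDiff_convolution_left _ (mol n k).hasCompactSupport_normed
    (mol n k).contDiff_normed hw

theorem moll_apply (k : ℕ) (w : ST n → F) (z : ST n) :
    moll k w z = ∫ y, (mol n k).normed volume y • w (z - y) := by
  simp [moll, convolution_def]

theorem moll_eq_zero {w : ST n → F} {r : ℝ} (hw : ∀ z, r ≤ ‖z‖ → w z = 0) (k : ℕ) {z : ST n}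
    (hz : r + 1 / (k + 1) ≤ ‖z‖) : moll k w z = 0 := by
  rw [moll_apply]
  refine integral_eq_zero_of_ae (Eventually.of_forall fun y => ?_)
  by_cases hy : y ∈ Metric.ball (0 : ST n) (1 / (k + 1))
  · simp only [Pi.zero_apply]
    rw [hw, smul_zero]
    rw [mem_ball_zero_iff] at hy
    linarith [norm_sub_norm_le z y]
  · have : y ∉ Function.support ((mol n k).normed volume) := by
      rw [ContDiffBump.support_normed_eq]; exact hy
    rw [Function.notMem_support] at this
    simp [this]

theorem tsupport_moll_subset {w : ST n → F} {r : ℝ} (hw : ∀ z, r ≤ ‖z‖ → w z = 0) (k : ℕ) :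
    tsupport (moll k w) ⊆ Metric.closedBall 0 (r + 1 / (k + 1)) := by
  refine closure_minimal (fun z hz => ?_) Metric.isClosed_closedBall
  rw [mem_closedBall_zero_iff]
  by_contra h
  exact hz (moll_eq_zero hw k (not_le.1 h).le)

theorem hasCompactSupport_moll {w : ST n → F} {r : ℝ} (hw : ∀ z, r ≤ ‖z‖ → w z = 0) (k : ℕ) :
    HasCompactSupport (moll k w) :=
  HasCompactSupport.of_support_subset_isCompact (isCompact_closedBall 0 (r + 1 / (k + 1)))
    ((subset_tsupport _).trans (tsupport_moll_subset hw k))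

theorem gradM_moll {U : Set (ST n)} {w : ST n → Vec N} {Dw : ST n → Mat N n}
    (hw : LocallyIntegrable w volume) (hDw : LocallyIntegrable Dw volume) (h : WGrad U w Dw)
    {k : ℕ} {z : ST n} (hz : Metric.closedBall z (1 / (k + 1)) ⊆ U) :
    gradM (moll k w) z = moll k Dw z := by
  set χ := (mol n k).normed (volume : Measure (ST n)) with hχ
  have hχs : ContDiff ℝ (⊤ : ℕ∞) χ := (mol n k).contDiff_normed
  have hχ1 : ContDiff ℝ 1 χ := (mol n k).contDiff_normed
  have hχc : HasCompactSupport χ := (mol n k).hasCompactSupport_normed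
  have hd := HasCompactSupport.hasFDerivAt_convolution_left (μ := volume)
    (ContinuousLinearMap.lsmul ℝ ℝ) hχc hχ1 hw z
  ext ⟨i, j⟩
  have hce : ConvolutionExistsAt (fderiv ℝ χ) w z
      ((ContinuousLinearMap.lsmul ℝ ℝ).precompL (ST n)) volume :=
    (hχc.fderiv (𝕜 := ℝ)).convolutionExists_left _ (hχ1.continuous_fderiv one_ne_zero) hw z
  have hce2 : ConvolutionExistsAt χ Dw z (ContinuousLinearMap.lsmul ℝ ℝ) volume :=
    hχc.convolutionExists_left _ hχ1.continuous hDw z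
  have e1 : gradM (moll k w) z (i, j) = ∫ y, fderiv ℝ χ y (sdir j) * w (z - y) i := by
    simp only [gradM]
    rw [show moll k w = χ ⋆[ContinuousLinearMap.lsmul ℝ ℝ, volume] w from rfl, hd.fderiv,
      convolution_def]
    have := ContinuousLinearMap.integral_comp_comm
      ((EuclideanSpace.proj i : Vec N →L[ℝ] ℝ).comp
        (ContinuousLinearMap.apply ℝ (Vec N) (sdir j : ST n))) hce
    simp only [ContinuousLinearMap.comp_apply, ContinuousLinearMap.apply_apply,
      EuclideanSpace.coe_proj] at this
    rw [← this]
    simp [ContinuousLinearMap.precompL_apply]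
  have e2 : moll k Dw z (i, j) = ∫ y, χ y * Dw (z - y) (i, j) := by
    rw [moll, convolution_def]
    have := ContinuousLinearMap.integral_comp_comm
      (EuclideanSpace.proj (i, j) : Mat N n →L[ℝ] ℝ) hce2
    simp only [EuclideanSpace.coe_proj] at this
    rw [← this]
    simp
  rw [e1, e2]
  have hψs : ContDiff ℝ (⊤ : ℕ∞) (fun y => χ (z - y)) := hχs.comp (contDiff_const.sub contDiff_id)
  have hsub : tsupport (fun y => χ (z - y)) ⊆ Metric.closedBall z (1 / (k + 1)) := by
    refine closure_minimal (fun y hy => ?_) Metric.isClosed_closedBall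
    have : z - y ∈ Function.support χ := hy
    rw [hχ, ContDiffBump.support_normed_eq, mem_ball_zero_iff] at this
    rw [Metric.mem_closedBall, dist_eq_norm, norm_sub_rev]; exact this.le
  have hψc : HasCompactSupport (fun y => χ (z - y)) :=
    HasCompactSupport.of_support_subset_isCompact (isCompact_closedBall z (1 / (k + 1)))
      ((subset_tsupport _).trans hsub)
  have key := h _ hψs hψc (hsub.trans hz) i j
  have hder : ∀ y, fderiv ℝ (fun y => χ (z - y)) y (sdir j) = - fderiv ℝ χ (z - y) (sdir j) := by
    intro y
    have h1 : HasFDerivAt (fun y : ST n => z - y) (-(ContinuousLinearMap.id ℝ (ST n))) y :=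
      (hasFDerivAt_id y).const_sub z
    have h2 := ((hχ1.differentiable one_ne_zero (z - y)).hasFDerivAt).comp y h1
    have h3 : fderiv ℝ (fun y => χ (z - y)) y = _ := h2.fderiv
    rw [h3]; simp
  simp only [hder, mul_neg, integral_neg, neg_inj] at key
  rw [← integral_sub_left_eq_self (fun y => fderiv ℝ χ y (sdir j) * w (z - y) i) volume z,
    ← integral_sub_left_eq_self (fun y => χ y * Dw (z - y) (i, j)) volume z]
  simp only [sub_sub_cancel]
  simpa only [mul_comm] using key

theorem lintegral_moll_le [CompleteSpace F] [MeasurableSpace F] [BorelSpace F]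
    [SecondCountableTopology F] {w : ST n → F} (hw : Measurable w) {s : ℝ} (hs : 1 ≤ s) (k : ℕ)
    {U V : Set (ST n)} (hU : MeasurableSet U) (hV : MeasurableSet V)
    (hUV : ∀ z ∈ U, Metric.ball z (1 / (k + 1)) ⊆ V) :
    ∫⁻ z in U, ‖moll k w z‖ₑ ^ s ≤ ∫⁻ z in V, ‖w z‖ₑ ^ s := by
  set χ := (mol n k).normed (volume : Measure (ST n)) with hχ
  have hχm : Measurable χ := (mol n k).continuous_normed.measurable
  let P : Measure (ST n) := volume.withDensity fun y => ENNReal.ofReal (χ y)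
  have hP : IsProbabilityMeasure P := ⟨by
    rw [withDensity_apply _ MeasurableSet.univ, Measure.restrict_univ,
      ← ofReal_integral_eq_lintegral_ofReal (mol n k).integrable_normed
        (Eventually.of_forall fun y => (mol n k).nonneg_normed y), (mol n k).integral_normed]
    simp⟩
  have h1 : ∀ z, ‖moll k w z‖ₑ ≤ ∫⁻ y, ‖w (z - y)‖ₑ ∂P := by
    intro z
    rw [moll_apply]
    refine (enorm_integral_le_lintegral_enorm _).trans ?_
    have hwm : Measurable fun y => ‖w (z - y)‖ₑ := (hw.comp (by fun_prop)).enorm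
    rw [lintegral_withDensity_eq_lintegral_mul _ hχm.ennreal_ofReal hwm]
    refine lintegral_mono fun y => ?_
    simp only [Pi.mul_apply, enorm_smul]
    rw [← hχ, Real.enorm_of_nonneg ((mol n k).nonneg_normed y)]
  calc ∫⁻ z in U, ‖moll k w z‖ₑ ^ s ≤ ∫⁻ z in U, (∫⁻ y, ‖w (z - y)‖ₑ ∂P) ^ s := by
        gcongr with z; exact h1 z
    _ ≤ _ := by
      refine lintegral_rpow_lintegral_le hs ?_ ?_
      · exact (hw.comp (measurable_fst.sub measurable_snd)).enorm
      · have hball : ∀ᵐ y ∂P, y ∈ Metric.ball (0 : ST n) (1 / (k + 1)) := by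
          rw [ae_withDensity_iff hχm.ennreal_ofReal]
          refine Eventually.of_forall fun y hy => ?_
          have : y ∈ Function.support χ := fun h => hy (by simp [h])
          rw [hχ, ContDiffBump.support_normed_eq] at this
          exact this
        filter_upwards [hball] with y hy
        rw [← lintegral_indicator hU, ← lintegral_indicator hV,
          ← lintegral_sub_right_eq_self (V.indicator fun z => ‖w z‖ₑ ^ s) y]
        refine lintegral_mono fun z => ?_
        by_cases hz : z ∈ U
        · have : z - y ∈ V := hUV z hz (by
            rw [Metric.mem_ball, dist_eq_norm]
            simpa using hy)
          rw [indicator_of_mem hz, indicator_of_mem this]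
        · simp [indicator_of_notMem hz]

end SpaceTime


/-! ### The normalized system -/

section Normalized

open scoped Convolution

theorem measurable_J {H : Type*} [NormedAddCommGroup H] [InnerProductSpace ℝ H] [MeasurableSpace H]
    [BorelSpace H] [SecondCountableTopology H] {α : Type*} [MeasurableSpace α] (p : ℝ) {v : α → H}
    (hv : Measurable v) : Measurable fun z => J p (v z) :=
  (hv.norm.pow_const (p - 2)).smul hv

theorem memLp_norm_rpow_sub_one {α : Type*} [MeasurableSpace α] {m : Measure α} {F : Type*}
    [NormedAddCommGroup F] {p : ℝ} (hp : 1 < p) {v : α → F} (hv : MemLp v (ENNReal.ofReal p) m) :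
    MemLp (fun z => ‖v z‖ ^ (p - 1)) (ENNReal.ofReal (p / (p - 1))) m := by
  have h := hv.norm_rpow_div (ENNReal.ofReal (p - 1))
  rwa [← ENNReal.ofReal_div_of_pos (by linarith), ENNReal.toReal_ofReal (by linarith)] at h

theorem memLp_J {H : Type*} [NormedAddCommGroup H] [InnerProductSpace ℝ H] [MeasurableSpace H]
    [BorelSpace H] [SecondCountableTopology H] {α : Type*} [MeasurableSpace α] {m : Measure α}
    {p : ℝ} (hp : 1 < p) {v : α → H} (hvm : Measurable v) (hv : MemLp v (ENNReal.ofReal p) m) :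
    MemLp (fun z => J p (v z)) (ENNReal.ofReal (p / (p - 1))) m := by
  refine (memLp_norm_rpow_sub_one hp hv).of_le (measurable_J p hvm).aestronglyMeasurable
    (Eventually.of_forall fun z => ?_)
  rw [norm_J hp, Real.norm_of_nonneg (by positivity)]

/-- Solutions of the normalized system `∂_t J(v) = lam · div G` in the ball of radius `2` of
space-time, extended by zero. -/
structure NSol (p ν L lam : ℝ) (v : ST n → Vec N) (Dv G : ST n → Mat N n) (f : ST n → ℝ) :
    Prop where
  hp : 1 < p
  hν : 0 < ν
  hL : 0 ≤ L
  hlam : 0 < lam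
  measv : Measurable v
  measDv : Measurable Dv
  measG : Measurable G
  measf : Measurable f
  memv : MemLp v (ENNReal.ofReal p) volume
  memDv : MemLp Dv (ENNReal.ofReal p) volume
  memf : MemLp f (ENNReal.ofReal p) volume
  zerov : ∀ z, 2 ≤ ‖z‖ → v z = 0
  zeroDv : ∀ z, 2 ≤ ‖z‖ → Dv z = 0
  zerof : ∀ z, 2 ≤ ‖z‖ → f z = 0
  fnonneg : ∀ z, 0 ≤ f z
  growth : ∀ᵐ z, ‖G z‖ ≤ L * ‖Dv z‖ ^ (p - 1) + f z ^ (p - 1)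
  coercive : ∀ᵐ z, ν * ‖Dv z‖ ^ p ≤ inner ℝ (G z) (Dv z) + f z ^ (p - 1) * ‖Dv z‖
  grad : WGrad (Metric.ball 0 2) v Dv
  weak : ∀ Ψ : ST n → Vec N, ContDiff ℝ (⊤ : ℕ∞) Ψ → HasCompactSupport Ψ →
    tsupport Ψ ⊆ Metric.ball 0 2 →
      ∫ z, inner ℝ (J p (v z)) (fderiv ℝ Ψ z (tdir n)) = lam * ∫ z, inner ℝ (G z) (gradM Ψ z)

variable {p ν L lam : ℝ} {v : ST n → Vec N} {Dv G : ST n → Mat N n} {f : ST n → ℝ}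

theorem NSol.memJ (S : NSol p ν L lam v Dv G f) :
    MemLp (fun z => J p (v z)) (ENNReal.ofReal (p / (p - 1))) volume :=
  memLp_J S.hp S.measv S.memv

theorem NSol.memG (S : NSol p ν L lam v Dv G f) :
    MemLp G (ENNReal.ofReal (p / (p - 1))) volume := by
  have h1 := ((memLp_norm_rpow_sub_one S.hp S.memDv).const_mul L).add
    (memLp_norm_rpow_sub_one S.hp S.memf)
  refine h1.of_le S.measG.aestronglyMeasurable ?_
  filter_upwards [S.growth] with z hz
  refine hz.trans ((le_abs_self _).trans (le_of_eq ?_))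
  simp [abs_of_nonneg (S.fnonneg z)]

theorem integrable_of_memLp_of_zero {F : Type*} [NormedAddCommGroup F] {q : ℝ} (hq : 1 ≤ q)
    {w : ST n → F} (hw : MemLp w (ENNReal.ofReal q) volume) {r : ℝ}
    (h0 : ∀ z, r ≤ ‖z‖ → w z = 0) : Integrable w volume := by
  have hsub : Function.support w ⊆ Metric.ball 0 r := fun z hz => by
    rw [mem_ball_zero_iff]; by_contra h; exact hz (h0 z (not_lt.1 h))
  rw [← integrableOn_iff_integrable_of_support_subset hsub]
  have : IsFiniteMeasure (volume.restrict (Metric.ball (0 : ST n) r)) :=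
    ⟨by rw [Measure.restrict_apply_univ]; exact measure_ball_lt_top⟩
  exact (hw.restrict (Metric.ball 0 r)).integrable (by simpa using hq)

theorem NSol.integrable_J (S : NSol p ν L lam v Dv G f) :
    Integrable (fun z => J p (v z)) volume := by
  have := S.hp
  refine integrable_of_memLp_of_zero (r := 2) ?_ S.memJ fun z hz => by rw [S.zerov z hz, J_zero]
  rw [le_div_iff₀ (by linarith)]; linarith

theorem NSol.integrable_Dv (S : NSol p ν L lam v Dv G f) : Integrable Dv volume :=
  integrable_of_memLp_of_zero S.hp.le S.memDv S.zeroDv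

theorem NSol.integrable_v (S : NSol p ν L lam v Dv G f) : Integrable v volume :=
  integrable_of_memLp_of_zero S.hp.le S.memv S.zerov

theorem fderiv_comp_add {F : Type*} [NormedAddCommGroup F] [NormedSpace ℝ F] (ψ : ST n → F)
    (a z : ST n) : fderiv ℝ (fun z => ψ (z + a)) z = fderiv ℝ ψ (z + a) :=
  fderiv_comp_add_right a

theorem norm_tdir : ‖tdir n‖ = 1 := by simp [tdir, Prod.norm_def]

/-- Integrated form of the equation, tested with differences in time. -/
theorem NSol.integral_inner_shift (S : NSol p ν L lam v Dv G f) {w : ST n → Vec N}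
    {Dw : ST n → Mat N n} (hwm : Measurable w) (hDwm : Measurable Dw)
    (hw : MemLp w (ENNReal.ofReal p) volume) (hDw : MemLp Dw (ENNReal.ofReal p) volume) {r h : ℝ}
    (hw0 : ∀ z, r ≤ ‖z‖ → w z = 0) (hDw0 : ∀ z, r ≤ ‖z‖ → Dw z = 0) (hgrad : WGrad univ w Dw)
    (hh : 0 ≤ h) (hrh : r + h < 2) :
    (∫ z, inner ℝ (J p (v z)) (w (z + h • tdir n))) - ∫ z, inner ℝ (J p (v z)) (w z)
      = lam * ∫ s in (0:ℝ)..h, ∫ z, inner ℝ (G z) (Dw (z + s • tdir n)) := by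
  have hwi := integrable_of_memLp_of_zero S.hp.le hw hw0
  have hDwi := integrable_of_memLp_of_zero S.hp.le hDw hDw0
  set M : ST n → ℝ := fun y => ∫ z, inner ℝ (J p (v z)) (w (z + y)) with hM
  set Nn : ST n → ℝ := fun y => ∫ z, inner ℝ (G z) (Dw (z + y)) with hNn
  have hMc : Continuous M := continuous_correlation S.hp S.memJ hw
  have hNc : Continuous Nn := continuous_correlation S.hp S.memG hDw
  set mk : ℕ → ℝ → ℝ := fun k s => ∫ z, inner ℝ (J p (v z)) (moll k w (z + s • tdir n)) with hmk
  set nk : ℕ → ℝ → ℝ := fun k s => ∫ z, inner ℝ (G z) (moll k Dw (z + s • tdir n)) with hnk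
  have hmk_eq : ∀ k s, mk k s
      = ((mol n k).normed volume ⋆[ContinuousLinearMap.lsmul ℝ ℝ, volume] M) (s • tdir n) := by
    intro k s
    have := integral_inner_convolution S.hp (measurable_J p S.measv) hwm S.memJ hw
      ((mol n k).continuous_normed (μ := volume)) (mol n k).hasCompactSupport_normed (s • tdir n) (m := volume)
    rw [convolution_def]
    exact this
  have hnk_eq : ∀ k s, nk k s
      = ((mol n k).normed volume ⋆[ContinuousLinearMap.lsmul ℝ ℝ, volume] Nn) (s • tdir n) := by
    intro k s
    have := integral_inner_convolution S.hp S.measG hDwm S.memG hDw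
      ((mol n k).continuous_normed (μ := volume)) (mol n k).hasCompactSupport_normed (s • tdir n) (m := volume)
    rw [convolution_def]
    exact this
  have hmk_lim : ∀ s, Tendsto (fun k => mk k s) atTop (𝓝 (M (s • tdir n))) := by
    intro s
    simp_rw [hmk_eq]
    exact ContDiffBump.convolution_tendsto_right_of_continuous tendsto_mol_rOut hMc _
  have hnk_lim : ∀ s, Tendsto (fun k => nk k s) atTop (𝓝 (Nn (s • tdir n))) := by
    intro s
    simp_rw [hnk_eq]
    exact ContDiffBump.convolution_tendsto_right_of_continuous tendsto_mol_rOut hNc _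
  have hnk_cont : ∀ k, Continuous (nk k) := by
    intro k
    have h1 : Continuous ((mol n k).normed volume
        ⋆[ContinuousLinearMap.lsmul ℝ ℝ, volume] Nn) :=
      HasCompactSupport.continuous_convolution_left _ (mol n k).hasCompactSupport_normed
        (mol n k).continuous_normed hNc.locallyIntegrable
    rw [show nk k = fun s => ((mol n k).normed volume
        ⋆[ContinuousLinearMap.lsmul ℝ ℝ, volume] Nn) (s • tdir n) from funext (hnk_eq k)]
    exact h1.comp (by fun_prop)
  obtain ⟨B, hB⟩ := (isCompact_closedBall (0 : ST n) (h + 1)).exists_bound_of_continuousOn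
    hNc.continuousOn
  have hnk_bd : ∀ k, ∀ s ∈ Icc 0 h, ‖nk k s‖ ≤ B := by
    intro k s hs
    rw [hnk_eq, convolution_def]
    have h1 : ∀ y, ‖(ContinuousLinearMap.lsmul ℝ ℝ) ((mol n k).normed volume y)
        (Nn (s • tdir n - y))‖ ≤ (mol n k).normed volume y * B := by
      intro y
      simp only [ContinuousLinearMap.lsmul_apply, smul_eq_mul, norm_mul,
        Real.norm_of_nonneg ((mol n k).nonneg_normed y)]
      by_cases hy : y ∈ Metric.ball (0 : ST n) (1 / (k + 1))
      · refine mul_le_mul_of_nonneg_left (hB _ ?_) ((mol n k).nonneg_normed y)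
        rw [mem_ball_zero_iff] at hy
        rw [mem_closedBall_zero_iff]
        have h2 : (1:ℝ) / (k + 1) ≤ 1 := by
          rw [div_le_one (by positivity)]; linarith [(k.cast_nonneg : (0:ℝ) ≤ k)]
        calc ‖s • tdir n - y‖ ≤ ‖s • tdir n‖ + ‖y‖ := norm_sub_le _ _
          _ ≤ h + 1 := by
            rw [norm_smul, norm_tdir, mul_one, Real.norm_of_nonneg hs.1]
            linarith [hs.2]
      · have : y ∉ Function.support ((mol n k).normed volume) := by
          rw [ContDiffBump.support_normed_eq]; exact hy
        rw [Function.notMem_support] at this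
        simp [this]
    refine (norm_integral_le_of_norm_le ((mol n k).integrable_normed.mul_const B)
      (Eventually.of_forall h1)).trans (le_of_eq ?_)
    rw [integral_mul_const, (mol n k).integral_normed, one_mul]
  have hftc : ∀ᶠ k : ℕ in atTop, mk k h - mk k 0 = lam * ∫ s in (0:ℝ)..h, nk k s := by
    have hev : ∀ᶠ k : ℕ in atTop, (1:ℝ) / (k + 1) < 2 - (r + h) :=
      (tendsto_order.1 tendsto_one_div_add_atTop_nhds_zero_nat).2 _ (by linarith)
    filter_upwards [hev] with k hk
    have hsm := contDiff_moll hwi.locallyIntegrable k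
    have hcs := hasCompactSupport_moll hw0 k
    have hder : ∀ s ∈ uIcc 0 h, HasDerivAt (mk k) (lam * nk k s) s := by
      intro s hs
      rw [uIcc_of_le hh] at hs
      have h1 := hasDerivAt_correlation_smooth S.integrable_J (hsm.of_le (by exact_mod_cast le_top)) hcs (tdir n) s
      have hts : tsupport (fun z => moll k w (z + s • tdir n)) ⊆ Metric.closedBall 0
          (r + 1 / (k + 1) + h) := by
        refine closure_minimal (fun z hz => ?_) Metric.isClosed_closedBall
        have h3 := tsupport_moll_subset hw0 k (subset_tsupport _ hz)
        rw [mem_closedBall_zero_iff] at h3 ⊢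
        have h4 : ‖z‖ ≤ ‖z + s • tdir n‖ + ‖s • tdir n‖ := by
          simpa using norm_sub_le (z + s • tdir n) (s • tdir n)
        rw [norm_smul, norm_tdir, mul_one, Real.norm_of_nonneg hs.1] at h4
        linarith [hs.2]
      have h2 := S.weak (fun z => moll k w (z + s • tdir n)) (hsm.comp (by fun_prop))
        (HasCompactSupport.of_support_subset_isCompact (isCompact_closedBall _ _)
          ((subset_tsupport _).trans hts))
        (hts.trans (Metric.closedBall_subset_ball (by linarith)))
      have h5 : ∀ z, gradM (fun z => moll k w (z + s • tdir n)) z = moll k Dw (z + s • tdir n) := by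
        intro z
        rw [← gradM_moll hwi.locallyIntegrable hDwi.locallyIntegrable hgrad (subset_univ _)]
        simp only [gradM, fderiv_comp_add]
      simp only [fderiv_comp_add, h5] at h2
      rw [h2] at h1
      exact h1
    have := intervalIntegral.integral_eq_sub_of_hasDerivAt hder
      (((hnk_cont k).const_mul lam).intervalIntegrable _ _)
    rw [← this, intervalIntegral.integral_const_mul]
  have hlim1 : Tendsto (fun k => ∫ s in (0:ℝ)..h, nk k s) atTop
      (𝓝 (∫ s in (0:ℝ)..h, Nn (s • tdir n))) := by
    refine intervalIntegral.tendsto_integral_filter_of_dominated_convergence (fun _ => B)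
      (Eventually.of_forall fun k => (hnk_cont k).aestronglyMeasurable)
      (Eventually.of_forall fun k => Eventually.of_forall fun s hs => ?_)
      intervalIntegrable_const (Eventually.of_forall fun s _ => hnk_lim s)
    rw [uIoc_of_le hh] at hs
    exact hnk_bd k s ⟨hs.1.le, hs.2⟩
  have hfin := tendsto_nhds_unique_of_eventuallyEq ((hmk_lim h).sub (hmk_lim 0))
    (hlim1.const_mul lam) hftc
  simpa [hM, hNn] using hfin

end Normalized


/-! ### The energy inequality -/

section Energy

theorem continuous_gradS {θ : ST n → ℝ} (hθ : ContDiff ℝ 1 θ) : Continuous (gradS θ) := by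
  refine (PiLp.continuous_toLp 2 _).comp (continuous_pi fun j => ?_)
  exact (hθ.continuous_fderiv one_ne_zero).clm_apply continuous_const

theorem gradS_eq_zero {θ : ST n → ℝ} {z : ST n} (hz : z ∉ tsupport θ) : gradS θ z = 0 := by
  have h : fderiv ℝ θ z = 0 := by
    by_contra h
    exact hz ((tsupport_fderiv_subset ℝ) (subset_tsupport _ h))
  ext j
  simp [gradS, h]

theorem continuous_tens : Continuous fun q : Vec N × Spc n => tens q.1 q.2 := by
  refine (PiLp.continuous_toLp 2 _).comp (continuous_pi fun ij => ?_)
  fun_prop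

theorem measurable_tens {α : Type*} [MeasurableSpace α] {b : α → Vec N} {a : α → Spc n}
    (hb : Measurable b) (ha : Measurable a) : Measurable fun z => tens (b z) (a z) :=
  continuous_tens.measurable.comp (hb.prodMk ha)

theorem hasCompactSupport_of_tsupport_subset_ball {F : Type*} [Zero F] {θ : ST n → F} {r : ℝ}
    (h : tsupport θ ⊆ Metric.ball 0 r) : HasCompactSupport θ :=
  Metric.isCompact_of_isClosed_isBounded (isClosed_tsupport θ) (Metric.isBounded_ball.subset h)

theorem locallyIntegrable_coord {F : Type*} [Fintype F] {w : ST n → EuclideanSpace ℝ F}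
    (hw : LocallyIntegrable w volume) (i : F) : LocallyIntegrable (fun z => w z i) volume :=
  fun z => by
    obtain ⟨s, hs, hi⟩ := hw z
    exact ⟨s, hs, (EuclideanSpace.proj i : EuclideanSpace ℝ F →L[ℝ] ℝ).integrable_comp hi⟩

theorem integrable_mul_of_continuous {w g : ST n → ℝ} (hw : LocallyIntegrable w volume)
    (hg : Continuous g) (hgc : HasCompactSupport g) : Integrable (fun z => w z * g z) volume := by
  have := hw.integrable_smul_left_of_hasCompactSupport hg hgc
  simpa [mul_comm] using this

theorem integral_fderiv_apply_eq_zero {θ : ST n → ℝ} (hs : ContDiff ℝ (⊤ : ℕ∞) θ)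
    (hc : HasCompactSupport θ) (d : ST n) : ∫ z, fderiv ℝ θ z d = 0 := by
  have hi := integral_mul_fderiv_eq_neg_fderiv_mul_of_integrable (μ := (volume : Measure (ST n)))
    (f := fun _ => (1:ℝ)) (g := θ) (v := d) (by simp)
    (by simpa using (((hs.continuous_fderiv (by simp)).clm_apply
      continuous_const).integrable_of_hasCompactSupport (hc.fderiv_apply (𝕜 := ℝ) d)))
    (by simpa using hs.continuous.integrable_of_hasCompactSupport hc)
    (by simp) (fun x _ => hs.differentiable (by simp) x)
  simpa using hi

/-- Product rule for weak gradients. -/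
theorem WGrad.smul_sub {U : Set (ST n)} {v : ST n → Vec N} {Dv : ST n → Mat N n}
    (h : WGrad U v Dv) (hv : LocallyIntegrable v volume) (hDv : LocallyIntegrable Dv volume)
    {θ : ST n → ℝ} (hθ : ContDiff ℝ (⊤ : ℕ∞) θ) (hθU : tsupport θ ⊆ U) (c : Vec N) :
    WGrad univ (fun z => θ z • (v z - c)) (fun z => θ z • Dv z + tens (v z - c) (gradS θ z)) := by
  intro ψ hψ hψc _ i j
  have hc : HasCompactSupport (fun z => θ z * ψ z) := hψc.mul_left
  have hs : ContDiff ℝ (⊤ : ℕ∞) (fun z => θ z * ψ z) := hθ.mul hψ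
  have h1 := h (fun z => θ z * ψ z) hs hc
    ((closure_mono (Function.support_mul_subset_left θ ψ)).trans hθU) i j
  have hd : ∀ z, fderiv ℝ (fun z => θ z * ψ z) z (sdir j)
      = θ z * fderiv ℝ ψ z (sdir j) + ψ z * fderiv ℝ θ z (sdir j) := by
    intro z
    rw [fderiv_fun_mul (hθ.differentiable (by simp) z) (hψ.differentiable (by simp) z)]
    simp
  have h0 := integral_fderiv_apply_eq_zero hs hc (sdir j)
  have hψd : Continuous fun z => fderiv ℝ ψ z (sdir j) :=
    (hψ.continuous_fderiv (by simp)).clm_apply continuous_const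
  have hθd : Continuous fun z => fderiv ℝ θ z (sdir j) :=
    (hθ.continuous_fderiv (by simp)).clm_apply continuous_const
  have hvi := locallyIntegrable_coord hv i
  have hvc : LocallyIntegrable (fun z => v z i - c i) volume := hvi.sub (locallyIntegrable_const _)
  have hDvi := locallyIntegrable_coord hDv (i, j)
  have hψdc : HasCompactSupport fun z => fderiv ℝ ψ z (sdir j) := hψc.fderiv_apply (𝕜 := ℝ) _
  have i1 : Integrable (fun z => (v z i - c i) * (θ z * fderiv ℝ ψ z (sdir j))) volume :=
    integrable_mul_of_continuous hvc (hθ.continuous.mul hψd) hψdc.mul_left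
  have i2 : Integrable (fun z => (v z i - c i) * (ψ z * fderiv ℝ θ z (sdir j))) volume :=
    integrable_mul_of_continuous hvc (hψ.continuous.mul hθd) hψc.mul_right
  have i3 : Integrable (fun z => Dv z (i, j) * (θ z * ψ z)) volume :=
    integrable_mul_of_continuous hDvi hs.continuous hc
  have i4 : Integrable (fun z => v z i * fderiv ℝ (fun z => θ z * ψ z) z (sdir j)) volume :=
    integrable_mul_of_continuous hvi
      ((hs.continuous_fderiv (by simp)).clm_apply continuous_const) (hc.fderiv_apply (𝕜 := ℝ) _)
  have i5 : Integrable (fun z => c i * fderiv ℝ (fun z => θ z * ψ z) z (sdir j)) volume :=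
    integrable_mul_of_continuous (locallyIntegrable_const _)
      ((hs.continuous_fderiv (by simp)).clm_apply continuous_const) (hc.fderiv_apply (𝕜 := ℝ) _)
  have e1 : ∫ z, (v z i - c i) * (θ z * fderiv ℝ ψ z (sdir j))
      + (v z i - c i) * (ψ z * fderiv ℝ θ z (sdir j)) = - ∫ z, Dv z (i, j) * (θ z * ψ z) := by
    rw [← h1]
    have : (fun z => (v z i - c i) * (θ z * fderiv ℝ ψ z (sdir j))
        + (v z i - c i) * (ψ z * fderiv ℝ θ z (sdir j)))
        = fun z => v z i * fderiv ℝ (fun z => θ z * ψ z) z (sdir j)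
          - c i * fderiv ℝ (fun z => θ z * ψ z) z (sdir j) := by
      funext z; rw [hd]; ring
    rw [this, integral_sub i4 i5, integral_const_mul, h0]; ring
  rw [integral_add i1 i2] at e1
  have e2 : (fun z => (θ z • Dv z + tens (v z - c) (gradS θ z)) (i, j) * ψ z)
      = fun z => Dv z (i, j) * (θ z * ψ z) + (v z i - c i) * (ψ z * fderiv ℝ θ z (sdir j)) := by
    funext z; simp [tens, gradS]; ring
  have e3 : (fun z => (θ z • (v z - c)) i * fderiv ℝ ψ z (sdir j))
      = fun z => (v z i - c i) * (θ z * fderiv ℝ ψ z (sdir j)) := by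
    funext z; simp; ring
  rw [e2, e3, integral_add i3 i2]
  linarith

variable {p ν L lam : ℝ} {v : ST n → Vec N} {Dv G : ST n → Mat N n} {f : ST n → ℝ}

theorem NSol.integrable_norm_rpow (S : NSol p ν L lam v Dv G f) :
    Integrable (fun z => ‖v z‖ ^ p) volume := by
  have := S.memv.integrable_norm_rpow (by simpa using by linarith [S.hp]) ENNReal.ofReal_ne_top
  rwa [ENNReal.toReal_ofReal (by linarith [S.hp])] at this

theorem NSol.integrable_bdry (S : NSol p ν L lam v Dv G f) (c : Vec N) :
    Integrable (fun z => bdry p (v z) c - ‖c‖ ^ p / p) volume := by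
  have h1 := S.integrable_norm_rpow.const_mul (1 - 1 / p)
  have h2 : Integrable (fun z => inner ℝ (J p (v z)) c) volume := S.integrable_J.inner_const c
  refine (h1.sub h2).congr (Eventually.of_forall fun z => ?_)
  simp only [bdry, Pi.sub_apply]; ring

theorem memLp_smul_of_continuous {F : Type*} [NormedAddCommGroup F] [NormedSpace ℝ F] {q : ℝ≥0∞}
    {g : ST n → ℝ} (hg : Continuous g) (hgc : HasCompactSupport g) {w : ST n → F}
    (hw : MemLp w q volume) : MemLp (fun z => g z • w z) q volume := by
  obtain ⟨C, hC⟩ := hgc.exists_bound_of_continuous hg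
  refine hw.of_le_mul (c := C) (hg.aestronglyMeasurable.smul hw.1)
    (Eventually.of_forall fun z => ?_)
  rw [norm_smul]; gcongr; exact hC z

theorem memLp_const_smul_of_continuous {F : Type*} [NormedAddCommGroup F] [NormedSpace ℝ F]
    {q : ℝ≥0∞} {g : ST n → ℝ} (hg : Continuous g) (hgc : HasCompactSupport g) (c : F) :
    MemLp (fun z => g z • c) q volume :=
  (hg.smul continuous_const).memLp_of_hasCompactSupport hgc.smul_right

theorem NSol.energy (S : NSol p ν L lam v Dv G f) {θ : ST n → ℝ} (hθ : ContDiff ℝ (⊤ : ℕ∞) θ)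
    (hθ0 : ∀ z, 0 ≤ θ z) (hθs : tsupport θ ⊆ Metric.ball 0 2) (c : Vec N) :
    lam * ∫ z, inner ℝ (G z) (θ z • Dv z + tens (v z - c) (gradS θ z))
      ≤ ∫ z, (bdry p (v z) c - ‖c‖ ^ p / p) * fderiv ℝ θ z (tdir n) := by
  have hp := S.hp
  have hθc := hasCompactSupport_of_tsupport_subset_ball hθs
  have hθ1 : ContDiff ℝ 1 θ := hθ.of_le (by exact_mod_cast le_top)
  obtain ⟨r, hr, hrs⟩ := exists_lt_subset_ball (isClosed_tsupport θ) hθs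
  set w : ST n → Vec N := fun z => θ z • (v z - c) with hw
  set Dw : ST n → Mat N n := fun z => θ z • Dv z + tens (v z - c) (gradS θ z) with hDw
  have hnot : ∀ z, r ≤ ‖z‖ → z ∉ tsupport θ := fun z hz hz' => by
    have := hrs hz'; rw [mem_ball_zero_iff] at this; linarith
  have hw0 : ∀ z, r ≤ ‖z‖ → w z = 0 := fun z hz => by
    simp [hw, image_eq_zero_of_notMem_tsupport (hnot z hz)]
  have hDw0 : ∀ z, r ≤ ‖z‖ → Dw z = 0 := fun z hz => by
    simp only [hDw, image_eq_zero_of_notMem_tsupport (hnot z hz), gradS_eq_zero (hnot z hz)]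
    ext; simp [tens]
  have hgc : Continuous (gradS θ) := continuous_gradS hθ1
  have hgcs : HasCompactSupport (gradS θ) :=
    HasCompactSupport.of_support_subset_isCompact hθc fun z hz => by
      by_contra h; exact hz (gradS_eq_zero h)
  have hwm : Measurable w := hθ.continuous.measurable.smul (S.measv.sub_const c)
  have hDwm : Measurable Dw := (hθ.continuous.measurable.smul S.measDv).add
    (measurable_tens (S.measv.sub_const c) hgc.measurable)
  have hwL : MemLp w (ENNReal.ofReal p) volume := by
    have := (memLp_smul_of_continuous hθ.continuous hθc S.memv).sub
      (memLp_const_smul_of_continuous hθ.continuous hθc c (q := ENNReal.ofReal p))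
    refine this.congr_norm hwm.aestronglyMeasurable (Eventually.of_forall fun z => ?_)
    simp [hw, smul_sub]
  have hDwL : MemLp Dw (ENNReal.ofReal p) volume := by
    have h1 := memLp_smul_of_continuous hθ.continuous hθc S.memDv
    have h2 := (memLp_smul_of_continuous hgc.norm hgcs.norm S.memv).sub
      (memLp_const_smul_of_continuous hgc.norm hgcs.norm c (q := ENNReal.ofReal p))
    have h3 : MemLp (fun z => tens (v z - c) (gradS θ z)) (ENNReal.ofReal p) volume := by
      refine h2.congr_norm (measurable_tens (S.measv.sub_const c) hgc.measurable
        ).aestronglyMeasurable (Eventually.of_forall fun z => ?_)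
      simp [norm_tens, ← smul_sub, norm_smul, mul_comm]
    exact h1.add h3
  have hgrad : WGrad univ w Dw := S.grad.smul_sub S.integrable_v.locallyIntegrable
    S.integrable_Dv.locallyIntegrable hθ hθs c
  have hH := fun (h : ℝ) (hh : 0 ≤ h) (hrh : r + h < 2) =>
    S.integral_inner_shift hwm hDwm hwL hDwL hw0 hDw0 hgrad hh hrh
  set b : ST n → ℝ := fun z => bdry p (v z) c - ‖c‖ ^ p / p with hb
  have hbi : Integrable b volume := S.integrable_bdry c
  set B : ℝ → ℝ := fun h => ∫ z, inner ℝ (b z) (θ (z + h • tdir n)) with hB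
  have hBd : HasDerivAt B (∫ z, inner ℝ (b z) (fderiv ℝ θ (z + (0:ℝ) • tdir n) (tdir n))) 0 :=
    hasDerivAt_correlation_smooth hbi hθ1 hθc (tdir n) 0
  set Nn : ℝ → ℝ := fun s => ∫ z, inner ℝ (G z) (Dw (z + s • tdir n)) with hNn
  have hNc : Continuous Nn :=
    (continuous_correlation hp S.memG hDwL).comp (by fun_prop : Continuous fun s : ℝ => s • tdir n)
  have hNd : HasDerivAt (fun h => ∫ s in (0:ℝ)..h, Nn s) (Nn 0) 0 :=
    intervalIntegral.integral_hasDerivAt_right (hNc.intervalIntegrable _ _)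
      (hNc.stronglyMeasurableAtFilter _ _) hNc.continuousAt
  set D : ℝ → ℝ := fun h => B h - B 0 - lam * ∫ s in (0:ℝ)..h, Nn s with hD
  have hDd := (hBd.sub_const (B 0)).sub (hNd.const_mul lam)
  have hD0 : D 0 = 0 := by simp [hD]
  have hDnn : ∀ h, 0 ≤ h → r + h < 2 → 0 ≤ D h := by
    intro h hh hrh
    have e1 := hH h hh hrh
    have hshift : ∫ z, inner ℝ (J p (v z)) (w z)
        = ∫ z, inner ℝ (J p (v (z + h • tdir n))) (w (z + h • tdir n)) :=
      (integral_add_right_eq_self (fun z => inner ℝ (J p (v z)) (w z)) (h • tdir n)).symm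
    have hB0 : B 0 = ∫ z, b (z + h • tdir n) * θ (z + h • tdir n) := by
      rw [integral_add_right_eq_self (fun z => b z * θ z) (h • tdir n)]
      simp [hB, mul_comm]
    have hBh : B h = ∫ z, b z * θ (z + h • tdir n) := by simp [hB, mul_comm]
    have ib : ∀ y : ST n, Integrable (fun z => b z * θ (z + y)) volume := fun y =>
      integrable_mul_of_continuous hbi.locallyIntegrable (hθ.continuous.comp (by fun_prop))
        (hθc.comp_homeomorph (Homeomorph.addRight y))
    have ib0 : Integrable (fun z => b (z + h • tdir n) * θ (z + h • tdir n)) volume := by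
      have := (ib 0).comp_add_right (h • tdir n)
      simpa using this
    have iw1 : Integrable (fun z => inner ℝ (J p (v z)) (w (z + h • tdir n))) volume :=
      integrable_inner_of_memLp hp S.memJ (memLp_comp_add_right hwL _)
    have iw2 : Integrable (fun z => inner ℝ (J p (v (z + h • tdir n))) (w (z + h • tdir n)))
        volume :=
      integrable_inner_of_memLp hp (memLp_comp_add_right S.memJ _) (memLp_comp_add_right hwL _)
    rw [hshift, ← integral_sub iw1 iw2] at e1
    simp only [hD]
    rw [← e1, hBh, hB0, ← integral_sub (ib _) ib0, sub_nonneg]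
    refine integral_mono (iw1.sub iw2) ((ib _).sub ib0) fun z => ?_
    have h1 := bdry_sub_bdry_le hp (v (z + h • tdir n)) (v z) c
    have h2 := mul_le_mul_of_nonneg_left h1 (hθ0 (z + h • tdir n))
    simp only [hw, hb, inner_smul_right, inner_sub_left] at h2 ⊢
    linarith
  have hDge : 0 ≤ (∫ z, inner ℝ (b z) (fderiv ℝ θ (z + (0:ℝ) • tdir n) (tdir n)))
      - lam * Nn 0 := by
    refine ge_of_tendsto hDd.tendsto_slope_zero_right ?_
    have : ∀ᶠ t : ℝ in 𝓝[>] 0, t < 2 - r :=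
      nhdsWithin_le_nhds (gt_mem_nhds (by linarith))
    filter_upwards [this, self_mem_nhdsWithin] with t ht ht0
    have ht0' : 0 < t := ht0
    have h3 := hDnn t ht0'.le (by linarith)
    have h4 : 0 ≤ t⁻¹ • (D (0 + t) - D 0) := by
      rw [hD0, zero_add, sub_zero]; exact smul_nonneg (by positivity) h3
    exact h4
  simp only [zero_smul, add_zero, hNn] at hDge
  have h5 : ∀ z, inner ℝ (b z) (fderiv ℝ θ z (tdir n)) = b z * fderiv ℝ θ z (tdir n) := fun z => by
    simp [mul_comm]
  simp only [h5] at hDge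
  linarith

end Energy


/-! ### Energy estimates with cutoff functions -/

section EnergySup

/-- `ζ` is a smooth cutoff function on space-time whose first derivatives are bounded by `M * ω`. -/
structure Cutoff (ζ ω : ST n → ℝ) (M : ℝ) : Prop where
  smooth : ContDiff ℝ (⊤ : ℕ∞) ζ
  nonneg : ∀ z, 0 ≤ ζ z
  supp : tsupport ζ ⊆ Metric.ball 0 2
  contω : Continuous ω
  suppω : HasCompactSupport ω
  grad_le : ∀ z, ‖gradS ζ z‖ ≤ M * ω z
  dt_le : ∀ z, |fderiv ℝ ζ z (tdir n)| ≤ M * ω z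

variable {p ν L lam : ℝ} {v : ST n → Vec N} {Dv G : ST n → Mat N n} {f : ST n → ℝ}

/-- The right-hand side of the energy estimate. -/
def enRHS (p lam M : ℝ) (v : ST n → Vec N) (Dv G : ST n → Mat N n) (f : ST n → ℝ)
    (ζ ω : ST n → ℝ) (c : Vec N) : ℝ :=
  (∫ z, ζ z * (f z ^ (p - 1) * ‖Dv z‖)) + M * (∫ z, ω z * (‖G z‖ * ‖v z - c‖))
    + M * lam⁻¹ * ∫ z, ω z * bdry p (v z) c

theorem integrable_norm_mul_norm {α : Type*} [MeasurableSpace α] {m : Measure α} {p : ℝ}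
    (hp : 1 < p) {X Y : Type*} [NormedAddCommGroup X] [NormedAddCommGroup Y] {x : α → X} {y : α → Y}
    (hX : MemLp x (ENNReal.ofReal (p / (p - 1))) m) (hY : MemLp y (ENNReal.ofReal p) m) :
    Integrable (fun z => ‖x z‖ * ‖y z‖) m := by
  have := holderConjugate_ofReal hp
  exact MemLp.integrable_mul hX.norm hY.norm

theorem NSol.locallyIntegrable_bdry (S : NSol p ν L lam v Dv G f) (c : Vec N) :
    LocallyIntegrable (fun z => bdry p (v z) c) volume := by
  have h := (S.integrable_bdry c).locallyIntegrable.add (locallyIntegrable_const (‖c‖ ^ p / p))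
  refine h.congr (Eventually.of_forall fun z => ?_)
  simp

theorem NSol.integrable_f_Dv (S : NSol p ν L lam v Dv G f) :
    Integrable (fun z => f z ^ (p - 1) * ‖Dv z‖) volume := by
  refine (integrable_norm_mul_norm S.hp (memLp_norm_rpow_sub_one S.hp S.memf) S.memDv).congr
    (Eventually.of_forall fun z => ?_)
  simp [abs_of_nonneg (S.fnonneg z), abs_of_nonneg (Real.rpow_nonneg (S.fnonneg z) _)]

theorem NSol.integrable_Dv_rpow (S : NSol p ν L lam v Dv G f) :
    Integrable (fun z => ‖Dv z‖ ^ p) volume := by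
  have := S.memDv.integrable_norm_rpow (by simpa using by linarith [S.hp]) ENNReal.ofReal_ne_top
  rwa [ENNReal.toReal_ofReal (by linarith [S.hp])] at this

theorem NSol.integrable_f_rpow (S : NSol p ν L lam v Dv G f) :
    Integrable (fun z => f z ^ p) volume := by
  have := S.memf.integrable_norm_rpow (by simpa using by linarith [S.hp]) ENNReal.ofReal_ne_top
  rw [ENNReal.toReal_ofReal (by linarith [S.hp])] at this
  refine this.congr (Eventually.of_forall fun z => ?_)
  simp [abs_of_nonneg (S.fnonneg z)]

theorem integrable_bdd_mul {w g : ST n → ℝ} (hg : Continuous g) (hgc : HasCompactSupport g)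
    (hw : Integrable w volume) : Integrable (fun z => g z * w z) volume := by
  simpa [mul_comm] using integrable_mul_of_continuous hw.locallyIntegrable hg hgc

theorem NSol.integrable_G_sub (S : NSol p ν L lam v Dv G f) {ω : ST n → ℝ} (hω : Continuous ω)
    (hωc : HasCompactSupport ω) (c : Vec N) :
    Integrable (fun z => ω z * (‖G z‖ * ‖v z - c‖)) volume := by
  have h1 : MemLp (fun z => ω z • (v z - c)) (ENNReal.ofReal p) volume := by
    refine ((memLp_smul_of_continuous hω hωc S.memv).sub
      (memLp_const_smul_of_continuous hω hωc c (q := ENNReal.ofReal p))).congr_norm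
      (hω.measurable.smul (S.measv.sub_const c)).aestronglyMeasurable
      (Eventually.of_forall fun z => ?_)
    simp [smul_sub]
  have h2 := integrable_norm_mul_norm S.hp S.memG h1
  refine h2.mono (hω.measurable.mul (S.measG.norm.mul
    (S.measv.sub_const c).norm)).aestronglyMeasurable (Eventually.of_forall fun z => ?_)
  simp [norm_smul]
  apply le_of_eq; ring

theorem NSol.integrable_bdd_bdry (S : NSol p ν L lam v Dv G f) {ω : ST n → ℝ} (hω : Continuous ω)
    (hωc : HasCompactSupport ω) (c : Vec N) :
    Integrable (fun z => ω z * bdry p (v z) c) volume := by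
  simpa [mul_comm] using integrable_mul_of_continuous (S.locallyIntegrable_bdry c) hω hωc

theorem NSol.energy_time (S : NSol p ν L lam v Dv G f) {ζ ω : ST n → ℝ} {M : ℝ}
    (hc : Cutoff ζ ω M) (c : Vec N) {Θ g : ℝ → ℝ} (hΘ : ContDiff ℝ (⊤ : ℕ∞) Θ)
    (hΘ0 : ∀ t, 0 ≤ Θ t) (hΘ1 : ∀ t, Θ t ≤ 1) (hg : Continuous g)
    (hΘg : ∀ t, HasDerivAt Θ (- g t) t) :
    ν * (∫ z, ζ z * Θ z.2 * ‖Dv z‖ ^ p) + lam⁻¹ * (∫ z, g z.2 * (ζ z * bdry p (v z) c))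
      ≤ enRHS p lam M v Dv G f ζ ω c := by
  have hlam := S.hlam
  set θ : ST n → ℝ := fun z => ζ z * Θ z.2 with hθ
  have hΘs : ContDiff ℝ (⊤ : ℕ∞) (fun z : ST n => Θ z.2) := hΘ.comp contDiff_snd
  have hθs : ContDiff ℝ (⊤ : ℕ∞) θ := hc.smooth.mul hΘs
  have hθsupp : tsupport θ ⊆ Metric.ball 0 2 :=
    (closure_mono (Function.support_mul_subset_left _ _)).trans hc.supp
  have hθc := hasCompactSupport_of_tsupport_subset_ball hθsupp
  have hζc := hasCompactSupport_of_tsupport_subset_ball hc.supp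
  have hd : ∀ z d, fderiv ℝ θ z d = Θ z.2 * fderiv ℝ ζ z d - g z.2 * ζ z * d.2 := by
    intro z d
    have h1 : HasFDerivAt (fun z : ST n => Θ z.2)
        ((-g z.2) • ContinuousLinearMap.snd ℝ (Spc n) ℝ) z :=
      (hΘg z.2).comp_hasFDerivAt z hasFDerivAt_snd
    have h2 := ((hc.smooth.differentiable (by simp) z).hasFDerivAt).mul h1
    have h3 : fderiv ℝ θ z = _ := h2.fderiv
    rw [h3]; simp; ring
  have hgr : ∀ z, gradS θ z = Θ z.2 • gradS ζ z := by
    intro z; ext j; simp [gradS, hd, sdir]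
  have hdt : ∀ z, fderiv ℝ θ z (tdir n) = Θ z.2 * fderiv ℝ ζ z (tdir n) - g z.2 * ζ z := by
    intro z; rw [hd]; simp [tdir]
  have hen := S.energy hθs (fun z => mul_nonneg (hc.nonneg z) (hΘ0 _)) hθsupp c
  have hdtc : Continuous fun z => fderiv ℝ θ z (tdir n) :=
    (hθs.continuous_fderiv (by simp)).clm_apply continuous_const
  have hdtcs : HasCompactSupport fun z => fderiv ℝ θ z (tdir n) := hθc.fderiv_apply (𝕜 := ℝ) _
  have ib1 : Integrable (fun z => bdry p (v z) c * fderiv ℝ θ z (tdir n)) volume :=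
    integrable_mul_of_continuous (S.locallyIntegrable_bdry c) hdtc hdtcs
  have ib2 : Integrable (fun z => ‖c‖ ^ p / p * fderiv ℝ θ z (tdir n)) volume :=
    integrable_mul_of_continuous (locallyIntegrable_const _) hdtc hdtcs
  have hrhs : ∫ z, (bdry p (v z) c - ‖c‖ ^ p / p) * fderiv ℝ θ z (tdir n)
      = ∫ z, bdry p (v z) c * fderiv ℝ θ z (tdir n) := by
    simp only [sub_mul]
    rw [integral_sub ib1 ib2, integral_const_mul, integral_fderiv_apply_eq_zero hθs hθc]; ring
  rw [hrhs] at hen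
  have iω := S.integrable_bdd_bdry hc.contω hc.suppω c
  have iζ : Integrable (fun z => g z.2 * (ζ z * bdry p (v z) c)) volume := by
    have := S.integrable_bdd_bdry (ω := fun z => g z.2 * ζ z)
      ((hg.comp continuous_snd).mul hc.smooth.continuous) hζc.mul_left c
    simpa [mul_assoc] using this
  have iG := S.integrable_G_sub hc.contω hc.suppω c
  have iD : Integrable (fun z => θ z * ‖Dv z‖ ^ p) volume :=
    integrable_bdd_mul hθs.continuous hθc S.integrable_Dv_rpow
  have iF : Integrable (fun z => ζ z * (f z ^ (p - 1) * ‖Dv z‖)) volume :=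
    integrable_bdd_mul hc.smooth.continuous hζc S.integrable_f_Dv
  have hup : ∫ z, bdry p (v z) c * fderiv ℝ θ z (tdir n)
      ≤ M * (∫ z, ω z * bdry p (v z) c) - ∫ z, g z.2 * (ζ z * bdry p (v z) c) := by
    rw [← integral_const_mul, ← integral_sub (iω.const_mul M) iζ]
    refine integral_mono ib1 ((iω.const_mul M).sub iζ) fun z => ?_
    simp only [hdt]
    have hb := bdry_nonneg S.hp (v z) c
    have h1 : Θ z.2 * fderiv ℝ ζ z (tdir n) ≤ M * ω z := by
      calc Θ z.2 * fderiv ℝ ζ z (tdir n) ≤ Θ z.2 * |fderiv ℝ ζ z (tdir n)| :=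
            mul_le_mul_of_nonneg_left (le_abs_self _) (hΘ0 _)
        _ ≤ 1 * |fderiv ℝ ζ z (tdir n)| := mul_le_mul_of_nonneg_right (hΘ1 _) (abs_nonneg _)
        _ ≤ _ := by rw [one_mul]; exact hc.dt_le z
    nlinarith [mul_le_mul_of_nonneg_right h1 hb]
  have hlow : ν * (∫ z, θ z * ‖Dv z‖ ^ p) - (∫ z, ζ z * (f z ^ (p - 1) * ‖Dv z‖))
      - M * (∫ z, ω z * (‖G z‖ * ‖v z - c‖))
      ≤ ∫ z, inner ℝ (G z) (θ z • Dv z + tens (v z - c) (gradS θ z)) := by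
    have iDF : Integrable (fun z => ν * (θ z * ‖Dv z‖ ^ p) - ζ z * (f z ^ (p - 1) * ‖Dv z‖))
        volume := (iD.const_mul ν).sub iF
    rw [← integral_const_mul, ← integral_const_mul, ← integral_sub (iD.const_mul ν) iF,
      ← integral_sub iDF (iG.const_mul M)]
    have hle : ∀ z, |inner ℝ (G z) (tens (v z - c) (gradS θ z))|
        ≤ M * (ω z * (‖G z‖ * ‖v z - c‖)) := by
      intro z
      refine (abs_real_inner_le_norm _ _).trans ?_
      rw [norm_tens, hgr, norm_smul, Real.norm_of_nonneg (hΘ0 _)]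
      have h1 : Θ z.2 * ‖gradS ζ z‖ ≤ M * ω z :=
        (mul_le_of_le_one_left (norm_nonneg _) (hΘ1 _)).trans (hc.grad_le z)
      calc ‖G z‖ * (‖v z - c‖ * (Θ z.2 * ‖gradS ζ z‖))
          ≤ ‖G z‖ * (‖v z - c‖ * (M * ω z)) := by gcongr
        _ = _ := by ring
    have ii : Integrable (fun z => inner ℝ (G z) (θ z • Dv z + tens (v z - c) (gradS θ z)))
        volume := by
      have j1 : Integrable (fun z => inner ℝ (G z) (θ z • Dv z)) volume :=
        integrable_inner_of_memLp S.hp S.memG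
          (memLp_smul_of_continuous hθs.continuous hθc S.memDv)
      have j2 : Integrable (fun z => inner ℝ (G z) (tens (v z - c) (gradS θ z))) volume := by
        refine (iG.const_mul M).mono' ?_ (Eventually.of_forall hle)
        exact (S.measG.inner (measurable_tens (S.measv.sub_const c)
          (continuous_gradS (hθs.of_le (by exact_mod_cast le_top))).measurable)).aestronglyMeasurable
      refine (j1.add j2).congr (Eventually.of_forall fun z => ?_)
      simp [inner_add_right]
    refine integral_mono_ae (iDF.sub (iG.const_mul M)) ii ?_
    filter_upwards [S.coercive] with z hz
    have h0 : 0 ≤ θ z := mul_nonneg (hc.nonneg z) (hΘ0 _)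
    have h1 : θ z ≤ ζ z := mul_le_of_le_one_right (hc.nonneg z) (hΘ1 _)
    have h2 := mul_le_mul_of_nonneg_left hz h0
    have h3 : 0 ≤ f z ^ (p - 1) * ‖Dv z‖ :=
      mul_nonneg (Real.rpow_nonneg (S.fnonneg z) _) (norm_nonneg _)
    have h4 := mul_le_mul_of_nonneg_right h1 h3
    have h5 := neg_le_of_abs_le (hle z)
    rw [inner_add_right, inner_smul_right]
    linarith
  have h6 := (mul_le_mul_of_nonneg_left hlow hlam.le).trans (hen.trans hup)
  have h7 := mul_le_mul_of_nonneg_left h6 (inv_pos.2 hlam).le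
  rw [← mul_assoc, inv_mul_cancel₀ hlam.ne', one_mul] at h7
  unfold enRHS
  linarith

theorem NSol.energy_cutoff (S : NSol p ν L lam v Dv G f) {ζ ω : ST n → ℝ} {M : ℝ}
    (hc : Cutoff ζ ω M) (c : Vec N) :
    ν * (∫ z, ζ z * ‖Dv z‖ ^ p) ≤ enRHS p lam M v Dv G f ζ ω c := by
  have h := S.energy_time hc c (Θ := fun _ => 1) (g := fun _ => 0) contDiff_const (by simp)
    (by simp) continuous_const (fun t => by simpa using hasDerivAt_const t (1:ℝ))
  simpa using h

theorem NSol.energy_slice (S : NSol p ν L lam v Dv G f) {ζ ω : ST n → ℝ} {M : ℝ}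
    (hc : Cutoff ζ ω M) (c : Vec N) :
    ∀ᵐ t : ℝ, lam⁻¹ * (∫ x, ζ (x, t) * bdry p (v (x, t)) c) ≤ enRHS p lam M v Dv G f ζ ω c := by
  have hζc := hasCompactSupport_of_tsupport_subset_ball hc.supp
  have ib := S.integrable_bdd_bdry hc.smooth.continuous hζc c
  have iB : Integrable (fun t : ℝ => lam⁻¹ * ∫ x, ζ (x, t) * bdry p (v (x, t)) c) volume :=
    (Integrable.integral_prod_right ib).const_mul _
  have key := ae_mem_of_forall_average_mem (m := (volume : Measure ℝ)) iB.locallyIntegrable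
    isOpen_univ (isClosed_Iic (a := enRHS p lam M v Dv G f ζ ω c)) ?_
  · filter_upwards [key] with t ht using ht (mem_univ t)
  intro g hg hgc _ hg0 hg1
  have hgi : Integrable g volume := hg.continuous.integrable_of_hasCompactSupport hgc
  set Θ : ℝ → ℝ := fun t => ∫ s in Ioi t, g s with hΘ
  have hΘd : ∀ t, HasDerivAt Θ (- g t) t := by
    intro t
    have h1 : HasDerivAt (fun t => ∫ s in (0:ℝ)..t, g s) (g t) t :=
      intervalIntegral.integral_hasDerivAt_right (hg.continuous.intervalIntegrable _ _)
        (hg.continuous.stronglyMeasurableAtFilter _ _) hg.continuous.continuousAt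
    have h2 : Θ = fun t => (∫ s in Ioi (0:ℝ), g s) - ∫ s in (0:ℝ)..t, g s := by
      funext t
      have := intervalIntegral.integral_Ioi_sub_Ioi' (a := 0) (b := t) hgi.integrableOn hgi.integrableOn
      simp only [hΘ]; linarith
    rw [h2]
    exact h1.const_sub _
  have hΘs : ContDiff ℝ (⊤ : ℕ∞) Θ := by
    rw [contDiff_infty_iff_deriv]
    refine ⟨fun t => (hΘd t).differentiableAt, ?_⟩
    rw [show deriv Θ = fun t => - g t from funext fun t => (hΘd t).deriv]
    exact hg.neg
  have h := S.energy_time hc c hΘs (fun t => setIntegral_nonneg measurableSet_Ioi fun s _ => hg0 s)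
    (fun t => by
      rw [← hg1]
      exact setIntegral_le_integral hgi (Eventually.of_forall hg0)) hg.continuous hΘd
  have h0 : 0 ≤ ν * (∫ z, ζ z * Θ z.2 * ‖Dv z‖ ^ p) :=
    mul_nonneg S.hν.le (integral_nonneg fun z => mul_nonneg (mul_nonneg (hc.nonneg z)
      (setIntegral_nonneg measurableSet_Ioi fun s _ => hg0 s)) (by positivity))
  have hfub : ∫ z : ST n, g z.2 * (ζ z * bdry p (v z) c)
      = ∫ t, g t * ∫ x, ζ (x, t) * bdry p (v (x, t)) c := by
    have ig : Integrable (fun z : ST n => g z.2 * (ζ z * bdry p (v z) c)) volume := by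
      have := S.integrable_bdd_bdry (ω := fun z => g z.2 * ζ z)
        ((hg.continuous.comp continuous_snd).mul hc.smooth.continuous) hζc.mul_left c
      simpa [mul_assoc] using this
    rw [Measure.volume_eq_prod] at ig ⊢
    rw [integral_prod_symm _ ig]
    refine integral_congr_ae (Eventually.of_forall fun t => ?_)
    simp only
    rw [integral_const_mul]
  simp only [smul_eq_mul, mem_Iic]
  have h3 : ∫ t, g t * (lam⁻¹ * ∫ x, ζ (x, t) * bdry p (v (x, t)) c)
      = lam⁻¹ * ∫ t, g t * ∫ x, ζ (x, t) * bdry p (v (x, t)) c := by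
    rw [← integral_const_mul]
    exact integral_congr_ae (Eventually.of_forall fun t => by simp only; ring)
  rw [h3, ← hfub]
  linarith

end EnergySup


/-! ### The gluing lemma -/

section Gluing

variable {p ν L lam : ℝ} {v : ST n → Vec N} {Dv G : ST n → Mat N n} {f : ST n → ℝ}

theorem integral_prod_smul_time {F : Type*} [NormedAddCommGroup F] [NormedSpace ℝ F]
    {w : ST n → F} {φ : Spc n → ℝ} {h : ℝ → ℝ}
    (hi : Integrable (fun z : ST n => (φ z.1 * h z.2) • w z) volume) :
    ∫ z : ST n, (φ z.1 * h z.2) • w z = ∫ t, h t • ∫ x, φ x • w (x, t) := by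
  rw [Measure.volume_eq_prod] at hi ⊢
  rw [integral_prod_symm _ hi]
  refine integral_congr_ae (Eventually.of_forall fun t => ?_)
  simp only
  rw [← integral_smul]
  refine integral_congr_ae (Eventually.of_forall fun x => ?_)
  simp only [smul_smul, mul_comm]

theorem tsupport_prod_subset {φ : Spc n → ℝ} {γ : ℝ → ℝ} {T : ℝ}
    (hφ : tsupport φ ⊆ Metric.ball 0 T) (hγ : tsupport γ ⊆ Ioo (-T) T) :
    tsupport (fun z : ST n => φ z.1 * γ z.2) ⊆ Metric.ball 0 T := by
  have h1 : tsupport (fun z : ST n => φ z.1 * γ z.2) ⊆ tsupport φ ×ˢ tsupport γ := by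
    refine closure_minimal (fun z hz => ⟨subset_tsupport _ fun h => hz ?_,
      subset_tsupport _ fun h => hz ?_⟩) ((isClosed_tsupport φ).prod (isClosed_tsupport γ))
    · simp [h]
    · simp [h]
  refine h1.trans fun z hz => ?_
  rw [show (0 : ST n) = ((0 : Spc n), (0:ℝ)) from rfl, ← ball_prod_same]
  refine ⟨hφ hz.1, ?_⟩
  rw [Real.ball_eq_Ioo]; simpa using hγ hz.2

/-- Weighted spatial averages of `J(v)` are almost constant in time. -/
theorem NSol.gluing (S : NSol p ν L lam v Dv G f) {φ : Spc n → ℝ} (hφ : ContDiff ℝ (⊤ : ℕ∞) φ)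
    {T M : ℝ} (hφs : tsupport φ ⊆ Metric.ball 0 T) (hT : 0 < T) (hT2 : T < 2)
    (hM : ∀ z, ‖gradS (fun z : ST n => φ z.1) z‖ ≤ M) :
    ∃ Y : Vec N, ∀ᵐ t : ℝ, t ∈ Ioo (-T) T →
      ‖(∫ x, φ x • J p (v (x, t))) - Y‖ ≤ lam * (M * ∫ z in Metric.ball 0 T, ‖G z‖) := by
  have hlam := S.hlam
  have hφc : HasCompactSupport φ :=
    Metric.isCompact_of_isClosed_isBounded (isClosed_tsupport φ) (Metric.isBounded_ball.subset hφs)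
  obtain ⟨Cφ, hCφ⟩ := hφc.exists_bound_of_continuous hφ.continuous
  set y : ℝ → Vec N := fun t => ∫ x, φ x • J p (v (x, t)) with hy
  have h_int : ∀ h : ℝ → ℝ, Continuous h → HasCompactSupport h →
      Integrable (fun z : ST n => (φ z.1 * h z.2) • J p (v z)) volume := by
    intro h hh hhc
    obtain ⟨C, hC⟩ := hhc.exists_bound_of_continuous hh
    refine S.integrable_J.bdd_smul (Cφ * C)
      ((hφ.continuous.comp continuous_fst).mul (hh.comp continuous_snd)).aestronglyMeasurable
      (Eventually.of_forall fun z => ?_)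
    rw [Pi.mul_apply, norm_mul]
    exact mul_le_mul (hCφ _) (hC _) (norm_nonneg _) ((norm_nonneg _).trans (hCφ z.1))
  have hyi : Integrable y volume := by
    have h1 : Integrable (fun z : ST n => φ z.1 • J p (v z)) volume :=
      S.integrable_J.bdd_smul Cφ (hφ.continuous.comp continuous_fst).aestronglyMeasurable
        (Eventually.of_forall fun z => hCφ _)
    exact Integrable.integral_prod_right h1
  let bmp : ContDiffBump (0:ℝ) := ⟨T / 4, T / 2, by positivity, by linarith⟩
  set g₂ : ℝ → ℝ := bmp.normed volume with hg₂
  have hg₂s : ContDiff ℝ (⊤ : ℕ∞) g₂ := bmp.contDiff_normed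
  have hg₂c : HasCompactSupport g₂ := bmp.hasCompactSupport_normed
  have hg₂0 : ∀ t, 0 ≤ g₂ t := bmp.nonneg_normed
  have hg₂1 : ∫ t, g₂ t = 1 := bmp.integral_normed
  have hg₂t : tsupport g₂ ⊆ Ioo (-T) T := by
    rw [hg₂, bmp.tsupport_normed_eq, Real.closedBall_eq_Icc]
    have hr : bmp.rOut = T / 2 := rfl
    rw [hr]
    exact fun t ht => ⟨by linarith [ht.1], by linarith [ht.2]⟩
  refine ⟨∫ t, g₂ t • y t, ?_⟩
  have key := ae_mem_of_forall_average_mem (m := (volume : Measure ℝ)) hyi.locallyIntegrable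
    (isOpen_Ioo (a := -T) (b := T)) (Metric.isClosed_closedBall (x := ∫ t, g₂ t • y t)
      (ε := lam * (M * ∫ z in Metric.ball 0 T, ‖G z‖))) ?_
  · filter_upwards [key] with t ht h
    have := ht h
    rwa [mem_closedBall_iff_norm] at this
  intro g hg hgc hgt hg0 hg1
  rw [mem_closedBall_iff_norm]
  set E := (∫ t, g t • y t) - ∫ t, g₂ t • y t with hE
  have hgi : Integrable g volume := hg.continuous.integrable_of_hasCompactSupport hgc
  have hg₂i : Integrable g₂ volume := hg₂s.continuous.integrable_of_hasCompactSupport hg₂c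
  set k : ℝ → ℝ := fun t => g t - g₂ t with hk
  have hks : ContDiff ℝ (⊤ : ℕ∞) k := hg.sub hg₂s
  have hkc : HasCompactSupport k := hgc.sub hg₂c
  have hki : Integrable k volume := hgi.sub hg₂i
  have hkt : tsupport k ⊆ Ioo (-T) T :=
    (tsupport_sub g g₂).trans (union_subset hgt hg₂t)
  obtain ⟨T', hT', hkT'⟩ : ∃ T' < T, tsupport k ⊆ Metric.ball 0 T' := by
    refine exists_lt_subset_ball (isClosed_tsupport k) ?_
    rw [Real.ball_eq_Ioo]; simpa using hkt
  have hk0 : ∀ t, T' ≤ |t| → k t = 0 := fun t ht => by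
    refine image_eq_zero_of_notMem_tsupport fun h => ?_
    have := hkT' h
    rw [mem_ball_zero_iff, Real.norm_eq_abs] at this
    linarith
  set γ : ℝ → ℝ := fun t => ∫ s in Iic t, k s with hγ
  have hγ1 : ∀ t, |γ t| ≤ 1 := by
    intro t
    have e : γ t = (∫ s in Iic t, g s) - ∫ s in Iic t, g₂ s :=
      integral_sub hgi.integrableOn hg₂i.integrableOn
    have a1 : 0 ≤ ∫ s in Iic t, g s := setIntegral_nonneg measurableSet_Iic fun s _ => hg0 s
    have a2 : 0 ≤ ∫ s in Iic t, g₂ s := setIntegral_nonneg measurableSet_Iic fun s _ => hg₂0 s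
    have a3 : ∫ s in Iic t, g s ≤ 1 := by
      rw [← hg1]; exact setIntegral_le_integral hgi (Eventually.of_forall hg0)
    have a4 : ∫ s in Iic t, g₂ s ≤ 1 := by
      rw [← hg₂1]; exact setIntegral_le_integral hg₂i (Eventually.of_forall hg₂0)
    rw [e, abs_le]; constructor <;> linarith
  have hγd : ∀ t, HasDerivAt γ (k t) t := by
    intro t
    have h1 : HasDerivAt (fun t => ∫ s in (0:ℝ)..t, k s) (k t) t :=
      intervalIntegral.integral_hasDerivAt_right (hks.continuous.intervalIntegrable _ _)
        (hks.continuous.stronglyMeasurableAtFilter _ _) hks.continuous.continuousAt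
    have h2 : γ = fun t => (∫ s in Iic (0:ℝ), k s) + ∫ s in (0:ℝ)..t, k s := by
      funext t
      have := intervalIntegral.integral_Iic_sub_Iic (a := 0) (b := t) hki.integrableOn
        hki.integrableOn
      simp only [hγ]; linarith
    rw [h2]
    exact h1.const_add _
  have hγs : ContDiff ℝ (⊤ : ℕ∞) γ := by
    rw [contDiff_infty_iff_deriv]
    refine ⟨fun t => (hγd t).differentiableAt, ?_⟩
    rw [show deriv γ = k from funext fun t => (hγd t).deriv]
    exact hks
  have hγ0 : ∀ t, T' < |t| → γ t = 0 := by
    intro t ht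
    rcases lt_abs.1 ht with h | h
    · have h1 : ∫ s, k s = 0 := by
        simp only [hk]; rw [integral_sub hgi hg₂i, hg1, hg₂1, sub_self]
      have h2 := integral_add_compl (measurableSet_Iic (a := t)) hki
      rw [h1, compl_Iic] at h2
      have h3 : ∫ s in Ioi t, k s = 0 :=
        setIntegral_eq_zero_of_forall_eq_zero fun s hs => hk0 s
          ((h.le.trans (le_of_lt hs)).trans (le_abs_self s))
      simp only [hγ]; linarith
    · refine setIntegral_eq_zero_of_forall_eq_zero fun s hs => hk0 s ?_
      have : s ≤ t := hs
      exact le_trans (by linarith) (neg_le_abs s)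
  have hγt : tsupport γ ⊆ Ioo (-T) T := by
    refine (closure_minimal (t := Icc (-T') T') (fun t ht => ?_) isClosed_Icc).trans
      (Icc_subset_Ioo (by linarith) hT')
    rw [mem_Icc, ← abs_le]; by_contra h; exact ht (hγ0 t (not_le.1 h))
  set κ : ST n → ℝ := fun z => φ z.1 * γ z.2 with hκ
  have hΦs : ContDiff ℝ (⊤ : ℕ∞) (fun z : ST n => φ z.1) := hφ.comp contDiff_fst
  have hκs : ContDiff ℝ (⊤ : ℕ∞) κ := hΦs.mul (hγs.comp contDiff_snd)
  have hκt : tsupport κ ⊆ Metric.ball 0 T := tsupport_prod_subset hφs hγt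
  have hκd : ∀ z d, fderiv ℝ κ z d
      = γ z.2 * fderiv ℝ (fun z : ST n => φ z.1) z d + φ z.1 * (k z.2 * d.2) := by
    intro z d
    have h1 : HasFDerivAt (fun z : ST n => γ z.2)
        ((k z.2) • ContinuousLinearMap.snd ℝ (Spc n) ℝ) z :=
      (hγd z.2).comp_hasFDerivAt z hasFDerivAt_snd
    have h2 := ((hΦs.differentiable (by simp) z).hasFDerivAt).mul h1
    have h3 : fderiv ℝ κ z = _ := h2.fderiv
    rw [h3]; simp; ring
  have hκg : ∀ z, gradS κ z = γ z.2 • gradS (fun z : ST n => φ z.1) z := by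
    intro z; ext j; simp [gradS, hκd, sdir]
  have hΦt : ∀ z, fderiv ℝ (fun z : ST n => φ z.1) z (tdir n) = 0 := by
    intro z
    have h1 : HasFDerivAt (fun z : ST n => φ z.1)
        ((fderiv ℝ φ z.1).comp (ContinuousLinearMap.fst ℝ (Spc n) ℝ)) z :=
      ((hφ.differentiable (by simp) z.1).hasFDerivAt).comp z hasFDerivAt_fst
    rw [h1.fderiv]; simp [tdir]
  have hκdt : ∀ z, fderiv ℝ κ z (tdir n) = φ z.1 * k z.2 := by
    intro z; rw [hκd, hΦt]; simp [tdir]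
  set Ψ : ST n → Vec N := fun z => κ z • E with hΨ
  have hΨs : ContDiff ℝ (⊤ : ℕ∞) Ψ := hκs.smul contDiff_const
  have hΨt : tsupport Ψ ⊆ Metric.ball 0 T :=
    (closure_mono (Function.support_smul_subset_left _ _)).trans hκt
  have hΨd : ∀ z d, fderiv ℝ Ψ z d = (fderiv ℝ κ z d) • E := by
    intro z d
    have := ((hκs.differentiable (by simp) z).hasFDerivAt).smul_const E
    have h3 : fderiv ℝ Ψ z = _ := this.fderiv
    rw [h3]; simp
  have hΨg : ∀ z, gradM Ψ z = tens E (gradS κ z) := by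
    intro z; ext ij; simp [gradM, tens, gradS, hΨd, mul_comm]
  have hweak := S.weak Ψ hΨs (hasCompactSupport_of_tsupport_subset_ball hΨt)
    (hΨt.trans (Metric.ball_subset_ball hT2.le))
  have hlhs : ∫ z, inner ℝ (J p (v z)) (fderiv ℝ Ψ z (tdir n)) = inner ℝ E E := by
    have e1 : ∀ z, inner ℝ (J p (v z)) (fderiv ℝ Ψ z (tdir n))
        = inner ℝ E ((φ z.1 * k z.2) • J p (v z)) := by
      intro z
      rw [hΨd, hκdt, inner_smul_right, inner_smul_right, real_inner_comm]
    simp only [e1]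
    rw [integral_inner (h_int k hks.continuous hkc), integral_prod_smul_time
      (h_int k hks.continuous hkc)]
    congr 1
    rw [hE, ← integral_sub]
    · exact integral_congr_ae (Eventually.of_forall fun t => by simp [hk, sub_smul, hy])
    · obtain ⟨C, hC⟩ := hgc.exists_bound_of_continuous hg.continuous
      exact hyi.bdd_smul C hg.continuous.aestronglyMeasurable (Eventually.of_forall hC)
    · obtain ⟨C, hC⟩ := hg₂c.exists_bound_of_continuous hg₂s.continuous
      exact hyi.bdd_smul C hg₂s.continuous.aestronglyMeasurable (Eventually.of_forall hC)
  have hGi : IntegrableOn (fun z => ‖G z‖) (Metric.ball 0 T) volume := by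
    have : IsFiniteMeasure (volume.restrict (Metric.ball (0 : ST n) T)) :=
      ⟨by rw [Measure.restrict_apply_univ]; exact measure_ball_lt_top⟩
    refine ((S.memG.restrict _).integrable ?_).norm
    rw [ENNReal.one_le_ofReal, le_div_iff₀ (by linarith [S.hp])]; linarith
  have hrhs : ∫ z, inner ℝ (G z) (gradM Ψ z)
      ≤ ‖E‖ * (M * ∫ z in Metric.ball 0 T, ‖G z‖) := by
    rw [← integral_indicator Metric.isOpen_ball.measurableSet, ← mul_assoc, ← integral_const_mul]
    refine (Real.le_norm_self _).trans (norm_integral_le_of_norm_le (((integrable_indicator_iff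
      Metric.isOpen_ball.measurableSet).2 hGi).const_mul _) (Eventually.of_forall fun z => ?_))
    rw [hΨg]
    by_cases hz : z ∈ Metric.ball 0 T
    · rw [indicator_of_mem hz, hκg]
      refine (norm_inner_le_norm _ _).trans ?_
      rw [norm_tens, norm_smul, mul_comm]
      refine mul_le_mul_of_nonneg_right (mul_le_mul_of_nonneg_left ?_ (norm_nonneg _))
        (norm_nonneg _)
      exact (mul_le_of_le_one_left (norm_nonneg _) (hγ1 _)).trans (hM z)
    · rw [indicator_of_notMem hz, gradS_eq_zero fun h => hz (hκt h), mul_zero]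
      refine (norm_inner_le_norm _ _).trans ?_
      rw [norm_tens, norm_zero, mul_zero, mul_zero]
  rw [hweak] at hlhs
  rw [real_inner_self_eq_norm_sq] at hlhs
  have h5 := mul_le_mul_of_nonneg_left hrhs hlam.le
  rw [hlhs] at h5
  by_contra hcon
  rw [not_le] at hcon
  have hM0 : 0 ≤ M := (norm_nonneg _).trans (hM 0)
  have h6 : 0 ≤ lam * (M * ∫ z in Metric.ball (0 : ST n) T, ‖G z‖) :=
    mul_nonneg hlam.le (mul_nonneg hM0 (integral_nonneg fun z => norm_nonneg _))
  nlinarith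
end Gluing


/-! ### Difference quotients and Poincaré inequalities -/

section Poincare

theorem enorm_sub_le_lintegral {Ψ : ST n → Vec N} (hΨ : ContDiff ℝ (⊤ : ℕ∞) Ψ) (z : ST n)
    (e : Spc n) :
    ‖Ψ (z + (e, 0)) - Ψ z‖ₑ
      ≤ ‖e‖ₑ * ∫⁻ σ in Ioc (0:ℝ) 1, ‖gradM Ψ (z + σ • (e, (0:ℝ)))‖ₑ := by
  have hd : ∀ σ : ℝ, HasDerivAt (fun σ : ℝ => Ψ (z + σ • ((e, 0) : ST n)))
      (matVec (gradM Ψ (z + σ • ((e, 0) : ST n))) e) σ := by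
    intro σ
    have h1 : HasDerivAt (fun σ : ℝ => z + σ • ((e, 0) : ST n)) ((e, 0) : ST n) σ := by
      simpa using ((hasDerivAt_id σ).smul_const ((e, 0) : ST n)).const_add z
    have h2 := ((hΨ.differentiable (by simp) (z + σ • ((e, 0) : ST n))).hasFDerivAt).comp_hasDerivAt
      σ h1
    rwa [fderiv_spatial] at h2
  have hc : Continuous fun σ : ℝ => matVec (gradM Ψ (z + σ • ((e, 0) : ST n))) e := by
    have : (fun σ : ℝ => matVec (gradM Ψ (z + σ • ((e, 0) : ST n))) e)
        = fun σ : ℝ => fderiv ℝ Ψ (z + σ • ((e, 0) : ST n)) (e, 0) :=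
      funext fun σ => (fderiv_spatial _ _).symm
    rw [this]
    exact ((hΨ.continuous_fderiv (by simp)).comp (by fun_prop)).clm_apply continuous_const
  have h3 := intervalIntegral.integral_eq_sub_of_hasDerivAt (a := 0) (b := 1)
    (fun σ _ => hd σ) (hc.intervalIntegrable _ _)
  simp only [one_smul, zero_smul, add_zero] at h3
  rw [← h3, intervalIntegral.integral_of_le zero_le_one]
  refine (enorm_integral_le_lintegral_enorm _).trans ?_
  rw [← lintegral_const_mul' _ _ (by simp)]
  refine lintegral_mono fun σ => ?_
  rw [mul_comm, ← enorm_norm, ← enorm_norm (gradM _ _), ← enorm_norm e, ← enorm_mul]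
  exact enorm_le_iff_norm_le.2 (by simpa using norm_matVec_le _ _)

variable {w : ST n → Vec N} {Dw : ST n → Mat N n}

theorem continuous_gradM {Ψ : ST n → Vec N} (hΨ : ContDiff ℝ (⊤ : ℕ∞) Ψ) :
    Continuous (gradM Ψ) := by
  refine (PiLp.continuous_toLp 2 _).comp (continuous_pi fun ij => ?_)
  have h1 : Continuous fun z => fderiv ℝ Ψ z (sdir ij.2) :=
    (hΨ.continuous_fderiv (by simp)).clm_apply continuous_const
  exact (EuclideanSpace.proj (𝕜 := ℝ) ij.1).continuous.comp h1

/-- Spatial difference quotients are controlled by the weak gradient. -/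
theorem lintegral_shift_le (hDw : Measurable Dw)
    (hwi : LocallyIntegrable w volume) (hDwi : LocallyIntegrable Dw volume) {R : ℝ}
    (h : WGrad (Metric.ball 0 R) w Dw) {s : ℝ} (hs : 1 ≤ s) {r r' : ℝ} (hrr : r < r')
    (hr' : r' ≤ R) (e : Spc n) {U : Set (ST n)}
    (hUr : ∀ z ∈ U, ∀ σ ∈ Ioc (0:ℝ) 1, z + σ • ((e, 0) : ST n) ∈ Metric.ball 0 r) :
    ∫⁻ z in U, ‖w (z + (e, 0)) - w z‖ₑ ^ s
      ≤ ‖e‖ₑ ^ s * ∫⁻ z in Metric.ball 0 r', ‖Dw z‖ₑ ^ s := by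
  have hs0 : 0 ≤ s := by linarith
  have ht := tendsto_moll_ae hwi
  have ht' : ∀ᵐ z, Tendsto (fun k => moll k w (z + (e, 0))) atTop (𝓝 (w (z + (e, 0)))) :=
    (measurePreserving_add_right volume ((e, 0) : ST n)).quasiMeasurePreserving.ae ht
  have hlim : ∀ᵐ z ∂(volume.restrict U), ‖w (z + (e, 0)) - w z‖ₑ ^ s
      = liminf (fun k => ‖moll k w (z + (e, 0)) - moll k w z‖ₑ ^ s) atTop := by
    refine ae_restrict_of_ae ?_
    filter_upwards [ht, ht'] with z h1 h2
    exact ((((continuous_enorm.tendsto _).comp (h2.sub h1)).ennrpow_const s).liminf_eq).symm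
  rw [lintegral_congr_ae hlim]
  refine (lintegral_liminf_le fun k => ?_).trans ?_
  · have hm := (contDiff_moll hwi k).continuous.measurable
    exact ((hm.comp (measurable_id.add_const _)).sub hm).enorm.pow_const s
  refine liminf_le_of_frequently_le' (Eventually.frequently ?_)
  have hk : ∀ᶠ k : ℕ in atTop, 1 / ((k:ℝ) + 1) < r' - r :=
    tendsto_one_div_add_atTop_nhds_zero_nat.eventually_lt_const (by linarith)
  filter_upwards [hk] with k hk
  have hcl : ∀ z ∈ Metric.ball (0 : ST n) r, Metric.closedBall z (1 / ((k:ℝ) + 1))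
      ⊆ Metric.ball 0 r' := by
    intro z hz
    refine Metric.closedBall_subset_ball' ?_
    rw [Metric.mem_ball] at hz; linarith
  have hsm := contDiff_moll hwi k
  have hgm : Measurable (gradM (moll k w)) := (continuous_gradM hsm).measurable
  have step : ∀ z, ‖moll k w (z + (e, 0)) - moll k w z‖ₑ ^ s
      ≤ ‖e‖ₑ ^ s * (∫⁻ σ in Ioc (0:ℝ) 1, ‖gradM (moll k w) (z + σ • ((e, 0) : ST n))‖ₑ) ^ s := by
    intro z
    rw [← ENNReal.mul_rpow_of_nonneg _ _ hs0]
    exact ENNReal.rpow_le_rpow (enorm_sub_le_lintegral hsm z e) hs0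
  refine (lintegral_mono step).trans ?_
  rw [lintegral_const_mul' _ _ (by simp [hs0])]
  refine mul_le_mul_right ?_ _
  have : IsProbabilityMeasure (volume.restrict (Ioc (0:ℝ) 1)) := ⟨by simp⟩
  refine lintegral_rpow_lintegral_le hs
    (F := fun z σ => ‖gradM (moll k w) (z + σ • ((e, 0) : ST n))‖ₑ) ?_ ?_
  · refine (hgm.comp ?_).enorm
    exact measurable_fst.add (measurable_snd.smul_const _)
  rw [ae_restrict_iff' measurableSet_Ioc]
  refine Eventually.of_forall fun σ hσ => ?_
  have e1 : ∫⁻ z in U, ‖gradM (moll k w) (z + σ • ((e, 0) : ST n))‖ₑ ^ s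
      ≤ ∫⁻ z in (fun z => z + σ • ((e, 0) : ST n)) ⁻¹' Metric.ball 0 r,
        ‖gradM (moll k w) (z + σ • ((e, 0) : ST n))‖ₑ ^ s :=
    lintegral_mono_set fun z hz => hUr z hz σ hσ
  refine e1.trans ?_
  have e2 := (measurePreserving_add_right volume (σ • ((e, 0) : ST n))).setLIntegral_comp_preimage
    (s := Metric.ball 0 r) Metric.isOpen_ball.measurableSet (hgm.enorm.pow_const s)
  refine e2.le.trans ?_
  have e3 : ∫⁻ z in Metric.ball 0 r, ‖gradM (moll k w) z‖ₑ ^ s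
      = ∫⁻ z in Metric.ball 0 r, ‖moll k Dw z‖ₑ ^ s := by
    refine setLIntegral_congr_fun Metric.isOpen_ball.measurableSet fun z hz => ?_
    rw [gradM_moll hwi hDwi h ((hcl z hz).trans (Metric.ball_subset_ball hr'))]
  rw [e3]
  exact lintegral_moll_le hDw hs k Metric.isOpen_ball.measurableSet
    Metric.isOpen_ball.measurableSet fun z hz => Metric.ball_subset_closedBall.trans (hcl z hz)

/-- A probability density supported in the ball of radius `r`. -/
structure Weight (φ : Spc n → ℝ) (r : ℝ) : Prop where
  cont : Continuous φ
  nonneg : ∀ x, 0 ≤ φ x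
  zero : ∀ x, x ∉ Metric.ball 0 r → φ x = 0
  one : ∫ x, φ x = 1

theorem Weight.hasCompactSupport {φ : Spc n → ℝ} {r : ℝ} (hφ : Weight φ r) :
    HasCompactSupport φ :=
  HasCompactSupport.of_support_subset_isCompact (isCompact_closedBall (0 : Spc n) r) fun x hx =>
    Metric.ball_subset_closedBall (by by_contra h; exact hx (hφ.zero x h))

theorem Weight.exists_le {φ : Spc n → ℝ} {r : ℝ} (hφ : Weight φ r) :
    ∃ C : ℝ, 0 ≤ C ∧ ∀ x, φ x ≤ C := by
  obtain ⟨C, hC⟩ := hφ.hasCompactSupport.exists_bound_of_continuous hφ.cont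
  exact ⟨C, (norm_nonneg _).trans (hC 0), fun x => (Real.le_norm_self _).trans (hC x)⟩

theorem Weight.integrable {φ : Spc n → ℝ} {r : ℝ} (hφ : Weight φ r) : Integrable φ volume :=
  hφ.cont.integrable_of_hasCompactSupport hφ.hasCompactSupport

/-- The weighted spatial mean. -/
def mean {F : Type*} [NormedAddCommGroup F] [NormedSpace ℝ F] (φ : Spc n → ℝ) (w : ST n → F)
    (t : ℝ) : F := ∫ x, φ x • w (x, t)

theorem Weight.integrable_smul {F : Type*} [NormedAddCommGroup F] [NormedSpace ℝ F]
    {φ : Spc n → ℝ} {r : ℝ} (hφ : Weight φ r) {α : Type*} [MeasurableSpace α] {m : Measure α}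
    {w : α → F} {g : α → Spc n} (hg : AEStronglyMeasurable (fun a => φ (g a)) m)
    (hw : Integrable w m) :
    Integrable (fun a => φ (g a) • w a) m := by
  obtain ⟨C, -, hC⟩ := hφ.exists_le
  exact hw.bdd_smul C hg (Eventually.of_forall fun x => by
    rw [Real.norm_of_nonneg (hφ.nonneg _)]; exact hC _)

theorem ae_slice_integrable {F : Type*} [NormedAddCommGroup F]
    {w : ST n → F} (hw : Integrable w volume) :
    ∀ᵐ t : ℝ, Integrable (fun x => w (x, t)) volume := by
  rw [Measure.volume_eq_prod] at hw
  exact hw.prod_left_ae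

theorem measurable_mean {φ : Spc n → ℝ} (hφ : Continuous φ) (hw : Measurable w) :
    Measurable (mean φ w) := by
  have h1 : StronglyMeasurable (fun q : ℝ × Spc n => φ q.2 • w (q.2, q.1)) :=
    ((hφ.measurable.comp measurable_snd).smul
      (hw.comp (measurable_snd.prodMk measurable_fst))).stronglyMeasurable
  exact (h1.integral_prod_right (ν := volume)).measurable

theorem enorm_sub_mean_le {φ : Spc n → ℝ} {r : ℝ} (hφ : Weight φ r) {t : ℝ}
    (ht : Integrable (fun x => w (x, t)) volume) (b : Vec N) :
    ‖b - mean φ w t‖ₑ ≤ ∫⁻ y, ENNReal.ofReal (φ y) * ‖b - w (y, t)‖ₑ := by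
  have h1 : b - mean φ w t = ∫ y, φ y • (b - w (y, t)) := by
    simp only [smul_sub]
    rw [integral_sub (hφ.integrable.smul_const b)
      (hφ.integrable_smul (hφ.cont.aestronglyMeasurable) ht), integral_smul_const, hφ.one,
      one_smul, mean]
  rw [h1]
  refine (enorm_integral_le_lintegral_enorm _).trans (le_of_eq (lintegral_congr fun y => ?_))
  rw [enorm_smul, Real.enorm_of_nonneg (hφ.nonneg _)]

theorem volume_ball_ne_zero' {r : ℝ} (hr : 0 < r) : volume (Metric.ball (0 : Spc n) r) ≠ 0 :=
  (Metric.measure_ball_pos _ _ hr).ne'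

theorem mem_ball_ST {z : ST n} {r : ℝ} :
    z ∈ Metric.ball (0 : ST n) r ↔ z.1 ∈ Metric.ball (0 : Spc n) r ∧ z.2 ∈ Ioo (-r) r := by
  rw [show (0 : ST n) = ((0 : Spc n), (0:ℝ)) from rfl, ← ball_prod_same, mem_prod,
    Real.ball_eq_Ioo]
  simp

theorem shift_mem_ball {z : ST n} {e : Spc n} {r : ℝ} (hz : z ∈ Metric.ball (0 : ST n) r)
    (he : z.1 + e ∈ Metric.ball (0 : Spc n) r) {σ : ℝ} (hσ : σ ∈ Ioc (0:ℝ) 1) :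
    z + σ • ((e, 0) : ST n) ∈ Metric.ball (0 : ST n) r := by
  rw [mem_ball_ST] at hz ⊢
  refine ⟨?_, by simpa using hz.2⟩
  have h := (convex_ball (0 : Spc n) r) hz.1 he (sub_nonneg.2 hσ.2) hσ.1.le (by ring)
  convert h using 1
  simp only [Prod.fst_add, Prod.smul_fst]
  module

/-- The Poincaré inequality for weighted means. -/
theorem exists_lintegral_sub_mean_le {φ : Spc n → ℝ} {r r' R s : ℝ} (hφ : Weight φ r) (hr : 0 < r)
    (hrr : r < r') (hr' : r' ≤ R) (hs : 1 ≤ s) :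
    ∃ C : ℝ≥0∞, C ≠ ⊤ ∧ ∀ (N : ℕ) (w : ST n → Vec N) (Dw : ST n → Mat N n), Measurable w →
      Measurable Dw → Integrable w volume → Integrable Dw volume →
      WGrad (Metric.ball 0 R) w Dw →
      ∫⁻ z in Metric.ball 0 r, ‖w z - mean φ w z.2‖ₑ ^ s
        ≤ C * ∫⁻ z in Metric.ball 0 r', ‖Dw z‖ₑ ^ s := by
  obtain ⟨Cφ, hC0, hCφ⟩ := hφ.exists_le
  have hs0 : 0 ≤ s := by linarith
  set V := volume (Metric.ball (0 : Spc n) (2 * r)) with hV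
  have hV0 : V ≠ 0 := volume_ball_ne_zero' (by linarith)
  have hVt : V ≠ ⊤ := measure_ball_lt_top.ne
  set P : Measure (Spc n) := V⁻¹ • volume.restrict (Metric.ball 0 (2 * r)) with hP
  have : IsProbabilityMeasure P := ⟨by
    rw [hP, Measure.smul_apply, Measure.restrict_apply_univ, smul_eq_mul,
      ENNReal.inv_mul_cancel hV0 hVt]⟩
  refine ⟨(ENNReal.ofReal Cφ * V) ^ s * ENNReal.ofReal (2 * r) ^ s, by
    refine ENNReal.mul_ne_top (ENNReal.rpow_ne_top_of_nonneg hs0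
      (ENNReal.mul_ne_top ENNReal.ofReal_ne_top hVt))
      (ENNReal.rpow_ne_top_of_nonneg hs0 ENNReal.ofReal_ne_top), ?_⟩
  intro N w Dw hw hDw hwi hDwi h
  set F : ST n → Spc n → ℝ≥0∞ := fun z e =>
    (Metric.ball (0 : Spc n) r).indicator (fun _ => ‖w (z + (e, 0)) - w z‖ₑ) (z.1 + e) with hF
  have hFm : Measurable (Function.uncurry F) := by
    have h1 : Measurable fun q : ST n × Spc n => ‖w (q.1 + (q.2, 0)) - w q.1‖ₑ :=
      ((hw.comp (measurable_fst.add (measurable_snd.prodMk measurable_const))).sub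
        (hw.comp measurable_fst)).enorm
    exact h1.indicator (measurableSet_preimage
      ((measurable_fst.comp measurable_fst).add measurable_snd)
      (Metric.isOpen_ball (x := (0 : Spc n)) (ε := r)).measurableSet)
  have hmain : ∫⁻ z in Metric.ball 0 r, (∫⁻ e, F z e ∂P) ^ s
      ≤ ENNReal.ofReal (2 * r) ^ s * ∫⁻ z in Metric.ball 0 r', ‖Dw z‖ₑ ^ s := by
    refine lintegral_rpow_lintegral_le hs hFm ?_
    refine Measure.ae_smul_measure ?_ _
    rw [ae_restrict_iff' Metric.isOpen_ball.measurableSet]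
    refine Eventually.of_forall fun e he => ?_
    have hm : MeasurableSet {z : ST n | z.1 + e ∈ Metric.ball (0 : Spc n) r} :=
      measurableSet_preimage (measurable_fst.add_const e) Metric.isOpen_ball.measurableSet
    have h1 : ∫⁻ z in Metric.ball 0 r, F z e ^ s
        = ∫⁻ z in Metric.ball 0 r ∩ {z : ST n | z.1 + e ∈ Metric.ball (0 : Spc n) r},
          ‖w (z + (e, 0)) - w z‖ₑ ^ s := by
      rw [inter_comm, ← Measure.restrict_restrict hm, ← lintegral_indicator hm]
      refine lintegral_congr fun z => ?_
      by_cases hz : z.1 + e ∈ Metric.ball (0 : Spc n) r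
      · have hz' : z ∈ {z : ST n | z.1 + e ∈ Metric.ball (0 : Spc n) r} := hz
        simp only [hF]
        rw [indicator_of_mem hz, indicator_of_mem hz']
      · have hz' : z ∉ {z : ST n | z.1 + e ∈ Metric.ball (0 : Spc n) r} := hz
        simp only [hF]
        rw [indicator_of_notMem hz, indicator_of_notMem hz', ENNReal.zero_rpow_of_pos (by linarith)]
    rw [h1]
    refine (lintegral_shift_le hDw hwi.locallyIntegrable hDwi.locallyIntegrable h hs hrr hr' e
      fun z hz σ hσ => shift_mem_ball hz.1 hz.2 hσ).trans ?_
    gcongr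
    rw [← ofReal_norm]
    exact ENNReal.ofReal_le_ofReal (by rw [mem_ball_zero_iff] at he; exact he.le)
  have hpt : ∀ᵐ z ∂(volume.restrict (Metric.ball (0 : ST n) r)), ‖w z - mean φ w z.2‖ₑ ^ s
      ≤ (ENNReal.ofReal Cφ * V) ^ s * (∫⁻ e, F z e ∂P) ^ s := by
    have hsl : ∀ᵐ z : ST n, Integrable (fun x => w (x, z.2)) volume :=
      Measure.quasiMeasurePreserving_snd.ae (ae_slice_integrable hwi)
    rw [ae_restrict_iff' Metric.isOpen_ball.measurableSet]
    filter_upwards [hsl] with z hz hzr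
    rw [← ENNReal.mul_rpow_of_nonneg _ _ hs0]
    refine ENNReal.rpow_le_rpow ((enorm_sub_mean_le hφ hz _).trans ?_) hs0
    rw [hP, lintegral_smul_measure, smul_eq_mul, mul_assoc, ← mul_assoc V,
      ENNReal.mul_inv_cancel hV0 hVt, one_mul, ← lintegral_const_mul' _ _ ENNReal.ofReal_ne_top,
      ← lintegral_indicator Metric.isOpen_ball.measurableSet,
      ← lintegral_add_left_eq_self _ z.1]
    refine lintegral_mono fun e => ?_
    simp only
    by_cases hze : z.1 + e ∈ Metric.ball (0 : Spc n) r
    · have he : e ∈ Metric.ball (0 : Spc n) (2 * r) := by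
        rw [mem_ball_zero_iff] at hze ⊢
        have h3 := mem_ball_zero_iff.1 (mem_ball_ST.1 hzr).1
        calc ‖e‖ = ‖(z.1 + e) - z.1‖ := by congr 1; abel
          _ ≤ ‖z.1 + e‖ + ‖z.1‖ := norm_sub_le _ _
          _ < _ := by linarith
      rw [indicator_of_mem he]
      simp only [hF]
      rw [indicator_of_mem hze, ← enorm_neg (w (z + (e, 0)) - w z), neg_sub]
      have : z + (e, 0) = (z.1 + e, z.2) := by ext <;> simp
      rw [this]
      gcongr
      exact hCφ _
    · rw [hφ.zero _ hze]; simp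
  refine (lintegral_mono_ae hpt).trans ?_
  rw [lintegral_const_mul' _ _ (ENNReal.rpow_ne_top_of_nonneg hs0
      (ENNReal.mul_ne_top ENNReal.ofReal_ne_top hVt)), mul_assoc]
  gcongr

theorem Weight.mono {φ : Spc n → ℝ} {r r' : ℝ} (hφ : Weight φ r) (h : r ≤ r') : Weight φ r' :=
  ⟨hφ.cont, hφ.nonneg, fun x hx => hφ.zero x fun h' => hx (Metric.ball_subset_ball h h'), hφ.one⟩

theorem setLIntegral_ball_ST {g : ST n → ℝ≥0∞} (hg : Measurable g) (r : ℝ) :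
    ∫⁻ z in Metric.ball (0 : ST n) r, g z
      = ∫⁻ t in Ioo (-r) r, ∫⁻ x in Metric.ball (0 : Spc n) r, g (x, t) := by
  have h1 : Metric.ball (0 : ST n) r = Metric.ball (0 : Spc n) r ×ˢ Ioo (-r) r := by
    ext z; rw [mem_ball_ST]; rfl
  rw [h1, Measure.volume_eq_prod, ← Measure.prod_restrict, lintegral_prod_symm _ hg.aemeasurable]

set_option maxHeartbeats 1000000 in
/-- If the slices of `w` are bounded in `L¹` and `Dw` is small in `L¹`, then the oscillation of `w`
is small in `L^s`. -/
theorem exists_lintegral_sub_mean_small {φ : Spc n → ℝ} {r r₁ r' R s : ℝ} (hφ : Weight φ r₁)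
    (hr : 0 < r) (hrr : r < r₁) (hrr' : r₁ < r') (hr' : r' ≤ R) (hs : 1 ≤ s) {η : ℝ} (hη : 0 < η) :
    ∃ C : ℝ≥0∞, C ≠ ⊤ ∧ ∀ (N : ℕ) (w : ST n → Vec N) (Dw : ST n → Mat N n), Measurable w →
      Measurable Dw → Integrable w volume → Integrable Dw volume →
      WGrad (Metric.ball 0 R) w Dw → ∀ S : ℝ≥0∞,
      (∀ᵐ t : ℝ, t ∈ Ioo (-r₁) r₁ →
        ∫⁻ x in Metric.ball (0 : Spc n) r₁, ‖w (x, t) - mean φ w t‖ₑ ≤ S) →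
      ∫⁻ z in Metric.ball 0 r, ‖w z - mean φ w z.2‖ₑ ^ s
        ≤ ENNReal.ofReal η * (∫⁻ z in Metric.ball 0 r', ‖Dw z‖ₑ ^ s)
          + C * S ^ (s - 1) * ∫⁻ z in Metric.ball 0 r', ‖Dw z‖ₑ := by
  obtain ⟨C₁, hC₁t, hC₁⟩ := exists_lintegral_sub_mean_le hφ (hr.trans hrr) hrr' hr' le_rfl
  have hs0 : 0 ≤ s := by linarith
  obtain ⟨δ, hδ0, hδr, hδη⟩ : ∃ δ : ℝ, 0 < δ ∧ δ < r₁ - r ∧ 2 ^ (s - 1) * δ ^ s ≤ η := by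
    have h1 : Tendsto (fun δ : ℝ => 2 ^ (s - 1) * δ ^ s) (𝓝[>] 0) (𝓝 0) := by
      have : Tendsto (fun δ : ℝ => (2:ℝ) ^ (s - 1) * δ ^ s) (𝓝 0) (𝓝 (2 ^ (s - 1) * 0 ^ s)) :=
        (Real.continuousAt_rpow_const 0 s (Or.inr hs0)).tendsto.const_mul _
      rw [Real.zero_rpow (by linarith), mul_zero] at this
      exact this.mono_left nhdsWithin_le_nhds
    have h2 := (h1.eventually_lt_const hη).and ((Ioo_mem_nhdsGT (sub_pos.2 hrr)))
    obtain ⟨δ, h3, h4⟩ := h2.exists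
    exact ⟨δ, h4.1, h4.2, h3.le⟩
  set V := volume (Metric.ball (0 : Spc n) δ) with hV
  have hV0 : V ≠ 0 := volume_ball_ne_zero' hδ0
  have hVt : V ≠ ⊤ := measure_ball_lt_top.ne
  set B := volume (Metric.ball (0 : Spc n) r) with hB
  have hBt : B ≠ ⊤ := measure_ball_lt_top.ne
  set P : Measure (Spc n) := V⁻¹ • volume.restrict (Metric.ball 0 δ) with hP
  have : IsProbabilityMeasure P := ⟨by
    rw [hP, Measure.smul_apply, Measure.restrict_apply_univ, smul_eq_mul,
      ENNReal.inv_mul_cancel hV0 hVt]⟩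
  refine ⟨2 ^ (s - 1) * ((V⁻¹) ^ s * B * C₁), ?_, ?_⟩
  · refine ENNReal.mul_ne_top (by simp) (ENNReal.mul_ne_top (ENNReal.mul_ne_top
      (ENNReal.rpow_ne_top_of_nonneg hs0 (ENNReal.inv_ne_top.2 hV0)) hBt) hC₁t)
  intro N w Dw hw hDw hwi hDwi h S hS
  have hmm : Measurable (mean φ w) := measurable_mean hφ.cont hw
  have hdm : Measurable fun z : ST n => ‖w z - mean φ w z.2‖ₑ :=
    (hw.sub (hmm.comp measurable_snd)).enorm
  set ω : ℝ → ℝ≥0∞ := fun t => ∫⁻ x in Metric.ball (0 : Spc n) r₁, ‖w (x, t) - mean φ w t‖ₑ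
    with hω
  have hωm : Measurable ω := by
    have h1 : Measurable fun q : ℝ × Spc n => ‖w (q.2, q.1) - mean φ w q.1‖ₑ :=
      ((hw.comp (measurable_snd.prodMk measurable_fst)).sub (hmm.comp measurable_fst)).enorm
    exact h1.lintegral_prod_right' (ν := volume.restrict (Metric.ball (0 : Spc n) r₁))
  set F : ST n → Spc n → ℝ≥0∞ := fun z e => ‖w (z + (e, 0)) - w z‖ₑ with hF
  have hFm : Measurable (Function.uncurry F) :=
    ((hw.comp (measurable_fst.add (measurable_snd.prodMk measurable_const))).sub
        (hw.comp measurable_fst)).enorm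
  have hmain : ∫⁻ z in Metric.ball 0 r, (∫⁻ e, F z e ∂P) ^ s
      ≤ ENNReal.ofReal δ ^ s * ∫⁻ z in Metric.ball 0 r', ‖Dw z‖ₑ ^ s := by
    refine lintegral_rpow_lintegral_le hs hFm ?_
    refine Measure.ae_smul_measure ?_ _
    rw [ae_restrict_iff' Metric.isOpen_ball.measurableSet]
    refine Eventually.of_forall fun e he => ?_
    refine (lintegral_shift_le hDw hwi.locallyIntegrable hDwi.locallyIntegrable h hs hrr' hr' e
      fun z hz σ hσ => shift_mem_ball (Metric.ball_subset_ball hrr.le hz) ?_ hσ).trans ?_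
    · rw [mem_ball_zero_iff] at he ⊢
      have := mem_ball_zero_iff.1 (mem_ball_ST.1 hz).1
      linarith [norm_add_le z.1 e]
    gcongr
    rw [← ofReal_norm]
    exact ENNReal.ofReal_le_ofReal (by rw [mem_ball_zero_iff] at he; exact he.le)
  have hpt : ∀ z ∈ Metric.ball (0 : ST n) r, ‖w z - mean φ w z.2‖ₑ ^ s
      ≤ 2 ^ (s - 1) * ((∫⁻ e, F z e ∂P) ^ s + (V⁻¹ * ω z.2) ^ s) := by
    intro z hz
    have h1 : ‖w z - mean φ w z.2‖ₑ ≤ (∫⁻ e, F z e ∂P) + V⁻¹ * ω z.2 := by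
      have h2 : ‖w z - mean φ w z.2‖ₑ
          ≤ ∫⁻ e, (F z e + ‖w (z + (e, 0)) - mean φ w z.2‖ₑ) ∂P := by
        calc ‖w z - mean φ w z.2‖ₑ = ∫⁻ e, ‖w z - mean φ w z.2‖ₑ ∂P := by simp
          _ ≤ _ := lintegral_mono fun e => by
            simp only [hF]
            rw [← enorm_neg (w (z + (e, 0)) - w z), neg_sub]
            refine le_trans (le_of_eq ?_) (enorm_add_le _ _)
            congr 1; abel
      refine h2.trans ?_
      have hFz : Measurable fun e => F z e := hFm.of_uncurry_left
      rw [lintegral_add_left hFz]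
      gcongr
      rw [hP, lintegral_smul_measure, smul_eq_mul]
      gcongr
      simp only [hω]
      rw [← lintegral_indicator Metric.isOpen_ball.measurableSet,
        ← lintegral_indicator Metric.isOpen_ball.measurableSet,
        ← lintegral_add_left_eq_self ((Metric.ball (0 : Spc n) r₁).indicator _) z.1]
      refine lintegral_mono fun e => ?_
      by_cases he : e ∈ Metric.ball (0 : Spc n) δ
      · have hze : z.1 + e ∈ Metric.ball (0 : Spc n) r₁ := by
          rw [mem_ball_zero_iff] at he ⊢
          have := mem_ball_zero_iff.1 (mem_ball_ST.1 hz).1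
          linarith [norm_add_le z.1 e]
        have : z + (e, 0) = (z.1 + e, z.2) := by ext <;> simp
        rw [indicator_of_mem he, indicator_of_mem hze, this]
      · rw [indicator_of_notMem he]; exact zero_le
    refine (ENNReal.rpow_le_rpow h1 hs0).trans ?_
    exact ENNReal.rpow_add_le_mul_rpow_add_rpow _ _ hs
  have hωS : ∀ᵐ t ∂(volume.restrict (Ioo (-r₁) r₁)), ω t ^ s ≤ S ^ (s - 1) * ω t := by
    rw [ae_restrict_iff' measurableSet_Ioo]
    filter_upwards [hS] with t ht htr
    have h1 : ω t ^ s = ω t ^ (s - 1) * ω t := by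
      conv_rhs => rw [← ENNReal.rpow_one (ω t), ← ENNReal.rpow_mul, one_mul]
      rw [← ENNReal.rpow_add_of_nonneg _ _ (by linarith) zero_le_one, sub_add_cancel]
    rw [h1]
    gcongr
    exact ht htr
  have hω2 : ∫⁻ z in Metric.ball (0 : ST n) r, (V⁻¹ * ω z.2) ^ s
      ≤ (V⁻¹) ^ s * B * (S ^ (s - 1) * (C₁ * ∫⁻ z in Metric.ball 0 r', ‖Dw z‖ₑ)) := by
    rw [setLIntegral_ball_ST (g := fun z => (V⁻¹ * ω z.2) ^ s)
      (((hωm.comp measurable_snd).const_mul _).pow_const _)]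
    simp only [lintegral_const, Measure.restrict_apply_univ, ENNReal.mul_rpow_of_nonneg _ _ hs0]
    have h3 : ∀ t, (V⁻¹) ^ s * ω t ^ s * volume (Metric.ball (0 : Spc n) r)
        = ((V⁻¹) ^ s * B) * ω t ^ s := fun t => by rw [← hB]; ring
    simp only [h3]
    rw [lintegral_const_mul _ (hωm.pow_const _)]
    gcongr
    calc ∫⁻ t in Ioo (-r) r, ω t ^ s ≤ ∫⁻ t in Ioo (-r₁) r₁, ω t ^ s :=
          lintegral_mono_set (Ioo_subset_Ioo (by linarith) hrr.le)
      _ ≤ ∫⁻ t in Ioo (-r₁) r₁, S ^ (s - 1) * ω t := lintegral_mono_ae hωS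
      _ = S ^ (s - 1) * ∫⁻ t in Ioo (-r₁) r₁, ω t := lintegral_const_mul _ hωm
      _ ≤ _ := by
        gcongr
        have h4 := hC₁ N w Dw hw hDw hwi hDwi h
        simp only [ENNReal.rpow_one] at h4
        rwa [setLIntegral_ball_ST hdm] at h4
  calc ∫⁻ z in Metric.ball 0 r, ‖w z - mean φ w z.2‖ₑ ^ s
      ≤ ∫⁻ z in Metric.ball (0 : ST n) r,
          2 ^ (s - 1) * ((∫⁻ e, F z e ∂P) ^ s + (V⁻¹ * ω z.2) ^ s) :=
        setLIntegral_mono' Metric.isOpen_ball.measurableSet hpt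
    _ = 2 ^ (s - 1) * ((∫⁻ z in Metric.ball (0 : ST n) r, (∫⁻ e, F z e ∂P) ^ s)
          + ∫⁻ z in Metric.ball (0 : ST n) r, (V⁻¹ * ω z.2) ^ s) := by
        rw [lintegral_const_mul' _ _ (by simp), lintegral_add_right]
        exact ((hωm.comp measurable_snd).const_mul _).pow_const _
    _ ≤ 2 ^ (s - 1) * (ENNReal.ofReal δ ^ s * (∫⁻ z in Metric.ball 0 r', ‖Dw z‖ₑ ^ s)
          + (V⁻¹) ^ s * B * (S ^ (s - 1) * (C₁ * ∫⁻ z in Metric.ball 0 r', ‖Dw z‖ₑ))) := by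
        gcongr
    _ = (2 ^ (s - 1) * ENNReal.ofReal δ ^ s) * (∫⁻ z in Metric.ball 0 r', ‖Dw z‖ₑ ^ s)
          + 2 ^ (s - 1) * ((V⁻¹) ^ s * B * C₁) * S ^ (s - 1)
            * ∫⁻ z in Metric.ball 0 r', ‖Dw z‖ₑ := by ring
    _ ≤ _ := by
        gcongr
        rw [ENNReal.ofReal_rpow_of_pos hδ0, show (2:ℝ≥0∞) = ENNReal.ofReal 2 by simp,
          ENNReal.ofReal_rpow_of_pos two_pos, ← ENNReal.ofReal_mul (by positivity)]
        exact ENNReal.ofReal_le_ofReal hδη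

theorem enorm_rpow_eq_ofReal {F : Type*} [NormedAddCommGroup F] (x : F) {s : ℝ} (hs : 0 ≤ s) :
    ‖x‖ₑ ^ s = ENNReal.ofReal (‖x‖ ^ s) := by
  rw [← ofReal_norm, ENNReal.ofReal_rpow_of_nonneg (norm_nonneg _) hs]

theorem ofReal_integral_norm_rpow {α F : Type*} [MeasurableSpace α] {m : Measure α}
    [NormedAddCommGroup F] {g : α → F} {s : ℝ} (hs : 0 ≤ s)
    (hg : Integrable (fun a => ‖g a‖ ^ s) m) :
    ENNReal.ofReal (∫ a, ‖g a‖ ^ s ∂m) = ∫⁻ a, ‖g a‖ₑ ^ s ∂m := by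
  rw [ofReal_integral_eq_lintegral_ofReal hg (Eventually.of_forall fun a => by positivity)]
  exact lintegral_congr fun a => (enorm_rpow_eq_ofReal _ hs).symm

theorem integrable_norm_rpow_of_lintegral {α F : Type*} [MeasurableSpace α] {m : Measure α}
    [NormedAddCommGroup F] [MeasurableSpace F] [BorelSpace F] {g : α → F} (hg : Measurable g)
    {s : ℝ} (hs : 0 ≤ s) (h : ∫⁻ a, ‖g a‖ₑ ^ s ∂m ≠ ⊤) :
    Integrable (fun a => ‖g a‖ ^ s) m := by
  refine ⟨(hg.norm.pow_const s).aestronglyMeasurable, ?_⟩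
  rw [hasFiniteIntegral_iff_ofReal (Eventually.of_forall fun a => by positivity)]
  refine lt_of_le_of_lt (le_of_eq (lintegral_congr fun a => (enorm_rpow_eq_ofReal _ hs).symm))
    h.lt_top

variable {p ν L lam : ℝ} {φ : Spc n → ℝ} {r r₁ r' : ℝ}

theorem exists_poincare (hφ : Weight φ r) (hr : 0 < r)
    (hrr : r < r') (hr' : r' ≤ 2) (hp : 1 < p) :
    ∃ C : ℝ, 0 ≤ C ∧ ∀ (N : ℕ) (ν L lam : ℝ) (v : ST n → Vec N) (Dv G : ST n → Mat N n)
      (f : ST n → ℝ), NSol p ν L lam v Dv G f →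
      IntegrableOn (fun z => ‖v z - mean φ v z.2‖ ^ p) (Metric.ball 0 r) volume ∧
      ∫ z in Metric.ball 0 r, ‖v z - mean φ v z.2‖ ^ p
        ≤ C * ∫ z in Metric.ball 0 r', ‖Dv z‖ ^ p := by
  obtain ⟨C, hCt, hC⟩ := exists_lintegral_sub_mean_le hφ hr hrr hr' hp.le
  refine ⟨C.toReal, ENNReal.toReal_nonneg, fun N ν L lam v Dv G f S => ?_⟩
  have hp0 : 0 ≤ p := by linarith
  have h1 := hC N v Dv S.measv S.measDv S.integrable_v S.integrable_Dv S.grad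
  have hm : Measurable fun z : ST n => v z - mean φ v z.2 :=
    S.measv.sub ((measurable_mean hφ.cont S.measv).comp measurable_snd)
  rw [← ofReal_integral_norm_rpow hp0 S.integrable_Dv_rpow.integrableOn] at h1
  have hI : IntegrableOn (fun z => ‖v z - mean φ v z.2‖ ^ p) (Metric.ball 0 r) volume :=
    integrable_norm_rpow_of_lintegral hm hp0
      (h1.trans_lt (ENNReal.mul_lt_top hCt.lt_top ENNReal.ofReal_lt_top)).ne
  refine ⟨hI, ?_⟩
  rw [← ofReal_integral_norm_rpow hp0 hI, ← ENNReal.ofReal_toReal hCt,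
    ← ENNReal.ofReal_mul ENNReal.toReal_nonneg] at h1
  exact (ENNReal.ofReal_le_ofReal_iff (mul_nonneg ENNReal.toReal_nonneg
    (integral_nonneg fun z => by positivity))).1 h1

theorem exists_poincare_small (hφ : Weight φ r₁) (hr : 0 < r) (hrr : r < r₁) (hrr' : r₁ < r')
    (hr' : r' ≤ 2) (hp : 1 < p) {η : ℝ} (hη : 0 < η) :
    ∃ C : ℝ, 0 ≤ C ∧ ∀ (N : ℕ) (ν L lam : ℝ) (v : ST n → Vec N) (Dv G : ST n → Mat N n)
      (f : ST n → ℝ), NSol p ν L lam v Dv G f → ∀ S₁ : ℝ, 0 ≤ S₁ →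
      (∀ᵐ t : ℝ, t ∈ Ioo (-r₁) r₁ →
        ∫ x in Metric.ball (0 : Spc n) r₁, ‖v (x, t) - mean φ v t‖ ≤ S₁) →
      ∫ z in Metric.ball 0 r, ‖v z - mean φ v z.2‖ ^ p
        ≤ η * (∫ z in Metric.ball 0 r', ‖Dv z‖ ^ p)
          + C * S₁ ^ (p - 1) * ∫ z in Metric.ball 0 r', ‖Dv z‖ := by
  obtain ⟨C, hCt, hC⟩ := exists_lintegral_sub_mean_small hφ hr hrr hrr' hr' hp.le hη
  refine ⟨C.toReal, ENNReal.toReal_nonneg, fun N ν L lam v Dv G f S S₁ hS₁ hS => ?_⟩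
  have hp0 : 0 ≤ p := by linarith
  have h1 := hC N v Dv S.measv S.measDv S.integrable_v S.integrable_Dv S.grad
    (ENNReal.ofReal S₁) ?_
  · have hm : Measurable fun z : ST n => v z - mean φ v z.2 :=
      S.measv.sub ((measurable_mean hφ.cont S.measv).comp measurable_snd)
    have hD1 := ofReal_integral_norm_rpow zero_le_one
      (m := volume.restrict (Metric.ball 0 r')) (g := Dv)
      (by simpa [IntegrableOn] using S.integrable_Dv.norm.integrableOn (s := Metric.ball 0 r'))
    simp only [Real.rpow_one, ENNReal.rpow_one] at hD1
    rw [← ofReal_integral_norm_rpow hp0 S.integrable_Dv_rpow.integrableOn, ← hD1,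
      ← ENNReal.ofReal_toReal hCt, ENNReal.ofReal_rpow_of_nonneg hS₁ (by linarith),
      ← ENNReal.ofReal_mul ENNReal.toReal_nonneg, ← ENNReal.ofReal_mul hη.le,
      ← ENNReal.ofReal_mul (by positivity), ← ENNReal.ofReal_add (mul_nonneg hη.le
        (integral_nonneg fun z => by positivity)) (mul_nonneg (by positivity)
        (integral_nonneg fun z => by positivity))] at h1
    have hI : IntegrableOn (fun z => ‖v z - mean φ v z.2‖ ^ p) (Metric.ball 0 r) volume :=
      integrable_norm_rpow_of_lintegral hm hp0 (h1.trans_lt ENNReal.ofReal_lt_top).ne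
    rw [← ofReal_integral_norm_rpow hp0 hI] at h1
    exact (ENNReal.ofReal_le_ofReal_iff (add_nonneg (mul_nonneg hη.le
        (integral_nonneg fun z => by positivity)) (mul_nonneg (by positivity)
        (integral_nonneg fun z => by positivity)))).1 h1
  · filter_upwards [hS, ae_slice_integrable S.integrable_v] with t ht hti htr
    have h2 : IntegrableOn (fun x => ‖v (x, t) - mean φ v t‖) (Metric.ball 0 r₁) volume :=
      (hti.integrableOn.sub (integrableOn_const measure_ball_lt_top.ne)).norm
    have h3 := ofReal_integral_norm_rpow zero_le_one
      (m := volume.restrict (Metric.ball (0 : Spc n) r₁)) (g := fun x => v (x, t) - mean φ v t)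
      (by simpa [IntegrableOn] using h2)
    simp only [Real.rpow_one, ENNReal.rpow_one] at h3
    rw [← h3]
    exact ENNReal.ofReal_le_ofReal (ht htr)

end Poincare


/-- The Sobolev exponent `max 1 (2n/(n+2))` whose conjugate is at least `2`. -/
def sob (n : ℕ) : ℝ := max 1 (2 * n / (n + 2))

theorem one_le_sob (n : ℕ) : 1 ≤ sob n := le_max_left _ _

theorem sob_lt_two (n : ℕ) : sob n < 2 := by
  refine max_lt (by norm_num) ?_
  rw [div_lt_iff₀ (by positivity)]
  linarith

theorem exists_slice_sobolev_one : ∃ C : ℝ≥0∞, C ≠ ⊤ ∧ ∀ (N : ℕ) (g : Spc 1 → Vec N),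
    ContDiff ℝ 1 g → (∀ x, 3 ≤ ‖x‖ → g x = 0) →
    (∫⁻ x, ‖g x‖ₑ ^ (2 : ℝ)) ^ (1 / 2 : ℝ) ≤ C * ∫⁻ x, ‖fderiv ℝ g x‖ₑ := by
  refine ⟨(volume (Metric.ball (0 : Spc 1) 3)) ^ (1 / 2 : ℝ),
    (ENNReal.rpow_lt_top_of_nonneg (by norm_num) measure_ball_lt_top.ne).ne, ?_⟩
  intro N g hg h0
  let e : ℝ ≃ₗᵢ[ℝ] Spc 1 := (OrthonormalBasis.singleton (Fin 1) ℝ).repr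
  have hgc : HasCompactSupport g := by
    refine HasCompactSupport.intro (isCompact_closedBall (0 : Spc 1) 3) fun x hx => h0 x ?_
    rw [mem_closedBall_zero_iff, not_le] at hx
    exact hx.le
  set D := ∫⁻ x, ‖fderiv ℝ g x‖ₑ with hD
  have hsup : ∀ x, ‖g x‖ₑ ≤ D := by
    intro x
    have h1 : ContDiff ℝ 1 (g ∘ e) := hg.comp e.contDiff
    have h2 : HasCompactSupport (g ∘ e) := hgc.comp_homeomorph e.toHomeomorph
    have h3 := HasCompactSupport.enorm_le_lintegral_Ici_deriv h1 h2 (e.symm x)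
    simp only [Function.comp_apply, LinearIsometryEquiv.apply_symm_apply] at h3
    refine h3.trans ((lintegral_mono' Measure.restrict_le_self le_rfl).trans ?_)
    rw [hD, ← e.measurePreserving.lintegral_comp_emb e.toHomeomorph.measurableEmbedding]
    refine lintegral_mono fun s => ?_
    have : deriv (g ∘ e) s = fderiv ℝ g (e s) (e 1) := by
      have hd := (hg.differentiable one_ne_zero (e s)).hasFDerivAt.comp_hasDerivAt s
        (e.toContinuousLinearEquiv.toContinuousLinearMap.hasDerivAt (x := s))
      simpa using hd.deriv
    show ‖deriv (g ∘ e) s‖ₑ ≤ _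
    rw [this]
    refine enorm_le_iff_norm_le.2 (((fderiv ℝ g (e s)).le_opNorm _).trans ?_)
    simp
  have h4 : ∫⁻ x, ‖g x‖ₑ ^ (2 : ℝ) ≤ D ^ (2 : ℝ) * volume (Metric.ball (0 : Spc 1) 3) := by
    rw [← setLIntegral_const, ← lintegral_indicator measurableSet_ball]
    refine lintegral_mono fun x => ?_
    by_cases hx : x ∈ Metric.ball (0 : Spc 1) 3
    · rw [indicator_of_mem hx]
      exact ENNReal.rpow_le_rpow (hsup x) (by norm_num)
    · rw [mem_ball_zero_iff, not_lt] at hx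
      simp [h0 x hx]
  refine (ENNReal.rpow_le_rpow h4 (by norm_num)).trans (le_of_eq ?_)
  rw [ENNReal.mul_rpow_of_nonneg _ _ (by norm_num), ← ENNReal.rpow_mul, mul_comm]
  norm_num

theorem exists_slice_sobolev (hn : 1 ≤ n) : ∃ C : ℝ≥0∞, C ≠ ⊤ ∧ ∀ (N : ℕ) (g : Spc n → Vec N),
    ContDiff ℝ 1 g → (∀ x, 3 ≤ ‖x‖ → g x = 0) →
    (∫⁻ x, ‖g x‖ₑ ^ (2 : ℝ)) ^ (sob n / 2) ≤ C * ∫⁻ x, ‖fderiv ℝ g x‖ₑ ^ sob n := by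
  have hs0 : 0 < sob n := by linarith [one_le_sob n]
  obtain rfl | hn2 : n = 1 ∨ 2 ≤ n := by omega
  · obtain ⟨C, hC, h⟩ := exists_slice_sobolev_one
    have hs : sob 1 = 1 := by unfold sob; norm_num
    refine ⟨C, hC, fun N g hg h0 => ?_⟩
    simpa [hs] using h N g hg h0
  · have hsob : sob n = 2 * n / (n + 2) := by
      refine max_eq_right ?_
      rw [le_div_iff₀ (by positivity)]
      have : (2 : ℝ) ≤ n := by exact_mod_cast hn2
      linarith
    let q : NNReal := ⟨sob n, hs0.le⟩
    refine ⟨(eLpNormLESNormFDerivOfEqInnerConst (volume : Measure (Spc n)) q : ℝ≥0∞) ^ (sob n),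
      (ENNReal.rpow_lt_top_of_nonneg hs0.le ENNReal.coe_ne_top).ne, fun N g hg h0 => ?_⟩
    have hgc : HasCompactSupport g := by
      refine HasCompactSupport.intro (isCompact_closedBall (0 : Spc n) 3) fun x hx => h0 x ?_
      rw [mem_closedBall_zero_iff, not_le] at hx
      exact hx.le
    have h := eLpNorm_le_eLpNorm_fderiv_of_eq_inner (μ := (volume : Measure (Spc n))) hg hgc
      (p := q) (p' := 2) (one_le_sob n) (by simp; omega) (by
        have : (n : ℝ) ≠ 0 := by positivity
        show ((2 : NNReal) : ℝ)⁻¹ = (sob n)⁻¹ - _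
        rw [hsob, finrank_euclideanSpace, Fintype.card_fin]
        field_simp
        push_cast
        ring)
    have hq0 : (q : ℝ≥0∞) ≠ 0 := by
      simpa using (show q ≠ 0 from fun h => hs0.ne' (congrArg NNReal.toReal h))
    rw [eLpNorm_eq_lintegral_rpow_enorm_toReal (by simp) (by simp),
      eLpNorm_eq_lintegral_rpow_enorm_toReal hq0 (by simp)] at h
    have hqr : (q : ℝ≥0∞).toReal = sob n := rfl
    have h2 : ((2 : NNReal) : ℝ≥0∞).toReal = 2 := rfl
    rw [hqr, h2] at h
    have h3 := ENNReal.rpow_le_rpow h hs0.le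
    rw [← ENNReal.rpow_mul, ENNReal.mul_rpow_of_nonneg _ _ hs0.le, ← ENNReal.rpow_mul,
      one_div_mul_cancel hs0.ne', ENNReal.rpow_one, one_div_mul_eq_div] at h3
    exact h3

theorem norm_fderiv_slice_le {Ψ : ST n → Vec N} (hΨ : ContDiff ℝ (⊤ : ℕ∞) Ψ) (x : Spc n) (t : ℝ) :
    ‖fderiv ℝ (fun y => Ψ (y, t)) x‖ ≤ ‖gradM Ψ (x, t)‖ := by
  have hd : HasFDerivAt (fun y => Ψ (y, t)) _ x :=
    ((hΨ.differentiable (by simp)) (x, t)).hasFDerivAt.comp x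
      (hasFDerivAt_prodMk_left x t)
  rw [hd.fderiv]
  refine ContinuousLinearMap.opNorm_le_bound _ (norm_nonneg _) fun e => ?_
  have := fderiv_spatial (Ψ := Ψ) (x, t) e
  simp only [ContinuousLinearMap.comp_apply, ContinuousLinearMap.inl_apply]
  rw [this]
  exact norm_matVec_le _ _

/-- Sobolev's inequality on time slices, integrated in time. -/
theorem exists_slice_sobolev_weak (hn : 1 ≤ n) : ∃ C : ℝ≥0∞, C ≠ ⊤ ∧
    ∀ (N : ℕ) (W : ST n → Vec N) (DW : ST n → Mat N n), Measurable W → Measurable DW →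
      Integrable W volume → Integrable DW volume → (∀ z, 2 ≤ ‖z‖ → W z = 0) →
      WGrad univ W DW →
      ∫⁻ t, (∫⁻ x, ‖W (x, t)‖ₑ ^ (2 : ℝ)) ^ (sob n / 2) ≤ C * ∫⁻ z, ‖DW z‖ₑ ^ sob n := by
  obtain ⟨C, hC, h⟩ := exists_slice_sobolev hn
  have hs0 : 0 < sob n := by linarith [one_le_sob n]
  refine ⟨C, hC, fun N W DW hW hDW hWi hDWi h0 hG => ?_⟩
  have hsm : ∀ k, ContDiff ℝ (⊤ : ℕ∞) (moll k W) := contDiff_moll hWi.locallyIntegrable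
  have hk : ∀ k : ℕ, ∫⁻ t, (∫⁻ x, ‖moll k W (x, t)‖ₑ ^ (2 : ℝ)) ^ (sob n / 2)
      ≤ C * ∫⁻ z, ‖DW z‖ₑ ^ sob n := by
    intro k
    have hg : Measurable fun z => ‖gradM (moll k W) z‖ₑ ^ sob n :=
      (continuous_gradM (hsm k)).measurable.enorm.pow_const _
    calc ∫⁻ t, (∫⁻ x, ‖moll k W (x, t)‖ₑ ^ (2 : ℝ)) ^ (sob n / 2)
        ≤ ∫⁻ t, C * ∫⁻ x, ‖gradM (moll k W) (x, t)‖ₑ ^ sob n := by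
          refine lintegral_mono fun t => (h N (fun x => moll k W (x, t))
            (((hsm k).of_le (by exact_mod_cast le_top)).comp (contDiff_prodMk_left t))
            fun x hx => ?_).trans ?_
          · refine moll_eq_zero h0 k ?_
            have h1 : (1 : ℝ) / (k + 1) ≤ 1 := by
              rw [div_le_one (by positivity)]; linarith [(Nat.cast_nonneg k : (0 : ℝ) ≤ k)]
            have h2 : ‖x‖ ≤ ‖(x, t)‖ := le_max_left _ _
            linarith
          · refine mul_le_mul_right (lintegral_mono fun x => ENNReal.rpow_le_rpow ?_ hs0.le) _
            exact enorm_le_iff_norm_le.2 (norm_fderiv_slice_le (hsm k) x t)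
      _ = C * ∫⁻ z, ‖gradM (moll k W) z‖ₑ ^ sob n := by
          rw [lintegral_const_mul _ (Measurable.lintegral_prod_left' hg), Measure.volume_eq_prod,
            lintegral_prod_symm' _ hg]
      _ ≤ C * ∫⁻ z, ‖DW z‖ₑ ^ sob n := by
          refine mul_le_mul_right ?_ _
          have := lintegral_moll_le hDW (one_le_sob n) k MeasurableSet.univ MeasurableSet.univ
            (fun z _ => subset_univ _)
          rw [Measure.restrict_univ] at this
          refine le_trans (le_of_eq (lintegral_congr fun z => ?_)) this
          rw [gradM_moll hWi.locallyIntegrable hDWi.locallyIntegrable hG (subset_univ _)]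
  have hae := Measure.ae_ae_of_ae_prod (μ := (volume : Measure ℝ)) (ν := (volume : Measure (Spc n)))
    (p := fun w => Tendsto (fun k => moll k W (w.2, w.1)) atTop (𝓝 (W (w.2, w.1))))
    ((Measure.measurePreserving_swap (μ := (volume : Measure ℝ))
      (ν := (volume : Measure (Spc n)))).quasiMeasurePreserving.ae
      (tendsto_moll_ae hWi.locallyIntegrable))
  have hmeas : ∀ k, Measurable fun z => ‖moll k W z‖ₑ ^ (2 : ℝ) := fun k =>
    (hsm k).continuous.measurable.enorm.pow_const _
  calc ∫⁻ t, (∫⁻ x, ‖W (x, t)‖ₑ ^ (2 : ℝ)) ^ (sob n / 2)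
      ≤ ∫⁻ t, liminf (fun k => (∫⁻ x, ‖moll k W (x, t)‖ₑ ^ (2 : ℝ)) ^ (sob n / 2)) atTop := by
        refine lintegral_mono_ae (hae.mono fun t ht => ?_)
        have h1 : ∫⁻ x, ‖W (x, t)‖ₑ ^ (2 : ℝ)
            ≤ liminf (fun k => ∫⁻ x, ‖moll k W (x, t)‖ₑ ^ (2 : ℝ)) atTop := by
          refine le_trans (le_of_eq ?_) (lintegral_liminf_le fun k =>
            (hmeas k).comp measurable_prodMk_right)
          refine lintegral_congr_ae (ht.mono fun x hx => ?_)
          exact (((ENNReal.continuous_rpow_const).tendsto _).comp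
            ((continuous_enorm.tendsto _).comp hx)).liminf_eq.symm
        refine (ENNReal.rpow_le_rpow h1 (by positivity)).trans (le_of_eq ?_)
        exact OrderIso.liminf_apply (ENNReal.orderIsoRpow (sob n / 2) (by positivity))
    _ ≤ liminf (fun k => ∫⁻ t, (∫⁻ x, ‖moll k W (x, t)‖ₑ ^ (2 : ℝ)) ^ (sob n / 2)) atTop :=
        lintegral_liminf_le fun k =>
          (Measurable.lintegral_prod_left' (hmeas k)).pow_const _
    _ ≤ _ := liminf_le_of_frequently_le' (Eventually.frequently (Eventually.of_forall hk))


/-! ### Elementary inequalities -/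

section Pointwise

variable {p : ℝ}

theorem exists_young_left (hp : 1 < p) {σ : ℝ} (hσ : 0 < σ) :
    ∃ C, 0 ≤ C ∧ ∀ a b : ℝ, 0 ≤ a → 0 ≤ b → a ^ (p - 1) * b ≤ σ * a ^ p + C * b ^ p := by
  refine ⟨σ⁻¹ ^ (p - 1), by positivity, fun a b ha hb => ?_⟩
  rcases le_total b (σ * a) with h | h
  · calc a ^ (p - 1) * b ≤ a ^ (p - 1) * (σ * a) := by gcongr
      _ = σ * (a ^ (p - 1) * a) := by ring
      _ = σ * a ^ p := by rw [rpow_sub_one_mul_self (by linarith) ha]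
      _ ≤ _ := le_add_of_nonneg_right (by positivity)
  · have h' : a ≤ σ⁻¹ * b := by rw [inv_mul_eq_div, le_div_iff₀ hσ]; linarith
    calc a ^ (p - 1) * b ≤ (σ⁻¹ * b) ^ (p - 1) * b := by gcongr
      _ = σ⁻¹ ^ (p - 1) * (b ^ (p - 1) * b) := by
          rw [Real.mul_rpow (by positivity) hb]; ring
      _ = σ⁻¹ ^ (p - 1) * b ^ p := by rw [rpow_sub_one_mul_self (by linarith) hb]
      _ ≤ _ := le_add_of_nonneg_left (by positivity)

theorem exists_young_right (hp : 1 < p) {σ : ℝ} (hσ : 0 < σ) :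
    ∃ C, 0 ≤ C ∧ ∀ a b : ℝ, 0 ≤ a → 0 ≤ b → a ^ (p - 1) * b ≤ C * a ^ p + σ * b ^ p := by
  set τ := σ ^ (1 / (p - 1)) with hτ
  have hτ0 : 0 < τ := by positivity
  have hτp : τ ^ (p - 1) = σ := by
    rw [hτ, ← Real.rpow_mul hσ.le, one_div_mul_cancel (by linarith), Real.rpow_one]
  refine ⟨τ⁻¹, by positivity, fun a b ha hb => ?_⟩
  rcases le_total a (τ * b) with h | h
  · calc a ^ (p - 1) * b ≤ (τ * b) ^ (p - 1) * b := by gcongr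
      _ = σ * (b ^ (p - 1) * b) := by rw [Real.mul_rpow hτ0.le hb, hτp]; ring
      _ = σ * b ^ p := by rw [rpow_sub_one_mul_self (by linarith) hb]
      _ ≤ _ := le_add_of_nonneg_left (by positivity)
  · have h' : b ≤ τ⁻¹ * a := by rw [inv_mul_eq_div, le_div_iff₀ hτ0]; linarith
    calc a ^ (p - 1) * b ≤ a ^ (p - 1) * (τ⁻¹ * a) := by gcongr
      _ = τ⁻¹ * (a ^ (p - 1) * a) := by ring
      _ = τ⁻¹ * a ^ p := by rw [rpow_sub_one_mul_self (by linarith) ha]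
      _ ≤ _ := le_add_of_nonneg_right (by positivity)

theorem exists_rpow_le_interp {s : ℝ} (hs : 0 < s) (hsp : s < p) {η : ℝ} (hη : 0 < η) :
    ∃ C, 0 ≤ C ∧ ∀ x : ℝ, 0 ≤ x → x ^ s ≤ η * (1 + x ^ p) + C * x := by
  set a := η ^ (1 / s) with ha
  set b := η ^ (1 / (s - p)) with hb
  have ha0 : 0 < a := by positivity
  have hb0 : 0 < b := by positivity
  have has : a ^ s = η := by rw [ha, ← Real.rpow_mul hη.le, one_div_mul_cancel hs.ne', Real.rpow_one]
  have hbs : b ^ (s - p) = η := by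
    rw [hb, ← Real.rpow_mul hη.le, one_div_mul_cancel (by linarith), Real.rpow_one]
  refine ⟨b ^ s / a, by positivity, fun x hx => ?_⟩
  rcases le_total x a with h | h
  · have : x ^ s ≤ η := by rw [← has]; gcongr
    have h2 : 0 ≤ η * x ^ p := by positivity
    have h3 : 0 ≤ b ^ s / a * x := by positivity
    linarith
  have hx0 : 0 < x := ha0.trans_le h
  rcases le_total b x with h' | h'
  · have h1 : x ^ s ≤ η * x ^ p := by
      have : x ^ s = x ^ (s - p) * x ^ p := by rw [← Real.rpow_add hx0]; ring_nf
      rw [this, ← hbs]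
      exact mul_le_mul_of_nonneg_right
        (Real.rpow_le_rpow_of_nonpos hb0 h' (by linarith)) (by positivity)
    have h3 : 0 ≤ b ^ s / a * x := by positivity
    linarith
  · have h1 : x ^ s ≤ b ^ s / a * x := by
      calc x ^ s ≤ b ^ s := by gcongr
        _ = b ^ s / a * a := by field_simp
        _ ≤ _ := by gcongr
    have h2 : 0 ≤ η * (1 + x ^ p) := by positivity
    linarith

theorem exists_rpow_sub_one_le (hp : 1 < p) {η : ℝ} (hη : 0 < η) :
    ∃ C, 0 ≤ C ∧ ∀ x : ℝ, 0 ≤ x → x ^ (p - 1) ≤ η + C * x ^ p := by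
  obtain ⟨C, hC, h⟩ := exists_young_right hp hη
  refine ⟨C, hC, fun x hx => ?_⟩
  have := h x 1 hx zero_le_one
  rw [Real.one_rpow] at this
  linarith

variable {H : Type*} [NormedAddCommGroup H] [InnerProductSpace ℝ H]

theorem max_rpow_le {a b : ℝ} (ha : 0 ≤ a) (hb : 0 ≤ b) :
    max a b ^ p ≤ a ^ p + b ^ p := by
  have h1 : 0 ≤ a ^ p := by positivity
  have h2 : 0 ≤ b ^ p := by positivity
  rcases le_total a b with h | h
  · rw [max_eq_right h]; linarith
  · rw [max_eq_left h]; linarith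

theorem exists_norm_sub_rpow_le (hp : 1 < p) {η : ℝ} (hη : 0 < η) :
    ∃ C, 0 ≤ C ∧ ∀ {H : Type} [NormedAddCommGroup H] [InnerProductSpace ℝ H] (v c : H),
      ‖v - c‖ ^ p ≤ η * (‖v‖ ^ p + ‖c‖ ^ p) + C * bdry p v c := by
  set τ := η ^ (1 / p) with hτ
  have hτ0 : 0 < τ := by positivity
  have hτp : τ ^ p = η := by
    rw [hτ, ← Real.rpow_mul hη.le, one_div_mul_cancel (by linarith), Real.rpow_one]
  have hcB := cB_pos hp
  refine ⟨((2 : ℝ) ^ (p - 2) + τ ^ (p - 2)) / cB p, by positivity, fun v c => ?_⟩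
  have hmax := max_rpow_le (p := p) (norm_nonneg v) (norm_nonneg c)
  have hb := le_bdry hp v c
  have hb0 := bdry_nonneg hp v c
  have hd2 := norm_sub_le_two_max v c
  set Λ := max ‖v‖ ‖c‖ with hΛ
  set d := ‖v - c‖ with hd
  have hd0 : 0 ≤ d := norm_nonneg _
  have hΛ0 : 0 ≤ Λ := le_max_of_le_left (norm_nonneg _)
  rcases le_total d (τ * Λ) with h | h
  · have : d ^ p ≤ η * Λ ^ p := by
      rw [← hτp, ← Real.mul_rpow hτ0.le hΛ0]; gcongr
    have h3 : 0 ≤ ((2 : ℝ) ^ (p - 2) + τ ^ (p - 2)) / cB p * bdry p v c := by positivity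
    nlinarith
  · rcases hΛ0.eq_or_lt with h0 | hΛpos
    · have : d = 0 := by rw [← h0] at hd2; linarith
      rw [this, Real.zero_rpow (by linarith)]; positivity
    have hdpos : 0 < d := (by positivity : 0 < τ * Λ).trans_le h
    have key : d ^ (p - 2) ≤ ((2 : ℝ) ^ (p - 2) + τ ^ (p - 2)) * Λ ^ (p - 2) := by
      have e1 : (2 * Λ) ^ (p - 2) = 2 ^ (p - 2) * Λ ^ (p - 2) := Real.mul_rpow (by norm_num) hΛ0
      have e2 : (τ * Λ) ^ (p - 2) = τ ^ (p - 2) * Λ ^ (p - 2) := Real.mul_rpow hτ0.le hΛ0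
      have n1 : 0 ≤ (2 * Λ) ^ (p - 2) := by positivity
      have n2 : 0 ≤ (τ * Λ) ^ (p - 2) := by positivity
      rw [add_mul, ← e1, ← e2]
      rcases le_total 2 p with h2 | h2
      · have : d ^ (p - 2) ≤ (2 * Λ) ^ (p - 2) := by gcongr
        linarith
      · have : d ^ (p - 2) ≤ (τ * Λ) ^ (p - 2) :=
          Real.rpow_le_rpow_of_nonpos (by positivity) h (by linarith)
        linarith
    have e3 : d ^ p = d ^ (p - 2) * d ^ 2 := (rpow_sub_two_mul_sq (by linarith) hd0).symm
    have h1 : d ^ p ≤ ((2 : ℝ) ^ (p - 2) + τ ^ (p - 2)) * (Λ ^ (p - 2) * d ^ 2) := by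
      rw [e3, ← mul_assoc]; gcongr
    have h2 : Λ ^ (p - 2) * d ^ 2 ≤ bdry p v c / cB p := by
      rw [le_div_iff₀ hcB]; linarith
    calc d ^ p ≤ ((2 : ℝ) ^ (p - 2) + τ ^ (p - 2)) * (bdry p v c / cB p) :=
          h1.trans (by gcongr)
      _ = ((2 : ℝ) ^ (p - 2) + τ ^ (p - 2)) / cB p * bdry p v c := by ring
      _ ≤ _ := le_add_of_nonneg_left (by positivity)

theorem exists_norm_sub_le_one_add (hp : 1 < p) {κ B : ℝ} (hκ : 0 < κ) (hB : 0 ≤ B) :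
    ∃ C, 0 ≤ C ∧ ∀ {H : Type} [NormedAddCommGroup H] [InnerProductSpace ℝ H] (v a : H) (μ : ℝ),
      1 ≤ μ → κ * μ ≤ ‖a‖ → ‖a‖ ≤ B * μ →
      ‖v - a‖ ≤ 1 + C * (μ ^ (2 - p) * bdry p v a) := by
  have hcB := cB_pos hp
  set k := min (κ ^ (p - 2)) ((B + 1) ^ (p - 2)) with hk
  have hk0 : 0 < k := lt_min (by positivity) (by positivity)
  refine ⟨(k * cB p)⁻¹, by positivity, fun v a μ hμ h1 h2 => ?_⟩
  have hb := le_bdry hp v a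
  have hb0 := bdry_nonneg hp v a
  have hva : ‖v‖ ≤ ‖a‖ + ‖v - a‖ := by
    have := norm_add_le a (v - a); rwa [add_sub_cancel] at this
  have hμ0 : 0 < μ := by linarith
  set Λ := max ‖v‖ ‖a‖ with hΛ
  set d := ‖v - a‖ with hd
  rcases le_total d 1 with hd1 | hd1
  · exact hd1.trans (le_add_of_nonneg_right (by positivity))
  have hΛa : κ * μ ≤ Λ := h1.trans (le_max_right _ _)
  have hΛ0 : 0 < Λ := (by positivity : 0 < κ * μ).trans_le hΛa
  have key : k * d ≤ μ ^ (2 - p) * (Λ ^ (p - 2) * d ^ 2) := by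
    have hμp : μ ^ (2 - p) * μ ^ (p - 2) = 1 := by
      rw [← Real.rpow_add hμ0]; simp
    rcases le_total 2 p with h2 | h2
    · have : (κ * μ) ^ (p - 2) ≤ Λ ^ (p - 2) := by gcongr
      rw [Real.mul_rpow hκ.le hμ0.le] at this
      calc k * d ≤ κ ^ (p - 2) * d ^ 2 := by
            gcongr
            · exact min_le_left _ _
            · nlinarith
        _ = μ ^ (2 - p) * ((κ ^ (p - 2) * μ ^ (p - 2)) * d ^ 2) := by
            rw [show μ ^ (2 - p) * ((κ ^ (p - 2) * μ ^ (p - 2)) * d ^ 2)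
              = (μ ^ (2 - p) * μ ^ (p - 2)) * (κ ^ (p - 2) * d ^ 2) by ring, hμp, one_mul]
        _ ≤ _ := by gcongr
    · have hΛle : Λ ≤ (B + 1) * (μ * d) := by
        refine max_le ?_ ?_ <;> nlinarith [mul_nonneg hB (by nlinarith : (0:ℝ) ≤ μ * d - μ),
          (by nlinarith : d ≤ μ * d)]
      have : ((B + 1) * (μ * d)) ^ (p - 2) ≤ Λ ^ (p - 2) :=
        Real.rpow_le_rpow_of_nonpos hΛ0 hΛle (by linarith)
      have hd0 : 0 ≤ d := by linarith
      rw [Real.mul_rpow (by linarith) (by positivity), Real.mul_rpow hμ0.le hd0] at this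
      have hdp : d ≤ d ^ (p - 2) * d ^ 2 := by
        rw [rpow_sub_two_mul_sq (by linarith) hd0]
        exact Real.self_le_rpow_of_one_le hd1 hp.le
      calc k * d ≤ (B + 1) ^ (p - 2) * (d ^ (p - 2) * d ^ 2) := by
            gcongr
            exact min_le_right _ _
        _ = μ ^ (2 - p) * (((B + 1) ^ (p - 2) * (μ ^ (p - 2) * d ^ (p - 2))) * d ^ 2) := by
            rw [show μ ^ (2 - p) * (((B + 1) ^ (p - 2) * (μ ^ (p - 2) * d ^ (p - 2))) * d ^ 2)
              = (μ ^ (2 - p) * μ ^ (p - 2)) * ((B + 1) ^ (p - 2) * (d ^ (p - 2) * d ^ 2)) by ring,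
              hμp, one_mul]
        _ ≤ _ := by gcongr
  have h3 : μ ^ (2 - p) * (Λ ^ (p - 2) * d ^ 2) ≤ μ ^ (2 - p) * (bdry p v a / cB p) := by
    gcongr
    rw [le_div_iff₀ hcB]; linarith
  have h4 : d ≤ (k * cB p)⁻¹ * (μ ^ (2 - p) * bdry p v a) := by
    have : d ≤ k⁻¹ * (μ ^ (2 - p) * (bdry p v a / cB p)) := by
      rw [inv_mul_eq_div, le_div_iff₀ hk0]; linarith
    refine this.trans (le_of_eq ?_)
    field_simp
  linarith

theorem scaled_bdry_le_sq (hp : 1 < p) (hp2 : p ≤ 2) {κ μ : ℝ} (hκ : 0 < κ) (hμ : 0 < μ) (v a : H)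
    (h : κ * μ ≤ ‖a‖) : μ ^ (2 - p) * bdry p v a ≤ (p + 1) * κ ^ (p - 2) * ‖v - a‖ ^ 2 := by
  have h1 := bdry_le hp v a
  have h2 : max ‖v‖ ‖a‖ ^ (p - 2) ≤ (κ * μ) ^ (p - 2) :=
    Real.rpow_le_rpow_of_nonpos (by positivity) (h.trans (le_max_right _ _)) (by linarith)
  rw [Real.mul_rpow hκ.le hμ.le] at h2
  have hμp : μ ^ (2 - p) * μ ^ (p - 2) = 1 := by
    rw [← Real.rpow_add hμ]; simp
  calc μ ^ (2 - p) * bdry p v a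
      ≤ μ ^ (2 - p) * ((p + 1) * ((κ ^ (p - 2) * μ ^ (p - 2)) * ‖v - a‖ ^ 2)) := by
        refine mul_le_mul_of_nonneg_left (h1.trans ?_) (by positivity)
        gcongr
    _ = (μ ^ (2 - p) * μ ^ (p - 2)) * ((p + 1) * κ ^ (p - 2) * ‖v - a‖ ^ 2) := by ring
    _ = _ := by rw [hμp, one_mul]

theorem exists_scaled_bdry_le (hp2 : 2 ≤ p) {η : ℝ} (hη : 0 < η) :
    ∃ C, 0 ≤ C ∧ ∀ {H : Type} [NormedAddCommGroup H] [InnerProductSpace ℝ H] (v a : H) (μ : ℝ),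
      0 < μ → μ ^ (2 - p) * bdry p v a
        ≤ η * ((μ ^ p)⁻¹ * (‖v‖ ^ p + ‖a‖ ^ p)) + C * ‖v - a‖ ^ p := by
  have hp : 1 < p := by linarith
  set τ := (η / (p + 1)) ^ (1 / 2 : ℝ) with hτ
  have hτ0 : 0 < τ := by positivity
  have hτ2 : τ ^ 2 = η / (p + 1) := by
    rw [hτ, ← Real.rpow_natCast, ← Real.rpow_mul (by positivity)]; norm_num
  refine ⟨(p + 1) * τ⁻¹ ^ (p - 2), by positivity, fun v a μ hμ => ?_⟩
  have h1 := bdry_le hp v a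
  have hmax := max_rpow_le (p := p) (norm_nonneg v) (norm_nonneg a)
  have hΛ0 : 0 ≤ max ‖v‖ ‖a‖ := le_max_of_le_left (norm_nonneg _)
  set Λ := max ‖v‖ ‖a‖ with hΛ
  set d := ‖v - a‖ with hd
  have hd0 : 0 ≤ d := norm_nonneg _
  have e1 : μ ^ (2 - p) * Λ ^ (p - 2) = (Λ / μ) ^ (p - 2) := by
    rw [Real.div_rpow hΛ0 hμ.le, show (2 - p) = -(p - 2) by ring, Real.rpow_neg hμ.le]
    ring
  have e2 : (Λ / μ) ^ p ≤ (μ ^ p)⁻¹ * (‖v‖ ^ p + ‖a‖ ^ p) := by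
    rw [Real.div_rpow hΛ0 hμ.le, div_eq_inv_mul]; gcongr
  have hx0 : 0 ≤ Λ / μ := by positivity
  set x := Λ / μ with hx
  have e3 : x ^ (p - 2) * d ^ 2 ≤ η / (p + 1) * x ^ p + τ⁻¹ ^ (p - 2) * d ^ p := by
    rcases le_total d (τ * x) with h | h
    · calc x ^ (p - 2) * d ^ 2 ≤ x ^ (p - 2) * (τ * x) ^ 2 := by gcongr
        _ = τ ^ 2 * (x ^ (p - 2) * x ^ 2) := by ring
        _ = η / (p + 1) * x ^ p := by rw [hτ2, rpow_sub_two_mul_sq (by linarith) hx0]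
        _ ≤ _ := le_add_of_nonneg_right (by positivity)
    · have h' : x ≤ τ⁻¹ * d := by rw [inv_mul_eq_div, le_div_iff₀ hτ0]; linarith
      calc x ^ (p - 2) * d ^ 2 ≤ (τ⁻¹ * d) ^ (p - 2) * d ^ 2 := by gcongr
        _ = τ⁻¹ ^ (p - 2) * (d ^ (p - 2) * d ^ 2) := by
            rw [Real.mul_rpow (by positivity) hd0]; ring
        _ = τ⁻¹ ^ (p - 2) * d ^ p := by rw [rpow_sub_two_mul_sq (by linarith) hd0]
        _ ≤ _ := le_add_of_nonneg_left (by positivity)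
  calc μ ^ (2 - p) * bdry p v a ≤ μ ^ (2 - p) * ((p + 1) * (Λ ^ (p - 2) * d ^ 2)) := by gcongr
    _ = (p + 1) * (x ^ (p - 2) * d ^ 2) := by rw [← e1]; ring
    _ ≤ (p + 1) * (η / (p + 1) * x ^ p + τ⁻¹ ^ (p - 2) * d ^ p) := by gcongr
    _ = η * x ^ p + (p + 1) * τ⁻¹ ^ (p - 2) * d ^ p := by field_simp
    _ ≤ _ := by gcongr

end Pointwise


/-! ### Caccioppoli inequalities -/

theorem gradS_pow {θ : ST n → ℝ} (hθ : ContDiff ℝ (⊤ : ℕ∞) θ) (m : ℕ) (z : ST n) :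
    gradS (fun z => θ z ^ m) z = (m * θ z ^ (m - 1)) • gradS θ z := by
  have hd := ((hθ.differentiable (by simp)) z).hasFDerivAt.pow m
  ext j
  simp only [gradS, hd.fderiv]
  simp

theorem exists_cutoff_pow (η : ContDiffBump (0 : ST n)) (hη : η.rOut < 2) {m : ℕ} (hm : 2 ≤ m) :
    ∃ M, 0 ≤ M ∧ Cutoff (fun z => η z ^ m) (fun z => η z ^ (m - 1)) M := by
  have hsm : ContDiff ℝ (⊤ : ℕ∞) η := η.contDiff
  have hc : HasCompactSupport (gradS η) :=
    HasCompactSupport.intro η.hasCompactSupport fun z hz => gradS_eq_zero hz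
  obtain ⟨A, hA⟩ := (continuous_gradS (hsm.of_le (by exact_mod_cast le_top))).bounded_above_of_compact_support hc
  obtain ⟨B, hB⟩ := (hsm.continuous_fderiv (by simp)).bounded_above_of_compact_support
    (η.hasCompactSupport.fderiv (𝕜 := ℝ))
  have hA0 : 0 ≤ A := (norm_nonneg _).trans (hA 0)
  have hB0 : 0 ≤ B := (norm_nonneg _).trans (hB 0)
  refine ⟨m * (A + B), by positivity, hsm.pow m, fun z => pow_nonneg η.nonneg _, ?_,
    η.continuous.pow _, ?_, fun z => ?_, fun z => ?_⟩
  · refine (closure_mono fun z hz => ?_ : _ ⊆ tsupport η).trans ?_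
    · simp only [Function.mem_support] at hz ⊢
      exact fun h => hz (by simp [h]; omega)
    · show tsupport η ⊆ _
      rw [η.tsupport_eq]; exact Metric.closedBall_subset_ball hη
  · exact η.hasCompactSupport.comp_left (g := fun x : ℝ => x ^ (m - 1)) (by simp; omega)
  · rw [gradS_pow hsm, norm_smul, Real.norm_of_nonneg (by have := η.nonneg (x := z); positivity)]
    have := hA z
    have h2 : 0 ≤ (m : ℝ) * η z ^ (m - 1) := by have := η.nonneg (x := z); positivity
    nlinarith
  · have hd := ((hsm.differentiable (by simp)) z).hasFDerivAt.pow m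
    have h3 : |fderiv ℝ η z (tdir n)| ≤ B := by
      have := ((fderiv ℝ η z).le_opNorm (tdir n)).trans
        (mul_le_mul_of_nonneg_right (hB z) (norm_nonneg _))
      rwa [norm_tdir, mul_one] at this
    rw [hd.fderiv]
    have h2 : 0 ≤ (m : ℝ) * η z ^ (m - 1) := by have := η.nonneg (x := z); positivity
    simp only [smul_apply, smul_eq_mul, abs_mul, nsmul_eq_mul]
    rw [← abs_mul, abs_of_nonneg h2]
    nlinarith

variable {p ν L lam : ℝ} {v : ST n → Vec N} {Dv G : ST n → Mat N n} {f : ST n → ℝ}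

theorem NSol.memLp_sub_const (S : NSol p ν L lam v Dv G f) (c : Vec N) (r : ℝ) :
    MemLp (fun z => v z - c) (ENNReal.ofReal p) (volume.restrict (Metric.ball 0 r)) := by
  have : IsFiniteMeasure ((volume : Measure (ST n)).restrict (Metric.ball 0 r)) :=
    ⟨by simpa using measure_ball_lt_top⟩
  exact (S.memv.restrict _).sub (memLp_const c)

theorem NSol.integrableOn_sub_rpow (S : NSol p ν L lam v Dv G f) (c : Vec N) (r : ℝ) :
    IntegrableOn (fun z => ‖v z - c‖ ^ p) (Metric.ball 0 r) volume := by
  have := (S.memLp_sub_const c r).integrable_norm_rpow (by simpa using by linarith [S.hp])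
    ENNReal.ofReal_ne_top
  rwa [ENNReal.toReal_ofReal (by linarith [S.hp])] at this

/-- The lower order terms in the Caccioppoli inequality. -/
def caccRHS (p lam : ℝ) (η : ContDiffBump (0 : ST n)) (m : ℕ) (v : ST n → Vec N) (f : ST n → ℝ)
    (c : Vec N) : ℝ :=
  (∫ z in Metric.ball 0 η.rOut, (f z ^ p + ‖v z - c‖ ^ p))
    + lam⁻¹ * ∫ z, η z ^ (m - 1) * bdry p (v z) c

theorem bump_eq_zero {E : Type*} [NormedAddCommGroup E] [NormedSpace ℝ E] [HasContDiffBump E]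
    (η : ContDiffBump (0 : E)) {z : E} (hz : z ∉ Metric.ball 0 η.rOut) : η z = 0 := by
  rw [← η.support_eq] at hz
  exact Function.notMem_support.1 hz

theorem exists_caccioppoli (η : ContDiffBump (0 : ST n)) (hη : η.rOut < 2) {m : ℕ} (hm : 2 ≤ m)
    {p ν L : ℝ} (hp : 1 < p) (hpm : p ≤ m) (hν : 0 < ν) (hL : 0 ≤ L) :
    ∃ C, 0 ≤ C ∧ ∀ (N : ℕ) (lam : ℝ) (v : ST n → Vec N) (Dv G : ST n → Mat N n) (f : ST n → ℝ),
      NSol p ν L lam v Dv G f → ∀ c : Vec N,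
        (∫ z, η z ^ m * ‖Dv z‖ ^ p ≤ C * caccRHS p lam η m v f c) ∧
        ∀ᵐ t : ℝ, lam⁻¹ * (∫ x, η (x, t) ^ m * bdry p (v (x, t)) c)
          ≤ C * caccRHS p lam η m v f c := by
  obtain ⟨M, hM, hcut⟩ := exists_cutoff_pow η hη hm
  set σ := ν / (2 * (1 + M * L)) with hσ
  have hσ0 : 0 < σ := by positivity
  have hσe : σ * (1 + M * L) = ν / 2 := by rw [hσ]; field_simp
  obtain ⟨C₁, hC₁, hY₁⟩ := exists_young_right hp hσ0
  obtain ⟨C₂, hC₂, hY₂⟩ := exists_young_left hp hσ0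
  obtain ⟨C₃, hC₃, hY₃⟩ := exists_young_left hp one_pos
  set B := C₁ + M * (L * C₂ + C₃ + 1) with hB
  have hB0 : 0 ≤ B := by positivity
  refine ⟨(B + M) * (2 / ν + 2), by positivity, fun N lam v Dv G f S c => ?_⟩
  have hlam := S.hlam
  have hm0 : m ≠ 0 := by omega
  have hηc : ∀ k : ℕ, k ≠ 0 → HasCompactSupport fun z => η z ^ k := fun k hk =>
    η.hasCompactSupport.comp_left (g := fun x : ℝ => x ^ k) (by simp [hk])
  have iI : Integrable (fun z => η z ^ m * ‖Dv z‖ ^ p) volume :=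
    integrable_bdd_mul (η.continuous.pow m) (hηc m hm0) S.integrable_Dv_rpow
  have iA : IntegrableOn (fun z => f z ^ p + ‖v z - c‖ ^ p) (Metric.ball 0 η.rOut) volume :=
    S.integrable_f_rpow.integrableOn.add (S.integrableOn_sub_rpow c _)
  have i1 : Integrable (fun z => η z ^ m * (f z ^ (p - 1) * ‖Dv z‖)) volume :=
    integrable_bdd_mul (η.continuous.pow m) (hηc m hm0) S.integrable_f_Dv
  have i2 : Integrable (fun z => η z ^ (m - 1) * (‖G z‖ * ‖v z - c‖)) volume :=
    S.integrable_G_sub (η.continuous.pow (m - 1)) (hηc (m - 1) (by omega)) c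
  have hpt : ∀ᵐ z, η z ^ m * (f z ^ (p - 1) * ‖Dv z‖) + M * (η z ^ (m - 1) * (‖G z‖ * ‖v z - c‖))
      ≤ ν / 2 * (η z ^ m * ‖Dv z‖ ^ p)
        + B * (Metric.ball 0 η.rOut).indicator (fun z => f z ^ p + ‖v z - c‖ ^ p) z := by
    filter_upwards [S.growth] with z hz
    by_cases hzB : z ∈ Metric.ball 0 η.rOut
    swap
    · have h0 : η z = 0 := bump_eq_zero η hzB
      rw [indicator_of_notMem hzB, h0, zero_pow hm0, zero_pow (by omega)]
      simp
    rw [indicator_of_mem hzB]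
    have hh0 : 0 ≤ η z := η.nonneg
    have hh1 : η z ≤ 1 := η.le_one
    have hf0 := S.fnonneg z
    set h := η z
    set x := ‖Dv z‖ with hx
    set y := ‖v z - c‖ with hy
    have hx0 : 0 ≤ x := norm_nonneg _
    have hy0 : 0 ≤ y := norm_nonneg _
    have hm1 : h ^ m ≤ 1 := pow_le_one₀ hh0 hh1
    have hm2 : h ^ (m - 1) ≤ 1 := pow_le_one₀ hh0 hh1
    have q1 : 0 ≤ f z ^ p := by positivity
    have q2 : 0 ≤ y ^ p := by positivity
    have q3 : 0 ≤ x ^ p := by positivity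
    have t1 : h ^ m * (f z ^ (p - 1) * x) ≤ C₁ * f z ^ p + σ * (h ^ m * x ^ p) := by
      calc h ^ m * (f z ^ (p - 1) * x) ≤ h ^ m * (C₁ * f z ^ p + σ * x ^ p) := by
            gcongr; exact hY₁ _ _ hf0 hx0
        _ = h ^ m * (C₁ * f z ^ p) + σ * (h ^ m * x ^ p) := by ring
        _ ≤ 1 * (C₁ * f z ^ p) + σ * (h ^ m * x ^ p) := by gcongr
        _ = _ := by ring
    have t2 : h ^ (m - 1) * (x ^ (p - 1) * y) ≤ σ * (h ^ m * x ^ p) + C₂ * y ^ p := by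
      set k := h ^ ((m : ℝ) / p) with hk
      have hk0 : 0 ≤ k := by positivity
      have hkp : k ^ p = h ^ m := by
        rw [hk, ← Real.rpow_mul hh0, div_mul_cancel₀ _ (by linarith : p ≠ 0), Real.rpow_natCast]
      have hk1 : h ^ (m - 1) ≤ k ^ (p - 1) := by
        rw [hk, ← Real.rpow_mul hh0, ← Real.rpow_natCast]
        have hc : ((m - 1 : ℕ) : ℝ) = m - 1 := by push_cast [Nat.one_le_iff_ne_zero.2 hm0]; ring
        have e : (m : ℝ) / p * (p - 1) = m - m / p := by field_simp
        have e2 : 1 ≤ (m : ℝ) / p := by rw [le_div_iff₀ (by linarith)]; linarith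
        have e3 : (m : ℝ) / p ≤ m := div_le_self (by positivity) hp.le
        refine Real.rpow_le_rpow_of_exponent_ge_of_imp hh0 hh1 ?_ ?_
        · rw [hc, e]; linarith
        · intro _ h'
          have : (1 : ℝ) ≤ ((m - 1 : ℕ) : ℝ) := by exact_mod_cast (by omega : 1 ≤ m - 1)
          linarith
      calc h ^ (m - 1) * (x ^ (p - 1) * y) ≤ k ^ (p - 1) * (x ^ (p - 1) * y) := by gcongr
        _ = (k * x) ^ (p - 1) * y := by rw [Real.mul_rpow hk0 hx0]; ring
        _ ≤ σ * (k * x) ^ p + C₂ * y ^ p := hY₂ _ _ (by positivity) hy0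
        _ = _ := by rw [Real.mul_rpow hk0 hx0, hkp]
    have t3 : h ^ (m - 1) * (f z ^ (p - 1) * y) ≤ f z ^ p + C₃ * y ^ p := by
      calc h ^ (m - 1) * (f z ^ (p - 1) * y) ≤ 1 * (f z ^ (p - 1) * y) := by gcongr
        _ ≤ _ := by rw [one_mul]; simpa using hY₃ _ _ hf0 hy0
    have t4 : h ^ (m - 1) * (‖G z‖ * y)
        ≤ L * (σ * (h ^ m * x ^ p) + C₂ * y ^ p) + (f z ^ p + C₃ * y ^ p) := by
      calc h ^ (m - 1) * (‖G z‖ * y)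
          ≤ h ^ (m - 1) * ((L * x ^ (p - 1) + f z ^ (p - 1)) * y) := by gcongr
        _ = L * (h ^ (m - 1) * (x ^ (p - 1) * y)) + h ^ (m - 1) * (f z ^ (p - 1) * y) := by ring
        _ ≤ _ := by gcongr
    calc h ^ m * (f z ^ (p - 1) * x) + M * (h ^ (m - 1) * (‖G z‖ * y))
        ≤ C₁ * f z ^ p + σ * (h ^ m * x ^ p)
          + M * (L * (σ * (h ^ m * x ^ p) + C₂ * y ^ p) + (f z ^ p + C₃ * y ^ p)) := by gcongr
      _ = σ * (1 + M * L) * (h ^ m * x ^ p)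
          + ((C₁ + M) * f z ^ p + M * (L * C₂ + C₃) * y ^ p) := by ring
      _ ≤ ν / 2 * (h ^ m * x ^ p) + (B * f z ^ p + B * y ^ p) := by
          rw [hσe]
          have b1 : C₁ + M ≤ B := by
            have : 0 ≤ M * (L * C₂ + C₃) := by positivity
            rw [hB]; linarith
          have b2 : M * (L * C₂ + C₃) ≤ B := by rw [hB]; linarith
          gcongr
      _ = _ := by ring
  have hZ0 : 0 ≤ ∫ z, η z ^ (m - 1) * bdry p (v z) c :=
    integral_nonneg fun z => mul_nonneg (pow_nonneg η.nonneg _) (bdry_nonneg hp _ _)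
  have hA0 : 0 ≤ ∫ z in Metric.ball 0 η.rOut, (f z ^ p + ‖v z - c‖ ^ p) :=
    integral_nonneg fun z => by have := S.fnonneg z; positivity
  have hE : enRHS p lam M v Dv G f (fun z => η z ^ m) (fun z => η z ^ (m - 1)) c
      ≤ ν / 2 * (∫ z, η z ^ m * ‖Dv z‖ ^ p) + (B + M) * caccRHS p lam η m v f c := by
    have h1 := integral_mono_ae (i1.add (i2.const_mul M))
      ((iI.const_mul (ν / 2)).add ((iA.integrable_indicator measurableSet_ball).const_mul B)) hpt
    simp only [Pi.add_apply] at h1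
    rw [integral_add i1 (i2.const_mul M), integral_const_mul, integral_add (iI.const_mul _)
      ((iA.integrable_indicator measurableSet_ball).const_mul B), integral_const_mul,
      integral_const_mul, integral_indicator measurableSet_ball] at h1
    unfold enRHS caccRHS
    beta_reduce
    set Z := ∫ z, η z ^ (m - 1) * bdry p (v z) c
    set A := ∫ z in Metric.ball 0 η.rOut, (f z ^ p + ‖v z - c‖ ^ p)
    have n1 : 0 ≤ B * (lam⁻¹ * Z) := by positivity
    have n2 : 0 ≤ M * A := by positivity
    linarith
  have hES : 0 ≤ caccRHS p lam η m v f c := by unfold caccRHS; positivity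
  have hen := S.energy_cutoff hcut c
  set E := caccRHS p lam η m v f c
  have hI : ∫ z, η z ^ m * ‖Dv z‖ ^ p ≤ (B + M) * (2 / ν) * E := by
    have : ν / 2 * (∫ z, η z ^ m * ‖Dv z‖ ^ p) ≤ (B + M) * E := by linarith
    calc ∫ z, η z ^ m * ‖Dv z‖ ^ p = 2 / ν * (ν / 2 * ∫ z, η z ^ m * ‖Dv z‖ ^ p) := by field_simp
      _ ≤ 2 / ν * ((B + M) * E) := by gcongr
      _ = _ := by ring
  have hBM : 0 ≤ (B + M) * E := by positivity
  have hBMν : 0 ≤ (B + M) * (2 / ν) * E := by positivity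
  refine ⟨by linarith, ?_⟩
  filter_upwards [S.energy_slice hcut c] with t ht
  have : ν / 2 * (∫ z, η z ^ m * ‖Dv z‖ ^ p) ≤ (B + M) * E := by
    calc _ ≤ ν / 2 * ((B + M) * (2 / ν) * E) := by gcongr
      _ = _ := by field_simp
  linarith


/-! ### Comparison of the mean with the mean of `J` -/

section SliceMean

variable {X : Type*} [MeasurableSpace X] {m : Measure X} {φ : X → ℝ}

theorem integral_mul_rpow_le (hφ0 : ∀ x, 0 ≤ φ x) (hφi : Integrable φ m) (hφ1 : ∫ x, φ x ∂m = 1)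
    {h : X → ℝ} (hh : AEStronglyMeasurable h m) (hh0 : ∀ x, 0 ≤ h x) {p s g : ℝ} (hs : 0 ≤ s)
    (hsp : s ≤ p) (hg : 0 < g) (hi : Integrable (fun x => φ x * h x ^ p) m)
    (hle : ∫ x, φ x * h x ^ p ∂m ≤ g ^ p) :
    Integrable (fun x => φ x * h x ^ s) m ∧ ∫ x, φ x * h x ^ s ∂m ≤ 2 * g ^ s := by
  have hpt : ∀ x, φ x * h x ^ s ≤ g ^ s * φ x + g ^ (s - p) * (φ x * h x ^ p) := by
    intro x
    have h1 : h x ^ s ≤ g ^ s + g ^ (s - p) * h x ^ p := by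
      rcases le_total (h x) g with hx | hx
      · refine le_add_of_le_of_nonneg (Real.rpow_le_rpow (hh0 x) hx hs) ?_
        have := hh0 x
        positivity
      · have hx0 : 0 < h x := hg.trans_le hx
        refine le_add_of_nonneg_of_le (by positivity) ?_
        have : h x ^ s = h x ^ (s - p) * h x ^ p := by rw [← Real.rpow_add hx0]; ring_nf
        rw [this]
        exact mul_le_mul_of_nonneg_right
          (Real.rpow_le_rpow_of_nonpos hg hx (by linarith)) (by positivity)
    nlinarith [mul_le_mul_of_nonneg_left h1 (hφ0 x)]
  have hdom := (hφi.const_mul (g ^ s)).add (hi.const_mul (g ^ (s - p)))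
  have h_int : Integrable (fun x => φ x * h x ^ s) m := by
    refine hdom.mono' (hφi.aestronglyMeasurable.mul
      (hh.aemeasurable.pow_const s).aestronglyMeasurable) (Eventually.of_forall fun x => ?_)
    have := hφ0 x
    have := hh0 x
    rw [Real.norm_of_nonneg (by positivity)]
    exact hpt x
  refine ⟨h_int, ?_⟩
  have h1 := integral_mono h_int hdom hpt
  simp only [Pi.add_apply] at h1
  rw [integral_add (hφi.const_mul _) (hi.const_mul _), integral_const_mul, integral_const_mul,
    hφ1] at h1
  have h2 : g ^ (s - p) * ∫ x, φ x * h x ^ p ∂m ≤ g ^ (s - p) * g ^ p := by gcongr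
  have h3 : g ^ (s - p) * g ^ p = g ^ s := by rw [← Real.rpow_add hg]; ring_nf
  linarith

variable {H : Type*} [NormedAddCommGroup H] [InnerProductSpace ℝ H]

theorem le_norm_J_sub {p : ℝ} (hp : 1 < p) (v c : H) :
    cJ p * (max ‖v‖ ‖c‖ ^ (p - 2) * ‖v - c‖) ≤ ‖J p v - J p c‖ := by
  rcases (norm_nonneg (v - c)).eq_or_lt with h | h
  · rw [← h]; simp
  · have := (le_inner_J_sub hp v c).trans (real_inner_le_norm _ _)
    refine le_of_mul_le_mul_right (le_trans (le_of_eq ?_) this) h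
    ring

theorem norm_J_sub_integral_le [CompleteSpace H] {p : ℝ} (hφ0 : ∀ x, 0 ≤ φ x)
    (hφi : Integrable φ m) (hφ1 : ∫ x, φ x ∂m = 1) {w : X → H}
    (hJ : Integrable (fun x => φ x • J p (w x)) m) (β : H) :
    ‖J p β - ∫ x, φ x • J p (w x) ∂m‖ ≤ ∫ x, φ x * ‖J p (w x) - J p β‖ ∂m := by
  have e : J p β = ∫ x, φ x • J p β ∂m := by rw [integral_smul_const, hφ1, one_smul]
  rw [e, ← integral_sub (hφi.smul_const _) hJ, ← e]
  refine (norm_integral_le_integral_norm _).trans (le_of_eq (integral_congr_ae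
    (Eventually.of_forall fun x => ?_)))
  simp only []
  rw [← smul_sub, norm_smul, Real.norm_of_nonneg (hφ0 x), norm_sub_rev]

theorem exists_norm_mean_sub_le {p : ℝ} (hp : 1 < p) : ∃ C δ : ℝ, 0 ≤ C ∧ 0 < δ ∧
    ∀ {X : Type} [MeasurableSpace X] {m : Measure X} {φ : X → ℝ} {H : Type}
      [NormedAddCommGroup H] [InnerProductSpace ℝ H] [CompleteSpace H] (w : X → H) (β a : H)
      (ε g : ℝ), (∀ x, 0 ≤ φ x) → Integrable φ m → ∫ x, φ x ∂m = 1 →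
      AEStronglyMeasurable w m → Integrable (fun x => φ x • J p (w x)) m →
      Integrable (fun x => φ x * ‖w x - β‖ ^ p) m → 0 < g →
      ∫ x, φ x * ‖w x - β‖ ^ p ∂m ≤ g ^ p →
      ‖(∫ x, φ x • J p (w x) ∂m) - J p a‖ ≤ ε → ε ≤ δ * ‖a‖ ^ (p - 1) →
      ‖β - a‖ ≤ C * (‖a‖ ^ (2 - p) * ε + g) := by
  have hcJ := cJ_pos hp
  -- the common part of the argument
  have core : ∀ {X : Type} [MeasurableSpace X] {m : Measure X} {φ : X → ℝ} {H : Type}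
      [NormedAddCommGroup H] [InnerProductSpace ℝ H] [CompleteSpace H] (w : X → H) (β a : H)
      (ε D : ℝ), (∀ x, 0 ≤ φ x) → Integrable φ m → ∫ x, φ x ∂m = 1 →
      Integrable (fun x => φ x • J p (w x)) m →
      ‖(∫ x, φ x • J p (w x) ∂m) - J p a‖ ≤ ε →
      ∫ x, φ x * ‖J p (w x) - J p β‖ ∂m ≤ D →
      cJ p * (max ‖β‖ ‖a‖ ^ (p - 2) * ‖β - a‖) ≤ D + ε := by
    intro X _ m φ H _ _ _ w β a ε D hφ0 hφi hφ1 hJ hε hD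
    have h1 := norm_J_sub_integral_le (p := p) hφ0 hφi hφ1 hJ β
    have h2 := norm_sub_le_norm_sub_add_norm_sub (J p β) (∫ x, φ x • J p (w x) ∂m) (J p a)
    linarith [le_norm_J_sub hp β a]
  rcases le_total 2 p with hp2 | hp2
  · set A := (p + 1) * 2 ^ (p - 2) * 4 with hA
    have hA0 : 0 ≤ A := by positivity
    refine ⟨2 + (A + 1) / cJ p, 1, by positivity, one_pos, ?_⟩
    intro X _ m φ H _ _ _ w β a ε g hφ0 hφi hφ1 hw hJ hi hg hle hε hεa
    have hε0 : 0 ≤ ε := (norm_nonneg _).trans hε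
    have hd2 := norm_sub_le_two_max β a
    have hΛ0 : 0 ≤ max ‖β‖ ‖a‖ := le_max_of_le_left (norm_nonneg _)
    have haΛ : ‖a‖ ≤ max ‖β‖ ‖a‖ := le_max_right _ _
    have hβΛ : ‖β‖ ≤ max ‖β‖ ‖a‖ := le_max_left _ _
    set Λ := max ‖β‖ ‖a‖ with hΛ
    have hR0 : 0 ≤ ‖a‖ ^ (2 - p) * ε := by positivity
    rcases le_total Λ g with hgΛ | hgΛ
    · calc ‖β - a‖ ≤ 2 * (‖a‖ ^ (2 - p) * ε + g) := by linarith
        _ ≤ _ := by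
          gcongr
          exact le_add_of_nonneg_right (by positivity)
    have hΛpos : 0 < Λ := hg.trans_le hgΛ
    have hmeas : AEStronglyMeasurable (fun x => ‖w x - β‖) m := (hw.sub aestronglyMeasurable_const).norm
    obtain ⟨i1, j1⟩ := integral_mul_rpow_le hφ0 hφi hφ1 hmeas (fun x => norm_nonneg _)
      zero_le_one (by linarith : (1 : ℝ) ≤ p) hg hi hle
    obtain ⟨i2, j2⟩ := integral_mul_rpow_le hφ0 hφi hφ1 hmeas (fun x => norm_nonneg _)
      (by linarith : 0 ≤ p - 1) (by linarith : p - 1 ≤ p) hg hi hle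
    simp only [Real.rpow_one] at i1 j1
    have hpt : ∀ x, φ x * ‖J p (w x) - J p β‖
        ≤ (p + 1) * 2 ^ (p - 2) * (Λ ^ (p - 2) * (φ x * ‖w x - β‖) + φ x * ‖w x - β‖ ^ (p - 1)) := by
      intro x
      set h := ‖w x - β‖
      have hh0 : 0 ≤ h := norm_nonneg _
      have hwx : ‖w x‖ ≤ ‖β‖ + h := by
        have := norm_add_le β (w x - β); rwa [add_sub_cancel] at this
      have hmx : max ‖w x‖ ‖β‖ ≤ Λ + h := max_le (by linarith) (by linarith)
      have h3 : max ‖w x‖ ‖β‖ ^ (p - 2) ≤ 2 ^ (p - 2) * (Λ ^ (p - 2) + h ^ (p - 2)) := by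
        calc max ‖w x‖ ‖β‖ ^ (p - 2) ≤ (2 * max Λ h) ^ (p - 2) := by
              gcongr
              exact hmx.trans (by linarith [le_max_left Λ h, le_max_right Λ h])
          _ = 2 ^ (p - 2) * max Λ h ^ (p - 2) :=
              Real.mul_rpow (by norm_num) (le_max_of_le_left hΛ0)
          _ ≤ _ := by
              gcongr
              exact max_rpow_le hΛ0 hh0
      have h4 := norm_J_sub_le hp (w x) β
      calc φ x * ‖J p (w x) - J p β‖
          ≤ φ x * ((p + 1) * (2 ^ (p - 2) * (Λ ^ (p - 2) + h ^ (p - 2)) * h)) := by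
            refine mul_le_mul_of_nonneg_left (h4.trans ?_) (hφ0 x)
            gcongr
        _ = (p + 1) * 2 ^ (p - 2) * (Λ ^ (p - 2) * (φ x * h) + φ x * (h ^ (p - 2) * h)) := by ring
        _ = _ := by rw [rpow_sub_two_mul_self hp hh0]
    have hD : ∫ x, φ x * ‖J p (w x) - J p β‖ ∂m ≤ A * (Λ ^ (p - 2) * g) := by
      have h1 := integral_mono_of_nonneg
        (Eventually.of_forall fun x => mul_nonneg (hφ0 x) (norm_nonneg (J p (w x) - J p β)))
        (((i1.const_mul (Λ ^ (p - 2))).add i2).const_mul ((p + 1) * 2 ^ (p - 2)))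
        (Eventually.of_forall hpt)
      refine h1.trans ?_
      simp only [Pi.add_apply]
      rw [integral_const_mul, integral_add (i1.const_mul _) i2, integral_const_mul]
      have h5 : g ^ (p - 1) ≤ Λ ^ (p - 2) * g := by
        rw [← rpow_sub_two_mul_self hp hg.le]; gcongr
      calc (p + 1) * 2 ^ (p - 2) * (Λ ^ (p - 2) * (∫ x, φ x * ‖w x - β‖ ∂m)
            + ∫ x, φ x * ‖w x - β‖ ^ (p - 1) ∂m)
          ≤ (p + 1) * 2 ^ (p - 2) * (Λ ^ (p - 2) * (2 * g) + 2 * (Λ ^ (p - 2) * g)) := by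
            gcongr
            linarith
        _ = _ := by rw [hA]; ring
    have hc := core w β a ε _ hφ0 hφi hφ1 hJ hε hD
    have hΛe : ‖a‖ ^ (2 - p) * ε = 0 ∧ ε = 0 ∨ Λ ^ (2 - p) * ε ≤ ‖a‖ ^ (2 - p) * ε := by
      rcases (norm_nonneg a).eq_or_lt with h0 | h0
      · left
        rw [← h0, Real.zero_rpow (by linarith)] at hεa
        have : ε = 0 := by linarith
        simp [this]
      · right
        gcongr 1
        exact Real.rpow_le_rpow_of_nonpos h0 haΛ (by linarith)
    have hΛe' : Λ ^ (2 - p) * ε ≤ ‖a‖ ^ (2 - p) * ε := by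
      rcases hΛe with ⟨h0, h1⟩ | h0
      · rw [h1]; simp
      · exact h0
    have hΛp : Λ ^ (2 - p) * Λ ^ (p - 2) = 1 := by rw [← Real.rpow_add hΛpos]; simp
    have h6 : cJ p * ‖β - a‖ ≤ A * g + ‖a‖ ^ (2 - p) * ε := by
      calc cJ p * ‖β - a‖ = Λ ^ (2 - p) * (cJ p * (Λ ^ (p - 2) * ‖β - a‖)) := by
            rw [show Λ ^ (2 - p) * (cJ p * (Λ ^ (p - 2) * ‖β - a‖))
              = (Λ ^ (2 - p) * Λ ^ (p - 2)) * (cJ p * ‖β - a‖) by ring, hΛp, one_mul]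
        _ ≤ Λ ^ (2 - p) * (A * (Λ ^ (p - 2) * g) + ε) := by gcongr
        _ = (Λ ^ (2 - p) * Λ ^ (p - 2)) * (A * g) + Λ ^ (2 - p) * ε := by ring
        _ ≤ _ := by rw [hΛp]; linarith
    calc ‖β - a‖ ≤ (A * g + ‖a‖ ^ (2 - p) * ε) / cJ p := by rw [le_div_iff₀ hcJ]; linarith
      _ ≤ ((A + 1) * (‖a‖ ^ (2 - p) * ε + g)) / cJ p := by
          gcongr
          nlinarith [mul_nonneg hA0 hR0]
      _ = (A + 1) / cJ p * (‖a‖ ^ (2 - p) * ε + g) := by ring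
      _ ≤ _ := by
          gcongr
          linarith
  · set k := cJ p / (16 * (p + 1)) with hk
    have hk0 : 0 < k := by positivity
    set θ := min 1 (k ^ (1 / (p - 1))) with hθ
    have hθ0 : 0 < θ := lt_min one_pos (by positivity)
    have hθp : θ ^ (p - 1) ≤ k := by
      calc θ ^ (p - 1) ≤ (k ^ (1 / (p - 1))) ^ (p - 1) := by
            gcongr
            exact min_le_right _ _
        _ = k := by
            rw [← Real.rpow_mul hk0.le, one_div_mul_cancel (by linarith), Real.rpow_one]
    set A := (p + 1) * 2 ^ (2 - p) * 2 with hA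
    have hA0 : 0 ≤ A := by positivity
    refine ⟨2 / θ + (A + 2 ^ (2 - p)) / cJ p, cJ p / 4, by positivity, by positivity, ?_⟩
    intro X _ m φ H _ _ _ w β a ε g hφ0 hφi hφ1 hw hJ hi hg hle hε hεa
    have hε0 : 0 ≤ ε := (norm_nonneg _).trans hε
    have hd2 := norm_sub_le_two_max β a
    have hΛ0 : 0 ≤ max ‖β‖ ‖a‖ := le_max_of_le_left (norm_nonneg _)
    have haΛ : ‖a‖ ≤ max ‖β‖ ‖a‖ := le_max_right _ _
    have hor : max ‖β‖ ‖a‖ = ‖β‖ ∨ max ‖β‖ ‖a‖ = ‖a‖ := max_choice _ _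
    have hcore := fun D => core w β a ε D hφ0 hφi hφ1 hJ hε
    set Λ := max ‖β‖ ‖a‖ with hΛ
    have hR0 : 0 ≤ ‖a‖ ^ (2 - p) * ε := by positivity
    rcases le_total (θ * Λ) g with hgΛ | hgΛ
    · calc ‖β - a‖ ≤ 2 / θ * (θ * Λ) := by rw [div_mul_eq_mul_div, le_div_iff₀ hθ0]; nlinarith
        _ ≤ 2 / θ * (‖a‖ ^ (2 - p) * ε + g) := by gcongr; linarith
        _ ≤ _ := by
          gcongr
          exact le_add_of_nonneg_right (by positivity)
    have hΛpos : 0 < Λ := pos_of_mul_pos_right (hg.trans_le hgΛ) hθ0.le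
    have hΛp : Λ ^ (2 - p) * Λ ^ (p - 2) = 1 := by rw [← Real.rpow_add hΛpos]; simp
    have hmeas : AEStronglyMeasurable (fun x => ‖w x - β‖) m := (hw.sub aestronglyMeasurable_const).norm
    obtain ⟨i1, j1⟩ := integral_mul_rpow_le hφ0 hφi hφ1 hmeas (fun x => norm_nonneg _)
      zero_le_one (by linarith : (1 : ℝ) ≤ p) hg hi hle
    obtain ⟨i2, j2⟩ := integral_mul_rpow_le hφ0 hφi hφ1 hmeas (fun x => norm_nonneg _)
      (by linarith : 0 ≤ p - 1) (by linarith : p - 1 ≤ p) hg hi hle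
    simp only [Real.rpow_one] at i1 j1
    -- a first, crude bound shows that `β` and `a` are comparable
    have hhalf : ‖β - a‖ ≤ Λ / 2 := by
      have hD : ∫ x, φ x * ‖J p (w x) - J p β‖ ∂m ≤ 4 * (p + 1) * g ^ (p - 1) := by
        have h1 := integral_mono_of_nonneg
          (Eventually.of_forall fun x => mul_nonneg (hφ0 x) (norm_nonneg (J p (w x) - J p β)))
          (i2.const_mul (2 * (p + 1)))
          (Eventually.of_forall fun x => by
            have := mul_le_mul_of_nonneg_left (norm_J_sub_le_of_le_two hp hp2 (w x) β) (hφ0 x)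
            calc _ ≤ _ := this
              _ = _ := by ring)
        refine h1.trans ?_
        rw [integral_const_mul]
        calc 2 * (p + 1) * ∫ x, φ x * ‖w x - β‖ ^ (p - 1) ∂m
            ≤ 2 * (p + 1) * (2 * g ^ (p - 1)) := by gcongr
          _ = _ := by ring
      have hc := hcore _ hD
      have h5 : 4 * (p + 1) * g ^ (p - 1) ≤ cJ p / 4 * Λ ^ (p - 1) := by
        calc 4 * (p + 1) * g ^ (p - 1) ≤ 4 * (p + 1) * (θ * Λ) ^ (p - 1) := by gcongr
          _ = 4 * (p + 1) * (θ ^ (p - 1) * Λ ^ (p - 1)) := by rw [Real.mul_rpow hθ0.le hΛ0]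
          _ ≤ 4 * (p + 1) * (k * Λ ^ (p - 1)) := by gcongr
          _ = _ := by rw [hk]; field_simp; ring
      have h6 : ε ≤ cJ p / 4 * Λ ^ (p - 1) := hεa.trans (by gcongr)
      have h7 : Λ ^ (p - 1) = Λ ^ (p - 2) * Λ := (rpow_sub_two_mul_self hp hΛ0).symm
      have h8 : (cJ p * Λ ^ (p - 2)) * ‖β - a‖ ≤ (cJ p * Λ ^ (p - 2)) * (Λ / 2) := by
        rw [h7] at h5 h6; linarith
      exact le_of_mul_le_mul_left h8 (by positivity)
    have hβ : Λ / 2 ≤ ‖β‖ := by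
      rcases hor with h | h
      · rw [← h]; linarith
      · have := norm_sub_norm_le a β
        rw [norm_sub_rev] at this; linarith
    have ha : Λ / 2 ≤ ‖a‖ := by
      rcases hor with h | h
      · have := norm_sub_norm_le β a; linarith
      · rw [← h]; linarith
    have hhp : (Λ / 2) ^ (p - 2) = 2 ^ (2 - p) * Λ ^ (p - 2) := by
      rw [Real.div_rpow hΛ0 (by norm_num), show (2 - p) = -(p - 2) by ring,
        Real.rpow_neg (by norm_num)]
      ring
    have hD : ∫ x, φ x * ‖J p (w x) - J p β‖ ∂m ≤ A * (Λ ^ (p - 2) * g) := by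
      have h1 := integral_mono_of_nonneg
        (Eventually.of_forall fun x => mul_nonneg (hφ0 x) (norm_nonneg (J p (w x) - J p β)))
        (i1.const_mul ((p + 1) * (2 ^ (2 - p) * Λ ^ (p - 2))))
        (Eventually.of_forall fun x => by
          have h4 := norm_J_sub_le hp (w x) β
          have h5 : max ‖w x‖ ‖β‖ ^ (p - 2) ≤ 2 ^ (2 - p) * Λ ^ (p - 2) := by
            rw [← hhp]
            exact Real.rpow_le_rpow_of_nonpos (by positivity)
              (hβ.trans (le_max_right _ _)) (by linarith)
          calc φ x * ‖J p (w x) - J p β‖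
              ≤ φ x * ((p + 1) * ((2 ^ (2 - p) * Λ ^ (p - 2)) * ‖w x - β‖)) := by
                refine mul_le_mul_of_nonneg_left (h4.trans ?_) (hφ0 x)
                gcongr
            _ = _ := by ring)
      refine h1.trans ?_
      rw [integral_const_mul]
      calc (p + 1) * (2 ^ (2 - p) * Λ ^ (p - 2)) * ∫ x, φ x * ‖w x - β‖ ∂m
          ≤ (p + 1) * (2 ^ (2 - p) * Λ ^ (p - 2)) * (2 * g) := by gcongr
        _ = _ := by rw [hA]; ring
    have hc := hcore _ hD
    have hΛe : Λ ^ (2 - p) * ε ≤ 2 ^ (2 - p) * (‖a‖ ^ (2 - p) * ε) := by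
      rw [← mul_assoc, ← Real.mul_rpow (by norm_num) (norm_nonneg a)]
      gcongr
      linarith
    have h6 : cJ p * ‖β - a‖ ≤ A * g + 2 ^ (2 - p) * (‖a‖ ^ (2 - p) * ε) := by
      calc cJ p * ‖β - a‖ = Λ ^ (2 - p) * (cJ p * (Λ ^ (p - 2) * ‖β - a‖)) := by
            rw [show Λ ^ (2 - p) * (cJ p * (Λ ^ (p - 2) * ‖β - a‖))
              = (Λ ^ (2 - p) * Λ ^ (p - 2)) * (cJ p * ‖β - a‖) by ring, hΛp, one_mul]
        _ ≤ Λ ^ (2 - p) * (A * (Λ ^ (p - 2) * g) + ε) := by gcongr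
        _ = (Λ ^ (2 - p) * Λ ^ (p - 2)) * (A * g) + Λ ^ (2 - p) * ε := by ring
        _ ≤ _ := by rw [hΛp]; linarith
    have h2p : (0 : ℝ) ≤ 2 ^ (2 - p) := by positivity
    calc ‖β - a‖ ≤ (A * g + 2 ^ (2 - p) * (‖a‖ ^ (2 - p) * ε)) / cJ p := by
          rw [le_div_iff₀ hcJ]; linarith
      _ ≤ ((A + 2 ^ (2 - p)) * (‖a‖ ^ (2 - p) * ε + g)) / cJ p := by
          gcongr
          nlinarith [mul_nonneg hA0 hR0, mul_nonneg h2p hg.le]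
      _ = (A + 2 ^ (2 - p)) / cJ p * (‖a‖ ^ (2 - p) * ε + g) := by ring
      _ ≤ _ := by
          gcongr
          exact le_add_of_nonneg_left (by positivity)

end SliceMean


/-! ### Slices of space-time integrals -/

theorem restrict_ball_ST (r : ℝ) : (volume : Measure (ST n)).restrict (Metric.ball 0 r)
    = (volume.restrict (Metric.ball (0 : Spc n) r)).prod (volume.restrict (Ioo (-r) r)) := by
  have h1 : Metric.ball (0 : ST n) r = Metric.ball (0 : Spc n) r ×ˢ Ioo (-r) r := by
    ext z; rw [mem_ball_ST]; rfl
  rw [h1, Measure.volume_eq_prod, ← Measure.prod_restrict]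

theorem ae_slice_integrableOn {F : Type*} [NormedAddCommGroup F] {w : ST n → F} {r : ℝ}
    (hw : IntegrableOn w (Metric.ball 0 r) volume) :
    ∀ᵐ t : ℝ, t ∈ Ioo (-r) r →
      IntegrableOn (fun x => w (x, t)) (Metric.ball (0 : Spc n) r) volume := by
  rw [IntegrableOn, restrict_ball_ST] at hw
  exact (ae_restrict_iff' measurableSet_Ioo).1 hw.prod_left_ae

theorem setIntegral_ball_mono_slice {g h : ST n → ℝ} {r : ℝ}
    (hg : IntegrableOn g (Metric.ball 0 r) volume) (hh : IntegrableOn h (Metric.ball 0 r) volume)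
    (hle : ∀ᵐ t : ℝ, t ∈ Ioo (-r) r →
      ∫ x in Metric.ball (0 : Spc n) r, g (x, t) ≤ ∫ x in Metric.ball (0 : Spc n) r, h (x, t)) :
    ∫ z in Metric.ball 0 r, g z ≤ ∫ z in Metric.ball 0 r, h z := by
  rw [IntegrableOn, restrict_ball_ST] at hg hh
  rw [restrict_ball_ST, integral_prod_symm _ hg, integral_prod_symm _ hh]
  exact integral_mono_ae hg.integral_prod_right hh.integral_prod_right
    ((ae_restrict_iff' measurableSet_Ioo).2 hle)

theorem Weight.setIntegral_eq {F : Type*} [NormedAddCommGroup F] [NormedSpace ℝ F]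
    {φ : Spc n → ℝ} {r : ℝ} (hφ : Weight φ r) (h : Spc n → F) :
    ∫ x in Metric.ball 0 r, φ x • h x = ∫ x, φ x • h x :=
  setIntegral_eq_integral_of_forall_compl_eq_zero fun x hx => by rw [hφ.zero x hx, zero_smul]

theorem Weight.integral_smul_sub {φ : Spc n → ℝ} {r : ℝ} (hφ : Weight φ r) {w : Spc n → Vec N}
    (hw : Integrable (fun x => φ x • w x) volume) (a : Vec N) :
    ∫ x, φ x • (w x - a) = (∫ x, φ x • w x) - a := by
  simp only [smul_sub]
  rw [integral_sub hw (hφ.integrable.smul_const a), integral_smul_const, hφ.one, one_smul]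

theorem Weight.norm_mean_sub_le {φ : Spc n → ℝ} {r : ℝ} (hφ : Weight φ r) {C : ℝ}
    (hC : ∀ x, φ x ≤ C) {w : ST n → Vec N} {t : ℝ}
    (ht : Integrable (fun x => w (x, t)) volume) (a : Vec N) :
    ‖mean φ w t - a‖ ≤ C * ∫ x in Metric.ball 0 r, ‖w (x, t) - a‖ := by
  have hi := hφ.integrable_smul (g := id) hφ.cont.aestronglyMeasurable ht
  have hfin : IsFiniteMeasure (volume.restrict (Metric.ball (0 : Spc n) r)) :=
    ⟨by rw [Measure.restrict_apply_univ]; exact measure_ball_lt_top⟩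
  rw [mean, ← hφ.integral_smul_sub hi a, ← hφ.setIntegral_eq, ← integral_const_mul]
  refine norm_integral_le_of_norm_le
    (((ht.integrableOn.sub (integrable_const a)).norm).const_mul C)
    (Eventually.of_forall fun x => ?_)
  rw [norm_smul, Real.norm_of_nonneg (hφ.nonneg _)]
  exact mul_le_mul_of_nonneg_right (hC x) (norm_nonneg _)

theorem Weight.setIntegral_norm_sub_mean_le {φ : Spc n → ℝ} {r r' : ℝ} (hφ : Weight φ r)
    (hr : r ≤ r') {C : ℝ} (hC : ∀ x, φ x ≤ C) {w : ST n → Vec N} {t : ℝ}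
    (ht : Integrable (fun x => w (x, t)) volume) (a : Vec N) :
    ∫ x in Metric.ball (0 : Spc n) r', ‖w (x, t) - mean φ w t‖
      ≤ (1 + C * volume.real (Metric.ball (0 : Spc n) r')) *
        ∫ x in Metric.ball (0 : Spc n) r', ‖w (x, t) - a‖ := by
  have hfin : IsFiniteMeasure (volume.restrict (Metric.ball (0 : Spc n) r')) :=
    ⟨by rw [Measure.restrict_apply_univ]; exact measure_ball_lt_top⟩
  have h1 := (hφ.mono hr).norm_mean_sub_le hC ht a
  have hwa : IntegrableOn (fun x => w (x, t) - a) (Metric.ball (0 : Spc n) r') volume :=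
    (ht.integrableOn (s := Metric.ball (0 : Spc n) r')).sub (integrable_const a)
  have hwm := (ht.integrableOn (s := Metric.ball (0 : Spc n) r')).sub
    (integrable_const (mean φ w t))
  have h2 : ∫ x in Metric.ball (0 : Spc n) r', ‖w (x, t) - mean φ w t‖
      ≤ ∫ x in Metric.ball (0 : Spc n) r', (‖w (x, t) - a‖ + ‖mean φ w t - a‖) :=
    integral_mono hwm.norm (hwa.norm.add (integrable_const _)) fun x => by
      have := norm_sub_le (w (x, t) - a) (mean φ w t - a)
      simpa using this
  rw [integral_add hwa.norm (integrable_const _), integral_const, smul_eq_mul,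
    Measure.real, Measure.restrict_apply_univ, ← Measure.real] at h2
  have h3 := mul_le_mul_of_nonneg_left h1
    (measureReal_nonneg (μ := volume) (s := Metric.ball (0 : Spc n) r'))
  nlinarith

/-! ### Comparison with the constant produced by the gluing lemma -/

theorem Weight.integral_bdry_le {p : ℝ} (hp : 1 < p) {φ : Spc n → ℝ} {r : ℝ} (hφ : Weight φ r)
    {w : Spc n → Vec N} (hw : Integrable w volume) (hJ : Integrable (fun x => J p (w x)) volume)
    (hwp : Integrable (fun x => ‖w x‖ ^ p) volume) (a : Vec N) {ε : ℝ}
    (hy : ‖(∫ x, φ x • J p (w x)) - J p a‖ ≤ ε) (β : Vec N) :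
    Integrable (fun x => φ x * inner ℝ (J p (w x) - J p a) (w x - β)) volume ∧
    ∫ x, φ x * bdry p (w x) a
      ≤ (∫ x, φ x * inner ℝ (J p (w x) - J p a) (w x - β)) + ε * ‖β - a‖ := by
  have iφ := hφ.integrable
  have mφ : AEStronglyMeasurable (fun x => φ (id x)) volume := hφ.cont.aestronglyMeasurable
  have i1 : Integrable (fun x => φ x • w x) volume := hφ.integrable_smul (g := id) mφ hw
  have i2 : Integrable (fun x => φ x • J p (w x)) volume := hφ.integrable_smul (g := id) mφ hJ
  have i3 : Integrable (fun x => φ x * ‖w x‖ ^ p) volume := hφ.integrable_smul (g := id) mφ hwp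
  have i4 : ∀ b : Vec N,
      Integrable (fun x => φ x * inner ℝ (J p (w x) - J p a) (w x - b)) volume := by
    intro b
    refine (((i3.sub (i2.inner_const b)).sub (i1.inner_const (J p a))).add
      (iφ.mul_const (inner ℝ (J p a) b))).congr (Eventually.of_forall fun x => ?_)
    simp only [Pi.sub_apply, Pi.add_apply, inner_sub_left, inner_sub_right, inner_J_self hp,
      real_inner_smul_left, real_inner_comm (J p a) (w x)]
    ring
  have i5 : Integrable (fun x => φ x * bdry p (w x) a) volume := by
    refine (((i3.const_mul (1 - 1 / p)).sub (i2.inner_const a)).add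
      (iφ.mul_const (‖a‖ ^ p / p))).congr (Eventually.of_forall fun x => ?_)
    simp only [Pi.sub_apply, Pi.add_apply, bdry, real_inner_smul_left]
    ring
  refine ⟨i4 β, ?_⟩
  have h1 : ∫ x, φ x * bdry p (w x) a ≤ ∫ x, φ x * inner ℝ (J p (w x) - J p a) (w x - a) :=
    integral_mono i5 (i4 a) fun x => mul_le_mul_of_nonneg_left (bdry_le_inner hp _ _) (hφ.nonneg x)
  have h2 : ∫ x, φ x * inner ℝ (J p (w x) - J p a) (w x - a)
      = (∫ x, φ x * inner ℝ (J p (w x) - J p a) (w x - β))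
        + inner ℝ ((∫ x, φ x • J p (w x)) - J p a) (β - a) := by
    have i6 : Integrable (fun x => φ x • (J p (w x) - J p a)) volume := by
      simp only [smul_sub]
      exact i2.sub (iφ.smul_const (J p a))
    rw [← hφ.integral_smul_sub i2, real_inner_comm, ← integral_inner i6,
      ← integral_add (i4 β) (i6.const_inner _)]
    refine integral_congr_ae (Eventually.of_forall fun x => ?_)
    simp only []
    rw [real_inner_comm (φ x • (J p (w x) - J p a)), real_inner_smul_left, ← mul_add,
      ← inner_add_right, sub_add_sub_cancel]
  have h3 := (real_inner_le_norm ((∫ x, φ x • J p (w x)) - J p a) (β - a)).trans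
    (mul_le_mul_of_nonneg_right hy (norm_nonneg _))
  linarith

theorem NSol.ae_slice {p ν L lam : ℝ} {v : ST n → Vec N} {Dv G : ST n → Mat N n} {f : ST n → ℝ}
    (S : NSol p ν L lam v Dv G f) : ∀ᵐ t : ℝ, Integrable (fun x => v (x, t)) volume ∧
      Integrable (fun x => J p (v (x, t))) volume ∧
      Integrable (fun x => ‖v (x, t)‖ ^ p) volume := by
  filter_upwards [ae_slice_integrable S.integrable_v, ae_slice_integrable S.integrable_J,
    ae_slice_integrable S.integrable_norm_rpow] with t h1 h2 h3 using ⟨h1, h2, h3⟩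

theorem NSol.integrableOn_bdry {p ν L lam : ℝ} {v : ST n → Vec N} {Dv G : ST n → Mat N n}
    {f : ST n → ℝ} (S : NSol p ν L lam v Dv G f) (c : Vec N) (r : ℝ) :
    IntegrableOn (fun z => bdry p (v z) c) (Metric.ball 0 r) volume :=
  (S.locallyIntegrable_bdry c).integrableOn_isCompact (isCompact_closedBall 0 r) |>.mono_set
    Metric.ball_subset_closedBall

/-- If the weighted means of `J v` are close to `J a`, then `v` is close to `a` in the sense of
`bdry`, up to the oscillation of `v` on slices. -/
theorem exists_weighted_bdry_le {p : ℝ} (hp : 1 < p) {φ : Spc n → ℝ} {r : ℝ} (hφ : Weight φ r)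
    (hr : 0 < r) {σ : ℝ} (hσ : 0 < σ) :
    ∃ C : ℝ, 0 ≤ C ∧ ∀ (N : ℕ) (ν L lam : ℝ) (v : ST n → Vec N) (Dv G : ST n → Mat N n)
      (f : ST n → ℝ), NSol p ν L lam v Dv G f →
      IntegrableOn (fun z => ‖v z - mean φ v z.2‖ ^ p) (Metric.ball 0 r) volume →
      ∀ (a : Vec N) (ε : ℝ), 0 ≤ ε →
      (∀ᵐ t : ℝ, t ∈ Ioo (-r) r → ‖(∫ x, φ x • J p (v (x, t))) - J p a‖ ≤ ε) →
      ∫ z in Metric.ball 0 r, φ z.1 * bdry p (v z) a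
        ≤ σ * ((∫ z in Metric.ball 0 r, ‖v z‖ ^ p) + ‖a‖ ^ p)
          + C * (∫ z in Metric.ball 0 r, ‖v z - mean φ v z.2‖ ^ p)
          + C * (ε * ((∫ z in Metric.ball 0 r, ‖v z‖) + ‖a‖)) := by
  obtain ⟨B, hB0, hB⟩ := hφ.exists_le
  set V := volume.real (Metric.ball (0 : ST n) r) with hV
  set V' := volume.real (Metric.ball (0 : Spc n) r) with hV'
  have hV'0 : 0 < V' := ENNReal.toReal_pos (volume_ball_ne_zero' hr) measure_ball_lt_top.ne
  have hV0 : 0 ≤ V := measureReal_nonneg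
  set σ' := σ / ((B + 1) * (V + 1)) with hσ'
  have hσ'0 : 0 < σ' := by positivity
  obtain ⟨C, hC0, hC⟩ := exists_young_left hp hσ'0
  have hsv : B * σ' * V ≤ σ := by
    rw [hσ', mul_div_assoc', div_mul_eq_mul_div, div_le_iff₀ (by positivity)]
    nlinarith [mul_nonneg hB0 hV0, mul_nonneg hσ.le (mul_nonneg hB0 hV0)]
  have hs1 : B * σ' ≤ σ := by
    rw [hσ', mul_div_assoc', div_le_iff₀ (by positivity)]
    nlinarith [mul_nonneg hB0 hV0, mul_nonneg hσ.le (mul_nonneg hB0 hV0)]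
  refine ⟨2 * B * C + B + V / V', by positivity, fun N ν L lam v Dv G f S hX a ε hε hy => ?_⟩
  have hfin : IsFiniteMeasure (volume.restrict (Metric.ball (0 : Spc n) r)) :=
    ⟨by rw [Measure.restrict_apply_univ]; exact measure_ball_lt_top⟩
  have hfin' : IsFiniteMeasure (volume.restrict (Metric.ball (0 : ST n) r)) :=
    ⟨by rw [Measure.restrict_apply_univ]; exact measure_ball_lt_top⟩
  set h : ST n → ℝ := fun z => B * (σ' * ‖v z‖ ^ p + (σ' * ‖a‖ ^ p
    + 2 * C * ‖v z - mean φ v z.2‖ ^ p)) + ε * (B * ‖v z‖ + ‖a‖ / V') with hh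
  have ivp := S.integrable_norm_rpow.integrableOn (s := Metric.ball 0 r)
  have iv := S.integrable_v.norm.integrableOn (s := Metric.ball 0 r)
  have j1 : IntegrableOn (fun z => σ' * ‖v z‖ ^ p) (Metric.ball 0 r) volume := ivp.const_mul σ'
  have j2 : IntegrableOn (fun z => 2 * C * ‖v z - mean φ v z.2‖ ^ p) (Metric.ball 0 r) volume :=
    hX.const_mul _
  have j3 : IntegrableOn (fun z => σ' * ‖a‖ ^ p + 2 * C * ‖v z - mean φ v z.2‖ ^ p)
    (Metric.ball 0 r) volume := (integrable_const _).add j2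
  have j4 : IntegrableOn (fun z => B * (σ' * ‖v z‖ ^ p + (σ' * ‖a‖ ^ p
    + 2 * C * ‖v z - mean φ v z.2‖ ^ p))) (Metric.ball 0 r) volume := (j1.add j3).const_mul B
  have j5 : IntegrableOn (fun z => B * ‖v z‖ + ‖a‖ / V') (Metric.ball 0 r) volume :=
    (iv.const_mul B).add (integrable_const _)
  have ih : IntegrableOn h (Metric.ball 0 r) volume := j4.add (j5.const_mul ε)
  have ig : IntegrableOn (fun z => φ z.1 * bdry p (v z) a) (Metric.ball 0 r) volume :=
    hφ.integrable_smul (g := Prod.fst) (hφ.cont.comp continuous_fst).aestronglyMeasurable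
      (S.integrableOn_bdry a r)
  have hmain : ∫ z in Metric.ball 0 r, φ z.1 * bdry p (v z) a ≤ ∫ z in Metric.ball 0 r, h z := by
    refine setIntegral_ball_mono_slice ig ih ?_
    filter_upwards [S.ae_slice, hy, ae_slice_integrableOn ih, ae_slice_integrableOn j4,
      ae_slice_integrableOn j5] with t ⟨s1, s2, s3⟩ s4 s5 s6 s7 ht
    obtain ⟨k1, k2⟩ := hφ.integral_bdry_le hp s1 s2 s3 a (s4 ht) (mean φ v t)
    have k3 : ∫ x, φ x * inner ℝ (J p (v (x, t)) - J p a) (v (x, t) - mean φ v t)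
        ≤ ∫ x in Metric.ball (0 : Spc n) r, B * (σ' * ‖v (x, t)‖ ^ p + (σ' * ‖a‖ ^ p
          + 2 * C * ‖v (x, t) - mean φ v t‖ ^ p)) := by
      rw [← setIntegral_eq_integral_of_forall_compl_eq_zero (s := Metric.ball (0 : Spc n) r)
        fun x hx => by rw [hφ.zero x hx, zero_mul]]
      refine integral_mono k1.integrableOn (s6 ht) fun x => ?_
      have q1 := real_inner_le_norm (J p (v (x, t)) - J p a) (v (x, t) - mean φ v t)
      have q2 := norm_sub_le (J p (v (x, t))) (J p a)
      rw [norm_J hp, norm_J hp] at q2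
      have q3 := mul_le_mul_of_nonneg_right q2 (norm_nonneg (v (x, t) - mean φ v t))
      have q4 := hC ‖v (x, t)‖ ‖v (x, t) - mean φ v t‖ (norm_nonneg _) (norm_nonneg _)
      have q5 := hC ‖a‖ ‖v (x, t) - mean φ v t‖ (norm_nonneg _) (norm_nonneg _)
      have q6 : inner ℝ (J p (v (x, t)) - J p a) (v (x, t) - mean φ v t)
          ≤ σ' * ‖v (x, t)‖ ^ p + (σ' * ‖a‖ ^ p + 2 * C * ‖v (x, t) - mean φ v t‖ ^ p) := by
        linarith
      exact (mul_le_mul_of_nonneg_left q6 (hφ.nonneg x)).trans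
        (mul_le_mul_of_nonneg_right (hB x) (by positivity))
    have k4 : ‖mean φ v t - a‖ ≤ ∫ x in Metric.ball (0 : Spc n) r, (B * ‖v (x, t)‖ + ‖a‖ / V') := by
      have := hφ.norm_mean_sub_le hB s1 0
      simp only [sub_zero] at this
      rw [integral_add (s1.norm.integrableOn.const_mul B) (integrable_const _), integral_const,
        smul_eq_mul, Measure.real, Measure.restrict_apply_univ, ← Measure.real, ← hV',
        integral_const_mul, mul_div_cancel₀ _ hV'0.ne']
      linarith [norm_sub_le (mean φ v t) a]
    have k5 : ∫ x in Metric.ball (0 : Spc n) r, h (x, t)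
        = (∫ x in Metric.ball (0 : Spc n) r, B * (σ' * ‖v (x, t)‖ ^ p + (σ' * ‖a‖ ^ p
          + 2 * C * ‖v (x, t) - mean φ v t‖ ^ p)))
        + ε * ∫ x in Metric.ball (0 : Spc n) r, (B * ‖v (x, t)‖ + ‖a‖ / V') := by
      rw [← integral_const_mul]
      exact integral_add (s6 ht) ((s7 ht).const_mul ε)
    have k6 : ∫ x in Metric.ball (0 : Spc n) r, φ x * bdry p (v (x, t)) a
        = ∫ x, φ x * bdry p (v (x, t)) a := hφ.setIntegral_eq _
    rw [k5, k6]
    linarith [mul_le_mul_of_nonneg_left k4 hε]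
  refine hmain.trans ?_
  have e1 : ∫ z in Metric.ball 0 r, h z
      = B * (σ' * (∫ z in Metric.ball 0 r, ‖v z‖ ^ p) + (σ' * ‖a‖ ^ p * V
        + 2 * C * ∫ z in Metric.ball 0 r, ‖v z - mean φ v z.2‖ ^ p))
        + ε * (B * (∫ z in Metric.ball 0 r, ‖v z‖) + ‖a‖ / V' * V) := by
    rw [hh, integral_add j4 (j5.const_mul ε), integral_const_mul, integral_add j1 j3,
      integral_add (integrable_const _) j2, integral_const_mul, integral_const_mul,
      integral_const_mul, integral_const_mul, integral_add (iv.const_mul B) (integrable_const _), integral_const_mul,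
      integral_const, integral_const, smul_eq_mul, smul_eq_mul, Measure.real,
      Measure.restrict_apply_univ, ← Measure.real]
    ring
  rw [e1]
  have P0 : 0 ≤ ∫ z in Metric.ball 0 r, ‖v z‖ ^ p := integral_nonneg fun z => by positivity
  have Q0 : 0 ≤ ∫ z in Metric.ball 0 r, ‖v z‖ := integral_nonneg fun z => by positivity
  have X0 : 0 ≤ ∫ z in Metric.ball 0 r, ‖v z - mean φ v z.2‖ ^ p :=
    integral_nonneg fun z => by positivity
  have A0 : 0 ≤ ‖a‖ ^ p := by positivity
  generalize (∫ z in Metric.ball 0 r, ‖v z‖ ^ p) = P at *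
  generalize (∫ z in Metric.ball 0 r, ‖v z‖) = Q at *
  generalize (∫ z in Metric.ball 0 r, ‖v z - mean φ v z.2‖ ^ p) = X at *
  have t1 := mul_le_mul_of_nonneg_right hs1 P0
  have t2 := mul_le_mul_of_nonneg_right hsv A0
  have t3 : 0 ≤ (B + V / V') * X := by positivity
  have t4 : 0 ≤ (2 * B * C) * (ε * (Q + ‖a‖)) + B * (ε * ‖a‖) + V / V' * (ε * Q) := by positivity
  have e2 : ‖a‖ / V' * V = V / V' * ‖a‖ := by ring
  rw [e2]
  linarith

/-- If the weighted means of `J v` are close to `J a`, then `v - a` is controlled in `L^p` by the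
oscillation of `v` on slices. -/
theorem exists_sub_const_le {p : ℝ} (hp : 1 < p) {φ : Spc n → ℝ} {r : ℝ} (hφ : Weight φ r)  :
    ∃ C δ : ℝ, 0 ≤ C ∧ 0 < δ ∧
      ∀ (N : ℕ) (ν L lam : ℝ) (v : ST n → Vec N) (Dv G : ST n → Mat N n)
      (f : ST n → ℝ), NSol p ν L lam v Dv G f →
      IntegrableOn (fun z => ‖v z - mean φ v z.2‖ ^ p) (Metric.ball 0 r) volume →
      ∀ (a : Vec N) (ε : ℝ), 0 ≤ ε →
      (∀ᵐ t : ℝ, t ∈ Ioo (-r) r → ‖(∫ x, φ x • J p (v (x, t))) - J p a‖ ≤ ε) →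
      ε ≤ δ * ‖a‖ ^ (p - 1) →
      ∫ z in Metric.ball 0 r, ‖v z - a‖ ^ p
        ≤ C * ((∫ z in Metric.ball 0 r, ‖v z - mean φ v z.2‖ ^ p) + (‖a‖ ^ (2 - p) * ε) ^ p) := by
  obtain ⟨B, hB0, hB⟩ := hφ.exists_le
  obtain ⟨C, δ, hC0, hδ, hC⟩ := exists_norm_mean_sub_le hp
  set V := volume.real (Metric.ball (0 : ST n) r) with hV
  set V' := volume.real (Metric.ball (0 : Spc n) r) with hV'
  have hV0 : 0 ≤ V := measureReal_nonneg
  have hV'0 : 0 ≤ V' := measureReal_nonneg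
  have hp0 : 0 ≤ p := by linarith
  set D := 2 ^ p * (C ^ p * 2 ^ p) with hD
  have hD0 : 0 ≤ D := by positivity
  refine ⟨2 ^ p + D * B * V' + D * V, δ, by positivity, hδ,
    fun N ν L lam v Dv G f S hX a ε hε hy hεδ => ?_⟩
  have hfin : IsFiniteMeasure (volume.restrict (Metric.ball (0 : Spc n) r)) :=
    ⟨by rw [Measure.restrict_apply_univ]; exact measure_ball_lt_top⟩
  have hfin' : IsFiniteMeasure (volume.restrict (Metric.ball (0 : ST n) r)) :=
    ⟨by rw [Measure.restrict_apply_univ]; exact measure_ball_lt_top⟩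
  set E := ‖a‖ ^ (2 - p) * ε with hE
  have hE0 : 0 ≤ E := by positivity
  have hadd : ∀ s t : ℝ, 0 ≤ s → 0 ≤ t → (s + t) ^ p ≤ 2 ^ p * (s ^ p + t ^ p) := by
    intro s t hs ht
    have h1 : s + t ≤ 2 * max s t := by linarith [le_max_left s t, le_max_right s t]
    refine (Real.rpow_le_rpow (by positivity) h1 hp0).trans ?_
    rw [Real.mul_rpow (by norm_num) (le_max_of_le_left hs)]
    exact mul_le_mul_of_nonneg_left (max_rpow_le hs ht) (by positivity)
  have iva := S.integrableOn_sub_rpow a r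
  have ih : IntegrableOn (fun z => (2 ^ p + D * B * V') * ‖v z - mean φ v z.2‖ ^ p + D * E ^ p)
    (Metric.ball 0 r) volume := (hX.const_mul _).add (integrable_const _)
  have hmain := setIntegral_ball_mono_slice iva ih ?_
  · refine hmain.trans ?_
    rw [integral_add (hX.const_mul _) (integrable_const _), integral_const_mul, integral_const,
      smul_eq_mul, Measure.real, Measure.restrict_apply_univ, ← Measure.real, ← hV]
    have X0 : 0 ≤ ∫ z in Metric.ball 0 r, ‖v z - mean φ v z.2‖ ^ p :=
      integral_nonneg fun z => by positivity
    have t1 : 0 ≤ D * V * ∫ z in Metric.ball 0 r, ‖v z - mean φ v z.2‖ ^ p := by positivity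
    have t2 : 0 ≤ (2 ^ p + D * B * V') * E ^ p := by positivity
    linarith
  filter_upwards [S.ae_slice, hy, ae_slice_integrableOn iva, ae_slice_integrableOn hX]
    with t ⟨s1, s2, s3⟩ s4 s5 s6 ht
  have s5 := s5 ht
  have s6 := s6 ht
  set β := mean φ v t with hβ
  set I := ∫ x in Metric.ball (0 : Spc n) r, ‖v (x, t) - β‖ ^ p with hI
  have I0 : 0 ≤ I := integral_nonneg fun z => by positivity
  have k0 : IntegrableOn (fun x => φ x * ‖v (x, t) - β‖ ^ p) (Metric.ball 0 r) volume :=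
    hφ.integrable_smul (g := id) hφ.cont.aestronglyMeasurable s6
  have k1 : Integrable (fun x => φ x * ‖v (x, t) - β‖ ^ p) volume := by
    refine (integrableOn_iff_integrable_of_support_subset fun x hx => ?_).1 k0
    by_contra hx'
    exact hx (by simp [hφ.zero x hx'])
  have k2 : ∫ x, φ x * ‖v (x, t) - β‖ ^ p ≤ B * I := by
    rw [← setIntegral_eq_integral_of_forall_compl_eq_zero (s := Metric.ball (0 : Spc n) r)
        fun x hx => by rw [hφ.zero x hx, zero_mul], hI, ← integral_const_mul]
    exact integral_mono k0 (s6.const_mul B) fun x =>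
      mul_le_mul_of_nonneg_right (hB x) (by positivity)
  have k3 : ‖β - a‖ ^ p ≤ C ^ p * 2 ^ p * (E ^ p + B * I) := by
    have key : ∀ κ : ℝ, 0 < κ → ‖β - a‖ ^ p ≤ C ^ p * 2 ^ p * (E ^ p + (B * I + κ)) := by
      intro κ hκ
      have hBI : 0 < B * I + κ := by positivity
      have := hC (m := volume) (φ := φ) (fun x => v (x, t)) β a ε ((B * I + κ) ^ (1 / p))
        hφ.nonneg hφ.integrable hφ.one s1.aestronglyMeasurable
        (hφ.integrable_smul (g := id) hφ.cont.aestronglyMeasurable s2) k1 (by positivity)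
        (by rw [← Real.rpow_mul hBI.le, one_div_mul_cancel (by linarith), Real.rpow_one]; linarith)
        (s4 ht) hεδ
      refine (Real.rpow_le_rpow (norm_nonneg _) this hp0).trans ?_
      rw [Real.mul_rpow hC0 (by positivity), mul_assoc]
      refine mul_le_mul_of_nonneg_left ((hadd _ _ hE0 (by positivity)).trans (le_of_eq ?_))
        (by positivity)
      rw [← Real.rpow_mul hBI.le, one_div_mul_cancel (by linarith), Real.rpow_one]
    have hlim : Tendsto (fun κ : ℝ => C ^ p * 2 ^ p * (E ^ p + (B * I + κ))) (𝓝[>] 0)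
        (𝓝 (C ^ p * 2 ^ p * (E ^ p + (B * I + 0)))) := by
      refine Tendsto.mono_left ?_ nhdsWithin_le_nhds
      exact (Continuous.tendsto (by fun_prop) 0)
    rw [add_zero] at hlim
    exact ge_of_tendsto hlim (by filter_upwards [self_mem_nhdsWithin] with κ hκ using key κ hκ)
  have k4 : ∫ x in Metric.ball (0 : Spc n) r, ‖v (x, t) - a‖ ^ p
      ≤ ∫ x in Metric.ball (0 : Spc n) r, (2 ^ p * ‖v (x, t) - β‖ ^ p + D * (E ^ p + B * I)) := by
    refine integral_mono s5 ((s6.const_mul _).add (integrable_const _)) fun x => ?_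
    have q1 : ‖v (x, t) - a‖ ≤ ‖v (x, t) - β‖ + ‖β - a‖ := by
      simpa using norm_add_le (v (x, t) - β) (β - a)
    have q2 := (Real.rpow_le_rpow (norm_nonneg _) q1 hp0).trans
      (hadd _ _ (norm_nonneg _) (norm_nonneg _))
    have q3 := mul_le_mul_of_nonneg_left k3 (by positivity : (0 : ℝ) ≤ 2 ^ p)
    simp only [hD] at *
    linarith
  refine k4.trans (le_of_eq ?_)
  have hlin : ∀ c d : ℝ, ∫ x in Metric.ball (0 : Spc n) r, (c * ‖v (x, t) - β‖ ^ p + d)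
      = c * I + V' * d := fun c d => by
    rw [integral_add (s6.const_mul _) (integrable_const _), integral_const_mul, integral_const,
      smul_eq_mul, Measure.real, Measure.restrict_apply_univ, ← Measure.real]
  rw [hlin, hlin]
  ring


/-! ### Estimate of the boundary term in the singular range -/

theorem gradS_bump_eq_zero (η : ContDiffBump (0 : ST n)) {z : ST n}
    (hz : z ∉ Metric.ball 0 η.rOut) : gradS η z = 0 := by
  have h : IsLocalMin η z := Eventually.of_forall fun y => by
    rw [bump_eq_zero η hz]; exact η.nonneg
  ext j
  simp [gradS, h.fderiv_eq_zero]

theorem NSol.integrableOn_rpow {p ν L lam : ℝ} {v : ST n → Vec N} {Dv G : ST n → Mat N n}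
    {f : ST n → ℝ} (S : NSol p ν L lam v Dv G f) {s : ℝ} (hs : 0 < s) (hsp : s ≤ p) (c : Vec N)
    (r : ℝ) : IntegrableOn (fun z => ‖Dv z‖ ^ s) (Metric.ball 0 r) volume ∧
      IntegrableOn (fun z => ‖v z - c‖ ^ s) (Metric.ball 0 r) volume := by
  have : IsFiniteMeasure ((volume : Measure (ST n)).restrict (Metric.ball 0 r)) :=
    ⟨by simpa using measure_ball_lt_top⟩
  have key : ∀ {E : Type} [NormedAddCommGroup E] (w : ST n → E),
      MemLp w (ENNReal.ofReal p) (volume.restrict (Metric.ball 0 r)) →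
      IntegrableOn (fun z => ‖w z‖ ^ s) (Metric.ball 0 r) volume := by
    intro E _ w hw
    have := (hw.mono_exponent (p := ENNReal.ofReal s)
      (ENNReal.ofReal_le_ofReal hsp)).integrable_norm_rpow (by simpa using hs)
      ENNReal.ofReal_ne_top
    rwa [ENNReal.toReal_ofReal hs.le] at this
  exact ⟨key _ (S.memDv.restrict _), key _ (S.memLp_sub_const c r)⟩

theorem exists_slice_sobolev_cutoff (hn : 1 ≤ n) (η : ContDiffBump (0 : ST n)) (hη : η.rOut < 2) :
    ∃ C : ℝ, 0 ≤ C ∧ ∀ (N : ℕ) (p ν L lam : ℝ) (v : ST n → Vec N) (Dv G : ST n → Mat N n)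
      (f : ST n → ℝ), NSol p ν L lam v Dv G f → sob n ≤ p → ∀ a : Vec N,
      ∫⁻ t, (∫⁻ x, ‖η (x, t) • (v (x, t) - a)‖ₑ ^ (2 : ℝ)) ^ (sob n / 2)
        ≤ ENNReal.ofReal (C * ∫ z in Metric.ball 0 η.rOut,
            (‖Dv z‖ ^ sob n + ‖v z - a‖ ^ sob n)) := by
  obtain ⟨C, hCt, hC⟩ := exists_slice_sobolev_weak hn
  have hsm : ContDiff ℝ (⊤ : ℕ∞) η := η.contDiff
  have hgc : HasCompactSupport (gradS η) :=
    HasCompactSupport.intro η.hasCompactSupport fun z hz => gradS_eq_zero hz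
  have hgcont : Continuous (gradS η) := continuous_gradS (hsm.of_le (by exact_mod_cast le_top))
  obtain ⟨M, hM⟩ := hgcont.bounded_above_of_compact_support hgc
  have hM0 : 0 ≤ M := (norm_nonneg _).trans (hM 0)
  have hs1 := one_le_sob n
  have hs0 : 0 < sob n := by linarith
  set q := sob n with hq
  refine ⟨C.toReal * ((2 * (1 + M)) ^ q), by positivity,
    fun N p ν L lam v Dv G f S hqp a => ?_⟩
  have lv : LocallyIntegrable (fun z => v z - a) volume :=
    S.integrable_v.locallyIntegrable.sub (locallyIntegrable_const a)
  have lD := S.integrable_Dv.locallyIntegrable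
  have mW : Measurable fun z => η z • (v z - a) :=
    η.continuous.measurable.smul (S.measv.sub_const a)
  have mT : Measurable fun z => tens (v z - a) (gradS η z) :=
    measurable_tens (S.measv.sub_const a) hgcont.measurable
  have mD : Measurable fun z => η z • Dv z + tens (v z - a) (gradS η z) :=
    (η.continuous.measurable.smul S.measDv).add mT
  have iW : Integrable (fun z => η z • (v z - a)) volume :=
    lv.integrable_smul_left_of_hasCompactSupport η.continuous η.hasCompactSupport
  have iT : Integrable (fun z => tens (v z - a) (gradS η z)) volume := by
    have h1 : Integrable (fun z => ‖gradS η z‖ • (v z - a)) volume :=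
      lv.integrable_smul_left_of_hasCompactSupport hgcont.norm hgc.norm
    refine h1.norm.mono' mT.aestronglyMeasurable (Eventually.of_forall fun z => ?_)
    rw [norm_tens, norm_smul, norm_norm, mul_comm]
  have iD : Integrable (fun z => η z • Dv z + tens (v z - a) (gradS η z)) volume :=
    (lD.integrable_smul_left_of_hasCompactSupport η.continuous η.hasCompactSupport).add iT
  have hts : tsupport η ⊆ Metric.ball (0 : ST n) 2 := by
    rw [η.tsupport_eq]; exact Metric.closedBall_subset_ball hη
  have h1 := hC N _ _ mW mD iW iD (fun z hz => by
    rw [bump_eq_zero η (by rw [mem_ball_zero_iff]; linarith), zero_smul])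
    (S.grad.smul_sub S.integrable_v.locallyIntegrable lD hsm hts a)
  refine h1.trans ?_
  obtain ⟨iDq, ivq⟩ := S.integrableOn_rpow hs0 hqp a η.rOut
  have h2 : ∫⁻ z, ‖η z • Dv z + tens (v z - a) (gradS η z)‖ₑ ^ q
      ≤ ∫⁻ z in Metric.ball 0 η.rOut,
        ENNReal.ofReal ((2 * (1 + M)) ^ q * (‖Dv z‖ ^ q + ‖v z - a‖ ^ q)) := by
    rw [← lintegral_indicator Metric.isOpen_ball.measurableSet]
    refine lintegral_mono fun z => ?_
    by_cases hz : z ∈ Metric.ball 0 η.rOut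
    · rw [indicator_of_mem hz, enorm_rpow_eq_ofReal _ hs0.le]
      refine ENNReal.ofReal_le_ofReal ?_
      have k1 : ‖η z • Dv z + tens (v z - a) (gradS η z)‖ ≤ ‖Dv z‖ + M * ‖v z - a‖ := by
        refine (norm_add_le _ _).trans (add_le_add ?_ ?_)
        · rw [norm_smul, Real.norm_of_nonneg η.nonneg]
          exact mul_le_of_le_one_left (norm_nonneg _) η.le_one
        · rw [norm_tens, mul_comm]
          exact mul_le_mul_of_nonneg_right (hM z) (norm_nonneg _)
      have k2 : ‖Dv z‖ + M * ‖v z - a‖ ≤ 2 * (1 + M) * max ‖Dv z‖ ‖v z - a‖ := by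
        have e1 := le_max_left ‖Dv z‖ ‖v z - a‖
        have e2 := le_max_right ‖Dv z‖ ‖v z - a‖
        nlinarith [mul_le_mul_of_nonneg_left e2 hM0, mul_nonneg hM0 ((norm_nonneg _).trans e2),
          (norm_nonneg _).trans e2]
      refine (Real.rpow_le_rpow (norm_nonneg _) (k1.trans k2) hs0.le).trans ?_
      rw [Real.mul_rpow (by positivity) (le_max_of_le_left (norm_nonneg _))]
      exact mul_le_mul_of_nonneg_left (max_rpow_le (norm_nonneg _) (norm_nonneg _))
        (by positivity)
    · rw [indicator_of_notMem hz, bump_eq_zero η hz, gradS_bump_eq_zero η hz, zero_smul, zero_add,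
        show tens (v z - a) (0 : Spc n) = 0 by rw [← norm_eq_zero, norm_tens]; simp, enorm_zero,
        ENNReal.zero_rpow_of_pos hs0]
  have iS : IntegrableOn (fun z => (2 * (1 + M)) ^ q * (‖Dv z‖ ^ q + ‖v z - a‖ ^ q))
      (Metric.ball 0 η.rOut) volume := (iDq.add ivq).const_mul _
  rw [← ofReal_integral_eq_lintegral_ofReal iS (Eventually.of_forall fun z => by positivity)] at h2
  calc C * ∫⁻ z, ‖η z • Dv z + tens (v z - a) (gradS η z)‖ₑ ^ q
      ≤ ENNReal.ofReal C.toReal * ENNReal.ofReal (∫ z in Metric.ball 0 η.rOut,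
          (2 * (1 + M)) ^ q * (‖Dv z‖ ^ q + ‖v z - a‖ ^ q)) := by
        rw [ENNReal.ofReal_toReal hCt]; exact mul_le_mul_right h2 C
    _ = _ := by
        rw [← ENNReal.ofReal_mul ENNReal.toReal_nonneg, integral_const_mul, mul_assoc]

/-- Absorbing a sublinear power of the left-hand side. -/
theorem le_of_interp_absorb {q A Z X D Γ : ℝ} (hq : 0 < q) (hX : 0 ≤ X)
    (hA : 0 ≤ A) (hD : 0 ≤ D) (hΓ : 0 ≤ Γ) (hXZ : X ≤ A + Z) (hZ : Z ≤ D * X ^ (1 - q / 2) * Γ) :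
    X ≤ 2 * A + (2 * D * Γ) ^ (2 / q) := by
  rcases hX.eq_or_lt with h0 | h0
  · rw [← h0]; positivity
  rcases le_or_gt (D * Γ) (X ^ (q / 2) / 2) with hc | hc
  · have e : X ^ (1 - q / 2) * X ^ (q / 2) = X := by
      rw [← Real.rpow_add h0, sub_add_cancel, Real.rpow_one]
    have h3 := mul_le_mul_of_nonneg_left hc (Real.rpow_nonneg hX (1 - q / 2))
    have : 0 ≤ (2 * D * Γ) ^ (2 / q) := by positivity
    linarith
  · have e1 : X = (X ^ (q / 2)) ^ (2 / q) := by
      rw [← Real.rpow_mul hX, div_mul_div_comm, mul_comm, div_self (by positivity), Real.rpow_one]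
    have e2 : (X ^ (q / 2)) ^ (2 / q) ≤ (2 * D * Γ) ^ (2 / q) :=
      Real.rpow_le_rpow (by positivity) (by linarith) (by positivity)
    linarith

set_option maxHeartbeats 1000000 in
/-- In the singular range the boundary term in the Caccioppoli inequality is absorbed by means of
the Sobolev inequality on slices. -/
theorem exists_caccRHS_le (hn : 1 ≤ n) (η : ContDiffBump (0 : ST n)) (hη : η.rOut < 2) {m : ℕ}
    (hm : 4 ≤ m) {p ν L : ℝ} (hp : sob n ≤ p) (hp1 : 1 < p) (hp2 : p ≤ 2) (hν : 0 < ν)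
    (hL : 0 ≤ L) {κ : ℝ} (hκ : 0 < κ) :
    ∃ C : ℝ, 0 ≤ C ∧ ∀ (N : ℕ) (μ : ℝ) (v : ST n → Vec N) (Dv G : ST n → Mat N n) (f : ST n → ℝ)
      (a : Vec N), 0 < μ → NSol p ν L (μ ^ (p - 2)) v Dv G f → κ * μ ≤ ‖a‖ →
      caccRHS p (μ ^ (p - 2)) η m v f a
        ≤ 2 * (∫ z in Metric.ball 0 η.rOut, (f z ^ p + ‖v z - a‖ ^ p))
          + C * (∫ z in Metric.ball 0 η.rOut,
              (‖Dv z‖ ^ sob n + ‖v z - a‖ ^ sob n)) ^ (2 / sob n) := by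
  have hm4 : (4 : ℝ) ≤ m := by exact_mod_cast hm
  obtain ⟨C₁, hC₁, hcac⟩ := exists_caccioppoli η hη (by omega : 2 ≤ m) hp1 (by linarith) hν hL
  obtain ⟨C₂, hC₂, hsob⟩ := exists_slice_sobolev_cutoff hn η hη
  have hs1 := one_le_sob n
  have hs2 := sob_lt_two n
  set q := sob n with hq
  set k := q / 2 with hk
  have hk0 : 1 / 2 ≤ k := by rw [hk]; linarith
  have hk1 : k < 1 := by rw [hk]; linarith
  set C₃ := (p + 1) * κ ^ (p - 2) with hC₃
  have hC₃0 : 0 ≤ C₃ := by positivity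
  set D := C₁ ^ (1 - k) * C₃ ^ k * C₂ with hD
  have hD0 : 0 ≤ D := by positivity
  refine ⟨(2 * D) ^ (2 / q), by positivity, fun N μ v Dv G f a hμ S ha => ?_⟩
  set X := caccRHS p (μ ^ (p - 2)) η m v f a with hX
  set A := ∫ z in Metric.ball 0 η.rOut, (f z ^ p + ‖v z - a‖ ^ p) with hA
  set Γ := ∫ z in Metric.ball 0 η.rOut, (‖Dv z‖ ^ q + ‖v z - a‖ ^ q) with hΓ
  have hlam : (μ ^ (p - 2))⁻¹ = μ ^ (2 - p) := by rw [← Real.rpow_neg hμ.le]; congr 1; ring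
  set b : ST n → ℝ := fun z => μ ^ (2 - p) * bdry p (v z) a with hb
  have hb0 : ∀ z, 0 ≤ b z := fun z => mul_nonneg (by positivity) (bdry_nonneg hp1 _ _)
  set Z := ∫ z, η z ^ (m - 1) * b z with hZ
  have hXZ : X = A + Z := by
    rw [hX, caccRHS, hlam, hZ, ← integral_const_mul]
    congr 2
    ext z
    simp only [hb]
    ring
  have hA0 : 0 ≤ A := integral_nonneg fun z => by
    have := S.fnonneg z; simp only [Pi.zero_apply]; positivity
  have hΓ0 : 0 ≤ Γ := integral_nonneg fun z => by simp only [Pi.zero_apply]; positivity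
  have hZ0 : 0 ≤ Z := integral_nonneg fun z => mul_nonneg (pow_nonneg η.nonneg _) (hb0 z)
  have hX0 : 0 ≤ X := by rw [hXZ]; positivity
  have cpow : ∀ j : ℕ, Continuous fun z : ST n => η z ^ j := fun j => η.continuous.pow j
  have kpow : ∀ j : ℕ, 1 ≤ j → HasCompactSupport fun z : ST n => η z ^ j := fun j hj =>
    η.hasCompactSupport.comp_left (g := fun s : ℝ => s ^ j) (by simp; omega)
  have ib : ∀ j : ℕ, 1 ≤ j → Integrable (fun z => η z ^ j * b z) volume := fun j hj => by
    refine ((S.integrable_bdd_bdry (cpow j) (kpow j hj) a).const_mul (μ ^ (2 - p))).congr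
      (Eventually.of_forall fun z => ?_)
    simp only [hb]; ring
  have mb : Measurable b := by
    have : Measurable fun z => bdry p (v z) a := by
      unfold bdry
      exact ((S.measv.norm.pow_const p).const_mul _ |>.sub
        ((measurable_J p S.measv).inner measurable_const)).add measurable_const
    exact this.const_mul _
  -- the interpolation estimate
  have key : Z ≤ D * X ^ (1 - k) * Γ := by
    have h1 : ∀ᵐ t : ℝ, ∫⁻ x, ENNReal.ofReal (η (x, t) ^ (m - 1) * b (x, t))
        ≤ ENNReal.ofReal ((C₁ * X) ^ (1 - k) * C₃ ^ k)
          * (∫⁻ x, ‖η (x, t) • (v (x, t) - a)‖ₑ ^ (2 : ℝ)) ^ k := by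
      filter_upwards [(hcac N _ v Dv G f S a).2, ae_slice_integrable (ib m (by omega))]
        with t ht hti
      have s1 : ∫⁻ x, ENNReal.ofReal (η (x, t) ^ m * b (x, t)) ≤ ENNReal.ofReal (C₁ * X) := by
        rw [← ofReal_integral_eq_lintegral_ofReal hti (Eventually.of_forall fun x =>
          mul_nonneg (pow_nonneg η.nonneg _) (hb0 _))]
        refine ENNReal.ofReal_le_ofReal (le_trans (le_of_eq ?_) ht)
        rw [hlam, ← integral_const_mul]
        congr 1
        ext x
        simp only [hb]
        ring
      have s2 : ∫⁻ x, ENNReal.ofReal (η (x, t) ^ 2 * b (x, t))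
          ≤ ENNReal.ofReal C₃ * ∫⁻ x, ‖η (x, t) • (v (x, t) - a)‖ₑ ^ (2 : ℝ) := by
        rw [← lintegral_const_mul' _ _ ENNReal.ofReal_ne_top]
        refine lintegral_mono fun x => ?_
        rw [enorm_rpow_eq_ofReal _ (by norm_num), ← ENNReal.ofReal_mul hC₃0]
        refine ENNReal.ofReal_le_ofReal ?_
        have := scaled_bdry_le_sq hp1 hp2 hκ hμ (v (x, t)) a ha
        rw [norm_smul, Real.norm_of_nonneg η.nonneg, Real.rpow_two, mul_pow]
        have := mul_le_mul_of_nonneg_left this (sq_nonneg (η (x, t)))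
        simp only [hb, hC₃]
        linarith
      have mF : AEMeasurable (fun x => ENNReal.ofReal (η (x, t) ^ m * b (x, t))) volume :=
        ((((cpow m).measurable.mul mb).comp measurable_prodMk_right).ennreal_ofReal).aemeasurable
      have mH : AEMeasurable (fun x => ENNReal.ofReal (η (x, t) ^ 2 * b (x, t))) volume :=
        ((((cpow 2).measurable.mul mb).comp measurable_prodMk_right).ennreal_ofReal).aemeasurable
      calc ∫⁻ x, ENNReal.ofReal (η (x, t) ^ (m - 1) * b (x, t))
          ≤ ∫⁻ x, ENNReal.ofReal (η (x, t) ^ m * b (x, t)) ^ (1 - k)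
              * ENNReal.ofReal (η (x, t) ^ 2 * b (x, t)) ^ k := by
            refine lintegral_mono fun x => ?_
            have e0 : 0 ≤ η (x, t) := η.nonneg
            have e1 := hb0 (x, t)
            rw [ENNReal.ofReal_rpow_of_nonneg (by positivity) (by linarith),
              ENNReal.ofReal_rpow_of_nonneg (by positivity) (by linarith),
              ← ENNReal.ofReal_mul (by positivity)]
            refine ENNReal.ofReal_le_ofReal ?_
            rw [Real.mul_rpow (by positivity) e1, Real.mul_rpow (by positivity) e1]
            rcases e1.eq_or_lt with h0 | h0
            · rw [← h0, mul_zero]; positivity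
            rcases e0.eq_or_lt with h0' | h0'
            · rw [← h0', zero_pow (by omega), zero_mul]; positivity
            have e2 : (b (x, t)) ^ (1 - k) * (b (x, t)) ^ k = b (x, t) := by
              rw [← Real.rpow_add h0, sub_add_cancel, Real.rpow_one]
            have e3 : η (x, t) ^ (m - 1) ≤ (η (x, t) ^ m) ^ (1 - k) * (η (x, t) ^ 2) ^ k := by
              rw [← Real.rpow_natCast, ← Real.rpow_natCast, ← Real.rpow_natCast,
                ← Real.rpow_mul e0, ← Real.rpow_mul e0, ← Real.rpow_add h0']
              refine Real.rpow_le_rpow_of_exponent_ge h0' η.le_one ?_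
              rw [Nat.cast_sub (by omega)]
              push_cast
              nlinarith
            calc η (x, t) ^ (m - 1) * b (x, t)
                ≤ ((η (x, t) ^ m) ^ (1 - k) * (η (x, t) ^ 2) ^ k)
                  * ((b (x, t)) ^ (1 - k) * (b (x, t)) ^ k) := by
                  rw [e2]; exact mul_le_mul_of_nonneg_right e3 e1
              _ = _ := by ring
        _ ≤ (∫⁻ x, ENNReal.ofReal (η (x, t) ^ m * b (x, t))) ^ (1 - k)
              * (∫⁻ x, ENNReal.ofReal (η (x, t) ^ 2 * b (x, t))) ^ k :=
            ENNReal.lintegral_mul_norm_pow_le mF mH (by linarith) (by linarith) (by ring)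
        _ ≤ ENNReal.ofReal (C₁ * X) ^ (1 - k)
              * (ENNReal.ofReal C₃ * ∫⁻ x, ‖η (x, t) • (v (x, t) - a)‖ₑ ^ (2 : ℝ)) ^ k :=
            mul_le_mul' (ENNReal.rpow_le_rpow s1 (by linarith))
              (ENNReal.rpow_le_rpow s2 (by linarith))
        _ = _ := by
            rw [ENNReal.mul_rpow_of_nonneg _ _ (by linarith),
              ENNReal.ofReal_rpow_of_nonneg (by positivity) (by linarith),
              ENNReal.ofReal_rpow_of_nonneg hC₃0 (by linarith), ENNReal.ofReal_mul (by positivity),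
              mul_assoc]
    have mz : Measurable fun z : ST n => ENNReal.ofReal (η z ^ (m - 1) * b z) :=
      ((cpow (m - 1)).measurable.mul mb).ennreal_ofReal
    have h2 : ENNReal.ofReal Z
        ≤ ENNReal.ofReal ((C₁ * X) ^ (1 - k) * C₃ ^ k) * ENNReal.ofReal (C₂ * Γ) := by
      rw [hZ, ofReal_integral_eq_lintegral_ofReal (ib (m - 1) (by omega))
        (Eventually.of_forall fun z => mul_nonneg (pow_nonneg η.nonneg _) (hb0 z)),
        Measure.volume_eq_prod, lintegral_prod_symm _ mz.aemeasurable]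
      refine (lintegral_mono_ae h1).trans ?_
      rw [lintegral_const_mul' _ _ ENNReal.ofReal_ne_top]
      exact mul_le_mul_right (hsob N p ν L _ v Dv G f S hp a) _
    have e1 : 0 ≤ (C₁ * X) ^ (1 - k) * C₃ ^ k :=
      mul_nonneg (Real.rpow_nonneg (mul_nonneg hC₁ hX0) _) (Real.rpow_nonneg hC₃0 _)
    rw [← ENNReal.ofReal_mul e1,
      ENNReal.ofReal_le_ofReal_iff (mul_nonneg e1 (mul_nonneg hC₂ hΓ0)),
      Real.mul_rpow hC₁ hX0] at h2
    refine h2.trans (le_of_eq ?_)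
    rw [hD]; ring
  refine (le_of_interp_absorb (by linarith) hX0 hA0 hD0 hΓ0 hXZ.le key).trans (le_of_eq ?_)
  rw [Real.mul_rpow (by positivity) hΓ0]


/-- An admissible exponent for the cutoff functions. -/
def mexp (p : ℝ) : ℕ := max 4 ⌈p⌉₊

theorem four_le_mexp (p : ℝ) : 4 ≤ mexp p := le_max_left _ _

theorem le_mexp (p : ℝ) : p ≤ mexp p :=
  (Nat.le_ceil p).trans (by exact_mod_cast le_max_right _ _)

theorem bump_mem_slice (η : ContDiffBump (0 : ST n)) {x : Spc n} {t : ℝ}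
    (hx : x ∈ Metric.ball 0 η.rIn) (ht : t ∈ Ioo (-η.rIn) η.rIn) : η (x, t) = 1 :=
  η.one_of_mem_closedBall (Metric.ball_subset_closedBall (mem_ball_ST.2 ⟨hx, ht⟩))

/-- The Caccioppoli inequality on concentric cylinders. -/
theorem exists_cacc_ball (η : ContDiffBump (0 : ST n)) (hη : η.rOut < 2) {p ν L : ℝ} (hp : 1 < p)
    (hν : 0 < ν) (hL : 0 ≤ L) :
    ∃ C : ℝ, 0 ≤ C ∧ ∀ (N : ℕ) (lam : ℝ) (v : ST n → Vec N) (Dv G : ST n → Mat N n)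
      (f : ST n → ℝ), NSol p ν L lam v Dv G f → ∀ c : Vec N,
      (∫ z in Metric.ball 0 η.rIn, ‖Dv z‖ ^ p ≤ C * caccRHS p lam η (mexp p) v f c) ∧
      ∀ᵐ t : ℝ, t ∈ Ioo (-η.rIn) η.rIn →
        IntegrableOn (fun x => bdry p (v (x, t)) c) (Metric.ball 0 η.rIn) volume ∧
        lam⁻¹ * ∫ x in Metric.ball 0 η.rIn, bdry p (v (x, t)) c
          ≤ C * caccRHS p lam η (mexp p) v f c := by
  have h4 := four_le_mexp p
  obtain ⟨C, hC, h⟩ := exists_caccioppoli η hη (by omega : 2 ≤ mexp p) hp (le_mexp p) hν hL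
  refine ⟨C, hC, fun N lam v Dv G f S c => ?_⟩
  obtain ⟨h1, h2⟩ := h N lam v Dv G f S c
  have cpow : Continuous fun z : ST n => η z ^ mexp p := η.continuous.pow _
  have kpow : HasCompactSupport fun z : ST n => η z ^ mexp p :=
    η.hasCompactSupport.comp_left (g := fun s : ℝ => s ^ mexp p) (by simp; omega)
  have hη0 : ∀ z : ST n, 0 ≤ η z ^ mexp p := fun z => pow_nonneg η.nonneg _
  constructor
  · refine le_trans ?_ h1
    have hi : Integrable (fun z => η z ^ mexp p * ‖Dv z‖ ^ p) volume :=
      integrable_bdd_mul cpow kpow S.integrable_Dv_rpow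
    calc ∫ z in Metric.ball 0 η.rIn, ‖Dv z‖ ^ p
        = ∫ z in Metric.ball 0 η.rIn, η z ^ mexp p * ‖Dv z‖ ^ p := by
          refine setIntegral_congr_fun Metric.isOpen_ball.measurableSet fun z hz => ?_
          rw [η.one_of_mem_closedBall (Metric.ball_subset_closedBall hz), one_pow, one_mul]
      _ ≤ _ := setIntegral_le_integral hi (Eventually.of_forall fun z =>
          mul_nonneg (hη0 z) (by positivity))
  · filter_upwards [h2, ae_slice_integrable (S.integrable_bdd_bdry cpow kpow c)] with t ht hi htI
    have e : ∀ x ∈ Metric.ball (0 : Spc n) η.rIn,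
        η (x, t) ^ mexp p * bdry p (v (x, t)) c = bdry p (v (x, t)) c := fun x hx => by
      rw [bump_mem_slice η hx htI, one_pow, one_mul]
    constructor
    · exact (integrableOn_congr_fun e Metric.isOpen_ball.measurableSet).1 hi.integrableOn
    · refine le_trans (mul_le_mul_of_nonneg_left ?_ (inv_nonneg.2 S.hlam.le)) ht
      rw [← setIntegral_congr_fun Metric.isOpen_ball.measurableSet e]
      exact setIntegral_le_integral hi (Eventually.of_forall fun x =>
        mul_nonneg (hη0 _) (bdry_nonneg hp _ _))

theorem NSol.caccRHS_le {p ν L lam : ℝ} {v : ST n → Vec N} {Dv G : ST n → Mat N n}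
    {f : ST n → ℝ} (S : NSol p ν L lam v Dv G f) (η : ContDiffBump (0 : ST n)) {m : ℕ}
    (hm : 2 ≤ m) (c : Vec N) :
    caccRHS p lam η m v f c ≤ (∫ z, f z ^ p) + (∫ z in Metric.ball 0 η.rOut, ‖v z - c‖ ^ p)
      + lam⁻¹ * ∫ z in Metric.ball 0 η.rOut, bdry p (v z) c := by
  unfold caccRHS
  rw [integral_add S.integrable_f_rpow.integrableOn (S.integrableOn_sub_rpow c _)]
  refine add_le_add (add_le_add_left ?_ _) (mul_le_mul_of_nonneg_left ?_ (inv_nonneg.2 S.hlam.le))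
  · exact setIntegral_le_integral S.integrable_f_rpow
      (Eventually.of_forall fun z => Real.rpow_nonneg (S.fnonneg z) _)
  · have cpow : Continuous fun z : ST n => η z ^ (m - 1) := η.continuous.pow _
    have kpow : HasCompactSupport fun z : ST n => η z ^ (m - 1) :=
      η.hasCompactSupport.comp_left (g := fun s : ℝ => s ^ (m - 1)) (by simp; omega)
    rw [← setIntegral_eq_integral_of_forall_compl_eq_zero (s := Metric.ball 0 η.rOut)
      fun z hz => by rw [bump_eq_zero η hz, zero_pow (by omega), zero_mul]]
    refine setIntegral_mono (S.integrable_bdd_bdry cpow kpow c).integrableOn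
      (S.integrableOn_bdry c _) fun z => ?_
    exact mul_le_of_le_one_left (bdry_nonneg S.hp _ _) (pow_le_one₀ η.nonneg η.le_one)

theorem bdry_zero_right {H : Type*} [NormedAddCommGroup H] [InnerProductSpace ℝ H] {p : ℝ}
    (hp : 1 < p) (v : H) : bdry p v 0 = (1 - 1 / p) * ‖v‖ ^ p := by
  rw [bdry, inner_zero_right, norm_zero, Real.zero_rpow (by linarith)]; simp

theorem NSol.caccRHS_zero_le {p ν L μ K : ℝ} {v : ST n → Vec N} {Dv G : ST n → Mat N n}
    {f : ST n → ℝ} (hμ : 0 < μ) (S : NSol p ν L (μ ^ (p - 2)) v Dv G f)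
    (hK : ∫ z, ‖v z‖ ^ p ≤ K * μ ^ p) (η : ContDiffBump (0 : ST n)) {m : ℕ} (hm : 2 ≤ m) :
    caccRHS p (μ ^ (p - 2)) η m v f 0 ≤ (∫ z, f z ^ p) + K * (μ ^ p + μ ^ (2 : ℝ)) := by
  have h1 := S.caccRHS_le η hm 0
  have hp := S.hp
  have hi := S.integrable_norm_rpow
  have h2 : ∫ z in Metric.ball 0 η.rOut, ‖v z‖ ^ p ≤ K * μ ^ p :=
    (setIntegral_le_integral hi (Eventually.of_forall fun z => by
      simp only [Pi.zero_apply]; positivity)).trans hK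
  have h3 : ∫ z in Metric.ball 0 η.rOut, bdry p (v z) 0 ≤ K * μ ^ p := by
    refine le_trans (setIntegral_mono (S.integrableOn_bdry 0 _) hi.integrableOn fun z => ?_) h2
    rw [bdry_zero_right hp]
    refine mul_le_of_le_one_left (by positivity) ?_
    have : 0 < 1 / p := by positivity
    linarith
  have h4 : (μ ^ (p - 2))⁻¹ * ∫ z in Metric.ball 0 η.rOut, bdry p (v z) 0 ≤ K * μ ^ (2 : ℝ) := by
    refine (mul_le_mul_of_nonneg_left h3 (by positivity)).trans (le_of_eq ?_)
    rw [← Real.rpow_neg hμ.le, mul_left_comm, ← Real.rpow_add hμ]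
    congr 2; ring
  simp only [sub_zero] at h1
  linarith

theorem exists_rpow_le_add {s p η : ℝ} (hs : 0 < s) (hsp : s ≤ p) (hη : 0 < η) :
    ∃ C : ℝ, 0 ≤ C ∧ ∀ x : ℝ, 0 ≤ x → x ^ s ≤ η + C * x ^ p := by
  refine ⟨(η ^ (1 / s)) ^ (s - p), by positivity, fun x hx => ?_⟩
  rcases le_or_gt x (η ^ (1 / s)) with h | h
  · have : x ^ s ≤ η := by
      calc x ^ s ≤ (η ^ (1 / s)) ^ s := Real.rpow_le_rpow hx h hs.le
        _ = η := by rw [← Real.rpow_mul hη.le, one_div_mul_cancel hs.ne', Real.rpow_one]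
    have : 0 ≤ (η ^ (1 / s)) ^ (s - p) * x ^ p := by positivity
    linarith
  · have h0 : 0 < η ^ (1 / s) := by positivity
    have hx0 := h0.trans h
    have e : x ^ s = x ^ (s - p) * x ^ p := by rw [← Real.rpow_add hx0]; congr 1; ring
    have := Real.rpow_le_rpow_of_nonpos h0 h.le (by linarith : s - p ≤ 0)
    rw [e]
    have := mul_le_mul_of_nonneg_right this (Real.rpow_nonneg hx p)
    linarith

theorem rpow_le_scaled {s p μ x : ℝ} (hs : 0 ≤ s) (hsp : s ≤ p) (hμ : 0 < μ) (hx : 0 ≤ x) :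
    x ^ s ≤ μ ^ s + μ ^ (s - p) * x ^ p := by
  rcases le_or_gt x μ with h | h
  · have := Real.rpow_le_rpow hx h hs
    have : 0 ≤ μ ^ (s - p) * x ^ p := by positivity
    linarith
  · have hx0 := hμ.trans h
    have e : x ^ s = x ^ (s - p) * x ^ p := by rw [← Real.rpow_add hx0]; congr 1; ring
    have := mul_le_mul_of_nonneg_right (Real.rpow_le_rpow_of_nonpos hμ h.le
      (by linarith : s - p ≤ 0)) (Real.rpow_nonneg hx p)
    have : 0 ≤ μ ^ s := by positivity
    rw [e]; linarith

theorem NSol.integrableOn_norm_rpow {p ν L lam s : ℝ} {v : ST n → Vec N} {Dv G : ST n → Mat N n}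
    {f : ST n → ℝ} (S : NSol p ν L lam v Dv G f) (hs : 0 < s) (hsp : s ≤ p) (r : ℝ) :
    IntegrableOn (fun z => ‖v z‖ ^ s) (Metric.ball 0 r) volume := by
  have := (S.integrableOn_rpow hs hsp 0 r).2
  simpa only [sub_zero] using this

theorem setIntegral_const_add_le {r η C I : ℝ} {g h : ST n → ℝ} (hg : IntegrableOn g (Metric.ball 0 r))
    (hh : IntegrableOn h (Metric.ball 0 r)) (hle : ∀ z, g z ≤ η + C * h z)
    (hI : C * (∫ z in Metric.ball 0 r, h z) ≤ I) :
    ∫ z in Metric.ball 0 r, g z ≤ η * volume.real (Metric.ball (0 : ST n) r) + I := by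
  have i2 : IntegrableOn (fun z => C * h z) (Metric.ball 0 r) volume := hh.const_mul C
  have i1 : IntegrableOn (fun _ : ST n => η) (Metric.ball 0 r) volume :=
    integrableOn_const measure_ball_lt_top.ne
  have i3 : IntegrableOn (fun z => η + C * h z) (Metric.ball 0 r) volume := i1.add i2
  refine (setIntegral_mono hg i3 hle).trans ?_
  rw [integral_add i1 i2, integral_const_mul, setIntegral_const, smul_eq_mul, mul_comm]
  linarith

/-- Lower powers of the solution are controlled by the intrinsic scale. -/
theorem NSol.setIntegral_rpow_le {p ν L lam μ K s : ℝ} {v : ST n → Vec N} {Dv G : ST n → Mat N n}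
    {f : ST n → ℝ} (hμ : 0 < μ) (S : NSol p ν L lam v Dv G f)
    (hK : ∫ z, ‖v z‖ ^ p ≤ K * μ ^ p) (hs : 0 < s) (hsp : s ≤ p) (r : ℝ) :
    ∫ z in Metric.ball 0 r, ‖v z‖ ^ s
      ≤ (volume.real (Metric.ball (0 : ST n) r) + K) * μ ^ s := by
  have h := setIntegral_const_add_le (I := K * μ ^ s) (S.integrableOn_norm_rpow hs hsp r)
    (S.integrableOn_norm_rpow (S.hp.trans' one_pos) le_rfl r)
    (fun z => rpow_le_scaled hs.le hsp hμ (norm_nonneg (v z))) ?_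
  · linarith
  · have h2 : ∫ z in Metric.ball 0 r, ‖v z‖ ^ p ≤ K * μ ^ p :=
      (setIntegral_le_integral S.integrable_norm_rpow (Eventually.of_forall fun z => by
        simp only [Pi.zero_apply]; positivity)).trans hK
    refine (mul_le_mul_of_nonneg_left h2 (by positivity)).trans (le_of_eq ?_)
    rw [mul_left_comm, ← Real.rpow_add hμ, sub_add_cancel]

/-- The constant produced by the gluing lemma is comparable to the intrinsic scale. -/
theorem exists_norm_const_le {p K : ℝ} (hp : 1 < p) {φ : Spc n → ℝ} {r : ℝ} (hφ : Weight φ r)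
    (hr : 0 < r) :
    ∃ C : ℝ, 0 ≤ C ∧ ∀ (N : ℕ) (ν L lam μ : ℝ) (v : ST n → Vec N) (Dv G : ST n → Mat N n)
      (f : ST n → ℝ), 0 < μ → NSol p ν L lam v Dv G f → ∫ z, ‖v z‖ ^ p ≤ K * μ ^ p →
      ∀ (a : Vec N) (ε : ℝ),
      (∀ᵐ t : ℝ, t ∈ Ioo (-r) r → ‖(∫ x, φ x • J p (v (x, t))) - J p a‖ ≤ ε) →
      ‖a‖ ^ (p - 1) ≤ C * μ ^ (p - 1) + ε := by
  obtain ⟨Cφ, hCφ, hφle⟩ := hφ.exists_le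
  set V := volume.real (Metric.ball (0 : ST n) r) with hV
  refine ⟨max 0 (Cφ * (V + K) / (2 * r)), le_max_left _ _, fun N ν L lam μ v Dv G f hμ S hK a ε ha => ?_⟩
  have ip := S.integrableOn_norm_rpow (s := p - 1) (by linarith) (by linarith) r
  have hI := S.setIntegral_rpow_le hμ hK (s := p - 1) (by linarith) (by linarith) r
  have ip' := ip
  rw [IntegrableOn, restrict_ball_ST] at ip'
  have key : ∀ᵐ t : ℝ, t ∈ Ioo (-r) r →
      ‖a‖ ^ (p - 1) - ε ≤ Cφ * ∫ x in Metric.ball 0 r, ‖v (x, t)‖ ^ (p - 1) := by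
    filter_upwards [ha, ae_slice_integrableOn ip] with t h1 h2 ht
    have e1 := h1 ht
    have e2 : ‖∫ x, φ x • J p (v (x, t))‖
        ≤ ∫ x in Metric.ball 0 r, Cφ * ‖v (x, t)‖ ^ (p - 1) := by
      rw [← setIntegral_eq_integral_of_forall_compl_eq_zero (s := Metric.ball 0 r)
        fun x hx => by rw [hφ.zero x hx, zero_smul]]
      refine norm_integral_le_of_norm_le ((h2 ht).const_mul _) (Eventually.of_forall fun x => ?_)
      rw [norm_smul, norm_J hp, Real.norm_of_nonneg (hφ.nonneg x)]
      exact mul_le_mul_of_nonneg_right (hφle x) (by positivity)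
    rw [integral_const_mul] at e2
    have e3 : ‖J p a‖ ≤ ‖∫ x, φ x • J p (v (x, t))‖ + ε := by
      have := norm_sub_norm_le (J p a) (∫ x, φ x • J p (v (x, t)))
      rw [norm_sub_rev] at this
      linarith
    rw [norm_J hp] at e3
    linarith
  have h5 : 2 * r * (‖a‖ ^ (p - 1) - ε)
      ≤ Cφ * ∫ z in Metric.ball 0 r, ‖v z‖ ^ (p - 1) := by
    rw [restrict_ball_ST, integral_prod_symm _ ip', ← integral_const_mul]
    have := setIntegral_mono_on_ae (μ := volume) (s := Ioo (-r) r)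
      (f := fun _ => ‖a‖ ^ (p - 1) - ε)
      (g := fun t => Cφ * ∫ x in Metric.ball 0 r, ‖v (x, t)‖ ^ (p - 1))
      (integrableOn_const measure_Ioo_lt_top.ne) (ip'.integral_prod_right.const_mul _)
      measurableSet_Ioo key
    rw [setIntegral_const, smul_eq_mul, Measure.real, Real.volume_Ioo,
      ENNReal.toReal_ofReal (by linarith)] at this
    linarith
  have h6 := h5.trans (mul_le_mul_of_nonneg_left hI hCφ)
  have h7 : ‖a‖ ^ (p - 1) - ε ≤ Cφ * (V + K) / (2 * r) * μ ^ (p - 1) := by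
    rw [div_mul_eq_mul_div, le_div_iff₀ (by positivity)]
    linarith
  have := mul_le_mul_of_nonneg_right (le_max_right 0 (Cφ * (V + K) / (2 * r)))
    (Real.rpow_nonneg hμ.le (p - 1))
  linarith


section Asymptotics

variable {ι : Type*} {l : Filter ι} {a b c : ι → ℝ}

/-- Eventually bounded from above along a filter. -/
def Bdd (l : Filter ι) (a : ι → ℝ) : Prop := ∃ C : ℝ, ∀ᶠ i in l, a i ≤ C

/-- Eventually below every positive number along a filter. -/
def Small (l : Filter ι) (a : ι → ℝ) : Prop := ∀ η : ℝ, 0 < η → ∀ᶠ i in l, a i ≤ η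

theorem Bdd.exists_pos (h : Bdd l a) : ∃ C : ℝ, 0 < C ∧ ∀ᶠ i in l, a i ≤ C := by
  obtain ⟨C, hC⟩ := h
  exact ⟨max C 1, by positivity, hC.mono fun i hi => hi.trans (le_max_left _ _)⟩

theorem Bdd.mono (h : Bdd l b) (hab : ∀ᶠ i in l, a i ≤ b i) : Bdd l a := by
  obtain ⟨C, hC⟩ := h
  exact ⟨C, by filter_upwards [hC, hab] with i h1 h2 using h2.trans h1⟩

theorem Bdd.add (ha : Bdd l a) (hb : Bdd l b) : Bdd l fun i => a i + b i := by
  obtain ⟨A, hA⟩ := ha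
  obtain ⟨B, hB⟩ := hb
  exact ⟨A + B, by filter_upwards [hA, hB] with i h1 h2 using add_le_add h1 h2⟩

theorem Bdd.const (C : ℝ) : Bdd l fun _ => C := ⟨C, Eventually.of_forall fun _ => le_rfl⟩

theorem Bdd.const_mul (ha : Bdd l a) {C : ℝ} (hC : 0 ≤ C) : Bdd l fun i => C * a i := by
  obtain ⟨A, hA⟩ := ha
  exact ⟨C * A, by filter_upwards [hA] with i h1 using mul_le_mul_of_nonneg_left h1 hC⟩

theorem Bdd.rpow (ha : Bdd l a) (h0 : ∀ i, 0 ≤ a i) {s : ℝ} (hs : 0 ≤ s) :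
    Bdd l fun i => a i ^ s := by
  obtain ⟨A, hA⟩ := ha
  exact ⟨A ^ s, by filter_upwards [hA] with i h1 using Real.rpow_le_rpow (h0 i) h1 hs⟩

theorem Small.bdd (h : Small l a) : Bdd l a := ⟨1, h 1 one_pos⟩

theorem Small.mono (h : Small l b) (hab : ∀ᶠ i in l, a i ≤ b i) : Small l a := fun η hη => by
  filter_upwards [h η hη, hab] with i h1 h2 using h2.trans h1

theorem Small.of_interp (h : ∀ η : ℝ, 0 < η → ∃ C : ℝ, 0 ≤ C ∧ ∀ᶠ i in l, a i ≤ η * b i + C * c i)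
    (hb : Bdd l b) (hc : Small l c) : Small l a := fun η hη => by
  obtain ⟨B, hB, hB'⟩ := hb.exists_pos
  obtain ⟨C, hC, hC'⟩ := h (η / (2 * B)) (by positivity)
  filter_upwards [hB', hC', hc (η / (2 * (C + 1))) (by positivity)] with i h1 h2 h3
  have e1 : η / (2 * B) * b i ≤ η / 2 := by
    refine (mul_le_mul_of_nonneg_left h1 (by positivity)).trans (le_of_eq ?_)
    field_simp
  have e2 : C * c i ≤ η / 2 := by
    refine (mul_le_mul_of_nonneg_left h3 hC).trans ?_
    rw [mul_div_assoc', div_le_iff₀ (by positivity)]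
    nlinarith
  linarith

theorem Small.add (ha : Small l a) (hb : Small l b) : Small l fun i => a i + b i := fun η hη => by
  filter_upwards [ha (η / 2) (by positivity), hb (η / 2) (by positivity)] with i h1 h2
  linarith

theorem Small.const_mul (ha : Small l a) {C : ℝ} (hC : 0 ≤ C) : Small l fun i => C * a i :=
  Small.of_interp (b := fun _ => 0) (fun _ _ => ⟨C, hC, Eventually.of_forall fun i => by simp⟩)
    (Bdd.const 0) ha

theorem Small.rpow (ha : Small l a) (h0 : ∀ i, 0 ≤ a i) {s : ℝ} (hs : 0 < s) :
    Small l fun i => a i ^ s := fun η hη => by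
  filter_upwards [ha (η ^ (1 / s)) (by positivity)] with i h1
  refine (Real.rpow_le_rpow (h0 i) h1 hs.le).trans (le_of_eq ?_)
  rw [← Real.rpow_mul hη.le, one_div_mul_cancel hs.ne', Real.rpow_one]

end Asymptotics

/-- The cutoff function equal to one in the ball of radius `r` and supported in the ball of
radius `R`. -/
def bmp (n : ℕ) {r R : ℝ} (hr : 0 < r) (hR : r < R) : ContDiffBump (0 : ST n) := ⟨r, R, hr, hR⟩

/-- The spatial bump underlying the averaging weight. -/
def wtBump (n : ℕ) : ContDiffBump (0 : Spc n) := ⟨11 / 10, 6 / 5, by norm_num, by norm_num⟩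

/-- The averaging weight. -/
def wt (n : ℕ) : Spc n → ℝ := (wtBump n).normed volume

theorem wt_weight {r : ℝ} (hr : 6 / 5 ≤ r) : Weight (wt n) r :=
  Weight.mono (r := 6 / 5) ⟨(wtBump n).continuous_normed, fun x => (wtBump n).nonneg_normed x,
    fun x hx => by
      by_contra h
      exact hx ((wtBump n).support_normed_eq (μ := volume) ▸ h),
    (wtBump n).integral_normed⟩ hr

theorem exists_le_wt (n : ℕ) : ∃ c : ℝ, 0 < c ∧ ∀ x ∈ Metric.ball 0 (11 / 10), c ≤ wt n x := by
  refine ⟨1 / ∫ x, wtBump n x, one_div_pos.2 (wtBump n).integral_pos, fun x hx => le_of_eq ?_⟩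
  rw [wt, ContDiffBump.normed_def,
    (wtBump n).one_of_mem_closedBall (Metric.ball_subset_closedBall hx)]

theorem contDiff_wt (n : ℕ) : ContDiff ℝ (⊤ : ℕ∞) (wt n) := (wtBump n).contDiff_normed

theorem tsupport_wt (n : ℕ) : tsupport (wt n) = Metric.closedBall 0 (6 / 5) :=
  (wtBump n).tsupport_normed_eq

theorem exists_gradS_wt_le (n : ℕ) :
    ∃ M : ℝ, 0 ≤ M ∧ ∀ z, ‖gradS (fun z : ST n => wt n z.1) z‖ ≤ M := by
  have hc : ContDiff ℝ (⊤ : ℕ∞) fun z : ST n => wt n z.1 := (contDiff_wt n).comp contDiff_fst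
  have h1 : ∀ z : ST n, gradS (fun z : ST n => wt n z.1) z
      = gradS (fun z : ST n => wt n z.1) (z.1, 0) := fun z => by
    have hd : ∀ z : ST n, fderiv ℝ (fun z : ST n => wt n z.1) z
        = (fderiv ℝ (wt n) z.1).comp (ContinuousLinearMap.fst ℝ (Spc n) ℝ) := fun z =>
      (((contDiff_wt n).differentiable (by simp) z.1).hasFDerivAt.comp z
        hasFDerivAt_fst).fderiv
    ext j
    simp [gradS, hd]
  set g : Spc n → Spc n := fun x => gradS (fun z : ST n => wt n z.1) (x, 0) with hg
  have hgc : Continuous g :=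
    (continuous_gradS (hc.of_le (by norm_cast))).comp
      (Continuous.prodMk continuous_id continuous_const)
  have hgs : HasCompactSupport g := by
    refine HasCompactSupport.intro (isCompact_closedBall (0 : Spc n) (6 / 5)) fun x hx => ?_
    refine gradS_eq_zero fun hmem => hx ?_
    have : tsupport (fun z : ST n => wt n z.1) ⊆ Prod.fst ⁻¹' tsupport (wt n) :=
      closure_minimal (fun z hz => subset_tsupport _ hz)
        ((isClosed_tsupport _).preimage continuous_fst)
    have h := this hmem
    rwa [tsupport_wt] at h
  obtain ⟨C, hC⟩ := hgc.bounded_above_of_compact_support hgs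
  exact ⟨max C 0, le_max_right _ _, fun z => by
    rw [h1 z]; exact (hC z.1).trans (le_max_left _ _)⟩

/-- Normalized solutions satisfying the intrinsic coupling. -/
structure Conf (n : ℕ) (p ν L K κ : ℝ) where
  N : ℕ
  μ : ℝ
  v : ST n → Vec N
  Dv : ST n → Mat N n
  G : ST n → Mat N n
  f : ST n → ℝ
  μpos : 0 < μ
  sol : NSol p ν L (μ ^ (p - 2)) v Dv G f
  nondeg : κ ≤ (∫ z in Metric.ball 0 1, ‖Dv z‖ ^ p) + ∫ z, f z ^ p
  sub : ∫ z, ‖v z‖ ^ p ≤ K * μ ^ p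
  sup : μ ^ p * (∫ z, ‖Dv z‖ ^ p) ≤ K * (∫ z in Metric.ball 0 1, ‖v z‖ ^ p) ∨ μ ^ p ≤ K
  sup' : μ ^ p * κ ≤ K * (∫ z in Metric.ball 0 1, ‖v z‖ ^ p) ∨ μ ^ p ≤ K

section Families

variable {p ν L K κ : ℝ}

/-- The quantity which is to be bounded from below. -/
def Conf.defect (c : Conf n p ν L K κ) : ℝ := (∫ z, ‖c.Dv z‖) + ∫ z, c.f z ^ p

variable {l : Filter (Conf n p ν L K κ)}

theorem Conf.integral_f_nonneg (c : Conf n p ν L K κ) : 0 ≤ ∫ z, c.f z ^ p :=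
  integral_nonneg fun z => Real.rpow_nonneg (c.sol.fnonneg z) _

theorem small_f (hl : Small l Conf.defect) : Small l fun c => ∫ z, c.f z ^ p :=
  hl.mono (Eventually.of_forall fun _ => le_add_of_nonneg_left
    (integral_nonneg fun _ => norm_nonneg _))

theorem small_Dv (hl : Small l Conf.defect) (r : ℝ) :
    Small l fun c => ∫ z in Metric.ball 0 r, ‖c.Dv z‖ :=
  hl.mono (Eventually.of_forall fun c => (setIntegral_le_integral c.sol.integrable_Dv.norm
    (Eventually.of_forall fun _ => norm_nonneg _)).trans
      (le_add_of_nonneg_right c.integral_f_nonneg))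

theorem Conf.setIntegral_v_le (c : Conf n p ν L K κ) (r : ℝ) :
    ∫ z in Metric.ball 0 r, ‖c.v z‖ ^ p ≤ K * c.μ ^ p :=
  (setIntegral_le_integral c.sol.integrable_norm_rpow (Eventually.of_forall fun z => by
    simp only [Pi.zero_apply]; positivity)).trans c.sub

theorem bdd_Dv (hp : 1 < p) (hν : 0 < ν) (hL : 0 ≤ L) (hK : 0 ≤ K) (hl : Small l Conf.defect) :
    Bdd l fun c => ∫ z in Metric.ball 0 (19 / 10), ‖c.Dv z‖ ^ p := by
  have h1 : (0:ℝ) < 19 / 10 := by norm_num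
  have h2 : (19 / 10 : ℝ) < 39 / 20 := by norm_num
  obtain ⟨C, hC, hcac⟩ := exists_cacc_ball (bmp n h1 h2) (by norm_num [bmp]) hp hν hL
  have hp0 : 0 < p := by linarith
  have hb : Bdd l fun c => K * K + C * ((∫ z, c.f z ^ p) + K * (K + (K ^ (1 / p)) ^ (2 : ℝ))) :=
    (Bdd.const _).add (((small_f hl).bdd.add (Bdd.const _)).const_mul hC)
  refine hb.mono (Eventually.of_forall fun c => ?_)
  have hf := c.integral_f_nonneg
  have e0 : 0 ≤ C * ((∫ z, c.f z ^ p) + K * (K + (K ^ (1 / p)) ^ (2 : ℝ))) := by positivity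
  have hμ := c.μpos
  rcases c.sup with h | h
  · have hμp : 0 < c.μ ^ p := by positivity
    have e1 : c.μ ^ p * (∫ z, ‖c.Dv z‖ ^ p) ≤ c.μ ^ p * (K * K) := by
      refine h.trans ((mul_le_mul_of_nonneg_left (c.setIntegral_v_le 1) hK).trans (le_of_eq ?_))
      ring
    have e2 := le_of_mul_le_mul_left e1 hμp
    have e3 : ∫ z in Metric.ball 0 (19 / 10), ‖c.Dv z‖ ^ p ≤ ∫ z, ‖c.Dv z‖ ^ p :=
      setIntegral_le_integral c.sol.integrable_Dv_rpow (Eventually.of_forall fun z => by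
        simp only [Pi.zero_apply]; positivity)
    linarith
  · have e1 := (hcac _ _ _ _ _ _ c.sol 0).1
    have e2 := NSol.caccRHS_zero_le hμ c.sol c.sub (bmp n h1 h2)
      (show 2 ≤ mexp p by have := four_le_mexp p; omega)
    have e3 : c.μ ≤ K ^ (1 / p) := by
      have := Real.rpow_le_rpow (by positivity) h (by positivity : 0 ≤ 1 / p)
      rwa [← Real.rpow_mul hμ.le, mul_one_div_cancel hp0.ne', Real.rpow_one] at this
    have e4 : c.μ ^ (2 : ℝ) ≤ (K ^ (1 / p)) ^ (2 : ℝ) := Real.rpow_le_rpow hμ.le e3 (by norm_num)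
    have e5 : caccRHS p (c.μ ^ (p - 2)) (bmp n h1 h2) (mexp p) c.v c.f 0
        ≤ (∫ z, c.f z ^ p) + K * (K + (K ^ (1 / p)) ^ (2 : ℝ)) :=
      e2.trans (add_le_add_right (mul_le_mul_of_nonneg_left (add_le_add h e4) hK) _)
    have e6 := mul_le_mul_of_nonneg_left e5 hC
    have : (0:ℝ) ≤ K * K := by positivity
    simp only [bmp] at e1
    simp only [bmp] at e6
    linarith

theorem small_Dv_rpow (hl : Small l Conf.defect)
    (hD : Bdd l fun c => ∫ z in Metric.ball 0 (19 / 10), ‖c.Dv z‖ ^ p) {s : ℝ} (hs : 0 < s)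
    (hsp : s < p) : Small l fun c => ∫ z in Metric.ball 0 (19 / 10), ‖c.Dv z‖ ^ s := by
  refine Small.of_interp (b := fun c => volume.real (Metric.ball (0 : ST n) (19 / 10))
    + ∫ z in Metric.ball 0 (19 / 10), ‖c.Dv z‖ ^ p) (fun η hη => ?_) ((Bdd.const _).add hD)
    (small_Dv hl (19 / 10))
  obtain ⟨C, hC, h⟩ := exists_rpow_le_interp hs hsp hη
  refine ⟨C, hC, Eventually.of_forall fun c => ?_⟩
  have i1 : IntegrableOn (fun z => η * ‖c.Dv z‖ ^ p) (Metric.ball 0 (19 / 10)) volume :=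
    (c.sol.integrable_Dv_rpow.const_mul η).integrableOn
  have i2 : IntegrableOn (fun z => C * ‖c.Dv z‖) (Metric.ball 0 (19 / 10)) volume :=
    (c.sol.integrable_Dv.norm.const_mul C).integrableOn
  have i3 : IntegrableOn (fun z => η * ‖c.Dv z‖ ^ p + C * ‖c.Dv z‖)
    (Metric.ball 0 (19 / 10)) volume := i1.add i2
  have := setIntegral_const_add_le (C := 1) (η := η)
    (I := η * (∫ z in Metric.ball 0 (19 / 10), ‖c.Dv z‖ ^ p)
      + C * ∫ z in Metric.ball 0 (19 / 10), ‖c.Dv z‖)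
    (c.sol.integrableOn_rpow hs hsp.le 0 _).1 i3
    (fun z => by have := h ‖c.Dv z‖ (norm_nonneg _); linarith)
    (by rw [integral_add i1 i2, integral_const_mul, integral_const_mul, one_mul])
  linarith

theorem small_G (hp : 1 < p) (hL : 0 ≤ L) (hl : Small l Conf.defect)
    (hD : Bdd l fun c => ∫ z in Metric.ball 0 (19 / 10), ‖c.Dv z‖ ^ p) :
    Small l fun c => ∫ z in Metric.ball 0 (17 / 10), ‖c.G z‖ := by
  have h1 : Small l fun c => ∫ z in Metric.ball 0 (19 / 10), c.f z ^ (p - 1) := by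
    refine Small.of_interp (b := fun _ => volume.real (Metric.ball (0 : ST n) (19 / 10)))
      (fun η hη => ?_) (Bdd.const _) (small_f hl)
    obtain ⟨C, hC, h⟩ := exists_rpow_sub_one_le hp hη
    refine ⟨C, hC, Eventually.of_forall fun c => ?_⟩
    have hfm : MemLp c.f (ENNReal.ofReal p) (volume.restrict (Metric.ball 0 (19 / 10))) :=
      c.sol.memf.restrict _
    refine setIntegral_const_add_le ?_ c.sol.integrable_f_rpow.integrableOn
      (fun z => h _ (c.sol.fnonneg z))
      (mul_le_mul_of_nonneg_left (setIntegral_le_integral c.sol.integrable_f_rpow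
        (Eventually.of_forall fun z => Real.rpow_nonneg (c.sol.fnonneg z) _)) hC)
    have i1 : IntegrableOn (fun _ : ST n => η) (Metric.ball 0 (19 / 10)) volume :=
      integrableOn_const measure_ball_lt_top.ne
    have i2 : IntegrableOn (fun z => η + C * c.f z ^ p) (Metric.ball 0 (19 / 10)) volume :=
      i1.add (c.sol.integrable_f_rpow.const_mul C).integrableOn
    refine i2.mono' (c.sol.measf.pow_const _).aestronglyMeasurable
      (Eventually.of_forall fun z => ?_)
    rw [Real.norm_of_nonneg (Real.rpow_nonneg (c.sol.fnonneg z) _)]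
    exact h _ (c.sol.fnonneg z)
  refine (((small_Dv_rpow hl hD (by linarith : 0 < p - 1) (by linarith)).const_mul hL).add h1).mono
    (Eventually.of_forall fun c => ?_)
  have i1 : IntegrableOn (fun z => L * ‖c.Dv z‖ ^ (p - 1)) (Metric.ball 0 (19 / 10)) volume :=
    ((c.sol.integrableOn_rpow (by linarith : 0 < p - 1) (by linarith) 0 _).1).const_mul L
  have i2 : IntegrableOn (fun z => c.f z ^ (p - 1)) (Metric.ball 0 (19 / 10)) volume := by
    have i1 : IntegrableOn (fun _ : ST n => (1:ℝ)) (Metric.ball 0 (19 / 10)) volume :=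
      integrableOn_const measure_ball_lt_top.ne
    have i2 : IntegrableOn (fun z => 1 + c.f z ^ p) (Metric.ball 0 (19 / 10)) volume :=
      i1.add c.sol.integrable_f_rpow.integrableOn
    refine i2.mono' (c.sol.measf.pow_const _).aestronglyMeasurable
      (Eventually.of_forall fun z => ?_)
    rw [Real.norm_of_nonneg (Real.rpow_nonneg (c.sol.fnonneg z) _)]
    have := rpow_le_scaled (s := p - 1) (p := p) (by linarith) (by linarith) one_pos
      (c.sol.fnonneg z)
    simpa using this
  have i3 : IntegrableOn (fun z => L * ‖c.Dv z‖ ^ (p - 1) + c.f z ^ (p - 1))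
    (Metric.ball 0 (19 / 10)) volume := i1.add i2
  have e0 : ∫ z in Metric.ball 0 (17 / 10), ‖c.G z‖
      ≤ ∫ z in Metric.ball 0 (17 / 10), (L * ‖c.Dv z‖ ^ (p - 1) + c.f z ^ (p - 1)) :=
    integral_mono_of_nonneg (Eventually.of_forall fun _ => norm_nonneg _)
      (i3.mono_set (Metric.ball_subset_ball (by norm_num))) (ae_restrict_of_ae c.sol.growth)
  refine (e0.trans (setIntegral_mono_set i3 (Eventually.of_forall fun z => ?_)
    (Metric.ball_subset_ball (by norm_num)).eventuallyLE)).trans (le_of_eq ?_)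
  · have := c.sol.fnonneg z
    simp only [Pi.zero_apply]; positivity
  · rw [integral_add i1 i2, integral_const_mul]

/-- The scaling parameter stays away from zero. -/
theorem exists_le_mu (hp : 1 < p) (hν : 0 < ν) (hL : 0 ≤ L) (hK : 0 ≤ K) (hκ : 0 < κ)
    (hl : Small l Conf.defect) : ∃ c₀ : ℝ, 0 < c₀ ∧ ∀ᶠ c in l, c₀ ≤ c.μ := by
  have h1 : (0:ℝ) < 1 := by norm_num
  have h2 : (1 : ℝ) < 3 / 2 := by norm_num
  obtain ⟨C, hC, hcac⟩ := exists_cacc_ball (bmp n h1 h2) (by norm_num [bmp]) hp hν hL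
  refine ⟨min 1 (κ / (8 * (C * K + 1))), by positivity, ?_⟩
  filter_upwards [((small_f hl).const_mul (by positivity : 0 ≤ C + 1)) (κ / 4) (by positivity)]
    with c hc
  by_contra! hlt
  have hμ := c.μpos
  have e1 := (hcac _ _ _ _ _ _ c.sol 0).1
  have e2 := mul_le_mul_of_nonneg_left (NSol.caccRHS_zero_le hμ c.sol c.sub (bmp n h1 h2)
    (show 2 ≤ mexp p by have := four_le_mexp p; omega)) hC
  have hμ1 : c.μ ≤ 1 := hlt.le.trans (min_le_left _ _)
  have e3 : c.μ ^ p ≤ c.μ := by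
    simpa using Real.rpow_le_rpow_of_exponent_ge hμ hμ1 hp.le
  have e4 : c.μ ^ (2 : ℝ) ≤ c.μ := by
    simpa using Real.rpow_le_rpow_of_exponent_ge hμ hμ1 (by norm_num : (1:ℝ) ≤ 2)
  have e5 : c.μ * (8 * (C * K + 1)) ≤ κ :=
    (le_div_iff₀ (by positivity)).1 (hlt.le.trans (min_le_right _ _))
  have e6 := c.nondeg
  have e7 := mul_le_mul_of_nonneg_left (add_le_add e3 e4) (mul_nonneg hC hK)
  simp only [bmp] at e1 e2
  nlinarith

end Families


section Families

variable {p ν L K κ : ℝ}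

/-- The deviation of a solution from its slicewise means. -/
def Conf.osc (c : Conf n p ν L K κ) (r : ℝ) : ℝ :=
  ∫ z in Metric.ball 0 r, ‖c.v z - mean (wt n) c.v z.2‖ ^ p

/-- The error in the gluing lemma. -/
def Conf.eps (c : Conf n p ν L K κ) (M : ℝ) : ℝ :=
  c.μ ^ (p - 2) * (M * ∫ z in Metric.ball 0 (17 / 10), ‖c.G z‖)

theorem Conf.eps_nonneg (c : Conf n p ν L K κ) {M : ℝ} (hM : 0 ≤ M) : 0 ≤ c.eps M :=
  mul_nonneg (Real.rpow_nonneg c.μpos.le _)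
    (mul_nonneg hM (integral_nonneg fun _ => norm_nonneg _))

theorem Conf.osc_nonneg (c : Conf n p ν L K κ) (r : ℝ) : 0 ≤ c.osc r :=
  integral_nonneg fun z => by simp only [Pi.zero_apply]; positivity

/-- The constants provided by the gluing lemma. -/
def Conf.Glued (c : Conf n p ν L K κ) (M : ℝ) (a : Vec c.N) : Prop :=
  ∀ᵐ t : ℝ, t ∈ Ioo (-(17 / 10)) (17 / 10) →
    ‖(∫ x, wt n x • J p (c.v (x, t))) - J p a‖ ≤ c.eps M

theorem Conf.Glued.mono {c : Conf n p ν L K κ} {M : ℝ} {a : Vec c.N} (h : c.Glued M a) {r : ℝ}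
    (hr : r ≤ 17 / 10) :
    ∀ᵐ t : ℝ, t ∈ Ioo (-r) r → ‖(∫ x, wt n x • J p (c.v (x, t))) - J p a‖ ≤ c.eps M :=
  Filter.Eventually.mono h fun _ ht htr => ht ⟨by linarith [htr.1], by linarith [htr.2]⟩

theorem exists_glued (hp : 1 < p) : ∃ M : ℝ, 0 ≤ M ∧
    ∃ a : (c : Conf n p ν L K κ) → Vec c.N, ∀ c : Conf n p ν L K κ, c.Glued M (a c) := by
  obtain ⟨M, hM, h⟩ := exists_gradS_wt_le n
  refine ⟨M, hM, ?_⟩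
  have : ∀ c : Conf n p ν L K κ, ∃ a : Vec c.N, c.Glued M a := fun c => by
    obtain ⟨Y, hY⟩ := c.sol.gluing (contDiff_wt n) (T := 17 / 10)
      (by rw [tsupport_wt]; exact Metric.closedBall_subset_ball (by norm_num)) (by norm_num)
      (by norm_num) h
    obtain ⟨a, rfl⟩ := exists_J_eq hp Y
    exact ⟨a, hY⟩
  choose a ha using this
  exact ⟨a, ha⟩

variable {l : Filter (Conf n p ν L K κ)} {M : ℝ} {a : (c : Conf n p ν L K κ) → Vec c.N}

theorem small_eps (hM : 0 ≤ M)
    (hG : Small l fun c => ∫ z in Metric.ball 0 (17 / 10), ‖c.G z‖) {c₀ : ℝ} (hc₀ : 0 < c₀)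
    (hμ : ∀ᶠ c in l, c₀ ≤ c.μ) : Small l fun c => c.eps M * c.μ ^ (1 - p) := by
  refine (hG.const_mul (by positivity : 0 ≤ M / c₀)).mono (hμ.mono fun c hc => ?_)
  have hI : 0 ≤ ∫ z in Metric.ball 0 (17 / 10), ‖c.G z‖ := integral_nonneg fun _ => norm_nonneg _
  have e : c.eps M * c.μ ^ (1 - p) = M * (∫ z in Metric.ball 0 (17 / 10), ‖c.G z‖) * c.μ⁻¹ := by
    rw [Conf.eps, mul_right_comm, ← Real.rpow_add c.μpos,
      show p - 2 + (1 - p) = -1 by ring, Real.rpow_neg_one]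
    ring
  rw [e, div_mul_eq_mul_div, div_eq_mul_inv]
  exact mul_le_mul_of_nonneg_left (inv_anti₀ hc₀ hc) (by positivity)

theorem exists_norm_le (hp : 1 < p) (ha : ∀ c : Conf n p ν L K κ, c.Glued M (a c))
    (he : Small l fun c => c.eps M * c.μ ^ (1 - p)) :
    ∃ B : ℝ, 0 < B ∧ ∀ᶠ c in l, ‖a c‖ ≤ B * c.μ := by
  obtain ⟨C, hC, h⟩ := exists_norm_const_le (K := K) hp (wt_weight (n := n) le_rfl) (by norm_num)
  refine ⟨(C + 1) ^ (1 / (p - 1)), by positivity, ?_⟩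
  filter_upwards [he 1 one_pos] with c hc
  have hμ := c.μpos
  have h1 := h _ _ _ _ _ _ _ _ _ hμ c.sol c.sub (a c) (c.eps M) ((ha c).mono (by norm_num))
  have h2 : c.eps M ≤ c.μ ^ (p - 1) := by
    have := mul_le_mul_of_nonneg_right hc (Real.rpow_nonneg hμ.le (p - 1))
    rwa [mul_assoc, ← Real.rpow_add hμ, show 1 - p + (p - 1) = 0 by ring, Real.rpow_zero, mul_one,
      one_mul] at this
  have h3 : ‖a c‖ ^ (p - 1) ≤ (C + 1) * c.μ ^ (p - 1) := by linarith
  have hp1 : 0 < p - 1 := by linarith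
  have h4 := Real.rpow_le_rpow (by positivity) h3 (by positivity : 0 ≤ 1 / (p - 1))
  rwa [Real.mul_rpow (by positivity) (by positivity), ← Real.rpow_mul (norm_nonneg _),
    ← Real.rpow_mul hμ.le, mul_one_div_cancel hp1.ne', Real.rpow_one, Real.rpow_one] at h4

theorem Conf.integrableOn_osc (hp : 1 < p) (c : Conf n p ν L K κ) {r : ℝ} (hr : 6 / 5 ≤ r)
    (hr' : r ≤ 17 / 10) :
    IntegrableOn (fun z => ‖c.v z - mean (wt n) c.v z.2‖ ^ p) (Metric.ball 0 r) volume := by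
  obtain ⟨C, _, h⟩ := exists_poincare (r' := 19 / 10) (wt_weight (n := n) hr) (by linarith)
    (by linarith) (by norm_num) hp
  exact (h _ _ _ _ _ _ _ _ c.sol).1

theorem bdd_osc (hp : 1 < p) (hD : Bdd l fun c => ∫ z in Metric.ball 0 (19 / 10), ‖c.Dv z‖ ^ p)
    {r : ℝ} (hr : 6 / 5 ≤ r) (hr' : r ≤ 17 / 10) : Bdd l fun c => c.osc r := by
  obtain ⟨C, hC, h⟩ := exists_poincare (r' := 19 / 10) (wt_weight (n := n) hr) (by linarith)
    (by linarith) (by norm_num) hp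
  exact (hD.const_mul hC).mono (Eventually.of_forall fun c => (h _ _ _ _ _ _ _ _ c.sol).2)

theorem small_osc (hp : 1 < p) (hl : Small l Conf.defect)
    (hD : Bdd l fun c => ∫ z in Metric.ball 0 (19 / 10), ‖c.Dv z‖ ^ p) {S : ℝ} (hS : 0 ≤ S)
    (h : ∀ᶠ c in l, ∀ᵐ t : ℝ, t ∈ Ioo (-(8 / 5)) (8 / 5) →
      ∫ x in Metric.ball (0 : Spc n) (8 / 5), ‖c.v (x, t) - mean (wt n) c.v t‖ ≤ S)
    {r : ℝ} (hr : 0 < r) (hr' : r < 8 / 5) : Small l fun c => c.osc r := by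
  refine Small.of_interp (fun η hη => ?_) hD (small_Dv hl (19 / 10))
  obtain ⟨C, hC, hp⟩ := exists_poincare_small (r' := 19 / 10)
    (wt_weight (n := n) (by norm_num : 6 / 5 ≤ (8 / 5 : ℝ))) hr hr' (by norm_num) (by norm_num)
    hp hη
  exact ⟨C * S ^ (p - 1), by positivity, h.mono fun c hc => hp _ _ _ _ _ _ _ _ c.sol S hS hc⟩

theorem small_weighted (hp : 1 < p) (hM : 0 ≤ M) (ha : ∀ c : Conf n p ν L K κ, c.Glued M (a c))
    (he : Small l fun c => c.eps M * c.μ ^ (1 - p)) {B : ℝ}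
    (haB : ∀ᶠ c in l, ‖a c‖ ≤ B * c.μ) (hB : 0 ≤ B) (hK : 0 ≤ K)
    (hX : Small l fun c => c.osc (6 / 5) * c.μ ^ (-p)) :
    Small l fun c => c.μ ^ (-p) * ∫ z in Metric.ball 0 (6 / 5), wt n z.1 * bdry p (c.v z) (a c) := by
  set V := volume.real (Metric.ball (0 : ST n) (6 / 5)) with hV
  have hV0 : 0 ≤ V := measureReal_nonneg
  refine Small.of_interp (b := fun _ => K + B ^ p)
    (c := fun c => c.osc (6 / 5) * c.μ ^ (-p) + (V + K + B) * (c.eps M * c.μ ^ (1 - p)))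
    (fun σ hσ => ?_) (Bdd.const _) (hX.add (he.const_mul (by positivity)))
  obtain ⟨C, hC, h⟩ := exists_weighted_bdry_le hp (wt_weight (n := n) le_rfl) (by norm_num) hσ
  refine ⟨C, hC, haB.mono fun c hc => ?_⟩
  have hμ := c.μpos
  have h1 := h _ _ _ _ _ _ _ _ c.sol (c.integrableOn_osc hp le_rfl (by norm_num)) (a c)
    (c.eps M) (c.eps_nonneg hM) ((ha c).mono (by norm_num))
  have h2 := c.setIntegral_v_le (6 / 5)
  have h3 : ‖a c‖ ^ p ≤ B ^ p * c.μ ^ p := by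
    rw [← Real.mul_rpow hB hμ.le]
    exact Real.rpow_le_rpow (norm_nonneg _) hc (by linarith)
  have h4 : ∫ z in Metric.ball 0 (6 / 5), ‖c.v z‖ ≤ (V + K) * c.μ := by
    have := NSol.setIntegral_rpow_le hμ c.sol c.sub one_pos hp.le (6 / 5)
    simpa only [Real.rpow_one] using this
  have h5 : c.eps M * ((∫ z in Metric.ball 0 (6 / 5), ‖c.v z‖) + ‖a c‖)
      ≤ c.eps M * ((V + K + B) * c.μ) :=
    mul_le_mul_of_nonneg_left (by linarith) (c.eps_nonneg hM)
  have h6 : ∫ z in Metric.ball 0 (6 / 5), wt n z.1 * bdry p (c.v z) (a c)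
      ≤ σ * ((K + B ^ p) * c.μ ^ p) + C * c.osc (6 / 5) + C * (c.eps M * ((V + K + B) * c.μ)) := by
    refine h1.trans (add_le_add (add_le_add_left (mul_le_mul_of_nonneg_left ?_ hσ.le) _)
      (mul_le_mul_of_nonneg_left h5 hC))
    linarith
  have e1 : c.μ ^ (-p) * c.μ ^ p = 1 := by
    rw [← Real.rpow_add hμ, neg_add_cancel, Real.rpow_zero]
  have e2 : c.μ ^ (-p) * c.μ = c.μ ^ (1 - p) := by
    rw [← Real.rpow_add_one hμ.ne']; congr 1; ring
  refine (mul_le_mul_of_nonneg_left h6 (Real.rpow_nonneg hμ.le _)).trans (le_of_eq ?_)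
  rw [← e2]
  linear_combination σ * (K + B ^ p) * e1

theorem small_bdry (hp : 1 < p)
    (h : Small l fun c => c.μ ^ (-p)
      * ∫ z in Metric.ball 0 (6 / 5), wt n z.1 * bdry p (c.v z) (a c)) :
    Small l fun c => c.μ ^ (-p) * ∫ z in Metric.ball 0 (11 / 10), bdry p (c.v z) (a c) := by
  obtain ⟨k, hk, hk'⟩ := exists_le_wt n
  obtain ⟨Cφ, hCφ, hφle⟩ := (wt_weight (n := n) le_rfl).exists_le
  refine (h.const_mul (by positivity : 0 ≤ k⁻¹)).mono (Eventually.of_forall fun c => ?_)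
  have hμ := c.μpos
  have ib : IntegrableOn (fun z => bdry p (c.v z) (a c)) (Metric.ball 0 (6 / 5)) volume :=
    c.sol.integrableOn_bdry (a c) _
  have hw0 : ∀ x, 0 ≤ wt n x := (wt_weight (n := n) le_rfl).nonneg
  have iw : IntegrableOn (fun z => wt n z.1 * bdry p (c.v z) (a c)) (Metric.ball 0 (6 / 5))
      volume := by
    refine (ib.const_mul Cφ).mono' (((contDiff_wt n).continuous.comp
      continuous_fst).aestronglyMeasurable.mul ib.aestronglyMeasurable)
      (Eventually.of_forall fun z => ?_)
    rw [Real.norm_of_nonneg (mul_nonneg (hw0 _) (bdry_nonneg hp _ _))]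
    exact mul_le_mul_of_nonneg_right (hφle _) (bdry_nonneg hp _ _)
  have hsub : Metric.ball (0 : ST n) (11 / 10) ⊆ Metric.ball 0 (6 / 5) :=
    Metric.ball_subset_ball (by norm_num)
  have e1 : k * ∫ z in Metric.ball 0 (11 / 10), bdry p (c.v z) (a c)
      ≤ ∫ z in Metric.ball 0 (6 / 5), wt n z.1 * bdry p (c.v z) (a c) := by
    rw [← integral_const_mul]
    refine (setIntegral_mono_on ((ib.mono_set hsub).const_mul k) (iw.mono_set hsub)
      Metric.isOpen_ball.measurableSet fun z hz => ?_).trans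
      (setIntegral_mono_set iw (Eventually.of_forall fun z =>
        mul_nonneg (hw0 _) (bdry_nonneg hp _ _)) hsub.eventuallyLE)
    exact mul_le_mul_of_nonneg_right (hk' _ (mem_ball_ST.1 hz).1) (bdry_nonneg hp _ _)
  have e2 : ∫ z in Metric.ball 0 (11 / 10), bdry p (c.v z) (a c)
      ≤ k⁻¹ * ∫ z in Metric.ball 0 (6 / 5), wt n z.1 * bdry p (c.v z) (a c) := by
    rw [inv_mul_eq_div, le_div_iff₀ hk]; linarith
  refine (mul_le_mul_of_nonneg_left e2 (Real.rpow_nonneg hμ.le (-p))).trans (le_of_eq ?_)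
  ring

theorem small_sub_const (hp : 1 < p) {B : ℝ}
    (haB : ∀ᶠ c in l, ‖a c‖ ≤ B * c.μ) (hB : 0 ≤ B)
    (h : Small l fun c => c.μ ^ (-p) * ∫ z in Metric.ball 0 (11 / 10), bdry p (c.v z) (a c)) :
    Small l fun c => c.μ ^ (-p) * ∫ z in Metric.ball 0 (11 / 10), ‖c.v z - a c‖ ^ p := by
  set V := volume.real (Metric.ball (0 : ST n) (11 / 10)) with hV
  have hV0 : 0 ≤ V := measureReal_nonneg
  refine Small.of_interp (b := fun _ => K + V * B ^ p) (fun η hη => ?_) (Bdd.const _) h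
  obtain ⟨C, hC, hle⟩ := exists_norm_sub_rpow_le hp hη
  refine ⟨C, hC, haB.mono fun c hc => ?_⟩
  have hμ := c.μpos
  have h2 := c.setIntegral_v_le (11 / 10)
  have h3 : ‖a c‖ ^ p ≤ B ^ p * c.μ ^ p := by
    rw [← Real.mul_rpow hB hμ.le]
    exact Real.rpow_le_rpow (norm_nonneg _) hc (by linarith)
  have ib : IntegrableOn (fun z => C * bdry p (c.v z) (a c)) (Metric.ball 0 (11 / 10)) volume :=
    (c.sol.integrableOn_bdry (a c) _).const_mul C
  have iv : IntegrableOn (fun z => η * ‖c.v z‖ ^ p) (Metric.ball 0 (11 / 10)) volume :=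
    (c.sol.integrable_norm_rpow.const_mul η).integrableOn
  have is : IntegrableOn (fun z => η * ‖c.v z‖ ^ p + C * bdry p (c.v z) (a c))
    (Metric.ball 0 (11 / 10)) volume := iv.add ib
  have h4 := setIntegral_const_add_le (C := 1) (η := η * ‖a c‖ ^ p)
    (I := η * (∫ z in Metric.ball 0 (11 / 10), ‖c.v z‖ ^ p)
      + C * ∫ z in Metric.ball 0 (11 / 10), bdry p (c.v z) (a c))
    (c.sol.integrableOn_sub_rpow (a c) _) is
    (fun z => by have := hle (c.v z) (a c); linarith)
    (by rw [integral_add iv ib, integral_const_mul, integral_const_mul, one_mul])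
  have h5 : ∫ z in Metric.ball 0 (11 / 10), ‖c.v z - a c‖ ^ p ≤ η * ((K + V * B ^ p) * c.μ ^ p)
      + C * ∫ z in Metric.ball 0 (11 / 10), bdry p (c.v z) (a c) := by
    have e1 := mul_le_mul_of_nonneg_left h2 hη.le
    have e2 := mul_le_mul_of_nonneg_left (mul_le_mul_of_nonneg_left h3 hη.le) hV0
    linarith
  have e1 : c.μ ^ (-p) * c.μ ^ p = 1 := by
    rw [← Real.rpow_add hμ, neg_add_cancel, Real.rpow_zero]
  refine (mul_le_mul_of_nonneg_left h5 (Real.rpow_nonneg hμ.le _)).trans (le_of_eq ?_)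
  linear_combination η * (K + V * B ^ p) * e1

/-- If the Caccioppoli right-hand side is small, the nondegeneracy is violated. -/
theorem eventually_false_of_small_cacc (hp : 1 < p) (hν : 0 < ν) (hL : 0 ≤ L) (hκ : 0 < κ)
    (hl : Small l Conf.defect) {R : ℝ} (hR : 1 < R) (hR2 : R < 2)
    (h : Small l fun c => caccRHS p (c.μ ^ (p - 2)) (bmp n one_pos hR) (mexp p) c.v c.f (a c)) :
    ∀ᶠ _ in l, False := by
  obtain ⟨C, hC, hcac⟩ := exists_cacc_ball (bmp n one_pos hR) hR2 hp hν hL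
  filter_upwards [((h.const_mul hC).add (small_f hl)) (κ / 2) (by positivity)] with c hc
  have e1 := (hcac _ _ _ _ _ _ c.sol (a c)).1
  have e2 := c.nondeg
  simp only [bmp] at e1 hc
  linarith

end Families


theorem Small.bdd_mul {ι : Type*} {l : Filter ι} {a b : ι → ℝ} (ha : Small l a)
    (h0 : ∀ i, 0 ≤ a i) (hb : Bdd l b) : Small l fun i => b i * a i := by
  obtain ⟨B, hB, h⟩ := hb.exists_pos
  exact (ha.const_mul hB.le).mono (h.mono fun i hi => mul_le_mul_of_nonneg_right hi (h0 i))

section Families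

variable {p ν L K κ : ℝ} {l : Filter (Conf n p ν L K κ)} {M : ℝ}
  {a : (c : Conf n p ν L K κ) → Vec c.N}

theorem inv_rpow_sub_two {μ : ℝ} (hμ : 0 < μ) (p : ℝ) : (μ ^ (p - 2))⁻¹ = μ ^ (2 - p) := by
  rw [← Real.rpow_neg hμ.le]; congr 1; ring

theorem exists_slice_bound (hp : 1 < p) (hν : 0 < ν) (hL : 0 ≤ L) {r R : ℝ} (hr : 6 / 5 ≤ r)
    (h0 : 0 < r) (hR : r < R) (hR2 : R < 2) {C₁ : ℝ} (hC₁ : 0 ≤ C₁)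
    (h1 : ∀ᶠ c in l, ∀ w : Vec c.N, ‖w - a c‖ ≤ 1 + C₁ * (c.μ ^ (2 - p) * bdry p w (a c)))
    (h2 : Bdd l fun c => caccRHS p (c.μ ^ (p - 2)) (bmp n h0 hR) (mexp p) c.v c.f (a c)) :
    ∃ S : ℝ, 0 ≤ S ∧ ∀ᶠ c in l, ∀ᵐ t : ℝ, t ∈ Ioo (-r) r →
      ∫ x in Metric.ball (0 : Spc n) r, ‖c.v (x, t) - mean (wt n) c.v t‖ ≤ S := by
  obtain ⟨C, hC, hcac⟩ := exists_cacc_ball (bmp n h0 hR) hR2 hp hν hL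
  obtain ⟨Cφ, hCφ, hφle⟩ := (wt_weight (n := n) le_rfl).exists_le
  obtain ⟨B, hB, hB'⟩ := h2.exists_pos
  set V := volume.real (Metric.ball (0 : Spc n) r) with hV
  have hV0 : 0 ≤ V := measureReal_nonneg
  refine ⟨(1 + Cφ * V) * (V + C₁ * (C * B)), by positivity, ?_⟩
  filter_upwards [h1, hB'] with c hc1 hc2
  filter_upwards [(hcac _ _ _ _ _ _ c.sol (a c)).2, c.sol.ae_slice] with t ht1 ht2 htr
  obtain ⟨hi, hle⟩ := ht1 htr
  simp only [bmp] at hi hle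
  refine ((wt_weight (n := n) le_rfl).setIntegral_norm_sub_mean_le hr hφle ht2.1 (a c)).trans
    (mul_le_mul_of_nonneg_left ?_ (by positivity))
  have i1 : IntegrableOn (fun _ : Spc n => (1:ℝ)) (Metric.ball 0 r) volume :=
    integrableOn_const measure_ball_lt_top.ne
  have i2 : IntegrableOn (fun x => C₁ * (c.μ ^ (2 - p) * bdry p (c.v (x, t)) (a c)))
    (Metric.ball 0 r) volume := (hi.const_mul _).const_mul _
  have i3 : IntegrableOn (fun x => 1 + C₁ * (c.μ ^ (2 - p) * bdry p (c.v (x, t)) (a c)))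
    (Metric.ball 0 r) volume := i1.add i2
  refine (integral_mono_of_nonneg (Eventually.of_forall fun _ => norm_nonneg _) i3
    (Eventually.of_forall fun x => hc1 (c.v (x, t)))).trans ?_
  rw [integral_add i1 i2, integral_const_mul, integral_const_mul, setIntegral_const, smul_eq_mul,
    mul_one, ← inv_rpow_sub_two c.μpos]
  refine add_le_add_right (mul_le_mul_of_nonneg_left (hle.trans
    (mul_le_mul_of_nonneg_left hc2 hC)) hC₁) _

theorem setIntegral_bdry_nonneg (hp : 1 < p) (c : Conf n p ν L K κ) (b : Vec c.N) (r : ℝ) :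
    0 ≤ ∫ z in Metric.ball 0 r, bdry p (c.v z) b :=
  integral_nonneg fun _ => bdry_nonneg hp _ _

theorem setIntegral_sub_nonneg (c : Conf n p ν L K κ) (b : Vec c.N) (r : ℝ) :
    0 ≤ ∫ z in Metric.ball 0 r, ‖c.v z - b‖ ^ p :=
  integral_nonneg fun z => by simp only [Pi.zero_apply]; positivity

/-- No degenerating family has bounded scaling parameters. -/
theorem eventually_false_of_mu_le (hp : 1 < p) (hν : 0 < ν) (hL : 0 ≤ L) (hK : 0 ≤ K)
    (hκ : 0 < κ) (hl : Small l Conf.defect) {μ₁ : ℝ} (hμ₁ : 0 < μ₁) (hμ : ∀ᶠ c in l, c.μ ≤ μ₁) :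
    ∀ᶠ _ in l, False := by
  obtain ⟨c₀, hc₀, hc₀'⟩ := exists_le_mu hp hν hL hK hκ hl
  have hD := bdd_Dv hp hν hL hK hl
  obtain ⟨M, hM, a, ha⟩ := exists_glued (n := n) (ν := ν) (L := L) (K := K) (κ := κ) hp
  have he := small_eps hM (small_G hp hL hl hD) hc₀ hc₀'
  obtain ⟨B, hB, haB⟩ := exists_norm_le hp ha he
  have hp0 : 0 < 1 - 1 / p := by
    have : 1 / p < 1 := by rw [div_lt_one (by linarith)]; exact hp
    linarith
  have hm2 : 2 ≤ mexp p := by have := four_le_mexp p; omega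
  have k1 : (0:ℝ) < 8 / 5 := by norm_num
  have k2 : (8 / 5 : ℝ) < 17 / 10 := by norm_num
  set D := c₀ ^ (2 - p) ⊓ μ₁ ^ (2 - p) with hDdef
  have hD0 : 0 < D := lt_min (by positivity) (by positivity)
  have hDle : ∀ᶠ c in l, D ≤ c.μ ^ (2 - p) := by
    filter_upwards [hμ, hc₀'] with c h1 h2
    rcases le_total p 2 with h | h
    · exact (min_le_left _ _).trans (Real.rpow_le_rpow hc₀.le h2 (by linarith))
    · exact (min_le_right _ _).trans (Real.rpow_le_rpow_of_nonpos c.μpos h1 (by linarith))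
  obtain ⟨S, hS, hslice⟩ := exists_slice_bound (l := l) (a := fun _ => 0) hp hν hL
    (by norm_num : (6 / 5 : ℝ) ≤ 8 / 5) k1 k2 (by norm_num)
    (by positivity : 0 ≤ (D * (1 - 1 / p))⁻¹)
    (hDle.mono fun c hc w => by
      rw [sub_zero, bdry_zero_right hp]
      have h1 := rpow_le_scaled (s := 1) (p := p) zero_le_one hp.le one_pos (norm_nonneg w)
      simp only [Real.rpow_one, Real.one_rpow, one_mul] at h1
      have h2 : D * (1 - 1 / p) * ‖w‖ ^ p ≤ c.μ ^ (2 - p) * ((1 - 1 / p) * ‖w‖ ^ p) := by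
        rw [mul_assoc]
        exact mul_le_mul_of_nonneg_right hc (by positivity)
      have h3 := mul_le_mul_of_nonneg_left h2 (by positivity : 0 ≤ (D * (1 - 1 / p))⁻¹)
      rw [inv_mul_cancel_left₀ (by positivity)] at h3
      linarith)
    ((show Bdd l fun c => (∫ z, c.f z ^ p) + K * (μ₁ ^ p + μ₁ ^ (2 : ℝ)) from
        (small_f hl).bdd.add (Bdd.const _)).mono (hμ.mono fun c hc =>
      (NSol.caccRHS_zero_le c.μpos c.sol c.sub (bmp n k1 k2) hm2).trans
        (add_le_add_right (mul_le_mul_of_nonneg_left (add_le_add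
          (Real.rpow_le_rpow c.μpos.le hc (by linarith))
          (Real.rpow_le_rpow c.μpos.le hc (by norm_num))) hK) _)))
  have ho := small_osc hp hl hD hS hslice (r := 6 / 5) (by norm_num) (by norm_num)
  have hX : Small l fun c => c.osc (6 / 5) * c.μ ^ (-p) :=
    (ho.const_mul (by positivity : 0 ≤ c₀ ^ (-p))).mono (hc₀'.mono fun c hc => by
      rw [mul_comm]
      exact mul_le_mul_of_nonneg_right (Real.rpow_le_rpow_of_nonpos hc₀ hc (by linarith))
        (c.osc_nonneg _))
  have hb := small_bdry hp (small_weighted hp hM ha he haB hB.le hK hX)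
  have hs := small_sub_const hp haB hB.le hb
  have hμb : ∀ s : ℝ, 0 ≤ s → Bdd l fun c => c.μ ^ s := fun s hs =>
    ⟨μ₁ ^ s, hμ.mono fun c hc => Real.rpow_le_rpow c.μpos.le hc hs⟩
  refine eventually_false_of_small_cacc (a := a) hp hν hL hκ hl (R := 11 / 10) (by norm_num)
    (by norm_num) ((((small_f hl).add (hs.bdd_mul (fun c => mul_nonneg
      (Real.rpow_nonneg c.μpos.le _) (setIntegral_sub_nonneg c _ _)) (hμb p (by linarith)))).add
      (hb.bdd_mul (fun c => mul_nonneg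
      (Real.rpow_nonneg c.μpos.le _) (setIntegral_bdry_nonneg hp c _ _))
        (hμb 2 (by norm_num)))).mono
      (Eventually.of_forall fun c => (c.sol.caccRHS_le _ hm2 _).trans (le_of_eq ?_)))
  simp only [bmp]
  rw [← mul_assoc, ← mul_assoc, ← Real.rpow_add c.μpos, ← Real.rpow_add c.μpos,
    inv_rpow_sub_two c.μpos, add_neg_cancel, Real.rpow_zero, one_mul, ← sub_eq_add_neg]

theorem exists_mul_mu_le_norm (hp : 1 < p) (hK : 0 ≤ K) (hκ : 0 < κ)
    (hμ : ∀ᶠ c in l, K < c.μ ^ p)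
    (h : Small l fun c => c.μ ^ (-p) * ∫ z in Metric.ball 0 (11 / 10), ‖c.v z - a c‖ ^ p) :
    ∃ k : ℝ, 0 < k ∧ ∀ᶠ c in l, k * c.μ ≤ ‖a c‖ := by
  set V := volume.real (Metric.ball (0 : ST n) (11 / 10)) with hV
  have hV0 : 0 ≤ V := measureReal_nonneg
  have hp0 : 0 < p := by linarith
  set E := K * 2 ^ p * V + 1 with hE
  have hE0 : 0 < E := by positivity
  refine ⟨(κ / (2 * E)) ^ (1 / p), by positivity, ?_⟩
  filter_upwards [hμ, (h.const_mul (by positivity : 0 ≤ K * 2 ^ p)) (κ / 2) (by positivity)]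
    with c hc1 hc2
  have hμ0 := c.μpos
  have h1 := c.sup'.resolve_right (not_le.2 hc1)
  have hle : ∀ z, ‖c.v z‖ ^ p ≤ 2 ^ p * ‖a c‖ ^ p + 2 ^ p * ‖c.v z - a c‖ ^ p := fun z => by
    have e1 : ‖c.v z‖ ≤ 2 * max ‖c.v z - a c‖ ‖a c‖ := by
      have := norm_sub_norm_le (c.v z) (a c)
      linarith [le_max_left ‖c.v z - a c‖ ‖a c‖, le_max_right ‖c.v z - a c‖ ‖a c‖]
    have e2 := Real.rpow_le_rpow (norm_nonneg _) e1 hp0.le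
    rw [Real.mul_rpow (by norm_num) (by positivity)] at e2
    have e3 := max_rpow_le (p := p) (norm_nonneg (c.v z - a c)) (norm_nonneg (a c))
    have e4 := mul_le_mul_of_nonneg_left e3 (by positivity : (0:ℝ) ≤ 2 ^ p)
    linarith
  have h2 := setIntegral_const_add_le (r := 11 / 10) c.sol.integrable_norm_rpow.integrableOn
    (c.sol.integrableOn_sub_rpow (a c) _) hle le_rfl
  have h3 : ∫ z in Metric.ball 0 1, ‖c.v z‖ ^ p ≤ ∫ z in Metric.ball 0 (11 / 10), ‖c.v z‖ ^ p :=
    setIntegral_mono_set c.sol.integrable_norm_rpow.integrableOn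
      (Eventually.of_forall fun z => by simp only [Pi.zero_apply]; positivity)
      (Metric.ball_subset_ball (by norm_num)).eventuallyLE
  have e1 : c.μ ^ p * c.μ ^ (-p) = 1 := by
    rw [← Real.rpow_add hμ0, add_neg_cancel, Real.rpow_zero]
  have hμp : 0 < c.μ ^ p := by positivity
  have h4 := mul_le_mul_of_nonneg_left (h3.trans h2) hK
  have h5 := mul_le_mul_of_nonneg_left hc2 hμp.le
  have h6 : c.μ ^ p * (K * 2 ^ p * (c.μ ^ (-p) * ∫ z in Metric.ball 0 (11 / 10), ‖c.v z - a c‖ ^ p))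
      = K * 2 ^ p * ∫ z in Metric.ball 0 (11 / 10), ‖c.v z - a c‖ ^ p := by
    linear_combination (K * 2 ^ p * ∫ z in Metric.ball 0 (11 / 10), ‖c.v z - a c‖ ^ p) * e1
  have hap : 0 ≤ ‖a c‖ ^ p := by positivity
  have h7 : κ / (2 * E) * c.μ ^ p ≤ ‖a c‖ ^ p := by
    rw [div_mul_eq_mul_div, div_le_iff₀ (by positivity)]
    rw [h6] at h5
    have : ‖a c‖ ^ p * (2 * E) = 2 * (K * (2 ^ p * ‖a c‖ ^ p * V)) + 2 * ‖a c‖ ^ p := by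
      rw [hE]; ring
    rw [this]
    linarith
  have h8 := Real.rpow_le_rpow (by positivity) h7 (by positivity : 0 ≤ 1 / p)
  rwa [Real.mul_rpow (by positivity) (by positivity), ← Real.rpow_mul hμ0.le,
    ← Real.rpow_mul (norm_nonneg _), mul_one_div_cancel hp0.ne', Real.rpow_one,
    Real.rpow_one] at h8

theorem exists_setIntegral_sub_le (hp : 1 < p) (hM : 0 ≤ M)
    (ha : ∀ c : Conf n p ν L K κ, c.Glued M (a c))
    (he : Small l fun c => c.eps M * c.μ ^ (1 - p)) {B k : ℝ} (hB : 0 < B) (hk : 0 < k)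
    (haB : ∀ᶠ c in l, ‖a c‖ ≤ B * c.μ) (hak : ∀ᶠ c in l, k * c.μ ≤ ‖a c‖) {r : ℝ}
    (hr : 6 / 5 ≤ r) (hr' : r ≤ 17 / 10) :
    ∃ C : ℝ, 0 ≤ C ∧ ∀ᶠ c in l, ∫ z in Metric.ball 0 r, ‖c.v z - a c‖ ^ p
      ≤ C * (c.osc r + (∫ z in Metric.ball 0 (17 / 10), ‖c.G z‖) ^ p) := by
  obtain ⟨C, δ, hC, hδ, h⟩ := exists_sub_const_le hp (wt_weight (n := n) hr)
  set D := k ^ (2 - p) + B ^ (2 - p) with hD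
  have hD0 : 0 < D := by positivity
  refine ⟨C * (1 + (D * M) ^ p), by positivity, ?_⟩
  filter_upwards [haB, hak, he (δ * k ^ (p - 1)) (by positivity)] with c h1 h2 h3
  have hμ := c.μpos
  have ha0 : 0 < ‖a c‖ := lt_of_lt_of_le (by positivity) h2
  have e1 : c.eps M ≤ δ * ‖a c‖ ^ (p - 1) := by
    have := mul_le_mul_of_nonneg_right h3 (Real.rpow_nonneg hμ.le (p - 1))
    rw [mul_assoc, ← Real.rpow_add hμ, show 1 - p + (p - 1) = 0 by ring, Real.rpow_zero, mul_one,
      mul_assoc, ← Real.mul_rpow hk.le hμ.le] at this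
    exact this.trans (mul_le_mul_of_nonneg_left (Real.rpow_le_rpow (by positivity) h2
      (by linarith)) hδ.le)
  have e2 : ‖a c‖ ^ (2 - p) ≤ D * c.μ ^ (2 - p) := by
    rw [hD, add_mul, ← Real.mul_rpow hk.le hμ.le, ← Real.mul_rpow hB.le hμ.le]
    rcases le_total p 2 with hp2 | hp2
    · exact (Real.rpow_le_rpow ha0.le h1 (by linarith)).trans
        (le_add_of_nonneg_left (by positivity))
    · exact (Real.rpow_le_rpow_of_nonpos (by positivity) h2 (by linarith)).trans
        (le_add_of_nonneg_right (by positivity))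
  set I := ∫ z in Metric.ball 0 (17 / 10), ‖c.G z‖ with hI
  have hI0 : 0 ≤ I := integral_nonneg fun _ => norm_nonneg _
  have e3 : ‖a c‖ ^ (2 - p) * c.eps M ≤ D * M * I := by
    refine (mul_le_mul_of_nonneg_right e2 (c.eps_nonneg hM)).trans (le_of_eq ?_)
    have : c.μ ^ (2 - p) * c.μ ^ (p - 2) = 1 := by
      rw [← Real.rpow_add hμ, show 2 - p + (p - 2) = 0 by ring, Real.rpow_zero]
    rw [Conf.eps, ← hI]
    linear_combination D * M * I * this
  have e4 : (‖a c‖ ^ (2 - p) * c.eps M) ^ p ≤ (D * M) ^ p * I ^ p := by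
    rw [← Real.mul_rpow (by positivity) hI0]
    exact Real.rpow_le_rpow (mul_nonneg (by positivity) (c.eps_nonneg hM)) e3 (by linarith)
  refine (h _ _ _ _ _ _ _ _ c.sol (c.integrableOn_osc hp hr hr') (a c) (c.eps M)
    (c.eps_nonneg hM) ((ha c).mono hr') e1).trans ?_
  rw [mul_assoc]
  refine mul_le_mul_of_nonneg_left ?_ hC
  have h5 := c.osc_nonneg r
  have h6 : 0 ≤ I ^ p := by positivity
  have h7 : 0 ≤ (D * M) ^ p := by positivity
  have e5 : c.osc r + (D * M) ^ p * I ^ p ≤ (1 + (D * M) ^ p) * (c.osc r + I ^ p) := by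
    nlinarith [mul_nonneg h7 h5]
  exact (add_le_add_right e4 _).trans e5

end Families


section Families

variable {p ν L K κ : ℝ} {l : Filter (Conf n p ν L K κ)} {M : ℝ}
  {a : (c : Conf n p ν L K κ) → Vec c.N}

theorem exists_caccRHS_le_of_le_two (hn : 1 ≤ n) (hp : 1 < p) (hsp : sob n < p) (hp2 : p ≤ 2)
    (hν : 0 < ν) (hL : 0 ≤ L) {k : ℝ} (hk : 0 < k) (hak : ∀ᶠ c in l, k * c.μ ≤ ‖a c‖)
    {r R : ℝ} (hr : 0 < r) (hrR : r < R) (hR : R ≤ 17 / 10) :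
    ∃ C : ℝ, 0 ≤ C ∧ ∀ᶠ c in l,
      caccRHS p (c.μ ^ (p - 2)) (bmp n hr hrR) (mexp p) c.v c.f (a c)
        ≤ (2 * (∫ z, c.f z ^ p) + 2 * ∫ z in Metric.ball 0 R, ‖c.v z - a c‖ ^ p)
          + C * ((∫ z in Metric.ball 0 (19 / 10), ‖c.Dv z‖ ^ sob n)
            + ∫ z in Metric.ball 0 R, ‖c.v z - a c‖ ^ sob n) ^ (2 / sob n) := by
  obtain ⟨C, hC, h⟩ := exists_caccRHS_le hn (bmp n hr hrR)
    (show R < 2 by linarith) (four_le_mexp p) hsp.le hp hp2 hν hL hk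
  have hs := one_le_sob n
  refine ⟨C, hC, hak.mono fun c hc => (h _ _ _ _ _ _ _ c.μpos c.sol hc).trans ?_⟩
  simp only [bmp]
  have i1 := c.sol.integrableOn_rpow (by linarith : 0 < sob n) hsp.le (a c) R
  have i2 := c.sol.integrableOn_rpow (by linarith : 0 < sob n) hsp.le (a c) (19 / 10)
  rw [integral_add c.sol.integrable_f_rpow.integrableOn (c.sol.integrableOn_sub_rpow _ _),
    integral_add i1.1 i1.2, mul_add]
  have e1 : ∫ z in Metric.ball 0 R, c.f z ^ p ≤ ∫ z, c.f z ^ p :=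
    setIntegral_le_integral c.sol.integrable_f_rpow
      (Eventually.of_forall fun z => Real.rpow_nonneg (c.sol.fnonneg z) _)
  have e2 : ∫ z in Metric.ball 0 R, ‖c.Dv z‖ ^ sob n
      ≤ ∫ z in Metric.ball 0 (19 / 10), ‖c.Dv z‖ ^ sob n :=
    setIntegral_mono_set i2.1
      (Eventually.of_forall fun z => by simp only [Pi.zero_apply]; positivity)
      (Metric.ball_subset_ball (by linarith)).eventuallyLE
  have e3 : 0 ≤ ∫ z in Metric.ball 0 R, ‖c.Dv z‖ ^ sob n := integral_nonneg fun z => by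
    simp only [Pi.zero_apply]; positivity
  have e4 : 0 ≤ ∫ z in Metric.ball 0 R, ‖c.v z - a c‖ ^ sob n := integral_nonneg fun z => by
    simp only [Pi.zero_apply]; positivity
  refine add_le_add (by linarith) (mul_le_mul_of_nonneg_left
    (Real.rpow_le_rpow (by linarith) (by linarith) (by positivity)) hC)

theorem exists_caccRHS_le_of_two_le (hp2 : 2 ≤ p) {B : ℝ} (hB : 0 < B)
    (haB : ∀ᶠ c in l, ‖a c‖ ≤ B * c.μ) {r R : ℝ} (hr : 0 < r) (hrR : r < R) {τ : ℝ}
    (hτ : 0 < τ) : ∃ C : ℝ, 0 ≤ C ∧ ∀ᶠ c in l,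
      caccRHS p (c.μ ^ (p - 2)) (bmp n hr hrR) (mexp p) c.v c.f (a c)
        ≤ τ * (K + volume.real (Metric.ball (0 : ST n) R) * B ^ p)
          + C * ((∫ z, c.f z ^ p) + ∫ z in Metric.ball 0 R, ‖c.v z - a c‖ ^ p) := by
  have hp : 1 < p := by linarith
  obtain ⟨C, hC, h⟩ := exists_scaled_bdry_le hp2 hτ
  refine ⟨C + 1, by positivity, haB.mono fun c hc => ?_⟩
  have hμ := c.μpos
  have h1 := c.sol.caccRHS_le (bmp n hr hrR) (show 2 ≤ mexp p by have := four_le_mexp p; omega)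
    (a c)
  simp only [bmp] at h1 ⊢
  set V := volume.real (Metric.ball (0 : ST n) R) with hV
  have hV0 : 0 ≤ V := measureReal_nonneg
  have hf := c.integral_f_nonneg
  have hμp : 0 < c.μ ^ p := by positivity
  have h3 : ‖a c‖ ^ p ≤ B ^ p * c.μ ^ p := by
    rw [← Real.mul_rpow hB.le hμ.le]
    exact Real.rpow_le_rpow (norm_nonneg _) hc (by linarith)
  have iv : IntegrableOn (fun z => τ * (c.μ ^ p)⁻¹ * ‖c.v z‖ ^ p) (Metric.ball 0 R) volume :=
    (c.sol.integrable_norm_rpow.const_mul _).integrableOn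
  have iw : IntegrableOn (fun z => C * ‖c.v z - a c‖ ^ p) (Metric.ball 0 R) volume :=
    (c.sol.integrableOn_sub_rpow (a c) _).const_mul C
  have is : IntegrableOn (fun z => τ * (c.μ ^ p)⁻¹ * ‖c.v z‖ ^ p + C * ‖c.v z - a c‖ ^ p)
    (Metric.ball 0 R) volume := iv.add iw
  have ib : IntegrableOn (fun z => c.μ ^ (2 - p) * bdry p (c.v z) (a c)) (Metric.ball 0 R) volume :=
    (c.sol.integrableOn_bdry (a c) _).const_mul _
  have h4 := setIntegral_const_add_le (C := 1) (η := τ * (c.μ ^ p)⁻¹ * ‖a c‖ ^ p)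
    (I := τ * (c.μ ^ p)⁻¹ * (∫ z in Metric.ball 0 R, ‖c.v z‖ ^ p)
      + C * ∫ z in Metric.ball 0 R, ‖c.v z - a c‖ ^ p) ib is
    (fun z => by have := h (c.v z) (a c) c.μ hμ; linarith)
    (by rw [integral_add iv iw, integral_const_mul, integral_const_mul, one_mul])
  rw [integral_const_mul, ← inv_rpow_sub_two hμ] at h4
  have h5 : τ * (c.μ ^ p)⁻¹ * (∫ z in Metric.ball 0 R, ‖c.v z‖ ^ p) ≤ τ * K := by
    refine (mul_le_mul_of_nonneg_left (c.setIntegral_v_le R) (by positivity)).trans (le_of_eq ?_)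
    field_simp
  have h6 : τ * (c.μ ^ p)⁻¹ * ‖a c‖ ^ p * V ≤ τ * (V * B ^ p) := by
    have := mul_le_mul_of_nonneg_right (mul_le_mul_of_nonneg_left h3
      (by positivity : 0 ≤ τ * (c.μ ^ p)⁻¹)) hV0
    refine this.trans (le_of_eq ?_)
    field_simp
  have h7 := mul_nonneg hC hf
  linarith

theorem bdd_caccRHS (hn : 1 ≤ n) (hp : 1 < p) (hsp : sob n < p) (hν : 0 < ν) (hL : 0 ≤ L)
    (hl : Small l Conf.defect)
    (hD : Bdd l fun c => ∫ z in Metric.ball 0 (19 / 10), ‖c.Dv z‖ ^ p)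
    {k B : ℝ} (hk : 0 < k) (hB : 0 < B) (hak : ∀ᶠ c in l, k * c.μ ≤ ‖a c‖)
    (haB : ∀ᶠ c in l, ‖a c‖ ≤ B * c.μ) {r R : ℝ} (hr : 0 < r) (hrR : r < R) (hR : R ≤ 17 / 10)
    (hW : Bdd l fun c => ∫ z in Metric.ball 0 R, ‖c.v z - a c‖ ^ p) :
    Bdd l fun c => caccRHS p (c.μ ^ (p - 2)) (bmp n hr hrR) (mexp p) c.v c.f (a c) := by
  have hs := one_le_sob n
  have hf := (small_f hl).bdd
  rcases le_total p 2 with hp2 | hp2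
  · obtain ⟨C, hC, h⟩ := exists_caccRHS_le_of_le_two hn hp hsp hp2 hν hL hk hak hr hrR hR
    have hs0 : Bdd l fun c => ∫ z in Metric.ball 0 R, ‖c.v z - a c‖ ^ sob n := by
      obtain ⟨C', hC', h'⟩ := exists_rpow_le_add (by linarith : 0 < sob n) hsp.le one_pos
      refine ((Bdd.const (1 * volume.real (Metric.ball (0 : ST n) R))).add
        (hW.const_mul hC')).mono (Eventually.of_forall fun c => ?_)
      exact setIntegral_const_add_le (c.sol.integrableOn_rpow (by linarith) hsp.le (a c) R).2
        (c.sol.integrableOn_sub_rpow (a c) R) (fun z => h' _ (norm_nonneg _)) le_rfl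
    refine (((hf.const_mul zero_le_two).add (hW.const_mul zero_le_two)).add
      ((((small_Dv_rpow hl hD (by linarith) hsp).bdd.add hs0).rpow (fun c => ?_)
        (by positivity)).const_mul hC)).mono h
    exact add_nonneg (integral_nonneg fun z => by simp only [Pi.zero_apply]; positivity)
      (integral_nonneg fun z => by simp only [Pi.zero_apply]; positivity)
  · obtain ⟨C, hC, h⟩ := exists_caccRHS_le_of_two_le hp2 hB haB hr hrR one_pos
    exact ((Bdd.const _).add ((hf.add hW).const_mul hC)).mono h

theorem small_caccRHS (hn : 1 ≤ n) (hp : 1 < p) (hsp : sob n < p) (hν : 0 < ν) (hL : 0 ≤ L)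
    (hl : Small l Conf.defect)
    (hD : Bdd l fun c => ∫ z in Metric.ball 0 (19 / 10), ‖c.Dv z‖ ^ p)
    {k B : ℝ} (hk : 0 < k) (hB : 0 < B) (hak : ∀ᶠ c in l, k * c.μ ≤ ‖a c‖)
    (haB : ∀ᶠ c in l, ‖a c‖ ≤ B * c.μ) {r R : ℝ} (hr : 0 < r) (hrR : r < R) (hR : R ≤ 17 / 10)
    (hW : Small l fun c => ∫ z in Metric.ball 0 R, ‖c.v z - a c‖ ^ p) :
    Small l fun c => caccRHS p (c.μ ^ (p - 2)) (bmp n hr hrR) (mexp p) c.v c.f (a c) := by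
  have hs := one_le_sob n
  have hf := small_f hl
  rcases le_total p 2 with hp2 | hp2
  · obtain ⟨C, hC, h⟩ := exists_caccRHS_le_of_le_two hn hp hsp hp2 hν hL hk hak hr hrR hR
    have hs0 : Small l fun c => ∫ z in Metric.ball 0 R, ‖c.v z - a c‖ ^ sob n := by
      refine Small.of_interp (fun η hη => ?_)
        (Bdd.const (volume.real (Metric.ball (0 : ST n) R))) hW
      obtain ⟨C', hC', h'⟩ := exists_rpow_le_add (by linarith : 0 < sob n) hsp.le hη
      refine ⟨C', hC', Eventually.of_forall fun c => ?_⟩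
      exact setIntegral_const_add_le (c.sol.integrableOn_rpow (by linarith) hsp.le (a c) R).2
        (c.sol.integrableOn_sub_rpow (a c) R) (fun z => h' _ (norm_nonneg _)) le_rfl
    refine (((hf.const_mul zero_le_two).add (hW.const_mul zero_le_two)).add
      ((((small_Dv_rpow hl hD (by linarith) hsp).add hs0).rpow (fun c => ?_)
        (by positivity)).const_mul hC)).mono h
    exact add_nonneg (integral_nonneg fun z => by simp only [Pi.zero_apply]; positivity)
      (integral_nonneg fun z => by simp only [Pi.zero_apply]; positivity)
  · exact Small.of_interp (fun τ hτ => exists_caccRHS_le_of_two_le hp2 hB haB hr hrR hτ)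
      (Bdd.const _) (hf.add hW)

/-- No degenerating family has scaling parameters tending to infinity. -/
theorem eventually_false_of_le_mu (hn : 1 ≤ n) (hp : 1 < p) (hsp : sob n < p) (hν : 0 < ν)
    (hL : 0 ≤ L) (hK : 0 ≤ K) (hκ : 0 < κ) (hl : Small l Conf.defect)
    (hμ : ∀ μ₁ : ℝ, ∀ᶠ c in l, μ₁ ≤ c.μ) : ∀ᶠ _ in l, False := by
  have hD := bdd_Dv hp hν hL hK hl
  have hG := small_G hp hL hl hD
  obtain ⟨M, hM, a, ha⟩ := exists_glued (n := n) (ν := ν) (L := L) (K := K) (κ := κ) hp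
  have he := small_eps hM hG one_pos (hμ 1)
  obtain ⟨B, hB, haB⟩ := exists_norm_le hp ha he
  have hμinv : Small l fun c => c.μ ^ (-p) := fun η hη => by
    filter_upwards [hμ (η ^ (1 / (-p)))] with c hc
    refine (Real.rpow_le_rpow_of_nonpos (by positivity) hc (by linarith)).trans (le_of_eq ?_)
    rw [← Real.rpow_mul hη.le, one_div_mul_cancel (by linarith), Real.rpow_one]
  have hX : Small l fun c => c.osc (6 / 5) * c.μ ^ (-p) :=
    hμinv.bdd_mul (fun c => Real.rpow_nonneg c.μpos.le _) (bdd_osc hp hD le_rfl (by norm_num))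
  have hs := small_sub_const hp haB hB.le
    (small_bdry hp (small_weighted hp hM ha he haB hB.le hK hX))
  obtain ⟨k, hk, hak⟩ := exists_mul_mu_le_norm hp hK hκ
    (by
      filter_upwards [hμ ((K + 1) ^ (1 / p))] with c hc
      have h1 := Real.rpow_le_rpow (by positivity) hc (by linarith : 0 ≤ p)
      rw [← Real.rpow_mul (by positivity), one_div_mul_cancel (by linarith), Real.rpow_one] at h1
      linarith) hs
  have hI0 : ∀ c : Conf n p ν L K κ, 0 ≤ ∫ z in Metric.ball 0 (17 / 10), ‖c.G z‖ := fun c =>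
    integral_nonneg fun _ => norm_nonneg _
  have hGp := hG.rpow hI0 (by linarith : 0 < p)
  obtain ⟨C, hC, hW⟩ := exists_setIntegral_sub_le hp hM ha he hB hk haB hak
    (by norm_num : (6 / 5 : ℝ) ≤ 17 / 10) le_rfl
  have hWb := (((bdd_osc hp hD (by norm_num : (6 / 5 : ℝ) ≤ 17 / 10) le_rfl).add
    hGp.bdd).const_mul hC).mono hW
  have k1 : (0:ℝ) < 8 / 5 := by norm_num
  have k2 : (8 / 5 : ℝ) < 17 / 10 := by norm_num
  obtain ⟨C₁, hC₁, h₁⟩ := exists_norm_sub_le_one_add hp hk hB.le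
  obtain ⟨S, hS, hslice⟩ := exists_slice_bound hp hν hL (by norm_num : (6 / 5 : ℝ) ≤ 8 / 5) k1 k2
    (by norm_num) hC₁
    (by filter_upwards [hμ 1, hak, haB] with c hc1 hc2 hc3 w using h₁ w (a c) c.μ hc1 hc2 hc3)
    (bdd_caccRHS hn hp hsp hν hL hl hD hk hB hak haB k1 k2 le_rfl hWb)
  have ho := small_osc hp hl hD hS hslice (r := 3 / 2) (by norm_num) (by norm_num)
  obtain ⟨C', hC', hW'⟩ := exists_setIntegral_sub_le hp hM ha he hB hk haB hak
    (by norm_num : (6 / 5 : ℝ) ≤ 3 / 2) (by norm_num)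
  exact eventually_false_of_small_cacc hp hν hL hκ hl (R := 3 / 2) (by norm_num) (by norm_num)
    (small_caccRHS hn hp hsp hν hL hl hD hk hB hak haB one_pos (by norm_num) (by norm_num)
      (((ho.add hGp).const_mul hC').mono hW'))

/-- The defect of normalized solutions is bounded from below. -/
theorem exists_le_defect (hn : 1 ≤ n) (hp : 1 < p) (hsp : sob n < p) (hν : 0 < ν)
    (hL : 0 ≤ L) (hK : 0 ≤ K) (hκ : 0 < κ) :
    ∃ ε : ℝ, 0 < ε ∧ ∀ c : Conf n p ν L K κ, ε ≤ c.defect := by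
  by_contra! hcon
  set l : Filter (Conf n p ν L K κ) := ⨅ ε : Ioi (0:ℝ), 𝓟 {c | c.defect ≤ ε} with hldef
  have hl : Small l Conf.defect := fun η hη =>
    mem_iInf_of_mem ⟨η, hη⟩ (mem_principal_self _)
  have hne : l.NeBot := by
    refine iInf_neBot_of_directed' ?_ fun ε => ?_
    · rintro ⟨x, hx⟩ ⟨y, hy⟩
      refine ⟨⟨min x y, mem_Ioi.2 (lt_min hx hy)⟩, principal_mono.2 fun c hc => ?_,
        principal_mono.2 fun c hc => ?_⟩
      · exact le_trans (show c.defect ≤ min x y from hc) (min_le_left _ _)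
      · exact le_trans (show c.defect ≤ min x y from hc) (min_le_right _ _)
    · obtain ⟨c, hc⟩ := hcon ε ε.2
      exact principal_neBot_iff.2 ⟨c, hc.le⟩
  have hA : ∀ μ₁ : ℝ, ∀ᶠ c in l, μ₁ ≤ c.μ := fun μ₁ => by
    have h1 := eventually_false_of_mu_le (l := l ⊓ 𝓟 {c | c.μ ≤ max μ₁ 1}) hp hν hL hK hκ
      (fun η hη => (hl η hη).filter_mono inf_le_left) (by positivity : 0 < max μ₁ 1)
      (mem_inf_of_right (mem_principal_self _))
    rw [eventually_inf_principal] at h1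
    filter_upwards [h1] with c hc
    by_contra! hlt
    exact hc (hlt.le.trans (le_max_left _ _))
  exact (eventually_false_of_le_mu hn hp hsp hν hL hK hκ hl hA).exists.elim fun _ h => h

end Families


/-! ### Rescaling -/

/-- Anisotropic dilation about the origin, followed by the translation to `z₀`. -/
def scl (z₀ : ST n) {R S : ℝ} (hR : 0 < R) (hS : 0 < S) : ST n ≃ₜ ST n where
  toFun z := (z₀.1 + R • z.1, z₀.2 + S * z.2)
  invFun w := (R⁻¹ • (w.1 - z₀.1), S⁻¹ * (w.2 - z₀.2))
  left_inv z := by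
    ext1
    · simp [smul_smul, inv_mul_cancel₀ hR.ne']
    · simp [inv_mul_cancel_left₀ hS.ne']
  right_inv w := by
    ext1
    · simp [smul_smul, mul_inv_cancel₀ hR.ne']
    · simp [mul_inv_cancel_left₀ hS.ne']
  continuous_toFun := by fun_prop
  continuous_invFun := by fun_prop

variable {z₀ : ST n} {R S : ℝ} {hR : 0 < R} {hS : 0 < S}

theorem scl_apply (z : ST n) : scl z₀ hR hS z = (z₀.1 + R • z.1, z₀.2 + S * z.2) := rfl

theorem exists_map_scl (z₀ : ST n) (hR : 0 < R) (hS : 0 < S) :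
    ∃ j : ℝ≥0∞, j ≠ 0 ∧ j ≠ ⊤ ∧ Measure.map (scl z₀ hR hS) volume = j • volume := by
  have h1 : Measure.map (fun x : Spc n => z₀.1 + R • x) volume
      = ENNReal.ofReal |(R ^ Module.finrank ℝ (Spc n))⁻¹| • volume := by
    have : (fun x : Spc n => z₀.1 + R • x) = (fun x => z₀.1 + x) ∘ fun x => R • x := rfl
    rw [this, ← Measure.map_map (measurable_const_add _) (measurable_const_smul _),
      Measure.map_addHaar_smul volume hR.ne', Measure.map_smul, map_add_left_eq_self]
  have h2 : Measure.map (fun x : ℝ => z₀.2 + S * x) volume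
      = ENNReal.ofReal |(S ^ Module.finrank ℝ ℝ)⁻¹| • volume := by
    have : (fun x : ℝ => z₀.2 + S * x) = (fun x => z₀.2 + x) ∘ fun x => S • x := rfl
    rw [this, ← Measure.map_map (measurable_const_add _) (measurable_const_smul _),
      Measure.map_addHaar_smul volume hS.ne', Measure.map_smul, map_add_left_eq_self]
  have h3 : Measure.map (scl z₀ hR hS) volume
      = (Measure.map (fun x : Spc n => z₀.1 + R • x) volume).prod
        (Measure.map (fun x : ℝ => z₀.2 + S * x) volume) := by
    rw [Measure.map_prod_map _ _ (by fun_prop) (by fun_prop)]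
    rfl
  refine ⟨ENNReal.ofReal |(R ^ Module.finrank ℝ (Spc n))⁻¹|
    * ENNReal.ofReal |(S ^ Module.finrank ℝ ℝ)⁻¹|, mul_ne_zero ?_ ?_,
    ENNReal.mul_ne_top ENNReal.ofReal_ne_top ENNReal.ofReal_ne_top, ?_⟩
  · rw [ENNReal.ofReal_ne_zero_iff, abs_pos]; positivity
  · rw [ENNReal.ofReal_ne_zero_iff, abs_pos]; positivity
  · rw [h3, h1, h2, Measure.prod_smul_left, Measure.prod_smul_right, smul_smul]
    rfl

theorem ae_scl {P : ST n → Prop} {U : Set (ST n)} (hU : MeasurableSet U)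
    (h : ∀ᵐ z ∂(volume.restrict U), P z) :
    ∀ᵐ z, scl z₀ hR hS z ∈ U → P (scl z₀ hR hS z) := by
  obtain ⟨j, hj0, hjt, hj⟩ := exists_map_scl z₀ hR hS
  have h1 : ∀ᵐ w ∂(Measure.map (scl z₀ hR hS) volume), w ∈ U → P w := by
    rw [hj]
    exact Measure.ae_smul_measure ((ae_restrict_iff' hU).1 h) j
  exact ae_of_ae_map (scl z₀ hR hS).continuous.measurable.aemeasurable h1

theorem exists_setIntegral_scl (z₀ : ST n) (hR : 0 < R) (hS : 0 < S) :
    ∃ j : ℝ, 0 < j ∧ ∀ (U : Set (ST n)) (g : ST n → ℝ), MeasurableSet U →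
      ∫ z in scl z₀ hR hS ⁻¹' U, g (scl z₀ hR hS z) = j * ∫ z in U, g z := by
  obtain ⟨j, hj0, hjt, hj⟩ := exists_map_scl z₀ hR hS
  refine ⟨j.toReal, ENNReal.toReal_pos hj0 hjt, fun U g hU => ?_⟩
  rw [← (scl z₀ hR hS).measurableEmbedding.setIntegral_map, hj, Measure.restrict_smul,
    integral_smul_measure, smul_eq_mul]

theorem setAverage_scl {U : Set (ST n)} (hU : MeasurableSet U) (g : ST n → ℝ) :
    ⨍ z in U, g z = ⨍ z in scl z₀ hR hS ⁻¹' U, g (scl z₀ hR hS z) := by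
  obtain ⟨j, hj0, h⟩ := exists_setIntegral_scl z₀ hR hS
  have h1 := h U (fun _ => 1) hU
  rw [setIntegral_const, setIntegral_const, smul_eq_mul, smul_eq_mul, mul_one, mul_one] at h1
  rw [setAverage_eq, setAverage_eq, h U g hU, h1, smul_eq_mul, smul_eq_mul, mul_inv]
  field_simp

theorem memLp_scl {F : Type*} [NormedAddCommGroup F] {g : ST n → F} {q : ℝ≥0∞} {U V : Set (ST n)}
    (hU : MeasurableSet U) (hV : MeasurableSet V) (hVU : ∀ z ∈ V, scl z₀ hR hS z ∈ U)
    (hg : MemLp g q (volume.restrict U)) :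
    MemLp (V.indicator fun z => g (scl z₀ hR hS z)) q volume := by
  obtain ⟨j, hj0, hjt, hj⟩ := exists_map_scl z₀ hR hS
  have h1 : MemLp (U.indicator g) q (Measure.map (scl z₀ hR hS) volume) := by
    rw [hj]
    exact ((memLp_indicator_iff_restrict hU).2 hg).smul_measure hjt
  have h2 := (scl z₀ hR hS).measurableEmbedding.memLp_map_measure_iff.1 h1
  refine (h2.indicator hV).ae_eq (Eventually.of_forall fun z => ?_)
  by_cases hz : z ∈ V
  · simp [hz, hVU z hz]
  · simp [hz]


/-! ### The flux of a weak solution -/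

theorem pderivS_eq {ψ : ST n → ℝ} {z : ST n} (h : DifferentiableAt ℝ ψ z) (j : Fin n) :
    pderivS j ψ z = fderiv ℝ ψ z (sdir j) := by
  have h1 : HasFDerivAt (fun y : Spc n => (y, z.2)) (ContinuousLinearMap.inl ℝ (Spc n) ℝ) z.1 :=
    hasFDerivAt_prodMk_left z.1 z.2
  have h2 : HasFDerivAt ψ (fderiv ℝ ψ z) (z.1, z.2) := h.hasFDerivAt
  have h3 : HasFDerivAt (fun y => ψ (y, z.2)) _ z.1 := h2.comp z.1 h1
  rw [pderivS, h3.fderiv]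
  rfl

theorem tderiv_eq {φ : ST n → Vec N} {z : ST n} (h : DifferentiableAt ℝ φ z) :
    tderiv φ z = fderiv ℝ φ z (tdir n) := by
  have h1 : HasFDerivAt (fun s : ℝ => (z.1, s)) (ContinuousLinearMap.inr ℝ (Spc n) ℝ) z.2 :=
    hasFDerivAt_prodMk_right z.1 z.2
  have h2 : HasFDerivAt φ (fderiv ℝ φ z) (z.1, z.2) := h.hasFDerivAt
  have h3 : HasFDerivAt (fun s => φ (z.1, s)) _ z.2 := h2.comp z.2 h1
  rw [tderiv, h3.hasDerivAt.deriv]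
  rfl

theorem gradPair_eq (M : ST n → Mat N n) {φ : ST n → Vec N} {z : ST n}
    (h : DifferentiableAt ℝ φ z) : gradPair M φ z = inner ℝ (M z) (gradM φ z) := by
  simp only [gradPair, PiLp.inner_apply, Fintype.sum_prod_type, gradM]
  refine Finset.sum_congr rfl fun i _ => Finset.sum_congr rfl fun j _ => ?_
  have h1 : HasFDerivAt (fun w => φ w i)
      ((EuclideanSpace.proj i : Vec N →L[ℝ] ℝ).comp (fderiv ℝ φ z)) z :=
    (EuclideanSpace.proj i : Vec N →L[ℝ] ℝ).hasFDerivAt.comp z h.hasFDerivAt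
  rw [pderivS_eq h1.differentiableAt, h1.fderiv]
  simp [mul_comm]

/-- A Carathéodory field evaluated along measurable functions is a.e. measurable. -/
theorem exists_measurable_caratheodory {U : Set (ST n)}
    {A : ST n → Vec N → Mat N n → Mat N n} {u : ST n → Vec N} {Du : ST n → Mat N n}
    (hm : ∀ v ξ, Measurable fun z => A z v ξ)
    (hc : ∀ᵐ z ∂(volume.restrict U), Continuous fun q : Vec N × Mat N n => A z q.1 q.2)
    (hu : Measurable u) (hDu : Measurable Du) :
    ∃ B : ST n → Mat N n, Measurable B ∧ ∀ᵐ z ∂(volume.restrict U), B z = A z (u z) (Du z) := by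
  classical
  obtain ⟨Z, hZ, hZm, hZc⟩ : ∃ Z : Set (ST n), volume.restrict U Zᶜ = 0 ∧ MeasurableSet Z ∧
      ∀ z ∈ Z, Continuous fun q : Vec N × Mat N n => A z q.1 q.2 := by
    refine ⟨(toMeasurable (volume.restrict U)
      {z | Continuous fun q : Vec N × Mat N n => A z q.1 q.2}ᶜ)ᶜ, ?_,
      (measurableSet_toMeasurable _ _).compl, fun z hz => ?_⟩
    · rw [compl_compl, measure_toMeasurable]
      exact hc
    · by_contra h
      exact hz (subset_toMeasurable _ _ h)
  let A' : (Vec N × Mat N n) → ST n → Mat N n := fun q z => if z ∈ Z then A z q.1 q.2 else 0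
  have h1 : Measurable (Function.uncurry A') := by
    refine measurable_uncurry_of_continuous_of_measurable (fun z => ?_) (fun q => ?_)
    · by_cases hz : z ∈ Z
      · simpa [A', hz] using hZc z hz
      · simpa [A', hz] using continuous_const
    · exact Measurable.ite hZm (hm _ _) measurable_const
  refine ⟨fun z => A' (u z, Du z) z, h1.comp ((hu.prodMk hDu).prodMk measurable_id), ?_⟩
  have : ∀ᵐ z ∂(volume.restrict U), z ∈ Z := hZ
  filter_upwards [this] with z hz
  simp [A', hz]

theorem exists_flux {p ν L T : ℝ} (hp : 1 < p) {Ω : Set (Spc n)}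
    {A : ST n → Vec N → Mat N n → Mat N n} {F : ST n → Mat N n} {u : ST n → Vec N}
    {Du : ST n → Mat N n} (S : WeakSolution p ν L T Ω A F u Du) :
    ∃ H : ST n → Mat N n, Measurable H ∧
      (∀ᵐ z ∂(volume.restrict (Ω ×ˢ Ioo 0 T)),
        ‖H z‖ ≤ L * ‖Du z‖ ^ (p - 1) + ‖F z‖ ^ (p - 1)) ∧
      (∀ᵐ z ∂(volume.restrict (Ω ×ˢ Ioo 0 T)),
        ν * ‖Du z‖ ^ p ≤ inner ℝ (H z) (Du z) + ‖F z‖ ^ (p - 1) * ‖Du z‖) ∧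
      ∀ φ : ST n → Vec N, ContDiff ℝ (⊤ : ℕ∞) φ → HasCompactSupport φ →
        tsupport φ ⊆ Ω ×ˢ Ioo 0 T →
        ∫ z in Ω ×ˢ Ioo 0 T, inner ℝ (J p (u z)) (fderiv ℝ φ z (tdir n))
          = ∫ z in Ω ×ˢ Ioo 0 T, inner ℝ (H z) (gradM φ z) := by
  obtain ⟨B, hB, hBA⟩ := exists_measurable_caratheodory S.measA S.contA S.measu S.measDu
  refine ⟨fun z => B z + J p (F z), hB.add (measurable_J p S.measF), ?_, ?_, ?_⟩
  · filter_upwards [hBA, S.growth] with z h1 h2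
    refine (norm_add_le _ _).trans (add_le_add ?_ (norm_J hp _).le)
    rw [h1]; exact h2 _ _
  · filter_upwards [hBA, S.coercivity] with z h1 h2
    have h3 := h2 (u z) (Du z)
    have h4 := neg_le_of_abs_le (abs_real_inner_le_norm (J p (F z)) (Du z))
    rw [norm_J hp] at h4
    rw [inner_add_left, h1]
    linarith
  · intro φ hφ hφc hφs
    have hd : Differentiable ℝ φ := hφ.differentiable (by simp)
    have hJu := memLp_J hp S.measu S.memLp_u
    have hJF := memLp_J hp S.measF S.memLp_F
    have hBm : MemLp B (ENNReal.ofReal (p / (p - 1))) (volume.restrict (Ω ×ˢ Ioo 0 T)) := by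
      refine ((memLp_norm_rpow_sub_one hp S.memLp_Du).const_mul L).of_le hB.aestronglyMeasurable ?_
      filter_upwards [hBA, S.growth] with z h1 h2
      rw [h1]
      exact (h2 _ _).trans (le_abs_self _)
    have hcd : Continuous (fderiv ℝ φ) := hφ.continuous_fderiv (by simp)
    have hφt : MemLp (fun z => fderiv ℝ φ z (tdir n)) (ENNReal.ofReal p)
        (volume.restrict (Ω ×ˢ Ioo 0 T)) := by
      refine (Continuous.memLp_of_hasCompactSupport (by fun_prop) ?_).restrict _
      exact (hφc.fderiv ℝ).comp_left (g := fun l : ST n →L[ℝ] Vec N => l (tdir n)) rfl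
    have hφg : MemLp (gradM φ) (ENNReal.ofReal p) (volume.restrict (Ω ×ˢ Ioo 0 T)) := by
      refine ((continuous_gradM hφ).memLp_of_hasCompactSupport ?_).restrict _
      exact (hφc.fderiv ℝ).comp_left (g := fun l : ST n →L[ℝ] Vec N =>
        (WithLp.toLp 2 fun ij => l (sdir ij.2) ij.1 : Mat N n)) (by ext; simp)
    have h0 := S.weakForm φ hφ hφc hφs
    have e1 : ∀ z, ‖u z‖ ^ (p - 2) * (inner ℝ (u z) (tderiv φ z) : ℝ)
        = inner ℝ (J p (u z)) (fderiv ℝ φ z (tdir n)) := fun z => by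
      rw [tderiv_eq (hd z), J, real_inner_smul_left]
    have e2 : ∀ z, ‖F z‖ ^ (p - 2) * gradPair F φ z
        = inner ℝ (J p (F z)) (gradM φ z) := fun z => by
      rw [gradPair_eq F (hd z), J, real_inner_smul_left]
    have e3 : ∫ z in Ω ×ˢ Ioo 0 T,
        (‖u z‖ ^ (p - 2) * (inner ℝ (u z) (tderiv φ z) : ℝ)
          - gradPair (fun w => A w (u w) (Du w)) φ z)
        = ∫ z in Ω ×ˢ Ioo 0 T, (inner ℝ (J p (u z)) (fderiv ℝ φ z (tdir n))
          - inner ℝ (B z) (gradM φ z)) := by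
      refine integral_congr_ae ?_
      filter_upwards [hBA] with z h1
      rw [e1 z, gradPair_eq _ (hd z), h1]
    simp only [e2] at h0
    rw [e3, integral_sub (integrable_inner_of_memLp hp hJu hφt)
      (integrable_inner_of_memLp hp hBm hφg)] at h0
    simp only [inner_add_left]
    rw [integral_add (integrable_inner_of_memLp hp hBm hφg)
      (integrable_inner_of_memLp hp hJF hφg)]
    linarith


/-! ### Normalization of a weak solution -/

section Normalization

variable {p ν L T d : ℝ} {Ω : Set (Spc n)} {A : ST n → Vec N → Mat N n → Mat N n}
  {F : ST n → Mat N n} {u : ST n → Vec N} {Du : ST n → Mat N n}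
variable {z₀ : ST n} {R S : ℝ} {hR : 0 < R} {hS : 0 < S}

theorem hasFDerivAt_scl_symm (w : ST n) : HasFDerivAt (scl z₀ hR hS).symm
    (((R⁻¹ • ContinuousLinearMap.fst ℝ (Spc n) ℝ)).prod
      (S⁻¹ • ContinuousLinearMap.snd ℝ (Spc n) ℝ)) w := by
  have h1 : HasFDerivAt (fun w : ST n => R⁻¹ • (w.1 - z₀.1))
      (R⁻¹ • ContinuousLinearMap.fst ℝ (Spc n) ℝ) w :=
    (hasFDerivAt_fst.sub_const z₀.1).const_smul R⁻¹
  have h2 : HasFDerivAt (fun w : ST n => S⁻¹ * (w.2 - z₀.2))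
      (S⁻¹ • ContinuousLinearMap.snd ℝ (Spc n) ℝ) w :=
    (hasFDerivAt_snd.sub_const z₀.2).const_mul S⁻¹
  exact h1.prodMk h2

theorem contDiff_scl_symm : ContDiff ℝ (⊤ : ℕ∞) (scl z₀ hR hS).symm := by
  change ContDiff ℝ (⊤ : ℕ∞) fun w : ST n => (R⁻¹ • (w.1 - z₀.1), S⁻¹ * (w.2 - z₀.2))
  fun_prop

theorem fderiv_comp_scl_symm {E : Type*} [NormedAddCommGroup E] [NormedSpace ℝ E] {Ψ : ST n → E}
    (hΨ : Differentiable ℝ Ψ) (z a : ST n) :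
    fderiv ℝ (fun w => Ψ ((scl z₀ hR hS).symm w)) (scl z₀ hR hS z) a
      = fderiv ℝ Ψ z (R⁻¹ • a.1, S⁻¹ * a.2) := by
  have h1 : HasFDerivAt Ψ (fderiv ℝ Ψ z) ((scl z₀ hR hS).symm (scl z₀ hR hS z)) := by
    rw [Homeomorph.symm_apply_apply]; exact (hΨ z).hasFDerivAt
  have h2 : HasFDerivAt (fun w => Ψ ((scl z₀ hR hS).symm w)) _ (scl z₀ hR hS z) :=
    h1.comp _ (hasFDerivAt_scl_symm (z₀ := z₀) (hR := hR) (hS := hS) (scl z₀ hR hS z))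
  rw [h2.fderiv]
  rfl

theorem fderiv_comp_scl_symm_sdir {E : Type*} [NormedAddCommGroup E] [NormedSpace ℝ E]
    {Ψ : ST n → E} (hΨ : Differentiable ℝ Ψ) (z : ST n) (j : Fin n) :
    fderiv ℝ (fun w => Ψ ((scl z₀ hR hS).symm w)) (scl z₀ hR hS z) (sdir j)
      = R⁻¹ • fderiv ℝ Ψ z (sdir j) := by
  rw [fderiv_comp_scl_symm hΨ, ← map_smul]
  congr 1
  ext1 <;> simp [sdir]

theorem fderiv_comp_scl_symm_tdir {E : Type*} [NormedAddCommGroup E] [NormedSpace ℝ E]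
    {Ψ : ST n → E} (hΨ : Differentiable ℝ Ψ) (z : ST n) :
    fderiv ℝ (fun w => Ψ ((scl z₀ hR hS).symm w)) (scl z₀ hR hS z) (tdir n)
      = S⁻¹ • fderiv ℝ Ψ z (tdir n) := by
  rw [fderiv_comp_scl_symm hΨ, ← map_smul]
  congr 1
  ext1 <;> simp [tdir]

theorem gradM_comp_scl_symm {Ψ : ST n → Vec N} (hΨ : Differentiable ℝ Ψ) (z : ST n) :
    gradM (fun w => Ψ ((scl z₀ hR hS).symm w)) (scl z₀ hR hS z) = R⁻¹ • gradM Ψ z := by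
  ext ij
  simp [gradM, fderiv_comp_scl_symm_sdir hΨ]

theorem J_smul_pos {E : Type*} [NormedAddCommGroup E] [InnerProductSpace ℝ E] {a : ℝ} (ha : 0 < a)
    (w : E) : J p (a • w) = a ^ (p - 1) • J p w := by
  rw [J, J, norm_smul, Real.norm_of_nonneg ha.le, Real.mul_rpow ha.le (norm_nonneg _), smul_smul,
    smul_smul]
  congr 1
  have : a ^ (p - 1) = a ^ (p - 2) * a := by
    rw [← Real.rpow_add_one ha.ne']; congr 1; ring
  rw [this]; ring

theorem setIntegral_preimage_scl_eq {U : Set (ST n)}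
    (hsub : ∀ z ∈ Metric.ball (0 : ST n) 2, scl z₀ hR hS z ∈ U) {g h : ST n → ℝ}
    (hg : ∀ z ∈ Metric.ball (0 : ST n) 2, g z = h z)
    (hg0 : ∀ z ∉ Metric.ball (0 : ST n) 2, g z = 0)
    (hh0 : ∀ z ∉ Metric.ball (0 : ST n) 2, h z = 0) :
    ∫ z in scl z₀ hR hS ⁻¹' U, g z = ∫ z, h z := by
  rw [setIntegral_eq_integral_of_forall_compl_eq_zero (s := scl z₀ hR hS ⁻¹' U)
    fun z hz => hg0 z fun h => hz (hsub z h)]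
  congr 1
  ext z
  by_cases hz : z ∈ Metric.ball (0 : ST n) 2
  · exact hg z hz
  · rw [hg0 z hz, hh0 z hz]

theorem tsupport_comp_scl_symm_subset {E : Type*} [NormedAddCommGroup E] {U : Set (ST n)}
    (hsub : ∀ z ∈ Metric.ball (0 : ST n) 2, scl z₀ hR hS z ∈ U) {Ψ : ST n → E}
    (hΨ : tsupport Ψ ⊆ Metric.ball 0 2) :
    tsupport (fun w => Ψ ((scl z₀ hR hS).symm w)) ⊆ U := by
  have h := tsupport_comp_eq_preimage Ψ (scl z₀ hR hS).symm
  change tsupport (fun w => Ψ ((scl z₀ hR hS).symm w)) = _ at h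
  rw [h]
  intro w hw
  simpa using hsub _ (hΨ hw)

theorem wgrad_scl (W : WeakSolution p ν L T Ω A F u Du)
    (hsub : ∀ z ∈ Metric.ball (0 : ST n) 2, scl z₀ hR hS z ∈ Ω ×ˢ Ioo 0 T) :
    WGrad (Metric.ball 0 2)
      ((Metric.ball 0 2).indicator fun z => (R * d)⁻¹ • u (scl z₀ hR hS z))
      ((Metric.ball 0 2).indicator fun z => d⁻¹ • Du (scl z₀ hR hS z)) := by
  intro ψ hψ hψc hψs i k
  have hU : MeasurableSet (Ω ×ˢ Ioo 0 T) := W.openΩ.measurableSet.prod measurableSet_Ioo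
  have hdψ : Differentiable ℝ ψ := hψ.differentiable (by simp)
  obtain ⟨j, hj, h_int⟩ := exists_setIntegral_scl z₀ hR hS
  have hcd := hψ.comp (contDiff_scl_symm (z₀ := z₀) (hR := hR) (hS := hS))
  have h0 := W.weakGrad (fun w => ψ ((scl z₀ hR hS).symm w)) hcd
    (hψc.comp_homeomorph (scl z₀ hR hS).symm) (tsupport_comp_scl_symm_subset hsub hψs) i k
  have hcd' : Differentiable ℝ fun w => ψ ((scl z₀ hR hS).symm w) :=
    hcd.differentiable (by simp)
  simp only [fun z => pderivS_eq (hcd' z) k] at h0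
  have hz0 : ∀ z ∉ Metric.ball (0 : ST n) 2, fderiv ℝ ψ z (sdir k) = 0 ∧ ψ z = 0 := by
    intro z hz
    have h1 : z ∉ tsupport ψ := fun h => hz (hψs h)
    refine ⟨?_, image_eq_zero_of_notMem_tsupport h1⟩
    rw [fderiv_of_notMem_tsupport ℝ h1]; rfl
  have h1 : ∫ z, ((Metric.ball 0 2).indicator (fun z => (R * d)⁻¹ • u (scl z₀ hR hS z)) z) i
      * fderiv ℝ ψ z (sdir k) = d⁻¹ * (j * ∫ z in Ω ×ˢ Ioo 0 T, u z i
        * fderiv ℝ (fun w => ψ ((scl z₀ hR hS).symm w)) z (sdir k)) := by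
    rw [← h_int _ _ hU, ← integral_const_mul]
    refine (setIntegral_preimage_scl_eq hsub (fun z hz => ?_) (fun z hz => ?_)
      (fun z hz => ?_)).symm
    · rw [indicator_of_mem hz, fderiv_comp_scl_symm_sdir hdψ, smul_eq_mul, PiLp.smul_apply,
        smul_eq_mul, mul_inv]
      ring
    · rw [fderiv_comp_scl_symm_sdir hdψ, (hz0 z hz).1]; simp
    · rw [(hz0 z hz).1, mul_zero]
  have h2 : ∫ z, ((Metric.ball 0 2).indicator (fun z => d⁻¹ • Du (scl z₀ hR hS z)) z) (i, k)
      * ψ z = d⁻¹ * (j * ∫ z in Ω ×ˢ Ioo 0 T, Du z (i, k) * ψ ((scl z₀ hR hS).symm z)) := by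
    rw [← h_int _ _ hU, ← integral_const_mul]
    refine (setIntegral_preimage_scl_eq hsub (fun z hz => ?_) (fun z hz => ?_)
      (fun z hz => ?_)).symm
    · rw [indicator_of_mem hz, Homeomorph.symm_apply_apply, PiLp.smul_apply, smul_eq_mul]
      ring
    · rw [Homeomorph.symm_apply_apply, (hz0 z hz).2]; simp
    · rw [(hz0 z hz).2, mul_zero]
  rw [h1, h2, h0]
  ring

theorem weak_scl {U : Set (ST n)} (hU : MeasurableSet U) {H : ST n → Mat N n} (hd : 0 < d)
    (hw : ∀ φ : ST n → Vec N, ContDiff ℝ (⊤ : ℕ∞) φ → HasCompactSupport φ → tsupport φ ⊆ U →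
      ∫ z in U, inner ℝ (J p (u z)) (fderiv ℝ φ z (tdir n)) = ∫ z in U, inner ℝ (H z) (gradM φ z))
    (hsub : ∀ z ∈ Metric.ball (0 : ST n) 2, scl z₀ hR hS z ∈ U)
    {Ψ : ST n → Vec N} (hΨ : ContDiff ℝ (⊤ : ℕ∞) Ψ) (hΨc : HasCompactSupport Ψ)
    (hΨs : tsupport Ψ ⊆ Metric.ball 0 2) :
    ∫ z, inner ℝ (J p ((Metric.ball 0 2).indicator (fun z => (R * d)⁻¹ • u (scl z₀ hR hS z)) z))
        (fderiv ℝ Ψ z (tdir n))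
      = S / R ^ p * ∫ z, inner ℝ ((Metric.ball 0 2).indicator
        (fun z => (d ^ (p - 1))⁻¹ • H (scl z₀ hR hS z)) z) (gradM Ψ z) := by
  have hdΨ : Differentiable ℝ Ψ := hΨ.differentiable (by simp)
  obtain ⟨j, hj, h_int⟩ := exists_setIntegral_scl z₀ hR hS
  have hcd := hΨ.comp (contDiff_scl_symm (z₀ := z₀) (hR := hR) (hS := hS))
  have h0 := hw (fun w => Ψ ((scl z₀ hR hS).symm w)) hcd
    (hΨc.comp_homeomorph (scl z₀ hR hS).symm) (tsupport_comp_scl_symm_subset hsub hΨs)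
  have hz0 : ∀ z ∉ Metric.ball (0 : ST n) 2, fderiv ℝ Ψ z (tdir n) = 0 ∧ gradM Ψ z = 0 := by
    intro z hz
    have h1 : z ∉ tsupport Ψ := fun h => hz (hΨs h)
    refine ⟨by rw [fderiv_of_notMem_tsupport ℝ h1]; rfl, ?_⟩
    ext ij
    simp [gradM, fderiv_of_notMem_tsupport ℝ h1]
  have h1 : ∫ z, inner ℝ (J p ((Metric.ball 0 2).indicator
        (fun z => (R * d)⁻¹ • u (scl z₀ hR hS z)) z)) (fderiv ℝ Ψ z (tdir n))
      = (S * ((R * d)⁻¹) ^ (p - 1)) * (j * ∫ z in U, inner ℝ (J p (u z))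
        (fderiv ℝ (fun w => Ψ ((scl z₀ hR hS).symm w)) z (tdir n))) := by
    rw [← h_int _ _ hU, ← integral_const_mul]
    refine (setIntegral_preimage_scl_eq hsub (fun z hz => ?_) (fun z hz => ?_)
      (fun z hz => ?_)).symm
    · rw [indicator_of_mem hz, fderiv_comp_scl_symm_tdir hdΨ, J_smul_pos (by positivity),
        real_inner_smul_left, real_inner_smul_right]
      field_simp
    · rw [fderiv_comp_scl_symm_tdir hdΨ, (hz0 z hz).1]; simp
    · rw [(hz0 z hz).1, inner_zero_right]
  have h2 : ∫ z, inner ℝ ((Metric.ball 0 2).indicator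
        (fun z => (d ^ (p - 1))⁻¹ • H (scl z₀ hR hS z)) z) (gradM Ψ z)
      = (R * (d ^ (p - 1))⁻¹) * (j * ∫ z in U, inner ℝ (H z)
        (gradM (fun w => Ψ ((scl z₀ hR hS).symm w)) z)) := by
    rw [← h_int _ _ hU, ← integral_const_mul]
    refine (setIntegral_preimage_scl_eq hsub (fun z hz => ?_) (fun z hz => ?_)
      (fun z hz => ?_)).symm
    · rw [indicator_of_mem hz, gradM_comp_scl_symm hdΨ, real_inner_smul_left,
        real_inner_smul_right]
      field_simp
    · rw [gradM_comp_scl_symm hdΨ, (hz0 z hz).2]; simp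
    · rw [(hz0 z hz).2, inner_zero_right]
  rw [h1, h2, h0, Real.inv_rpow (by positivity), Real.mul_rpow hR.le hd.le,
    Real.rpow_sub_one hR.ne']
  field_simp

theorem exists_nsol_scl (W : WeakSolution p ν L T Ω A F u Du) (hp : 1 < p) (hd : 0 < d)
    (hsub : ∀ z ∈ Metric.ball (0 : ST n) 2, scl z₀ hR hS z ∈ Ω ×ˢ Ioo 0 T) :
    ∃ G : ST n → Mat N n, NSol p ν L (S / R ^ p)
      ((Metric.ball 0 2).indicator fun z => (R * d)⁻¹ • u (scl z₀ hR hS z))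
      ((Metric.ball 0 2).indicator fun z => d⁻¹ • Du (scl z₀ hR hS z)) G
      ((Metric.ball 0 2).indicator fun z => d⁻¹ * ‖F (scl z₀ hR hS z)‖) := by
  obtain ⟨H, hH, hgr, hco, hw⟩ := exists_flux hp W
  have hU : MeasurableSet (Ω ×ˢ Ioo 0 T) := W.openΩ.measurableSet.prod measurableSet_Ioo
  have hB : MeasurableSet (Metric.ball (0 : ST n) 2) := measurableSet_ball
  have hΦ : Measurable (scl z₀ hR hS) := (scl z₀ hR hS).continuous.measurable
  have hout : ∀ z : ST n, 2 ≤ ‖z‖ → z ∉ Metric.ball (0 : ST n) 2 := fun z hz h =>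
    absurd (mem_ball_zero_iff.1 h) (not_lt.2 hz)
  have hHm : Measurable fun z => (d ^ (p - 1))⁻¹ • H (scl z₀ hR hS z) :=
    (hH.comp hΦ).const_smul (d ^ (p - 1))⁻¹
  have hdi : 0 < d⁻¹ := inv_pos.2 hd
  refine ⟨(Metric.ball 0 2).indicator fun z => (d ^ (p - 1))⁻¹ • H (scl z₀ hR hS z), hp, W.hν,
    W.hν.le.trans W.hνL, by positivity,
    ((W.measu.comp hΦ).const_smul (R * d)⁻¹).indicator hB, ((W.measDu.comp hΦ).const_smul d⁻¹).indicator hB,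
    hHm.indicator hB, ((W.measF.comp hΦ).norm.const_mul d⁻¹).indicator hB,
    memLp_scl hU hB hsub (W.memLp_u.const_smul (R * d)⁻¹),
    memLp_scl hU hB hsub (W.memLp_Du.const_smul d⁻¹),
    memLp_scl hU hB hsub (W.memLp_F.norm.const_mul d⁻¹),
    fun z hz => indicator_of_notMem (hout z hz) _, fun z hz => indicator_of_notMem (hout z hz) _,
    fun z hz => indicator_of_notMem (hout z hz) _,
    fun z => indicator_nonneg (fun z _ => by positivity) z, ?_, ?_, wgrad_scl W hsub,
    fun Ψ h1 h2 h3 => weak_scl hU hd hw hsub h1 h2 h3⟩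
  · filter_upwards [ae_scl (z₀ := z₀) (hR := hR) (hS := hS) hU hgr] with z h
    by_cases hz : z ∈ Metric.ball (0 : ST n) 2
    · have h1 := h (hsub z hz)
      simp only [indicator_of_mem hz, norm_smul, norm_inv, Real.norm_of_nonneg hd.le,
        Real.norm_of_nonneg (Real.rpow_nonneg hd.le (p - 1))]
      rw [Real.mul_rpow hdi.le (norm_nonneg _), Real.mul_rpow hdi.le (norm_nonneg _),
        Real.inv_rpow hd.le]
      calc _ ≤ (d ^ (p - 1))⁻¹ * _ := mul_le_mul_of_nonneg_left h1 (by positivity)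
        _ = _ := by ring
    · simp only [indicator_of_notMem hz, norm_zero, Real.zero_rpow (by linarith : p - 1 ≠ 0)]
      simp
  · filter_upwards [ae_scl (z₀ := z₀) (hR := hR) (hS := hS) hU hco] with z h
    by_cases hz : z ∈ Metric.ball (0 : ST n) 2
    · have h1 := h (hsub z hz)
      simp only [indicator_of_mem hz, norm_smul, norm_inv, Real.norm_of_nonneg hd.le,
        real_inner_smul_left, real_inner_smul_right]
      rw [Real.mul_rpow hdi.le (norm_nonneg _), Real.mul_rpow hdi.le (norm_nonneg _),
        Real.inv_rpow hd.le, Real.inv_rpow hd.le, Real.rpow_sub_one hd.ne']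
      calc _ = (d ^ p)⁻¹ * (ν * ‖Du (scl z₀ hR hS z)‖ ^ p) := by ring
        _ ≤ (d ^ p)⁻¹ * _ := mul_le_mul_of_nonneg_left h1 (by positivity)
        _ = _ := by field_simp
    · simp only [indicator_of_notMem hz, norm_zero, Real.zero_rpow (by linarith : p ≠ 0)]
      simp

end Normalization


/-! ### The reverse Hölder inequality on normalized cylinders -/

/-- The normalized outer cylinder. -/
def outerCyl (n : ℕ) (p : ℝ) : Set (ST n) :=
  Metric.ball (0 : Spc n) 2 ×ˢ Ioo (-(2:ℝ) ^ p) ((2:ℝ) ^ p)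

theorem measurableSet_outerCyl (p : ℝ) : MeasurableSet (outerCyl n p) :=
  measurableSet_ball.prod measurableSet_Ioo

theorem isBounded_outerCyl (p : ℝ) : Bornology.IsBounded (outerCyl n p) :=
  Metric.isBounded_ball.prod (Metric.isBounded_Ioo _ _)

theorem ball_two_subset_outerCyl {p : ℝ} (hp : 1 < p) :
    Metric.ball (0 : ST n) 2 ⊆ outerCyl n p := by
  intro z hz
  obtain ⟨h1, h2, h3⟩ := mem_ball_ST.1 hz
  have : (2:ℝ) ≤ 2 ^ p := by
    simpa using Real.rpow_le_rpow_of_exponent_le (by norm_num : (1:ℝ) ≤ 2) hp.le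
  exact ⟨h1, by linarith, by linarith⟩

theorem volume_outerCyl_ne_top (p : ℝ) : volume (outerCyl n p) ≠ ⊤ :=
  (isBounded_outerCyl p).measure_lt_top.ne

theorem volume_ball_ne_zero : volume (Metric.ball (0 : ST n) 1) ≠ 0 :=
  (Metric.measure_ball_pos volume _ one_pos).ne'

theorem volume_outerCyl_ne_zero {p : ℝ} (hp : 1 < p) : volume (outerCyl n p) ≠ 0 := fun h =>
  volume_ball_ne_zero (measure_mono_null
    ((Metric.ball_subset_ball one_le_two).trans (ball_two_subset_outerCyl hp)) h)

theorem setIntegral_indicator_smul_rpow {E : Type*} [NormedAddCommGroup E] [NormedSpace ℝ E]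
    {B s : Set (ST n)} (hs : MeasurableSet s) (hsB : s ⊆ B) (g : ST n → E) {a r : ℝ} (ha : 0 < a) :
    ∫ z in s, ‖B.indicator (fun z => a • g z) z‖ ^ r = a ^ r * ∫ z in s, ‖g z‖ ^ r := by
  rw [← integral_const_mul]
  refine setIntegral_congr_fun hs fun z hz => ?_
  rw [indicator_of_mem (hsB hz), norm_smul, Real.norm_of_nonneg ha.le,
    Real.mul_rpow ha.le (norm_nonneg _)]

theorem integral_indicator_smul_rpow {E : Type*} [NormedAddCommGroup E] [NormedSpace ℝ E]
    {B : Set (ST n)} (hB : MeasurableSet B) (g : ST n → E) {a r : ℝ} (ha : 0 < a) (hr : 0 < r) :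
    ∫ z, ‖B.indicator (fun z => a • g z) z‖ ^ r = a ^ r * ∫ z in B, ‖g z‖ ^ r := by
  rw [← setIntegral_indicator_smul_rpow hB subset_rfl g ha,
    setIntegral_eq_integral_of_forall_compl_eq_zero fun z hz => ?_]
  rw [indicator_of_notMem hz, norm_zero, Real.zero_rpow hr.ne']

theorem average_rpow_le {X : Type*} [MeasurableSpace X] {m : Measure X} {g : X → ℝ} {E : Set X}
    {q : ℝ} (hq : 1 ≤ q) (h0 : m E ≠ 0) (ht : m E ≠ ⊤) (hg : ∀ x, 0 ≤ g x)
    (hi : IntegrableOn g E m) (hiq : IntegrableOn (fun x => g x ^ q) E m) :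
    (⨍ x in E, g x ∂m) ^ q ≤ ⨍ x in E, g x ^ q ∂m :=
  (convexOn_rpow hq).map_set_average_le
    (Real.continuous_rpow_const (by linarith)).continuousOn isClosed_Ici h0 ht
    (Eventually.of_forall hg) hi hiq

theorem integrableOn_rpow_of_memLp {X : Type*} [MeasurableSpace X] {m : Measure X} {E : Type*}
    [NormedAddCommGroup E] {g : X → E} {B : Set X} {p q : ℝ} (hq : 0 < q) (hqp : q ≤ p)
    (ht : m B ≠ ⊤) (hg : MemLp g (ENNReal.ofReal p) (m.restrict B)) :
    IntegrableOn (fun x => ‖g x‖ ^ q) B m := by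
  have : IsFiniteMeasure (m.restrict B) := ⟨by simpa using ht.lt_top⟩
  have h := (hg.mono_exponent (ENNReal.ofReal_le_ofReal hqp)).integrable_norm_rpow
    (by simpa using hq) ENNReal.ofReal_ne_top
  rwa [ENNReal.toReal_ofReal hq.le] at h

theorem setIntegral_eq_mul_average {X : Type*} [MeasurableSpace X] {m : Measure X} {g : X → ℝ}
    {E : Set X} (h0 : m E ≠ 0) (ht : m E ≠ ⊤) :
    ∫ x in E, g x ∂m = m.real E * ⨍ x in E, g x ∂m := by
  rw [setAverage_eq, smul_eq_mul, mul_inv_cancel_left₀]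
  exact (measureReal_ne_zero_iff ht).2 h0

section Core

variable {p ν L K T d μ : ℝ} {Ω : Set (Spc n)} {A : ST n → Vec N → Mat N n → Mat N n}
  {F : ST n → Mat N n} {u : ST n → Vec N} {Du : ST n → Mat N n}
variable {z₀ : ST n} {R S : ℝ} {hR : 0 < R} {hS : 0 < S}

theorem memLp_comp_scl {E : Type*} [NormedAddCommGroup E] {g : ST n → E} {q : ℝ≥0∞}
    {U V : Set (ST n)} (hU : MeasurableSet U) (hV : MeasurableSet V)
    (hVU : ∀ z ∈ V, scl z₀ hR hS z ∈ U) (hg : MemLp g q (volume.restrict U)) :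
    MemLp (fun z => g (scl z₀ hR hS z)) q (volume.restrict V) :=
  (memLp_indicator_iff_restrict hV).1 (memLp_scl hU hV hVU hg)

/-- The enlarged intrinsic constant after normalization. -/
def normK (n : ℕ) (p K : ℝ) : ℝ :=
  K * (2 ^ p * volume.real (outerCyl n p)
    + volume.real (outerCyl n p) / volume.real (Metric.ball (0 : ST n) 1) + 1)

theorem exists_conf (W : WeakSolution p ν L T Ω A F u Du) (hp : 1 < p) (hK : 0 ≤ K) (hd : 0 < d)
    (hμ : 0 < μ) (hRS : S / R ^ p = μ ^ (p - 2))
    (hsub : ∀ z ∈ outerCyl n p, scl z₀ hR hS z ∈ Ω ×ˢ Ioo 0 T)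
    (hdp : ⨍ z in Metric.ball 0 1, (‖Du (scl z₀ hR hS z)‖ ^ p + ‖F (scl z₀ hR hS z)‖ ^ p) = d ^ p)
    (h1 : ⨍ z in outerCyl n p, ‖u (scl z₀ hR hS z)‖ ^ p / (2 ^ p * R ^ p) ≤ K * μ ^ p * d ^ p)
    (h2 : μ ^ p * ⨍ z in outerCyl n p, (‖Du (scl z₀ hR hS z)‖ ^ p + ‖F (scl z₀ hR hS z)‖ ^ p)
      ≤ K * ⨍ z in Metric.ball 0 1, ‖u (scl z₀ hR hS z)‖ ^ p / R ^ p ∨ μ ^ p ≤ K) :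
    ∃ c : Conf n p ν L (normK n p K) (volume.real (Metric.ball (0 : ST n) 1)),
      c.defect = d⁻¹ * (∫ z in Metric.ball 0 2, ‖Du (scl z₀ hR hS z)‖)
        + (d ^ p)⁻¹ * ∫ z in Metric.ball 0 2, ‖F (scl z₀ hR hS z)‖ ^ p := by
  have hp0 : 0 < p := by linarith
  have hU : MeasurableSet (Ω ×ˢ Ioo 0 T) := W.openΩ.measurableSet.prod measurableSet_Ioo
  have hE := measurableSet_outerCyl (n := n) p
  have hB2 : MeasurableSet (Metric.ball (0 : ST n) 2) := measurableSet_ball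
  have hB1 : MeasurableSet (Metric.ball (0 : ST n) 1) := measurableSet_ball
  have h12 : Metric.ball (0 : ST n) 1 ⊆ Metric.ball 0 2 := Metric.ball_subset_ball one_le_two
  have h2E := ball_two_subset_outerCyl (n := n) hp
  obtain ⟨G, sol⟩ := exists_nsol_scl (z₀ := z₀) (hR := hR) (hS := hS) W hp hd
    fun z hz => hsub z (h2E hz)
  have iu : IntegrableOn (fun z => ‖u (scl z₀ hR hS z)‖ ^ p) (outerCyl n p) :=
    integrableOn_rpow_of_memLp hp0 le_rfl (volume_outerCyl_ne_top p)
      (memLp_comp_scl hU hE hsub W.memLp_u)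
  have iD : IntegrableOn (fun z => ‖Du (scl z₀ hR hS z)‖ ^ p) (outerCyl n p) :=
    integrableOn_rpow_of_memLp hp0 le_rfl (volume_outerCyl_ne_top p)
      (memLp_comp_scl hU hE hsub W.memLp_Du)
  have iF : IntegrableOn (fun z => ‖F (scl z₀ hR hS z)‖ ^ p) (outerCyl n p) :=
    integrableOn_rpow_of_memLp hp0 le_rfl (volume_outerCyl_ne_top p)
      (memLp_comp_scl hU hE hsub W.memLp_F)
  have hV1 : 0 < volume.real (Metric.ball (0 : ST n) 1) :=
    ENNReal.toReal_pos volume_ball_ne_zero (Metric.isBounded_ball.measure_lt_top.ne)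
  have hV2 : 0 < volume.real (outerCyl n p) :=
    ENNReal.toReal_pos (volume_outerCyl_ne_zero hp) (volume_outerCyl_ne_top p)
  have hdi : 0 < d⁻¹ := inv_pos.2 hd
  have hRdi : 0 < (R * d)⁻¹ := by positivity
  have hfeq : ∀ z, (Metric.ball 0 2).indicator (fun z => d⁻¹ * ‖F (scl z₀ hR hS z)‖) z ^ p
      = ‖(Metric.ball 0 2).indicator (fun z => d⁻¹ • ‖F (scl z₀ hR hS z)‖) z‖ ^ p := fun z =>
    congrArg (· ^ p) (Real.norm_of_nonneg (sol.fnonneg z)).symm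
  have ef : ∫ z, (Metric.ball 0 2).indicator (fun z => d⁻¹ * ‖F (scl z₀ hR hS z)‖) z ^ p
      = (d ^ p)⁻¹ * ∫ z in Metric.ball 0 2, ‖F (scl z₀ hR hS z)‖ ^ p := by
    simp only [hfeq]
    rw [integral_indicator_smul_rpow hB2 _ hdi hp0, Real.inv_rpow hd.le]
    simp only [norm_norm]
  have eD := integral_indicator_smul_rpow hB2 (fun z => Du (scl z₀ hR hS z)) hdi hp0
  have eD1 := setIntegral_indicator_smul_rpow (r := p) hB1 h12 (fun z => Du (scl z₀ hR hS z)) hdi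
  have ev := integral_indicator_smul_rpow hB2 (fun z => u (scl z₀ hR hS z)) hRdi hp0
  have ev1 := setIntegral_indicator_smul_rpow (r := p) hB1 h12 (fun z => u (scl z₀ hR hS z)) hRdi
  rw [Real.inv_rpow hd.le] at eD eD1
  rw [Real.inv_rpow (by positivity), Real.mul_rpow hR.le hd.le] at ev ev1
  have hdp' : (∫ z in Metric.ball 0 1, ‖Du (scl z₀ hR hS z)‖ ^ p)
      + ∫ z in Metric.ball 0 1, ‖F (scl z₀ hR hS z)‖ ^ p
      = volume.real (Metric.ball (0 : ST n) 1) * d ^ p := by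
    rw [← hdp, ← setIntegral_eq_mul_average volume_ball_ne_zero
      Metric.isBounded_ball.measure_lt_top.ne]
    exact (integral_add (iD.mono_set (h12.trans h2E)) (iF.mono_set (h12.trans h2E))).symm
  have mono : ∀ {g : ST n → ℝ} {s t : Set (ST n)}, MeasurableSet t → IntegrableOn g t →
      (∀ z, 0 ≤ g z) → s ⊆ t → ∫ z in s, g z ≤ ∫ z in t, g z := fun ht hi h0 hst =>
    setIntegral_mono_set hi (Eventually.of_forall h0) hst.eventuallyLE
  have nn : ∀ {E : Type} [NormedAddCommGroup E] (g : ST n → E) (z : ST n),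
      0 ≤ ‖g (scl z₀ hR hS z)‖ ^ p := fun g z => by positivity
  have mF := mono hB2 (iF.mono_set h2E) (nn F) h12
  have mF2 := mono hE iF (nn F) h2E
  have mD := mono hB2 (iD.mono_set h2E) (nn Du) h12
  have mD2 := mono hE iD (nn Du) h2E
  have mu := mono hE iu (nn u) h2E
  have hF0 : 0 ≤ ∫ z in Metric.ball 0 1, ‖F (scl z₀ hR hS z)‖ ^ p :=
    setIntegral_nonneg hB1 fun z _ => nn F z
  have hu0 : 0 ≤ ∫ z in Metric.ball 0 1, ‖u (scl z₀ hR hS z)‖ ^ p :=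
    setIntegral_nonneg hB1 fun z _ => nn u z
  have hdp0 : 0 < d ^ p := by positivity
  have hRp0 : 0 < R ^ p := by positivity
  have hμp0 : 0 < μ ^ p := by positivity
  have h2p0 : (0:ℝ) < 2 ^ p := by positivity
  have hV21 : 0 < volume.real (outerCyl n p) / volume.real (Metric.ball (0 : ST n) 1) := by
    positivity
  have hV2p : 0 < 2 ^ p * volume.real (outerCyl n p) := by positivity
  have hKV : K * (volume.real (outerCyl n p) / volume.real (Metric.ball (0 : ST n) 1))
      ≤ normK n p K := mul_le_mul_of_nonneg_left (by linarith) hK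
  have hK2 : K * (2 ^ p * volume.real (outerCyl n p)) ≤ normK n p K :=
    mul_le_mul_of_nonneg_left (by linarith) hK
  have hK1 : K ≤ normK n p K := le_mul_of_one_le_right hK (by linarith)
  have key : μ ^ p * ((∫ z in outerCyl n p, ‖Du (scl z₀ hR hS z)‖ ^ p)
      + ∫ z in outerCyl n p, ‖F (scl z₀ hR hS z)‖ ^ p) * (d ^ p)⁻¹
      ≤ normK n p K * ((R ^ p * d ^ p)⁻¹ * ∫ z in Metric.ball 0 1, ‖u (scl z₀ hR hS z)‖ ^ p)
      ∨ μ ^ p ≤ normK n p K := by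
    rcases h2 with h2 | h2
    · left
      rw [setAverage_eq, setAverage_eq, integral_add iD iF, integral_div, smul_eq_mul,
        smul_eq_mul] at h2
      refine le_trans (le_of_eq ?_) ((mul_le_mul_of_nonneg_left h2
        (by positivity : 0 ≤ volume.real (outerCyl n p) * (d ^ p)⁻¹)).trans
        (le_trans (le_of_eq ?_) (mul_le_mul_of_nonneg_right hKV (by positivity))))
      · field_simp
      · field_simp
    · exact Or.inr (h2.trans hK1)
  refine ⟨⟨N, μ, _, _, G, _, hμ, hRS ▸ sol, ?_, ?_, ?_, ?_⟩, ?_⟩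
  · rw [eD1, ef, ← mul_add, ← div_eq_inv_mul, le_div_iff₀ hdp0, ← hdp']
    exact add_le_add_right mF _
  · rw [setAverage_eq, integral_div, smul_eq_mul] at h1
    rw [ev]
    refine (mul_le_mul_of_nonneg_left mu (by positivity)).trans
      (le_trans (le_of_eq ?_) ((mul_le_mul_of_nonneg_left h1 (by positivity :
        0 ≤ 2 ^ p * volume.real (outerCyl n p) * (d ^ p)⁻¹)).trans (le_trans (le_of_eq ?_)
        (mul_le_mul_of_nonneg_right hK2 hμp0.le))))
    · field_simp
    · field_simp
  · rw [eD, ev1]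
    refine key.imp_left fun h => le_trans ?_ h
    rw [mul_assoc, mul_comm (d ^ p)⁻¹]
    gcongr
    exact mD2.trans (le_add_of_nonneg_right (hF0.trans (mF.trans mF2)))
  · rw [ev1]
    refine key.imp_left fun h => le_trans ?_ h
    rw [mul_assoc]
    gcongr
    rw [← div_eq_mul_inv, le_div_iff₀ hdp0, ← hdp']
    exact add_le_add (mD.trans mD2) (mF.trans mF2)
  · have e1 := integral_indicator_smul_rpow hB2 (fun z => Du (scl z₀ hR hS z)) hdi one_pos
    simp only [Real.rpow_one] at e1
    exact congrArg₂ (· + ·) e1 ef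

end Core


theorem exists_reverse_hoelder_scl {p ν L K q : ℝ} (hn : 1 ≤ n) (hp : 1 < p) (hsp : sob n < p)
    (hν : 0 < ν) (hL : 0 ≤ L) (hK : 0 ≤ K) (hq : 1 ≤ q) (hqp : q ≤ p) :
    ∃ c > 0, ∀ (N : ℕ) (T : ℝ) (Ω : Set (Spc n))
      (A : ST n → Vec N → Mat N n → Mat N n) (F : ST n → Mat N n)
      (u : ST n → Vec N) (Du : ST n → Mat N n),
      WeakSolution p ν L T Ω A F u Du →
      ∀ (z₀ : ST n) (R S μ : ℝ) (hR : 0 < R) (hS : 0 < S), 0 < μ → S / R ^ p = μ ^ (p - 2) →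
        (∀ z ∈ outerCyl n p, scl z₀ hR hS z ∈ Ω ×ˢ Ioo 0 T) →
        (⨍ z in outerCyl n p, ‖u (scl z₀ hR hS z)‖ ^ p / (2 ^ p * R ^ p) ≤ K * μ ^ p
          * ⨍ z in Metric.ball 0 1, (‖Du (scl z₀ hR hS z)‖ ^ p + ‖F (scl z₀ hR hS z)‖ ^ p)) →
        (μ ^ p * ⨍ z in outerCyl n p, (‖Du (scl z₀ hR hS z)‖ ^ p + ‖F (scl z₀ hR hS z)‖ ^ p)
          ≤ K * ⨍ z in Metric.ball 0 1, ‖u (scl z₀ hR hS z)‖ ^ p / R ^ p ∨ μ ^ p ≤ K) →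
        ⨍ z in Metric.ball 0 1, ‖Du (scl z₀ hR hS z)‖ ^ p
          ≤ c * (⨍ z in outerCyl n p, ‖Du (scl z₀ hR hS z)‖ ^ q) ^ (p / q)
            + c * ⨍ z in outerCyl n p, ‖F (scl z₀ hR hS z)‖ ^ p := by
  have hp0 : 0 < p := by linarith
  have hV1 : 0 < volume.real (Metric.ball (0 : ST n) 1) :=
    ENNReal.toReal_pos volume_ball_ne_zero (Metric.isBounded_ball.measure_lt_top.ne)
  have hV2 : 0 < volume.real (outerCyl n p) :=
    ENNReal.toReal_pos (volume_outerCyl_ne_zero hp) (volume_outerCyl_ne_top p)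
  have hK' : 0 ≤ normK n p K := by rw [normK]; positivity
  obtain ⟨ε, hε, hdef⟩ := exists_le_defect hn hp hsp hν hL hK' hV1
  refine ⟨(2 * volume.real (outerCyl n p) / ε) ^ p + 2 * volume.real (outerCyl n p) / ε,
    by positivity, ?_⟩
  intro N T Ω A F u Du W z₀ R S μ hR hS hμ hRS hsub h1 h2
  have hU : MeasurableSet (Ω ×ˢ Ioo 0 T) := W.openΩ.measurableSet.prod measurableSet_Ioo
  have hE := measurableSet_outerCyl (n := n) p
  have h2E := ball_two_subset_outerCyl (n := n) hp
  have h1E : Metric.ball (0 : ST n) 1 ⊆ outerCyl n p :=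
    (Metric.ball_subset_ball one_le_two).trans h2E
  have iF : IntegrableOn (fun z => ‖F (scl z₀ hR hS z)‖ ^ p) (outerCyl n p) :=
    integrableOn_rpow_of_memLp hp0 le_rfl (volume_outerCyl_ne_top p)
      (memLp_comp_scl hU hE hsub W.memLp_F)
  have iD : ∀ r : ℝ, 0 < r → r ≤ p →
      IntegrableOn (fun z => ‖Du (scl z₀ hR hS z)‖ ^ r) (outerCyl n p) := fun r h h' =>
    integrableOn_rpow_of_memLp h h' (volume_outerCyl_ne_top p)
      (memLp_comp_scl hU hE hsub W.memLp_Du)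
  have iD1 : IntegrableOn (fun z => ‖Du (scl z₀ hR hS z)‖) (outerCyl n p) := by
    simpa using iD 1 one_pos hp.le
  have hY0 : 0 ≤ ⨍ z in outerCyl n p, ‖Du (scl z₀ hR hS z)‖ ^ q := by
    rw [setAverage_eq]
    exact smul_nonneg (by positivity) (integral_nonneg fun z => by positivity)
  have hY10 : 0 ≤ ⨍ z in outerCyl n p, ‖Du (scl z₀ hR hS z)‖ := by
    rw [setAverage_eq]
    exact smul_nonneg (by positivity) (integral_nonneg fun z => by positivity)
  have hZ0 : 0 ≤ ⨍ z in outerCyl n p, ‖F (scl z₀ hR hS z)‖ ^ p := by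
    rw [setAverage_eq]
    exact smul_nonneg (by positivity) (integral_nonneg fun z => by positivity)
  have hJ := average_rpow_le hq (volume_outerCyl_ne_zero hp) (volume_outerCyl_ne_top p)
    (fun z => norm_nonneg (Du (scl z₀ hR hS z))) iD1 (iD q (by linarith) hqp)
  have hle : ⨍ z in Metric.ball 0 1, ‖Du (scl z₀ hR hS z)‖ ^ p
      ≤ ⨍ z in Metric.ball 0 1, (‖Du (scl z₀ hR hS z)‖ ^ p + ‖F (scl z₀ hR hS z)‖ ^ p) := by
    rw [setAverage_eq, setAverage_eq]
    refine smul_le_smul_of_nonneg_left (setIntegral_mono ((iD p hp0 le_rfl).mono_set h1E)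
      (((iD p hp0 le_rfl).add iF).mono_set h1E) fun z => ?_) (by positivity)
    exact le_add_of_nonneg_right (by positivity)
  have hX0 : 0 ≤ ⨍ z in Metric.ball 0 1,
      (‖Du (scl z₀ hR hS z)‖ ^ p + ‖F (scl z₀ hR hS z)‖ ^ p) := by
    rw [setAverage_eq]
    exact smul_nonneg (by positivity) (integral_nonneg fun z => by positivity)
  refine hle.trans ?_
  have hYp : (⨍ z in outerCyl n p, ‖Du (scl z₀ hR hS z)‖) ^ p
      ≤ (⨍ z in outerCyl n p, ‖Du (scl z₀ hR hS z)‖ ^ q) ^ (p / q) := by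
    have h := Real.rpow_le_rpow (by positivity) hJ (by positivity : 0 ≤ p / q)
    rwa [← Real.rpow_mul hY10, mul_div_cancel₀ _ (by linarith : q ≠ 0)] at h
  have hYp0 := Real.rpow_nonneg hY0 (p / q)
  have hc0 : 0 ≤ 2 * volume.real (outerCyl n p) / ε := by positivity
  have hcp0 : 0 ≤ (2 * volume.real (outerCyl n p) / ε) ^ p := by positivity
  rcases hX0.eq_or_lt with hX | hX
  · rw [← hX]; positivity
  obtain ⟨d, hd, hdX⟩ : ∃ d : ℝ, 0 < d ∧ ⨍ z in Metric.ball 0 1,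
      (‖Du (scl z₀ hR hS z)‖ ^ p + ‖F (scl z₀ hR hS z)‖ ^ p) = d ^ p :=
    ⟨_, Real.rpow_pos_of_pos hX (1 / p), by
      rw [← Real.rpow_mul hX.le, one_div_mul_cancel hp0.ne', Real.rpow_one]⟩
  rw [hdX] at h1 ⊢
  have hdp0 : 0 < d ^ p := by positivity
  obtain ⟨c, hc⟩ := exists_conf W hp hK hd hμ hRS hsub hdX h1 h2
  have hlow := (hdef c).trans_eq hc
  have m1 : ∫ z in Metric.ball 0 2, ‖Du (scl z₀ hR hS z)‖
      ≤ volume.real (outerCyl n p) * ⨍ z in outerCyl n p, ‖Du (scl z₀ hR hS z)‖ := by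
    rw [← setIntegral_eq_mul_average (volume_outerCyl_ne_zero hp) (volume_outerCyl_ne_top p)]
    exact setIntegral_mono_set iD1 (Eventually.of_forall fun z => norm_nonneg _) h2E.eventuallyLE
  have m2 : ∫ z in Metric.ball 0 2, ‖F (scl z₀ hR hS z)‖ ^ p
      ≤ volume.real (outerCyl n p) * ⨍ z in outerCyl n p, ‖F (scl z₀ hR hS z)‖ ^ p := by
    rw [← setIntegral_eq_mul_average (volume_outerCyl_ne_zero hp) (volume_outerCyl_ne_top p)]
    exact setIntegral_mono_set iF (Eventually.of_forall fun z => by positivity) h2E.eventuallyLE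
  rcases le_or_gt (ε / 2) ((d ^ p)⁻¹ * ∫ z in Metric.ball 0 2, ‖F (scl z₀ hR hS z)‖ ^ p)
    with h | h
  · have h3 : d ^ p ≤ 2 * volume.real (outerCyl n p) / ε
        * ⨍ z in outerCyl n p, ‖F (scl z₀ hR hS z)‖ ^ p := by
      rw [← div_eq_inv_mul, le_div_iff₀ hdp0] at h
      rw [div_mul_eq_mul_div, le_div_iff₀ hε]
      linarith
    nlinarith [mul_nonneg hc0 hYp0, mul_nonneg hcp0 hYp0, mul_nonneg hcp0 hZ0]
  · have h3 : d ≤ 2 * volume.real (outerCyl n p) / ε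
        * ⨍ z in outerCyl n p, ‖Du (scl z₀ hR hS z)‖ := by
      have h4 : ε / 2 ≤ d⁻¹ * ∫ z in Metric.ball 0 2, ‖Du (scl z₀ hR hS z)‖ := by linarith
      rw [← div_eq_inv_mul, le_div_iff₀ hd] at h4
      rw [div_mul_eq_mul_div, le_div_iff₀ hε]
      linarith
    have h5 := Real.rpow_le_rpow hd.le h3 hp0.le
    rw [Real.mul_rpow hc0 hY10] at h5
    have h6 := h5.trans (mul_le_mul_of_nonneg_left hYp hcp0)
    nlinarith [mul_nonneg hc0 hYp0, mul_nonneg hc0 hZ0, mul_nonneg hcp0 hZ0]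

theorem preimage_scl_cyl (z₀ : ST n) {R S : ℝ} (hR : 0 < R) (hS : 0 < S) (a b : ℝ) :
    scl z₀ hR hS ⁻¹' (Metric.ball z₀.1 (a * R) ×ˢ Ioo (z₀.2 - b * S) (z₀.2 + b * S))
      = Metric.ball (0 : Spc n) a ×ˢ Ioo (-b) b := by
  ext z
  simp only [mem_preimage, scl_apply, mem_prod, mem_ball_iff_norm, add_sub_cancel_left, norm_smul,
    Real.norm_of_nonneg hR.le, sub_zero, mem_Ioo]
  refine and_congr ?_ (and_congr ?_ ?_)
  · rw [mul_comm R, mul_lt_mul_iff_left₀ hR]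
  · rw [← mul_lt_mul_iff_left₀ hS (b := -b)]
    constructor <;> intro h <;> linarith
  · rw [← mul_lt_mul_iff_left₀ hS (c := b)]
    constructor <;> intro h <;> linarith

/-- The intrinsic cylinders are rescaled standard cylinders. -/
theorem exists_parCyl_eq {p μ ρ : ℝ} (hp : 1 < p) (hμ : 0 < μ) (hρ : 0 < ρ) (z₀ : ST n) :
    ∃ R S : ℝ, 0 < R ∧ 0 < S ∧ S / R ^ p = μ ^ (p - 2) ∧ μ ^ (2 - max p 2) * ρ ^ p = R ^ p ∧
      μ ^ (2 - max p 2) * (2 * ρ) ^ p = 2 ^ p * R ^ p ∧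
      parCyl p μ ρ z₀ = Metric.ball z₀.1 (1 * R) ×ˢ Ioo (z₀.2 - 1 * S) (z₀.2 + 1 * S) ∧
      parCyl p μ (2 * ρ) z₀
        = Metric.ball z₀.1 (2 * R) ×ˢ Ioo (z₀.2 - 2 ^ p * S) (z₀.2 + 2 ^ p * S) := by
  have h2 : (2 * ρ) ^ p = 2 ^ p * ρ ^ p := Real.mul_rpow (by norm_num) hρ.le
  have hρp : 0 < ρ ^ p := by positivity
  rcases lt_or_ge p 2 with h | h
  · refine ⟨ρ, μ ^ (p - 2) * ρ ^ p, hρ, by positivity, by field_simp, ?_, ?_, ?_, ?_⟩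
    · rw [max_eq_right h.le, sub_self, Real.rpow_zero, one_mul]
    · rw [max_eq_right h.le, sub_self, Real.rpow_zero, one_mul, h2]
    · rw [parCyl, if_pos h, one_mul, one_mul]
    · rw [parCyl, if_pos h, h2, mul_left_comm]
  · have hRp : (μ ^ ((2 - p) / p) * ρ) ^ p = μ ^ (2 - p) * ρ ^ p := by
      rw [Real.mul_rpow (by positivity) hρ.le, ← Real.rpow_mul hμ.le,
        div_mul_cancel₀ _ (by linarith : p ≠ 0)]
    refine ⟨μ ^ ((2 - p) / p) * ρ, ρ ^ p, by positivity, hρp, ?_, ?_, ?_, ?_, ?_⟩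
    · rw [hRp, show p - 2 = -(2 - p) by ring, Real.rpow_neg hμ.le]
      have : 0 < μ ^ (2 - p) := by positivity
      field_simp
    · rw [max_eq_left h, hRp]
    · rw [max_eq_left h, hRp, h2]; ring
    · rw [parCyl, if_neg (not_lt.2 h), one_mul, one_mul]
    · rw [parCyl, if_neg (not_lt.2 h), h2, mul_left_comm]

theorem ball_one_eq_prod :
    Metric.ball (0 : ST n) 1 = Metric.ball (0 : Spc n) 1 ×ˢ Ioo (-1:ℝ) 1 := by
  ext z; exact mem_ball_ST

end RevHoelder

/-- Reverse Hölder inequality: let `p > max{2n/(n+2), 1}` and `u` a weak solution. Suppose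
`Q_{2ρ}^{(μ)}(z₀) ⊆ Ω_T` satisfies
(i) `⨍⨍_{Q_{2ρ}^{(μ)}} |u|^p/(μ^{2−𝔭}(2ρ)^p) ≤ K μ^p ⨍⨍_{Q_ρ^{(μ)}} (|Du|^p + |F|^p)` and
(ii) either `μ^p ⨍⨍_{Q_{2ρ}^{(μ)}} (|Du|^p + |F|^p) ≤ K ⨍⨍_{Q_ρ^{(μ)}} |u|^p/(μ^{2−𝔭}ρ^p)`
or `μ^p ≤ K`. Then
`⨍⨍_{Q_ρ^{(μ)}} |Du|^p ≤ c (⨍⨍_{Q_{2ρ}^{(μ)}} |Du|^q)^{p/q} + c ⨍⨍_{Q_{2ρ}^{(μ)}} |F|^p`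
with `q = max{2n/(n+2), np/(n+2), 1, p−1}` and `c = c(n, p, ν, L, K)`. -/
theorem reverse_hoelder (n : ℕ) (p ν L K : ℝ)
    (hp : max (2 * (n : ℝ) / ((n : ℝ) + 2)) 1 < p) (hK : 1 ≤ K) :
    ∃ c > 0, ∀ (N : ℕ) (T : ℝ) (Ω : Set (Spc n))
      (A : Spc n × ℝ → Vec N → Mat N n → Mat N n) (F : Spc n × ℝ → Mat N n)
      (u : Spc n × ℝ → Vec N) (Du : Spc n × ℝ → Mat N n),
      WeakSolution p ν L T Ω A F u Du →
      ∀ (z₀ : Spc n × ℝ) (ρ μ : ℝ), 0 < ρ → 0 < μ →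
        parCyl p μ (2 * ρ) z₀ ⊆ Ω ×ˢ Ioo 0 T →
        -- (i) the μ-sub-intrinsic coupling
        (⨍ z in parCyl p μ (2 * ρ) z₀, ‖u z‖ ^ p / (μ ^ (2 - max p 2) * (2 * ρ) ^ p)
          ≤ K * μ ^ p * ⨍ z in parCyl p μ ρ z₀, (‖Du z‖ ^ p + ‖F z‖ ^ p)) →
        -- (ii) the μ-super-intrinsic coupling
        ((μ ^ p * ⨍ z in parCyl p μ (2 * ρ) z₀, (‖Du z‖ ^ p + ‖F z‖ ^ p)
            ≤ K * ⨍ z in parCyl p μ ρ z₀, ‖u z‖ ^ p / (μ ^ (2 - max p 2) * ρ ^ p))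
          ∨ μ ^ p ≤ K) →
        ⨍ z in parCyl p μ ρ z₀, ‖Du z‖ ^ p
          ≤ c * (⨍ z in parCyl p μ (2 * ρ) z₀,
                  ‖Du z‖ ^ (max (max (2 * (n : ℝ) / ((n : ℝ) + 2)) ((n : ℝ) * p / ((n : ℝ) + 2)))
                    (max 1 (p - 1))))
                ^ (p / max (max (2 * (n : ℝ) / ((n : ℝ) + 2)) ((n : ℝ) * p / ((n : ℝ) + 2)))
                    (max 1 (p - 1)))
              + c * ⨍ z in parCyl p μ (2 * ρ) z₀, ‖F z‖ ^ p := by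
  have hp1 : 1 < p := (le_max_right _ _).trans_lt hp
  by_cases hpar : 1 ≤ n ∧ 0 < ν ∧ 0 ≤ L
  swap
  · exact ⟨1, one_pos, fun N T Ω A F u Du W =>
      absurd ⟨W.hn, W.hν, W.hν.le.trans W.hνL⟩ hpar⟩
  obtain ⟨hn, hν, hL⟩ := hpar
  have hsp : RevHoelder.sob n < p := by rwa [RevHoelder.sob, max_comm]
  have hq1 : 1 ≤ max (max (2 * (n : ℝ) / ((n : ℝ) + 2)) ((n : ℝ) * p / ((n : ℝ) + 2)))
      (max 1 (p - 1)) := (le_max_left _ _).trans (le_max_right _ _)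
  have hqp : max (max (2 * (n : ℝ) / ((n : ℝ) + 2)) ((n : ℝ) * p / ((n : ℝ) + 2)))
      (max 1 (p - 1)) ≤ p := by
    refine max_le (max_le ((le_max_left _ _).trans hp.le) ?_) (max_le hp1.le (by linarith))
    rw [div_le_iff₀ (by positivity)]
    nlinarith
  obtain ⟨c, hc, H⟩ := RevHoelder.exists_reverse_hoelder_scl hn hp1 hsp hν hL
    (zero_le_one.trans hK) hq1 hqp
  refine ⟨c, hc, ?_⟩
  intro N T Ω A F u Du W z₀ ρ μ hρ hμ hsub h1 h2
  obtain ⟨R, S, hR, hS, hRS, e1, e2, hQ1, hQ2⟩ := RevHoelder.exists_parCyl_eq hp1 hμ hρ z₀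
  have m1 : MeasurableSet (parCyl p μ ρ z₀) := by
    rw [hQ1]; exact measurableSet_ball.prod measurableSet_Ioo
  have m2 : MeasurableSet (parCyl p μ (2 * ρ) z₀) := by
    rw [hQ2]; exact measurableSet_ball.prod measurableSet_Ioo
  have q1 : RevHoelder.scl z₀ hR hS ⁻¹' parCyl p μ ρ z₀ = Metric.ball 0 1 := by
    rw [hQ1, RevHoelder.preimage_scl_cyl, RevHoelder.ball_one_eq_prod]
  have q2 : RevHoelder.scl z₀ hR hS ⁻¹' parCyl p μ (2 * ρ) z₀ = RevHoelder.outerCyl n p := by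
    rw [hQ2, RevHoelder.preimage_scl_cyl, RevHoelder.outerCyl]
  have a1 : ∀ g : Spc n × ℝ → ℝ, ⨍ z in parCyl p μ ρ z₀, g z
      = ⨍ z in Metric.ball 0 1, g (RevHoelder.scl z₀ hR hS z) := fun g => by
    rw [RevHoelder.setAverage_scl (z₀ := z₀) (hR := hR) (hS := hS) m1 g, q1]
  have a2 : ∀ g : Spc n × ℝ → ℝ, ⨍ z in parCyl p μ (2 * ρ) z₀, g z
      = ⨍ z in RevHoelder.outerCyl n p, g (RevHoelder.scl z₀ hR hS z) := fun g => by
    rw [RevHoelder.setAverage_scl (z₀ := z₀) (hR := hR) (hS := hS) m2 g, q2]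
  rw [e2, a1, a2] at h1
  rw [e1, a1, a2] at h2
  rw [a1, a2, a2]
  exact H N T Ω A F u Du W z₀ R S μ hR hS hμ hRS (fun z hz => hsub (q2.ge hz)) h1 h2
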